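/- Let n ≥ 2 and let W be a normalized double-well potential. There exists a universal constant ε₀ > 0 such that for every ε < ε₀ the minimizer of ψ(ε) is unique modulo translations: if u and v both minimize ψ(ε), then there exists x₀ ∈ ℝⁿ such that v(x) = u(x − x₀) for a.e. x ∈ ℝⁿ. -/

import Mathlib

noncomputable section

open MeasureTheory Real Set Filter

abbrev En (n : ℕ) : Type := EuclideanSpace ℝ (Fin n)

/-- Volume of the unit ball of `ℝⁿ`. -/
def ballVol (n : ℕ) : ℝ := (volume (Metric.ball (0 : En n) 1)).toReal

/-- A normalized double-well potential. -/
structure DoubleWell (W : ℝ → ℝ) : Prop where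
  contDiffOn : ContDiffOn ℝ 2 W (Icc 0 1)
  lipschitzSecond : ∃ L : NNReal, LipschitzOnWith L (iteratedDerivWithin 2 W (Icc 0 1)) (Icc 0 1)
  zero_at_zero : W 0 = 0
  zero_at_one : W 1 = 0
  pos_on : ∀ t ∈ Ioo (0:ℝ) 1, 0 < W t
  second_pos_zero : 0 < iteratedDerivWithin 2 W (Icc 0 1) 0
  second_pos_one : 0 < iteratedDerivWithin 2 W (Icc 0 1) 1
  normalized : ∫ t in (0:ℝ)..1, Real.sqrt (W t) = 1

/-- `Φ(t) = ∫₀ᵗ √W`. -/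
def Phi (W : ℝ → ℝ) (t : ℝ) : ℝ := ∫ s in (0:ℝ)..t, Real.sqrt (W s)

/-- `V(t) = Φ(t)^{n/(n-1)}`. -/
def Vpot (n : ℕ) (W : ℝ → ℝ) (t : ℝ) : ℝ := Phi W t ^ ((n : ℝ) / ((n : ℝ) - 1))

/-- Membership in `H¹(ℝⁿ;[0,1])`. -/
structure H1Box (n : ℕ) (u : En n → ℝ) : Prop where
  mem_Icc : ∀ x, u x ∈ Icc (0:ℝ) 1
  diff : Differentiable ℝ u
  memL2 : MemLp u 2 (volume : Measure (En n))
  grad_memL2 : MemLp (fun x => fderiv ℝ u x) 2 (volume : Measure (En n))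

/-- The Allen–Cahn energy. -/
def AC (n : ℕ) (W : ℝ → ℝ) (σ : ℝ) (u : En n → ℝ) : ℝ :=
  σ * (∫ x : En n, ‖fderiv ℝ u x‖ ^ 2) + σ⁻¹ * (∫ x : En n, W (u x))

/-- The isoperimetric-type infimum `Ψ(σ,m)`. -/
def Psi (n : ℕ) (W : ℝ → ℝ) (σ m : ℝ) : ℝ :=
  sInf ((fun u => AC n W σ u) ''
    {u : En n → ℝ | H1Box n u ∧ (∫ x : En n, Vpot n W (u x)) = m})

/-- `u` is a minimizer of `ψ(ε) = Ψ(ε,1)`. -/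
def Minimizes (n : ℕ) (W : ℝ → ℝ) (ε : ℝ) (u : En n → ℝ) : Prop :=
  H1Box n u ∧ (∫ x : En n, Vpot n W (u x)) = 1 ∧ AC n W ε u = Psi n W ε 1

/-- Radial function. -/
def Radial (n : ℕ) (u : En n → ℝ) : Prop :=
  ∃ ζ : ℝ → ℝ, ∀ x : En n, u x = ζ ‖x‖

/-- Radial decreasing function. -/
def RadialDecreasing (n : ℕ) (u : En n → ℝ) : Prop :=
  ∃ ζ : ℝ → ℝ, AntitoneOn ζ (Ici 0) ∧ ∀ x : En n, u x = ζ ‖x‖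

/-- The Laplacian as the trace of the second derivative. -/
def lap (n : ℕ) (u : En n → ℝ) (x : En n) : ℝ :=
  ∑ i : Fin n,
    fderiv ℝ (fun y => fderiv ℝ u y (EuclideanSpace.single i 1)) x (EuclideanSpace.single i 1)

/-- The optimal transition profile `η`. -/
structure TransitionProfile (W : ℝ → ℝ) (η : ℝ → ℝ) : Prop where
  mem : ∀ s, η s ∈ Ioo (0:ℝ) 1
  init : η 0 = 1/2
  ode : ∀ s, HasDerivAt η (-(Real.sqrt (W (η s)))) s
  anti : StrictAnti η
  tendsto_bot : Tendsto η atBot (nhds 1)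
  tendsto_top : Tendsto η atTop (nhds 0)

/-- `d_Φ(u,v)`. -/
def dPhi (n : ℕ) (W : ℝ → ℝ) (u v : En n → ℝ) : ℝ :=
  ∫ x : En n, |Phi W (u x) - Phi W (v x)| ^ ((n : ℝ) / ((n : ℝ) - 1))

/-- `R₀ = ω_n^{-1/n}`. -/
def R0 (n : ℕ) : ℝ := ballVol n ^ (-(1:ℝ) / (n : ℝ))



/-- Globally defined double-well potential with two derivatives. -/
structure GW (W W1 W2 : ℝ → ℝ) : Prop where
  hd1 : ∀ t, HasDerivAt W (W1 t) t
  hd2 : ∀ t, HasDerivAt W1 (W2 t) t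
  c2 : Continuous W2
  zero : W 0 = 0
  one : W 1 = 0
  pos : ∀ t ∈ Ioo (0:ℝ) 1, 0 < W t
  p0 : 0 < W2 0
  p1 : 0 < W2 1
  norm : ∫ t in (0:ℝ)..1, Real.sqrt (W t) = 1

lemma ext_GW {W : ℝ → ℝ} (hW : DoubleWell W) :
    ∃ We W1 W2 : ℝ → ℝ, GW We W1 W2 ∧ ∀ t ∈ Icc (0:ℝ) 1, We t = W t := by
  have hu : UniqueDiffOn ℝ (Icc (0:ℝ) 1) := uniqueDiffOn_Icc one_pos
  set w1 := derivWithin W (Icc (0:ℝ) 1) with hw1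
  set w2 := iteratedDerivWithin 2 W (Icc (0:ℝ) 1) with hw2
  have hc2 : ContinuousOn w2 (Icc 0 1) := by
    obtain ⟨L, hL⟩ := hW.lipschitzSecond
    exact hL.continuousOn
  set e2 : ℝ → ℝ := fun t => w2 (projIcc (0:ℝ) 1 zero_le_one t) with he2
  have he2c : Continuous e2 := by
    have : Continuous (fun y : Icc (0:ℝ) 1 => w2 y) := continuousOn_iff_continuous_domRestrict.mp hc2
    exact this.comp continuous_projIcc
  have he2i : ∀ t ∈ Icc (0:ℝ) 1, e2 t = w2 t := by
    intro t ht
    simp [he2, projIcc_of_mem _ ht]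
  have hd : ∀ t ∈ Icc (0:ℝ) 1, HasDerivWithinAt W (w1 t) (Icc 0 1) t := by
    intro t ht
    exact ((hW.contDiffOn.differentiableOn (by norm_num)) t ht).hasDerivWithinAt
  have hw1c : ContDiffOn ℝ 1 w1 (Icc 0 1) := by
    have := hW.contDiffOn.derivWithin (m := 1) hu (by norm_num)
    exact this
  have hd2 : ∀ t ∈ Icc (0:ℝ) 1, HasDerivWithinAt w1 (w2 t) (Icc 0 1) t := by
    intro t ht
    have h := ((hw1c.differentiableOn (by norm_num)) t ht).hasDerivWithinAt
    have : w2 t = derivWithin w1 (Icc 0 1) t := by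
      rw [hw2, iteratedDerivWithin_succ, iteratedDerivWithin_one]
    rwa [this]
  set E1 : ℝ → ℝ := fun t => w1 0 + ∫ s in (0:ℝ)..t, e2 s with hE1
  have hE1d : ∀ t, HasDerivAt E1 (e2 t) t := by
    intro t
    exact (he2c.integral_hasStrictDerivAt 0 t).hasDerivAt.const_add _
  have hE1i : ∀ t ∈ Icc (0:ℝ) 1, E1 t = w1 t := by
    intro t ht
    have := intervalIntegral.integral_eq_sub_of_hasDerivAt_of_le (a := 0) (b := t) (f := w1) (f' := e2) ht.1
      (hw1c.continuousOn.mono (Icc_subset_Icc_right ht.2))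
      (by
        intro x hx
        have hx' : x ∈ Icc (0:ℝ) 1 := ⟨hx.1.le, hx.2.le.trans ht.2⟩
        rw [he2i x hx']
        exact (hd2 x hx').hasDerivAt (Icc_mem_nhds hx.1 (hx.2.trans_le ht.2)))
      (he2c.intervalIntegrable _ _)
    simp only [hE1, this]; ring
  have hE1c : Continuous E1 := continuous_iff_continuousAt.2 fun t => (hE1d t).continuousAt
  set E0 : ℝ → ℝ := fun t => ∫ s in (0:ℝ)..t, E1 s with hE0
  have hE0d : ∀ t, HasDerivAt E0 (E1 t) t := by
    intro t
    exact (hE1c.integral_hasStrictDerivAt 0 t).hasDerivAt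
  have hE0i : ∀ t ∈ Icc (0:ℝ) 1, E0 t = W t := by
    intro t ht
    have := intervalIntegral.integral_eq_sub_of_hasDerivAt_of_le (a := 0) (b := t) (f := W) (f' := E1) ht.1
      (hW.contDiffOn.continuousOn.mono (Icc_subset_Icc_right ht.2))
      (by
        intro x hx
        have hx' : x ∈ Icc (0:ℝ) 1 := ⟨hx.1.le, hx.2.le.trans ht.2⟩
        rw [hE1i x hx']
        exact (hd x hx').hasDerivAt (Icc_mem_nhds hx.1 (hx.2.trans_le ht.2)))
      (hE1c.intervalIntegrable _ _)
    simp only [hE0, this, hW.zero_at_zero]; ring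
  have m0 : (0:ℝ) ∈ Icc (0:ℝ) 1 := by simp
  have m1 : (1:ℝ) ∈ Icc (0:ℝ) 1 := by simp
  refine ⟨E0, E1, e2, ⟨hE0d, hE1d, he2c, ?_, ?_, ?_, ?_, ?_, ?_⟩, hE0i⟩
  · rw [hE0i 0 m0, hW.zero_at_zero]
  · rw [hE0i 1 m1, hW.zero_at_one]
  · intro t ht
    rw [hE0i t ⟨ht.1.le, ht.2.le⟩]; exact hW.pos_on t ht
  · rw [he2i 0 m0]; exact hW.second_pos_zero
  · rw [he2i 1 m1]; exact hW.second_pos_one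
  · refine Eq.trans ?_ hW.normalized
    apply intervalIntegral.integral_congr
    intro t ht
    rw [uIcc_of_le zero_le_one] at ht
    simp only [hE0i t ht]

lemma Phi_congr {W We : ℝ → ℝ} (h : ∀ t ∈ Icc (0:ℝ) 1, We t = W t) {t : ℝ} (ht : t ∈ Icc (0:ℝ) 1) :
    Phi We t = Phi W t := by
  unfold Phi
  apply intervalIntegral.integral_congr
  intro s hs
  rw [uIcc_of_le ht.1] at hs
  simp only [h s ⟨hs.1, hs.2.trans ht.2⟩]

lemma Minimizes_congr {n : ℕ} {W We : ℝ → ℝ} (h : ∀ t ∈ Icc (0:ℝ) 1, We t = W t) (ε : ℝ)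
    (u : En n → ℝ) : Minimizes n W ε u ↔ Minimizes n We ε u := by
  have hV : ∀ u : En n → ℝ, H1Box n u → (∫ x, Vpot n W (u x)) = ∫ x, Vpot n We (u x) := by
    intro u hu
    congr 1; ext x
    simp only [Vpot, Phi_congr h (hu.mem_Icc x)]
  have hA : ∀ u : En n → ℝ, H1Box n u → AC n W ε u = AC n We ε u := by
    intro u hu
    unfold AC
    congr 3; ext x
    rw [h _ (hu.mem_Icc x)]
  have hP : Psi n W ε 1 = Psi n We ε 1 := by
    unfold Psi
    congr 1
    ext y
    constructor
    · rintro ⟨v, ⟨hv, hv1⟩, rfl⟩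
      exact ⟨v, ⟨hv, by rw [← hV v hv]; exact hv1⟩, (hA v hv).symm⟩
    · rintro ⟨v, ⟨hv, hv1⟩, rfl⟩
      exact ⟨v, ⟨hv, by rw [hV v hv]; exact hv1⟩, (hA v hv)⟩
  constructor
  · rintro ⟨a, b, c⟩
    exact ⟨a, by rw [← hV u a]; exact b, by rw [← hA u a, ← hP]; exact c⟩
  · rintro ⟨a, b, c⟩
    exact ⟨a, by rw [hV u a]; exact b, by rw [hA u a, hP]; exact c⟩


lemma mvt_eq {f f' : ℝ → ℝ} {a b : ℝ} (hab : a < b) (hc : ContinuousOn f (Icc a b))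
    (hd : ∀ x ∈ Ioo a b, HasDerivAt f (f' x) x) : ∃ c ∈ Ioo a b, f b - f a = f' c * (b - a) := by
  obtain ⟨c, hc, h⟩ := exists_hasDerivAt_eq_slope f f' hab hc hd
  refine ⟨c, hc, ?_⟩
  have : b - a ≠ 0 := by linarith
  rw [h]; field_simp

/-- The derivative of `V`. -/
def V1 (n : ℕ) (W : ℝ → ℝ) (t : ℝ) : ℝ :=
  (n : ℝ) / ((n : ℝ) - 1) * Phi W t ^ ((n : ℝ) / ((n : ℝ) - 1) - 1) * Real.sqrt (W t)

namespace GW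
variable {W W1 W2 : ℝ → ℝ}

lemma cW (g : GW W W1 W2) : Continuous W := continuous_iff_continuousAt.2 fun t => (g.hd1 t).continuousAt
lemma cW1 (g : GW W W1 W2) : Continuous W1 := continuous_iff_continuousAt.2 fun t => (g.hd2 t).continuousAt
lemma cG (g : GW W W1 W2) : Continuous (fun t => √(W t)) := g.cW.sqrt

lemma nonneg (g : GW W W1 W2) {t : ℝ} (ht : t ∈ Icc (0:ℝ) 1) : 0 ≤ W t := by
  rcases eq_or_lt_of_le ht.1 with h | h
  · rw [← h, g.zero]
  rcases eq_or_lt_of_le ht.2 with h' | h'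
  · rw [h', g.one]
  exact (g.pos t ⟨h, h'⟩).le

lemma symm (g : GW W W1 W2) : GW (fun t => W (1 - t)) (fun t => - W1 (1 - t)) (fun t => W2 (1 - t)) where
  hd1 := fun t => by
    have := (g.hd1 (1 - t)).comp t ((hasDerivAt_id t).const_sub 1)
    simpa [Function.comp_def] using this
  hd2 := fun t => by
    have := ((g.hd2 (1 - t)).comp t ((hasDerivAt_id t).const_sub 1)).fun_neg
    simpa [Function.comp_def] using this
  c2 := g.c2.comp (by fun_prop)
  zero := by simp [g.one]
  one := by simp [g.zero]
  pos := fun t ht => g.pos _ ⟨by linarith [ht.2], by linarith [ht.1]⟩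
  p0 := by simpa using g.p1
  p1 := by simpa using g.p0
  norm := by
    have := intervalIntegral.integral_comp_sub_left (a := 0) (b := 1) (fun t => √(W t)) 1
    simp only [sub_self, sub_zero] at this
    rw [this, g.norm]

lemma d0 (g : GW W W1 W2) : 0 ≤ W1 0 := by
  by_contra h
  push Not at h
  have h1 : Tendsto (slope W 0) (nhdsWithin 0 (Ioi 0)) (nhds (W1 0)) :=
    (hasDerivAt_iff_tendsto_slope.1 (g.hd1 0)).mono_left
      (nhdsWithin_mono _ (fun x hx => ne_of_gt hx))
  have h2 : ∀ᶠ t in nhdsWithin (0:ℝ) (Ioi 0), 0 ≤ slope W 0 t := by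
    filter_upwards [Ioo_mem_nhdsGT (show (0:ℝ) < 1 by norm_num)] with t ht
    rw [slope_def_field, g.zero]
    have := g.pos t ht
    have := ht.1
    simp only [sub_zero]; positivity
  exact absurd (ge_of_tendsto h1 h2) (not_le.2 h)

lemma d1 (g : GW W W1 W2) : W1 1 ≤ 0 := by
  have := g.symm.d0
  simpa using this

lemma exists_M (g : GW W W1 W2) : ∃ M : ℝ, 1 ≤ M ∧ ∀ t ∈ Icc (0:ℝ) 1, |W2 t| ≤ M ∧ |W1 t| ≤ M := by
  obtain ⟨a, ha⟩ := isCompact_Icc.exists_bound_of_continuousOn (s := Icc (0:ℝ) 1) g.c2.continuousOn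
  obtain ⟨b, hb⟩ := isCompact_Icc.exists_bound_of_continuousOn (s := Icc (0:ℝ) 1) g.cW1.continuousOn
  refine ⟨max 1 (max a b), le_max_left _ _, fun t ht => ⟨?_, ?_⟩⟩
  · exact ((ha t ht).trans (le_max_left _ _)).trans (le_max_right _ _)
  · exact ((hb t ht).trans (le_max_right _ _)).trans (le_max_right _ _)

lemma lipW1 (g : GW W W1 W2) : ∃ M : ℝ, 0 < M ∧ ∀ a ∈ Icc (0:ℝ) 1, ∀ b ∈ Icc (0:ℝ) 1, |W1 a - W1 b| ≤ M * |a - b| := by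
  obtain ⟨M, hM, h⟩ := g.exists_M
  refine ⟨M, by linarith, fun a ha b hb => ?_⟩
  have := Convex.norm_image_sub_le_of_norm_hasDerivWithin_le (s := Icc (0:ℝ) 1) (C := M)
    (fun x _ => (g.hd2 x).hasDerivWithinAt) (fun x hx => (h x hx).1) (convex_Icc 0 1) hb ha
  simpa using this

lemma lipW (g : GW W W1 W2) : ∃ M : ℝ, 0 < M ∧ ∀ a ∈ Icc (0:ℝ) 1, ∀ b ∈ Icc (0:ℝ) 1, |W a - W b| ≤ M * |a - b| := by
  obtain ⟨M, hM, h⟩ := g.exists_M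
  refine ⟨M, by linarith, fun a ha b hb => ?_⟩
  have := Convex.norm_image_sub_le_of_norm_hasDerivWithin_le (s := Icc (0:ℝ) 1) (C := M)
    (fun x _ => (g.hd1 x).hasDerivWithinAt) (fun x hx => (h x hx).2) (convex_Icc 0 1) hb ha
  simpa using this

/-- strict convexity near 0. -/
lemma bot (g : GW W W1 W2) : ∃ δ c : ℝ, 0 < δ ∧ δ < 1/4 ∧ 0 < c ∧
    (∀ a ∈ Icc 0 δ, ∀ b ∈ Icc 0 δ, 2 * c * (a - b)^2 ≤ (W1 a - W1 b) * (a - b)) ∧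
    (∀ t ∈ Icc 0 δ, 0 ≤ W1 t) ∧ (∀ t ∈ Icc 0 δ, c * t^2 ≤ W t) := by
  have h1 : ∀ᶠ t in nhds (0:ℝ), W2 0 / 2 < W2 t :=
    g.c2.continuousAt.eventually_const_lt (by linarith [g.p0])
  obtain ⟨d, hd, h⟩ := Metric.eventually_nhds_iff.1 h1
  set δ := min (d/2) (1/8) with hδ
  have hδ0 : 0 < δ := by positivity
  have hδd : δ < d := (min_le_left _ _).trans_lt (by linarith)
  have hw2 : ∀ t ∈ Icc 0 δ, W2 0 / 2 < W2 t := by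
    intro t ht
    apply h
    rw [Real.dist_eq, sub_zero, abs_of_nonneg ht.1]; linarith [ht.2]
  have key : ∀ a b, 0 ≤ a → a < b → b ≤ δ → W2 0 / 2 * (b - a) ≤ W1 b - W1 a := by
    intro a b ha hab hb
    obtain ⟨c, hc, e⟩ := mvt_eq hab g.cW1.continuousOn (fun x _ => g.hd2 x)
    rw [e]
    have := hw2 c ⟨by linarith [hc.1], by linarith [hc.2]⟩
    apply mul_le_mul_of_nonneg_right this.le (by linarith)
  have key2 : ∀ t ∈ Icc 0 δ, W2 0 / 2 * t ≤ W1 t := by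
    intro t ht
    rcases eq_or_lt_of_le ht.1 with e | e
    · rw [← e]; simp [g.d0]
    · have := key 0 t le_rfl e ht.2
      have := g.d0
      simp at *; linarith
  refine ⟨δ, W2 0 / 4, hδ0, (min_le_right _ _).trans_lt (by norm_num), by linarith [g.p0], ?_, ?_, ?_⟩
  · intro a ha b hb
    rcases lt_trichotomy a b with e | e | e
    · have := key a b ha.1 e hb.2
      nlinarith
    · subst e; simp
    · have := key b a hb.1 e ha.2
      nlinarith
  · intro t ht
    have := key2 t ht
    have h0 := g.p0
    have := ht.1
    nlinarith [mul_nonneg h0.le ht.1]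
  · intro t ht
    have hm : MonotoneOn (fun t => W t - W2 0 / 4 * t^2) (Icc 0 δ) := by
      apply monotoneOn_of_deriv_nonneg (convex_Icc _ _)
      · exact (g.cW.sub (by fun_prop)).continuousOn
      · intro x _
        exact ((g.hd1 x).differentiableAt.sub (by fun_prop)).differentiableWithinAt
      · intro x hx
        rw [interior_Icc] at hx
        have : HasDerivAt (fun t => W t - W2 0 / 4 * t^2) (W1 x - W2 0 / 4 * (2 * x)) x := by
          have := (g.hd1 x).fun_sub ((hasDerivAt_pow 2 x).const_mul (W2 0 / 4))
          simpa using this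
        rw [this.deriv]
        have := key2 x ⟨hx.1.le, hx.2.le⟩
        linarith
    have := hm ⟨le_rfl, hδ0.le⟩ ht ht.1
    simp [g.zero] at this
    linarith

lemma lowW (g : GW W W1 W2) : ∃ c : ℝ, 0 < c ∧ ∀ t ∈ Icc (0:ℝ) 1, c * (t * (1 - t))^2 ≤ W t := by
  obtain ⟨d, c, hd, hd4, hc, -, -, h⟩ := g.bot
  obtain ⟨d', c', hd', hd4', hc', -, -, h'⟩ := g.symm.bot
  have : ∃ m, 0 < m ∧ ∀ t ∈ Icc d (1-d'), m ≤ W t := by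
    obtain ⟨x, hx, hm⟩ := isCompact_Icc.exists_isMinOn (s := Icc d (1-d')) ⟨d, le_rfl, by linarith⟩
      g.cW.continuousOn
    exact ⟨W x, g.pos x ⟨by linarith [hx.1], by linarith [hx.2]⟩, fun t ht => hm ht⟩
  obtain ⟨m, hm, hmi⟩ := this
  refine ⟨min (min c c') m, by positivity, fun t ht => ?_⟩
  have e1 : (t * (1-t))^2 ≤ t^2 := by
    apply pow_le_pow_left₀ (mul_nonneg ht.1 (by linarith [ht.2])); nlinarith [ht.1, ht.2]
  have e2 : (t * (1-t))^2 ≤ (1-t)^2 := by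
    apply pow_le_pow_left₀ (mul_nonneg ht.1 (by linarith [ht.2])); nlinarith [ht.1, ht.2]
  have e3 : (t * (1-t))^2 ≤ 1 := by nlinarith [ht.1, ht.2]
  have e0 := sq_nonneg (t * (1-t))
  rcases le_total t d with h1 | h1
  · have := h t ⟨ht.1, h1⟩
    calc _ ≤ c * t^2 := by
          apply mul_le_mul ((min_le_left _ _).trans (min_le_left _ _)) e1 e0 hc.le
      _ ≤ _ := this
  rcases le_total (1-d') t with h2 | h2
  · have := h' (1-t) ⟨by linarith [ht.2], by linarith⟩
    simp only [sub_sub_cancel] at this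
    calc _ ≤ c' * (1-t)^2 := by
          apply mul_le_mul ((min_le_left _ _).trans (min_le_right _ _)) e2 e0 hc'.le
      _ ≤ _ := this
  · calc _ ≤ m * 1 := by
          apply mul_le_mul (min_le_right _ _) e3 e0 hm.le
      _ ≤ _ := by rw [mul_one]; exact hmi t ⟨h1, h2⟩

/-! ### Phi and V -/

lemma dPhi' (g : GW W W1 W2) (t : ℝ) : HasDerivAt (Phi W) (√(W t)) t :=
  (g.cG.integral_hasStrictDerivAt 0 t).hasDerivAt

lemma cPhi (g : GW W W1 W2) : Continuous (Phi W) := continuous_iff_continuousAt.2 fun t => (g.dPhi' t).continuousAt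

lemma Phi_zero : Phi W 0 = 0 := by simp [Phi]
lemma Phi_one (g : GW W W1 W2) : Phi W 1 = 1 := g.norm

lemma Phi_mono (g : GW W W1 W2) : Monotone (Phi W) := by
  apply monotone_of_deriv_nonneg (fun t => (g.dPhi' t).differentiableAt)
  intro t; rw [(g.dPhi' t).deriv]; positivity

lemma Phi_mem (g : GW W W1 W2) {t : ℝ} (ht : t ∈ Icc (0:ℝ) 1) : Phi W t ∈ Icc (0:ℝ) 1 := by
  have h1 := g.Phi_mono ht.1
  have h2 := g.Phi_mono ht.2
  rw [Phi_zero] at h1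
  rw [g.Phi_one] at h2
  exact ⟨h1, h2⟩

/-- `Φ ≥ c t²`. -/
lemma Phi_low (g : GW W W1 W2) : ∃ c : ℝ, 0 < c ∧ ∀ t ∈ Icc (0:ℝ) 1, c * t^2 ≤ Phi W t := by
  obtain ⟨c, hc, h⟩ := g.lowW
  refine ⟨√c / 6, by positivity, fun t ht => ?_⟩
  have hm : MonotoneOn (fun t => Phi W t - √c * (t^2/2 - t^3/3)) (Icc 0 1) := by
    have hd : ∀ x, HasDerivAt (fun t => Phi W t - √c * (t^2/2 - t^3/3)) (√(W x) - √c * (x - x^2)) x := by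
      intro x
      have h2 := ((hasDerivAt_pow 2 x).div_const 2).sub ((hasDerivAt_pow 3 x).div_const 3)
      have := (g.dPhi' x).sub (h2.const_mul (√c))
      refine this.congr_deriv ?_
      simp
    apply monotoneOn_of_deriv_nonneg (convex_Icc _ _)
    · exact fun x _ => (hd x).continuousAt.continuousWithinAt
    · exact fun x _ => (hd x).differentiableAt.differentiableWithinAt
    · intro x hx
      rw [interior_Icc] at hx
      rw [(hd x).deriv]
      have := h x ⟨hx.1.le, hx.2.le⟩
      have h3 := Real.sqrt_le_sqrt this
      rw [Real.sqrt_mul hc.le, Real.sqrt_sq (mul_nonneg hx.1.le (by linarith [hx.2]))] at h3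
      nlinarith
  have := hm ⟨le_rfl, zero_le_one⟩ ht ht.1
  simp [Phi_zero] at this
  have h3 : t^2 * (1/6) ≤ t^2/2 - t^3/3 := by nlinarith [ht.1, ht.2, sq_nonneg t, mul_nonneg (sq_nonneg t) (by linarith [ht.2] : 0 ≤ 1 - t)]
  nlinarith [Real.sqrt_nonneg c]

lemma Phi_pos (g : GW W W1 W2) {t : ℝ} (h0 : 0 < t) (ht : t ≤ 1) : 0 < Phi W t := by
  obtain ⟨c, hc, h⟩ := g.Phi_low
  have := h t ⟨h0.le, ht⟩
  have : 0 < c * t^2 := by positivity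
  linarith

lemma np1 {n : ℕ} (hn : 2 ≤ n) : 1 < (n:ℝ)/((n:ℝ)-1) ∧ (n:ℝ)/((n:ℝ)-1) ≤ 2 := by
  have : (2:ℝ) ≤ n := by exact_mod_cast hn
  constructor
  · rw [lt_div_iff₀ (by linarith)]; linarith
  · rw [div_le_iff₀ (by linarith)]; linarith

lemma dV (g : GW W W1 W2) {n : ℕ} (hn : 2 ≤ n) (t : ℝ) : HasDerivAt (Vpot n W) (V1 n W t) t := by
  have h := (Real.hasDerivAt_rpow_const (x := Phi W t) (p := (n:ℝ)/((n:ℝ)-1)) (Or.inr (np1 hn).1.le)).comp t (g.dPhi' t)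
  exact h

lemma cV (g : GW W W1 W2) {n : ℕ} (hn : 2 ≤ n) : Continuous (Vpot n W) :=
  continuous_iff_continuousAt.2 fun t => (g.dV hn t).continuousAt

lemma cV1 (g : GW W W1 W2) {n : ℕ} (hn : 2 ≤ n) : Continuous (V1 n W) := by
  unfold V1
  apply Continuous.mul _ g.cG
  apply continuous_const.mul
  apply g.cPhi.rpow_const
  intro x; right
  linarith [(np1 hn).1]

lemma V_zero {n : ℕ} (hn : 2 ≤ n) : Vpot n W 0 = 0 := by
  rw [Vpot, Phi_zero, Real.zero_rpow]; linarith [(np1 hn).1]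
lemma V_one (g : GW W W1 W2) {n : ℕ} : Vpot n W 1 = 1 := by
  rw [Vpot, g.Phi_one, Real.one_rpow]

lemma V_mem (g : GW W W1 W2) {n : ℕ} (hn : 2 ≤ n) {t : ℝ} (ht : t ∈ Icc (0:ℝ) 1) : Vpot n W t ∈ Icc (0:ℝ) 1 := by
  have := g.Phi_mem ht
  exact ⟨Real.rpow_nonneg this.1 _, Real.rpow_le_one this.1 this.2 (by linarith [(np1 hn).1])⟩

lemma V_pos (g : GW W W1 W2) {n : ℕ} {t : ℝ} (h0 : 0 < t) (ht : t ≤ 1) : 0 < Vpot n W t :=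
  Real.rpow_pos_of_pos (g.Phi_pos h0 ht) _

lemma V_mono (g : GW W W1 W2) {n : ℕ} (hn : 2 ≤ n) {a b : ℝ} (ha : 0 ≤ a) (hab : a ≤ b) : Vpot n W a ≤ Vpot n W b := by
  apply Real.rpow_le_rpow _ (g.Phi_mono hab) (by linarith [(np1 hn).1])
  have := g.Phi_mono ha; rwa [Phi_zero] at this

lemma V_le_Phi (g : GW W W1 W2) {n : ℕ} (hn : 2 ≤ n) {t : ℝ} (ht : t ∈ Icc (0:ℝ) 1) : Vpot n W t ≤ Phi W t := by
  have := g.Phi_mem ht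
  have h := Real.rpow_le_rpow_of_exponent_ge' this.1 this.2 zero_le_one (np1 hn).1.le
  rwa [Real.rpow_one] at h

lemma V1_nonneg (g : GW W W1 W2) {n : ℕ} (hn : 2 ≤ n) {t : ℝ} (ht : t ∈ Icc (0:ℝ) 1) : 0 ≤ V1 n W t := by
  have := g.Phi_mem ht
  have := Real.rpow_nonneg this.1 ((n : ℝ) / ((n : ℝ) - 1) - 1)
  have := (np1 hn).1
  unfold V1; positivity

lemma V1_le (g : GW W W1 W2) {n : ℕ} (hn : 2 ≤ n) {t : ℝ} (ht : t ∈ Icc (0:ℝ) 1) : V1 n W t ≤ 2 * √(W t) := by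
  have := g.Phi_mem ht
  have h1 := Real.rpow_le_one this.1 this.2 (by linarith [(np1 hn).1] : 0 ≤ (n : ℝ) / ((n : ℝ) - 1) - 1)
  have h0 := Real.rpow_nonneg this.1 ((n : ℝ) / ((n : ℝ) - 1) - 1)
  have := np1 hn
  unfold V1
  apply mul_le_mul_of_nonneg_right _ (Real.sqrt_nonneg _)
  nlinarith

lemma V1_sq (g : GW W W1 W2) {n : ℕ} (hn : 2 ≤ n) {t : ℝ} (ht : t ∈ Icc (0:ℝ) 1) : V1 n W t ^ 2 ≤ 4 * W t := by
  have h1 := g.V1_le hn ht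
  have h0 := g.V1_nonneg hn ht
  have := Real.sq_sqrt (g.nonneg ht)
  nlinarith [Real.sqrt_nonneg (W t)]

lemma V1_zero (g : GW W W1 W2) {n : ℕ} : V1 n W 0 = 0 := by simp [V1, g.zero]
lemma V1_one (g : GW W W1 W2) {n : ℕ} : V1 n W 1 = 0 := by simp [V1, g.one]

lemma lipV (g : GW W W1 W2) {n : ℕ} (hn : 2 ≤ n) : ∃ M : ℝ, 0 < M ∧ ∀ a ∈ Icc (0:ℝ) 1, ∀ b ∈ Icc (0:ℝ) 1,
    |Vpot n W a - Vpot n W b| ≤ M * |a - b| := by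
  obtain ⟨M, h⟩ := isCompact_Icc.exists_bound_of_continuousOn (s := Icc (0:ℝ) 1) (g.cV1 hn).continuousOn
  refine ⟨max M 1, by positivity, fun a ha b hb => ?_⟩
  have := Convex.norm_image_sub_le_of_norm_hasDerivWithin_le (s := Icc (0:ℝ) 1) (C := max M 1)
    (fun x _ => (g.dV hn x).hasDerivWithinAt) (fun x hx => (h x hx).trans (le_max_left _ _)) (convex_Icc 0 1) hb ha
  simpa using this

/-! ### Facts using `W'(0)=0` -/

lemma upW1 (g : GW W W1 W2) (h0 : W1 0 = 0) : ∃ C : ℝ, 1 ≤ C ∧ ∀ t ∈ Icc (0:ℝ) 1, |W1 t| ≤ C * t := by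
  obtain ⟨M, hM, h⟩ := g.lipW1
  refine ⟨max M 1, le_max_right _ _, fun t ht => ?_⟩
  have := h t ht 0 (by simp)
  rw [h0, sub_zero, sub_zero, abs_of_nonneg ht.1] at this
  exact this.trans (mul_le_mul_of_nonneg_right (le_max_left _ _) ht.1)

lemma difW (g : GW W W1 W2) (h0 : W1 0 = 0) : ∃ C : ℝ, 1 ≤ C ∧ ∀ a ∈ Icc (0:ℝ) 1, ∀ b ∈ Icc (0:ℝ) 1,
    |W a - W b| ≤ C * (a + b) * |a - b| := by
  obtain ⟨C, hC, h⟩ := g.upW1 h0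
  refine ⟨C, hC, ?_⟩
  have key : ∀ a ∈ Icc (0:ℝ) 1, ∀ b ∈ Icc (0:ℝ) 1, a < b → |W a - W b| ≤ C * (a + b) * |a - b| := by
    intro a ha b hb hab
    obtain ⟨c, hc, e⟩ := mvt_eq hab g.cW.continuousOn (fun x _ => g.hd1 x)
    rw [abs_sub_comm, e, abs_mul, abs_sub_comm b a]
    apply mul_le_mul_of_nonneg_right _ (abs_nonneg _)
    have := h c ⟨by linarith [hc.1, ha.1], by linarith [hc.2, hb.2]⟩
    have h1 := hc.2; have h2 := ha.1
    nlinarith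
  intro a ha b hb
  rcases lt_trichotomy a b with e | e | e
  · exact key a ha b hb e
  · subst e; simp
  · have := key b hb a ha e
    rwa [abs_sub_comm, abs_sub_comm b a, add_comm b a] at this

lemma upW (g : GW W W1 W2) (h0 : W1 0 = 0) : ∃ C : ℝ, 1 ≤ C ∧ ∀ t ∈ Icc (0:ℝ) 1, W t ≤ C * t^2 := by
  obtain ⟨C, hC, h⟩ := g.difW h0
  refine ⟨C, hC, fun t ht => ?_⟩
  have := h t ht 0 (by simp)
  rw [g.zero, sub_zero, sub_zero, add_zero, abs_of_nonneg ht.1, abs_of_nonneg (g.nonneg ht)] at this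
  nlinarith

lemma upV1 (g : GW W W1 W2) (h0 : W1 0 = 0) {n : ℕ} (hn : 2 ≤ n) : ∃ C : ℝ, 1 ≤ C ∧ ∀ t ∈ Icc (0:ℝ) 1, |V1 n W t| ≤ C * t := by
  obtain ⟨C, hC, h⟩ := g.upW h0
  refine ⟨2 * C, by linarith, fun t ht => ?_⟩
  rw [abs_of_nonneg (g.V1_nonneg hn ht)]
  have h1 := g.V1_le hn ht
  have : √(W t) ≤ C * t := by
    apply Real.sqrt_le_iff.2 ⟨mul_nonneg (by linarith) ht.1, (h t ht).trans ?_⟩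
    nlinarith [sq_nonneg t]
  linarith

lemma difV (g : GW W W1 W2) (h0 : W1 0 = 0) {n : ℕ} (hn : 2 ≤ n) : ∃ C : ℝ, 1 ≤ C ∧ ∀ a ∈ Icc (0:ℝ) 1, ∀ b ∈ Icc (0:ℝ) 1,
    |Vpot n W a - Vpot n W b| ≤ C * (a + b) * |a - b| := by
  obtain ⟨C, hC, h⟩ := g.upV1 h0 hn
  refine ⟨C, hC, ?_⟩
  have key : ∀ a ∈ Icc (0:ℝ) 1, ∀ b ∈ Icc (0:ℝ) 1, a < b → |Vpot n W a - Vpot n W b| ≤ C * (a + b) * |a - b| := by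
    intro a ha b hb hab
    obtain ⟨c, hc, e⟩ := mvt_eq hab (g.cV hn).continuousOn (fun x _ => g.dV hn x)
    rw [abs_sub_comm, e, abs_mul, abs_sub_comm b a]
    apply mul_le_mul_of_nonneg_right _ (abs_nonneg _)
    have := h c ⟨by linarith [hc.1, ha.1], by linarith [hc.2, hb.2]⟩
    have h1 := hc.2; have h2 := ha.1
    nlinarith
  intro a ha b hb
  rcases lt_trichotomy a b with e | e | e
  · exact key a ha b hb e
  · subst e; simp
  · have := key b hb a ha e
    rwa [abs_sub_comm, abs_sub_comm b a, add_comm b a] at this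

lemma upV (g : GW W W1 W2) (h0 : W1 0 = 0) {n : ℕ} (hn : 2 ≤ n) : ∃ C : ℝ, 1 ≤ C ∧ ∀ t ∈ Icc (0:ℝ) 1, Vpot n W t ≤ C * t^2 := by
  obtain ⟨C, hC, h⟩ := g.difV h0 hn
  refine ⟨C, hC, fun t ht => ?_⟩
  have := h t ht 0 (by simp)
  rw [V_zero hn, sub_zero, sub_zero, add_zero, abs_of_nonneg ht.1, abs_of_nonneg (g.V_mem hn ht).1] at this
  nlinarith

/-- `V ≤ C W` away from 1. -/
lemma V_le_W (g : GW W W1 W2) (h0 : W1 0 = 0) {n : ℕ} (hn : 2 ≤ n) {δ : ℝ} (hδ : 0 < δ) : ∃ C : ℝ, 0 < C ∧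
    ∀ t ∈ Icc (0:ℝ) 1, t ≤ 1 - δ → Vpot n W t ≤ C * W t := by
  obtain ⟨C, hC, h⟩ := g.upV h0 hn
  obtain ⟨c, hc, h'⟩ := g.lowW
  refine ⟨C / (c * δ^2), by positivity, fun t ht htd => ?_⟩
  rw [div_mul_eq_mul_div, le_div_iff₀ (by positivity)]
  have h1 := h t ht
  have h2 := h' t ht
  have h3 : δ^2 * t^2 ≤ (t*(1-t))^2 := by
    rw [← mul_pow]; apply pow_le_pow_left₀ (mul_nonneg hδ.le ht.1); nlinarith [ht.1]
  calc Vpot n W t * (c * δ^2) ≤ C * t^2 * (c * δ^2) := by gcongr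
    _ = C * (c * (δ^2 * t^2)) := by ring
    _ ≤ C * (c * (t*(1-t))^2) := by gcongr
    _ ≤ C * W t := by gcongr

/-- facts near 1. -/
lemma top (g : GW W W1 W2) {n : ℕ} (hn : 2 ≤ n) : ∃ δ c C : ℝ, 0 < δ ∧ δ < 1/4 ∧ 0 < c ∧ 0 < C ∧
    (∀ a ∈ Icc (1-δ) 1, ∀ b ∈ Icc (1-δ) 1, 2 * c * (a - b)^2 ≤ (W1 a - W1 b) * (a - b)) ∧
    (∀ t ∈ Icc (1-δ) 1, W1 t ≤ 0) ∧
    (∀ a ∈ Icc (1-δ) 1, ∀ b ∈ Icc (1-δ) 1, a ≤ b → √(W b) ≤ √(W a)) ∧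
    (∀ a ∈ Icc (1-δ) 1, ∀ b ∈ Icc (1-δ) 1, (V1 n W a - V1 n W b) * (a - b) ≤ C * (a - b)^2) := by
  obtain ⟨δ, c, hδ, hδ4, hc, h1, h2, -⟩ := g.symm.bot
  have hmono : ∀ a ∈ Icc (1-δ) 1, ∀ b ∈ Icc (1-δ) 1, a ≤ b → √(W b) ≤ √(W a) := by
    intro a ha b hb hab
    apply Real.sqrt_le_sqrt
    have : AntitoneOn W (Icc (1-δ) 1) := by
      apply antitoneOn_of_deriv_nonpos (convex_Icc _ _) g.cW.continuousOn
      · exact fun x _ => (g.hd1 x).differentiableAt.differentiableWithinAt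
      · intro x hx
        rw [interior_Icc] at hx
        rw [(g.hd1 x).deriv]
        have := h2 (1-x) ⟨by linarith [hx.2], by linarith [hx.1]⟩
        simp only [sub_sub_cancel] at this; linarith
    exact this ha hb hab
  set α := (n : ℝ) / ((n : ℝ) - 1) - 1 with hα
  have hα0 : 0 < α := by linarith [(np1 hn).1]
  have hPp : ∀ t ∈ Icc (1-δ) 1, 0 < Phi W t := fun t ht => g.Phi_pos (by linarith [ht.1]) ht.2
  have hder : ∀ t ∈ Icc (1-δ) 1, HasDerivAt (fun t => Phi W t ^ α) (√(W t) * α * Phi W t ^ (α - 1)) t := by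
    intro t ht
    exact (g.dPhi' t).rpow_const (Or.inl (hPp t ht).ne')
  have hcont : ContinuousOn (fun t => √(W t) * α * Phi W t ^ (α - 1)) (Icc (1-δ) 1) := by
    apply ContinuousOn.mul (g.cG.continuousOn.mul continuousOn_const)
    exact g.cPhi.continuousOn.rpow_const (fun t ht => Or.inl (hPp t ht).ne')
  obtain ⟨M, hM⟩ := isCompact_Icc.exists_bound_of_continuousOn hcont
  obtain ⟨G, hG⟩ := isCompact_Icc.exists_bound_of_continuousOn (s := Icc (1-δ) 1) g.cG.continuousOn
  have hM0 : 0 ≤ M := (norm_nonneg _).trans (hM 1 ⟨by linarith, le_rfl⟩)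
  have hG0 : 0 ≤ G := (norm_nonneg _).trans (hG 1 ⟨by linarith, le_rfl⟩)
  have key : ∀ a ∈ Icc (1-δ) 1, ∀ b ∈ Icc (1-δ) 1, b < a → V1 n W a - V1 n W b ≤ (2 * G * M + 1) * (a - b) := by
    intro a ha b hb hab
    have hn2 := np1 hn
    have hlip : Phi W a ^ α - Phi W b ^ α ≤ M * (a - b) := by
      obtain ⟨c, hc, e⟩ := mvt_eq (f := fun t => Phi W t ^ α) hab (fun x hx => (hder x ⟨by linarith [hx.1, hb.1], by linarith [hx.2, ha.2]⟩).continuousAt.continuousWithinAt)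
        (fun x hx => hder x ⟨by linarith [hx.1, hb.1], by linarith [hx.2, ha.2]⟩)
      rw [e]
      apply mul_le_mul_of_nonneg_right _ (by linarith)
      exact (le_abs_self _).trans (hM c ⟨by linarith [hc.1, hb.1], by linarith [hc.2, ha.2]⟩)
    have e1 := hmono b hb a ha hab.le
    have e2 : √(W b) ≤ G := (le_abs_self _).trans (hG b hb)
    have e3 := Real.sqrt_nonneg (W b)
    have e4 : 0 ≤ Phi W a ^ α := Real.rpow_nonneg (hPp a ha).le _
    have : V1 n W a - V1 n W b = (n : ℝ) / ((n : ℝ) - 1) * (Phi W a ^ α * (√(W a) - √(W b)) + √(W b) * (Phi W a ^ α - Phi W b ^ α)) := by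
      unfold V1; ring
    rw [this]
    have f1 : Phi W a ^ α * (√(W a) - √(W b)) ≤ 0 := mul_nonpos_of_nonneg_of_nonpos e4 (by linarith)
    have f2 : √(W b) * (Phi W a ^ α - Phi W b ^ α) ≤ G * (M * (a - b)) := by
      calc _ ≤ √(W b) * (M * (a - b)) := by gcongr
        _ ≤ _ := by
          apply mul_le_mul_of_nonneg_right e2 (mul_nonneg hM0 (by linarith))
    have f3 : 0 ≤ G * (M * (a - b)) := mul_nonneg hG0 (mul_nonneg hM0 (by linarith))
    calc _ ≤ (n : ℝ) / ((n : ℝ) - 1) * (G * (M * (a - b))) := by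
          apply mul_le_mul_of_nonneg_left (by linarith) (by linarith)
      _ ≤ 2 * (G * (M * (a - b))) := mul_le_mul_of_nonneg_right hn2.2 f3
      _ ≤ _ := by nlinarith
  refine ⟨δ, c, 2 * G * M + 1, hδ, hδ4, hc, by positivity, ?_, ?_, hmono, ?_⟩
  · intro a ha b hb
    have := h1 (1-a) ⟨by linarith [ha.2], by linarith [ha.1]⟩ (1-b) ⟨by linarith [hb.2], by linarith [hb.1]⟩
    simp only [sub_sub_cancel] at this
    nlinarith
  · intro t ht
    have := h2 (1-t) ⟨by linarith [ht.2], by linarith [ht.1]⟩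
    simp only [sub_sub_cancel] at this; linarith
  · intro a ha b hb
    rcases lt_trichotomy b a with e | e | e
    · have := key a ha b hb e
      nlinarith
    · subst e; simp
    · have := key b hb a ha e
      nlinarith

/-- `1 - V ≤ C W` away from 0. -/
lemma V_top_W (g : GW W W1 W2) {n : ℕ} (hn : 2 ≤ n) {δ : ℝ} (hδ : 0 < δ) : ∃ C : ℝ, 0 < C ∧
    ∀ t ∈ Icc (0:ℝ) 1, δ ≤ t → 1 - Vpot n W t ≤ C * W t := by
  obtain ⟨d, -, -, hd, hd4, -, -, -, -, hanti, -⟩ := g.top hn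
  obtain ⟨c, hc, h'⟩ := g.lowW
  refine ⟨max (2 / (√c * (1/2))) (1 / (c * (δ * d)^2)), by positivity, fun t ht htd => ?_⟩
  have hW0 := g.nonneg ht
  rcases le_total (1 - d) t with h | h
  · refine le_trans ?_ (mul_le_mul_of_nonneg_right (le_max_left _ _) hW0)
    rcases eq_or_lt_of_le ht.2 with e | e
    · rw [e, g.V_one, g.one]; simp
    obtain ⟨x, hx, ex⟩ := mvt_eq e (g.cV hn).continuousOn (fun x _ => g.dV hn x)
    rw [g.V_one] at ex
    rw [ex]
    have h1 := g.V1_le hn (t := x) ⟨by linarith [hx.1, ht.1], hx.2.le⟩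
    have h2 := hanti t ⟨h, ht.2⟩ x ⟨by linarith [hx.1], hx.2.le⟩ hx.1.le
    have h3 := Real.sqrt_le_sqrt (h' t ht)
    rw [Real.sqrt_mul hc.le, Real.sqrt_sq (mul_nonneg ht.1 (by linarith [ht.2]))] at h3
    have h4 : √c * (1/2) * (1 - t) ≤ √(W t) := by
      refine le_trans ?_ h3
      have : 1/2 * (1-t) ≤ t * (1-t) := mul_le_mul_of_nonneg_right (by linarith) (by linarith)
      have := mul_le_mul_of_nonneg_left this (Real.sqrt_nonneg c)
      linarith
    have hs : 0 < √c * (1/2) := by positivity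
    rw [div_mul_eq_mul_div, le_div_iff₀ hs]
    have h5 := Real.mul_self_sqrt hW0
    calc V1 n W x * (1-t) * (√c * (1/2)) = V1 n W x * (√c * (1/2) * (1-t)) := by ring
      _ ≤ (2 * √(W t)) * √(W t) := by
          apply mul_le_mul (by linarith) h4 (mul_nonneg hs.le (by linarith)) (by positivity)
      _ = 2 * W t := by rw [mul_assoc, h5]
  · refine le_trans ?_ (mul_le_mul_of_nonneg_right (le_max_right _ _) hW0)
    have h1 := (g.V_mem hn ht).1
    have h2 : c * (δ * d)^2 ≤ W t := by
      refine le_trans ?_ (h' t ht)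
      have : d ≤ 1 - t := by linarith
      have := ht.1
      gcongr
    rw [div_mul_eq_mul_div, one_mul, le_div_iff₀ (by positivity)]
    have : 0 ≤ c * (δ*d)^2 := by positivity
    nlinarith

/-- `V'` is Lipschitz away from 1. -/
lemma lipV1 (g : GW W W1 W2) (h0 : W1 0 = 0) {n : ℕ} (hn : 2 ≤ n) {δ : ℝ} (hδ : 0 < δ) : ∃ C : ℝ, 0 < C ∧
    ∀ a ∈ Icc (0:ℝ) (1-δ), ∀ b ∈ Icc (0:ℝ) (1-δ), |V1 n W a - V1 n W b| ≤ C * |a - b| := by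
  obtain ⟨cP, hcP, hP⟩ := g.Phi_low
  obtain ⟨cW, hcW, hWl⟩ := g.lowW
  obtain ⟨CW, hCW, hWu⟩ := g.upW h0
  obtain ⟨C1, hC1, hW1⟩ := g.upW1 h0
  set p := (n : ℝ) / ((n : ℝ) - 1) with hp
  have hp1 : 1 < p := (np1 hn).1
  have hp2 : p ≤ 2 := (np1 hn).2
  set α := p - 1 with hα
  set K := 2 * (cP⁻¹ * CW + C1 / (2 * (√cW * δ))) + 1 with hK
  have hK0 : 0 < K := by positivity
  have hder : ∀ t ∈ Ioo (0:ℝ) (1-δ), HasDerivAt (V1 n W)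
      (p * (√(W t) * α * Phi W t ^ (α - 1)) * √(W t) + p * Phi W t ^ α * (W1 t / (2 * √(W t)))) t := by
    intro t ht
    have hPp := g.Phi_pos ht.1 (by linarith [ht.2])
    have hWp := g.pos t ⟨ht.1, by linarith [ht.2]⟩
    have d1 := (g.dPhi' t).rpow_const (p := α) (Or.inl hPp.ne')
    have d2 := (g.hd1 t).sqrt hWp.ne'
    exact ((d1.const_mul p).mul d2)
  have hbd : ∀ t ∈ Ioo (0:ℝ) (1-δ), |p * (√(W t) * α * Phi W t ^ (α - 1)) * √(W t) + p * Phi W t ^ α * (W1 t / (2 * √(W t)))| ≤ K := by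
    intro t ht
    have hI : t ∈ Icc (0:ℝ) 1 := ⟨ht.1.le, by linarith [ht.2]⟩
    have ht0 := ht.1
    have hPp := g.Phi_pos ht.1 hI.2
    have hWp := g.pos t ⟨ht.1, by linarith [ht.2]⟩
    have hPm := g.Phi_mem hI
    have a1 : Phi W t ^ (α - 1) ≤ (cP * t^2)⁻¹ := by
      have : Phi W t ^ (α - 1) ≤ Phi W t ^ (-1:ℝ) :=
        Real.rpow_le_rpow_of_exponent_ge hPp hPm.2 (by linarith)
      rw [Real.rpow_neg_one] at this
      exact this.trans (inv_anti₀ (by positivity) (hP t hI))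
    have a2 : Phi W t ^ α ≤ 1 := Real.rpow_le_one hPm.1 hPm.2 (by linarith)
    have a20 : 0 ≤ Phi W t ^ α := Real.rpow_nonneg hPm.1 _
    have a10 : 0 ≤ Phi W t ^ (α-1) := Real.rpow_nonneg hPm.1 _
    have a3 : √cW * δ * t ≤ √(W t) := by
      have h3 := Real.sqrt_le_sqrt (hWl t hI)
      rw [Real.sqrt_mul hcW.le, Real.sqrt_sq (mul_nonneg ht0.le (by linarith [hI.2]))] at h3
      refine le_trans ?_ h3
      have : δ * t ≤ t * (1-t) := by nlinarith [ht.2]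
      have := mul_le_mul_of_nonneg_left this (Real.sqrt_nonneg cW)
      linarith
    have hcd : 0 < √cW * δ * t := by positivity
    have b1 : |p * (√(W t) * α * Phi W t ^ (α - 1)) * √(W t)| ≤ 2 * (cP⁻¹ * CW) := by
      have e : p * (√(W t) * α * Phi W t ^ (α - 1)) * √(W t) = p * α * (W t * Phi W t ^ (α-1)) := by
        have := Real.mul_self_sqrt hWp.le
        calc _ = p * α * ((√(W t) * √(W t)) * Phi W t ^ (α-1)) := by ring
          _ = _ := by rw [this]
      rw [e, abs_of_nonneg (by apply mul_nonneg (mul_nonneg (by linarith) (by linarith)); positivity)]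
      have c1 : W t * Phi W t ^ (α-1) ≤ (CW * t^2) * (cP * t^2)⁻¹ :=
        mul_le_mul (hWu t hI) a1 a10 (by positivity)
      have c2 : (CW * t^2) * (cP * t^2)⁻¹ = cP⁻¹ * CW := by field_simp
      rw [c2] at c1
      apply mul_le_mul _ c1 (by positivity) (by norm_num)
      nlinarith
    have b2 : |p * Phi W t ^ α * (W1 t / (2 * √(W t)))| ≤ 2 * (C1 / (2 * (√cW * δ))) := by
      rw [abs_mul]
      apply mul_le_mul _ _ (abs_nonneg _) (by norm_num)
      · rw [abs_of_nonneg (by positivity)]; nlinarith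
      · rw [abs_div, abs_of_pos (a := 2 * √(W t)) (by positivity), div_le_div_iff₀ (by positivity) (by positivity)]
        calc |W1 t| * (2 * (√cW * δ)) ≤ C1 * t * (2 * (√cW * δ)) := by gcongr; exact hW1 t hI
          _ = C1 * (2 * (√cW * δ * t)) := by ring
          _ ≤ C1 * (2 * √(W t)) := by gcongr
    calc _ ≤ _ := abs_add_le _ _
      _ ≤ K := by rw [hK]; linarith
  have key : ∀ a ∈ Icc (0:ℝ) (1-δ), ∀ b ∈ Icc (0:ℝ) (1-δ), a < b → |V1 n W a - V1 n W b| ≤ K * |a - b| := by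
    intro a ha b hb hab
    obtain ⟨x, hx, e⟩ := mvt_eq hab (g.cV1 hn).continuousOn
      (fun x hx => hder x ⟨by linarith [hx.1, ha.1], by linarith [hx.2, hb.2]⟩)
    rw [abs_sub_comm, e, abs_mul, abs_sub_comm b a]
    exact mul_le_mul_of_nonneg_right (hbd x ⟨by linarith [hx.1, ha.1], by linarith [hx.2, hb.2]⟩) (abs_nonneg _)
  refine ⟨K, hK0, fun a ha b hb => ?_⟩
  rcases lt_trichotomy a b with e | e | e
  · exact key a ha b hb e
  · subst e; simp
  · have := key b hb a ha e
    rwa [abs_sub_comm, abs_sub_comm b a] at this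

end GW


lemma H1Box.mk' {n : ℕ} {u : En n → ℝ} (h1 : ∀ x, u x ∈ Icc (0:ℝ) 1) (h2 : Differentiable ℝ u)
    (h3 : Integrable (fun x => u x ^ 2)) (h4 : Integrable (fun x => ‖fderiv ℝ u x‖ ^ 2)) : H1Box n u :=
  ⟨h1, h2, (memLp_two_iff_integrable_sq h2.continuous.aestronglyMeasurable).2 h3,
    (memLp_two_iff_integrable_sq_norm
      (measurable_fderiv ℝ u).stronglyMeasurable.aestronglyMeasurable).2 h4⟩

namespace H1Box
variable {n : ℕ} {u v : En n → ℝ}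

lemma intSq (h : H1Box n u) : Integrable (fun x => u x ^ 2) := h.memL2.integrable_sq
lemma intD (h : H1Box n u) : Integrable (fun x => ‖fderiv ℝ u x‖ ^ 2) :=
  (memLp_two_iff_integrable_sq_norm
      (measurable_fderiv ℝ u).stronglyMeasurable.aestronglyMeasurable).1 h.grad_memL2

lemma cont (h : H1Box n u) : Continuous u := h.diff.continuous

lemma intF (h : H1Box n u) {F : ℝ → ℝ} (hF : Continuous F) {C : ℝ}
    (hb : ∀ t ∈ Icc (0:ℝ) 1, |F t| ≤ C * t^2) : Integrable (fun x => F (u x)) := by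
  refine (h.intSq.const_mul C).mono' (hF.comp h.cont).aestronglyMeasurable ?_
  exact Eventually.of_forall fun x => hb _ (h.mem_Icc x)

lemma scale (h : H1Box n u) {l : ℝ} (hl : 0 < l) : H1Box n (fun x => u (l • x)) := by
  refine H1Box.mk' (fun x => h.mem_Icc _) (h.diff.comp (by fun_prop)) ?_ ?_
  · exact h.intSq.comp_smul hl.ne'
  · have : (fun x => ‖fderiv ℝ (fun x => u (l • x)) x‖ ^ 2) =
        fun x => l^2 * (fun y => ‖fderiv ℝ u y‖^2) (l • x) := by
      ext x
      rw [fderiv_comp_smul, norm_smul, mul_pow, Real.norm_eq_abs, sq_abs]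
    rw [this]
    exact (h.intD.comp_smul hl.ne').const_mul _

end H1Box

lemma integral_scale {n : ℕ} (f : En n → ℝ) {l : ℝ} (hl : 0 < l) :
    ∫ x, f (l • x) = (l^n)⁻¹ * ∫ x, f x := by
  rw [Measure.integral_comp_smul]
  simp [abs_of_pos hl]

lemma integral_D_scale {n : ℕ} (u : En n → ℝ) {l : ℝ} (hl : 0 < l) :
    ∫ x, ‖fderiv ℝ (fun x => u (l • x)) x‖ ^ 2 = l^2 * (l^n)⁻¹ * ∫ x, ‖fderiv ℝ u x‖ ^ 2 := by
  have : (fun x => ‖fderiv ℝ (fun x => u (l • x)) x‖ ^ 2) =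
        fun x => l^2 * (fun y => ‖fderiv ℝ u y‖^2) (l • x) := by
    ext x
    rw [fderiv_comp_smul, norm_smul, mul_pow, Real.norm_eq_abs, sq_abs]
  rw [this, integral_const_mul, integral_scale (fun y => ‖fderiv ℝ u y‖^2) hl]
  ring

lemma AC_nonneg {n : ℕ} {W W1 W2 : ℝ → ℝ} (g : GW W W1 W2) {ε : ℝ} (hε : 0 < ε) {u : En n → ℝ}
    (h : H1Box n u) : 0 ≤ AC n W ε u := by
  unfold AC
  have h1 : 0 ≤ ∫ x, ‖fderiv ℝ u x‖ ^ 2 := integral_nonneg fun x => by positivity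
  have h2 : 0 ≤ ∫ x, W (u x) := integral_nonneg fun x => g.nonneg (h.mem_Icc x)
  positivity

lemma Psi_le {n : ℕ} {W W1 W2 : ℝ → ℝ} (g : GW W W1 W2) {ε : ℝ} (hε : 0 < ε) {u : En n → ℝ}
    (h : H1Box n u) (h1 : ∫ x, Vpot n W (u x) = 1) : Psi n W ε 1 ≤ AC n W ε u := by
  apply csInf_le
  · refine ⟨0, ?_⟩
    rintro _ ⟨v, ⟨hv, _⟩, rfl⟩
    exact AC_nonneg g hε hv
  · exact ⟨u, ⟨h, h1⟩, rfl⟩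

lemma Psi_nonneg {n : ℕ} {W W1 W2 : ℝ → ℝ} (g : GW W W1 W2) {ε : ℝ} (hε : 0 < ε) :
    0 ≤ Psi n W ε 1 := by
  apply Real.sInf_nonneg
  rintro _ ⟨v, ⟨hv, _⟩, rfl⟩
  exact AC_nonneg g hε hv

/-- exact scaling inequality -/
lemma Psi_scale {n : ℕ} (hn : 2 ≤ n) {W W1 W2 : ℝ → ℝ} (g : GW W W1 W2) {ε : ℝ} (hε : 0 < ε) {u : En n → ℝ}
    (h : H1Box n u) (hm : 0 < ∫ x, Vpot n W (u x)) :
    Psi n W ε 1 ≤ (∫ x, Vpot n W (u x)) ^ (-(((n:ℝ)-2)/n)) * (ε * ∫ x, ‖fderiv ℝ u x‖ ^ 2)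
      + (∫ x, Vpot n W (u x))⁻¹ * (ε⁻¹ * ∫ x, W (u x)) := by
  set m := ∫ x, Vpot n W (u x) with hmd
  have hn0 : (n:ℝ) ≠ 0 := by positivity
  set l := m ^ ((1:ℝ)/n) with hl
  have hl0 : 0 < l := Real.rpow_pos_of_pos hm _
  have hln : l ^ n = m := by
    rw [hl, ← Real.rpow_natCast, ← Real.rpow_mul hm.le]; field_simp; simp
  have hl2 : l^2 * (l^n)⁻¹ = m ^ (-(((n:ℝ)-2)/n)) := by
    rw [hln, hl, ← Real.rpow_natCast, ← Real.rpow_mul hm.le, ← Real.rpow_neg_one m, ← Real.rpow_add hm]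
    congr 1; push_cast; field_simp; ring
  have hs := h.scale hl0
  have hV : ∫ x, Vpot n W (u (l • x)) = 1 := by
    rw [integral_scale (fun y => Vpot n W (u y)) hl0, hln, ← hmd, inv_mul_cancel₀ hm.ne']
  refine (Psi_le g hε hs hV).trans (le_of_eq ?_)
  unfold AC
  rw [integral_D_scale u hl0, integral_scale (fun y => W (u y)) hl0, hl2, hln]
  ring

lemma Psi_min {n : ℕ} (hn : 2 ≤ n) {W W1 W2 : ℝ → ℝ} (g : GW W W1 W2) {ε : ℝ} (hε : 0 < ε) {u : En n → ℝ}
    (h : H1Box n u) : Psi n W ε 1 * min 1 (∫ x, Vpot n W (u x)) ≤ AC n W ε u := by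
  have hp := Psi_nonneg (n := n) g hε
  have hD : 0 ≤ ε * ∫ x, ‖fderiv ℝ u x‖ ^ 2 :=
    mul_nonneg hε.le (integral_nonneg fun x => by positivity)
  have hWn : 0 ≤ ε⁻¹ * ∫ x, W (u x) :=
    mul_nonneg (by positivity) (integral_nonneg fun x => g.nonneg (h.mem_Icc x))
  have hm0 : 0 ≤ ∫ x, Vpot n W (u x) := integral_nonneg fun x => (g.V_mem hn (h.mem_Icc x)).1
  rcases eq_or_lt_of_le hm0 with e | hm
  · rw [← e]; simp; exact AC_nonneg g hε h
  have key := Psi_scale hn g hε h hm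
  set m := ∫ x, Vpot n W (u x) with hmd
  have hn2 : (2:ℝ) ≤ n := by exact_mod_cast hn
  have hq : 0 ≤ ((n:ℝ)-2)/n := div_nonneg (by linarith) (by linarith)
  have hq1 : ((n:ℝ)-2)/n ≤ 1 := by rw [div_le_one (by linarith)]; linarith
  unfold AC
  rcases le_total 1 m with h1 | h1
  · rw [min_eq_left h1, mul_one]
    refine key.trans (add_le_add ?_ ?_)
    · refine mul_le_of_le_one_left hD ?_
      exact Real.rpow_le_one_of_one_le_of_nonpos h1 (by linarith)
    · refine mul_le_of_le_one_left hWn ?_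
      exact inv_le_one_of_one_le₀ h1
  · rw [min_eq_right h1]
    have : m ^ (-(((n:ℝ)-2)/n)) ≤ m⁻¹ := by
      rw [← Real.rpow_neg_one m]
      exact Real.rpow_le_rpow_of_exponent_ge hm h1 (by linarith)
    have k2 : Psi n W ε 1 ≤ m⁻¹ * (ε * ∫ x, ‖fderiv ℝ u x‖ ^ 2) + m⁻¹ * (ε⁻¹ * ∫ x, W (u x)) :=
      key.trans (add_le_add (mul_le_mul_of_nonneg_right this hD) le_rfl)
    calc Psi n W ε 1 * m ≤ (m⁻¹ * (ε * ∫ x, ‖fderiv ℝ u x‖ ^ 2) + m⁻¹ * (ε⁻¹ * ∫ x, W (u x))) * m :=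
          mul_le_mul_of_nonneg_right k2 hm.le
      _ = _ := by field_simp

/-! ### Isometries -/

lemma integral_isom {n : ℕ} (f : En n → ℝ) (L : En n ≃ₗᵢ[ℝ] En n) (b : En n) :
    ∫ x, f (L x + b) = ∫ x, f x := by
  have h1 := L.measurePreserving.integral_comp L.toHomeomorph.measurableEmbedding (fun y => f (y + b))
  rw [h1, integral_add_right_eq_self]

lemma integrable_isom {n : ℕ} {f : En n → ℝ} (hf : Integrable f) (L : En n ≃ₗᵢ[ℝ] En n) (b : En n) :
    Integrable (fun x => f (L x + b)) := by
  have h1 := L.measurePreserving.integrable_comp_emb L.toHomeomorph.measurableEmbedding (g := fun y => f (y + b))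
  exact h1.2 (hf.comp_add_right b)

lemma fderiv_isom {n : ℕ} {u : En n → ℝ} (hu : Differentiable ℝ u) (L : En n ≃ₗᵢ[ℝ] En n) (b x : En n) :
    fderiv ℝ (fun x => u (L x + b)) x = (fderiv ℝ u (L x + b)).comp (L : En n →L[ℝ] En n) := by
  have h1 : HasFDerivAt (fun x => L x + b) (L : En n →L[ℝ] En n) x :=
    (L : En n →L[ℝ] En n).hasFDerivAt.add_const b
  exact ((hu (L x + b)).hasFDerivAt.comp x h1).fderiv

lemma norm_fderiv_isom {n : ℕ} {u : En n → ℝ} (hu : Differentiable ℝ u) (L : En n ≃ₗᵢ[ℝ] En n) (b x : En n) :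
    ‖fderiv ℝ (fun x => u (L x + b)) x‖ = ‖fderiv ℝ u (L x + b)‖ := by
  rw [fderiv_isom hu]
  exact ContinuousLinearMap.opNorm_comp_linearIsometryEquiv _ L

lemma H1Box.isom {n : ℕ} {u : En n → ℝ} (h : H1Box n u) (L : En n ≃ₗᵢ[ℝ] En n) (b : En n) :
    H1Box n (fun x => u (L x + b)) := by
  refine H1Box.mk' (fun x => h.mem_Icc _) (h.diff.comp (L.differentiable.add_const b)) ?_ ?_
  · exact integrable_isom h.intSq L b
  · simp_rw [norm_fderiv_isom h.diff]
    exact integrable_isom h.intD L b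

lemma Minimizes.isom {n : ℕ} {W : ℝ → ℝ} {ε : ℝ} {u : En n → ℝ} (h : Minimizes n W ε u)
    (L : En n ≃ₗᵢ[ℝ] En n) (b : En n) : Minimizes n W ε (fun x => u (L x + b)) := by
  refine ⟨h.1.isom L b, ?_, ?_⟩
  · rw [integral_isom (fun y => Vpot n W (u y)), h.2.1]
  · rw [← h.2.2]
    unfold AC
    simp_rw [norm_fderiv_isom h.1.diff]
    rw [integral_isom (fun y => W (u y)), integral_isom (fun y => ‖fderiv ℝ u y‖^2)]

lemma Minimizes.trans {n : ℕ} {W : ℝ → ℝ} {ε : ℝ} {u : En n → ℝ} (h : Minimizes n W ε u)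
    (b : En n) : Minimizes n W ε (fun x => u (x + b)) := by
  have := h.isom (LinearIsometryEquiv.refl ℝ _) b
  simpa using this

/-- reflection across the hyperplane `⟨ν,x⟩ = c`. -/
def hrefl {n : ℕ} (ν : En n) (c : ℝ) (x : En n) : En n := x - (2 * (inner ℝ ν x - c)) • ν

def reflL {n : ℕ} (ν : En n) : En n ≃ₗᵢ[ℝ] En n := (ℝ ∙ ν)ᗮ.reflection

lemma reflL_apply {n : ℕ} {ν : En n} (hν : ‖ν‖ = 1) (x : En n) :
    reflL ν x = x - (2 * inner ℝ ν x) • ν := by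
  unfold reflL
  rw [Submodule.reflection_orthogonal_apply, Submodule.reflection_singleton_apply]
  simp only [hν]
  simp
  module

lemma hrefl_eq {n : ℕ} {ν : En n} (hν : ‖ν‖ = 1) (c : ℝ) (x : En n) :
    hrefl ν c x = reflL ν x + (2 * c) • ν := by
  rw [reflL_apply hν, hrefl]
  module

lemma hrefl_hrefl {n : ℕ} {ν : En n} (hν : ‖ν‖ = 1) (c : ℝ) (x : En n) : hrefl ν c (hrefl ν c x) = x := by
  unfold hrefl
  rw [inner_sub_right, inner_smul_right, real_inner_self_eq_norm_sq, hν]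
  module

lemma inner_hrefl {n : ℕ} {ν : En n} (hν : ‖ν‖ = 1) (c : ℝ) (x : En n) :
    inner ℝ ν (hrefl ν c x) - c = -(inner ℝ ν x - c) := by
  unfold hrefl
  rw [inner_sub_right, inner_smul_right, real_inner_self_eq_norm_sq, hν]
  ring

lemma Minimizes.hrefl {n : ℕ} {W : ℝ → ℝ} {ε : ℝ} {u : En n → ℝ} (h : Minimizes n W ε u)
    {ν : En n} (hν : ‖ν‖ = 1) (c : ℝ) : Minimizes n W ε (fun x => u (hrefl ν c x)) := by
  simp_rw [hrefl_eq hν]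
  exact h.isom _ _


lemma hasDerivAt_max_pow (k : ℕ) (t : ℝ) :
    HasDerivAt (fun t : ℝ => max t 0 ^ (k+2)) ((k+2) * max t 0 ^ (k+1)) t := by
  rcases lt_trichotomy t 0 with h | h | h
  · have : (fun t : ℝ => max t 0 ^ (k+2)) =ᶠ[nhds t] fun _ => 0 := by
      filter_upwards [Iio_mem_nhds h] with s hs
      rw [max_eq_right (le_of_lt hs)]; simp
    rw [max_eq_right h.le]
    simp only [ne_eq, Nat.add_eq_zero_iff, one_ne_zero, and_false, not_false_eq_true, zero_pow, mul_zero]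
    exact (hasDerivAt_const t (0:ℝ)).congr_of_eventuallyEq this
  · subst h
    simp only [max_self, ne_eq, Nat.add_eq_zero_iff, one_ne_zero, and_false, not_false_eq_true, zero_pow, mul_zero]
    rw [hasDerivAt_iff_isLittleO]
    simp only [max_self, sub_zero, smul_zero, ne_eq, Nat.add_eq_zero_iff, OfNat.ofNat_ne_zero, and_false, not_false_eq_true, zero_pow]
    have h1 : (fun x : ℝ => max x 0 ^ (k+2)) =O[nhds 0] fun x => x^(k+2) := by
      apply Asymptotics.IsBigO.of_bound 1
      filter_upwards with x
      rw [one_mul, norm_pow, norm_pow]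
      apply pow_le_pow_left₀ (norm_nonneg _)
      rw [Real.norm_eq_abs, Real.norm_eq_abs, abs_of_nonneg (le_max_right _ _)]
      exact max_le (le_abs_self _) (abs_nonneg _)
    have h2 : (fun x : ℝ => x^(k+2)) =o[nhds 0] fun x : ℝ => x := by
      have := Asymptotics.isLittleO_pow_id (𝕜 := ℝ) (n := k+2) (by omega)
      exact this
    exact h1.trans_isLittleO h2
  · have : (fun t : ℝ => max t 0 ^ (k+2)) =ᶠ[nhds t] fun t => t^(k+2) := by
      filter_upwards [Ioi_mem_nhds h] with s hs
      rw [max_eq_left (le_of_lt hs)]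
    rw [max_eq_left h.le]
    have h2 := (hasDerivAt_pow (k+2) t).congr_of_eventuallyEq this
    refine h2.congr_deriv ?_
    push_cast; rfl

variable {n : ℕ}

def pp (y : En n) : ℝ := max (1 - ‖y‖^2) 0
def phi0 (y : En n) : ℝ := pp y ^ 4
def rho0 (y : En n) : ℝ := 8 * pp y ^ 3
def kap0 (y : En n) : ℝ := n * rho0 y - 48 * pp y ^ 2 * ‖y‖^2

lemma hasFDerivAt_pp_pow (k : ℕ) (y : En n) :
    HasFDerivAt (fun y => pp y ^ (k+2)) ((-(2 * (k+2) * pp y ^ (k+1))) • innerSL ℝ y) y := by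
  have h1 : HasFDerivAt (fun y : En n => 1 - ‖y‖^2) (-((2:ℝ) • innerSL ℝ y)) y := by
    have := (hasStrictFDerivAt_norm_sq y).hasFDerivAt.const_sub 1
    refine this.congr_fderiv ?_
    ext z; simp
  have h2 := (hasDerivAt_max_pow k (1 - ‖y‖^2)).comp_hasFDerivAt y h1
  refine h2.congr_fderiv ?_
  ext z
  simp [pp]; ring

lemma pp_nonneg (y : En n) : 0 ≤ pp y := le_max_right _ _
lemma pp_le_one (y : En n) : pp y ≤ 1 := max_le (by nlinarith [norm_nonneg y]) zero_le_one
lemma pp_eq_zero {y : En n} (h : 1 ≤ ‖y‖) : pp y = 0 := by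
  apply max_eq_right; nlinarith
lemma continuous_pp : Continuous (pp (n := n)) := by unfold pp; fun_prop

lemma hasFDerivAt_phi0 (y : En n) : HasFDerivAt phi0 ((-(rho0 y)) • innerSL ℝ y) y := by
  have := hasFDerivAt_pp_pow 2 y
  refine this.congr_fderiv ?_
  congr 1; unfold rho0; push_cast; ring

lemma hasFDerivAt_rho0 (y : En n) : HasFDerivAt rho0 ((-(48 * pp y ^ 2)) • innerSL ℝ y) y := by
  have := (hasFDerivAt_pp_pow 1 y).const_mul 8
  refine this.congr_fderiv ?_
  rw [smul_smul]
  congr 1; push_cast; ring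

lemma continuous_phi0 : Continuous (phi0 (n := n)) := continuous_pp.pow 4
lemma continuous_rho0 : Continuous (rho0 (n := n)) := (continuous_pp.pow 3).const_mul 8
lemma continuous_kap0 : Continuous (kap0 (n := n)) := by
  unfold kap0
  exact (continuous_rho0.const_mul _).sub (((continuous_pp.pow 2).const_mul _).mul (by fun_prop))

lemma phi0_mem (y : En n) : phi0 y ∈ Icc (0:ℝ) 1 :=
  ⟨pow_nonneg (pp_nonneg y) _, pow_le_one₀ (pp_nonneg y) (pp_le_one y)⟩

lemma hcs_of_zero {f : En n → ℝ} (h : ∀ y, 1 ≤ ‖y‖ → f y = 0) : HasCompactSupport f := by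
  apply HasCompactSupport.intro (isCompact_closedBall (0 : En n) 1)
  intro x hx
  apply h
  simp at hx; exact hx.le

lemma rho0_zero {y : En n} (h : 1 ≤ ‖y‖) : rho0 y = 0 := by simp [rho0, pp_eq_zero h]
lemma phi0_zero {y : En n} (h : 1 ≤ ‖y‖) : phi0 y = 0 := by simp [phi0, pp_eq_zero h]
lemma kap0_zero {y : En n} (h : 1 ≤ ‖y‖) : kap0 y = 0 := by simp [kap0, rho0, pp_eq_zero h]

lemma int_cz {f : En n → ℝ} (hc : Continuous f) (h : ∀ y, 1 ≤ ‖y‖ → f y = 0) : Integrable f :=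
  hc.integrable_of_hasCompactSupport (hcs_of_zero h)

lemma sum_coord (L : En n →L[ℝ] ℝ) (y : En n) :
    ∑ i, L (EuclideanSpace.single i 1) * y i = L y := by
  have : y = ∑ i, y i • EuclideanSpace.single i (1:ℝ) := by
    have := (EuclideanSpace.basisFun (Fin n) ℝ).sum_repr y
    simpa using this.symm
  conv_rhs => rw [this]
  rw [map_sum]
  simp [mul_comm]

/-- Integration by parts against the radial field. -/
lemma ibp_radial {h : En n → ℝ} (hd : Differentiable ℝ h)
    (hi : Integrable (fun y => rho0 y * ‖fderiv ℝ h y‖)) :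
    ∫ y, rho0 y * fderiv ℝ h y y = - ∫ y, h y * kap0 y := by
  set e : Fin n → En n := fun i => EuclideanSpace.single i 1 with he
  have hei : ∀ i, ‖e i‖ = 1 := by intro i; simp [he]
  set G : Fin n → En n → ℝ := fun i y => rho0 y * y i with hG
  have hGd : ∀ i y, HasFDerivAt (G i) (rho0 y • (EuclideanSpace.proj i : En n →L[ℝ] ℝ) + (y i) • ((-(48 * pp y ^ 2)) • innerSL ℝ y)) y := by
    intro i y
    exact (hasFDerivAt_rho0 y).mul (EuclideanSpace.proj i : En n →L[ℝ] ℝ).hasFDerivAt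
  have hGe : ∀ i y, fderiv ℝ (G i) y (e i) = rho0 y - 48 * pp y^2 * (y i * y i) := by
    intro i y
    rw [(hGd i y).fderiv]
    simp [he, EuclideanSpace.inner_single_right]
    ring
  have hm : Measurable (fderiv ℝ h) := measurable_fderiv ℝ h
  have i1 : ∀ i, Integrable (fun y => fderiv ℝ h y (e i) * G i y) := by
    intro i
    refine hi.mono' ?_ ?_
    · apply AEStronglyMeasurable.mul
      · exact ((measurable_fderiv_apply_const ℝ h (e i))).aestronglyMeasurable
      · exact (continuous_rho0.mul (by fun_prop)).aestronglyMeasurable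
    · refine Eventually.of_forall fun y => ?_
      simp only [hG]
      have hr : 0 ≤ rho0 y := mul_nonneg (by norm_num) (pow_nonneg (pp_nonneg y) _)
      rw [norm_mul, norm_mul, Real.norm_eq_abs (rho0 y), abs_of_nonneg hr]
      have a1 : ‖fderiv ℝ h y (e i)‖ ≤ ‖fderiv ℝ h y‖ := by
        have := (fderiv ℝ h y).le_opNorm (e i)
        rwa [hei, mul_one] at this
      rcases le_total 1 ‖y‖ with hy | hy
      · simp [rho0_zero hy]
      · have a2 : ‖y i‖ ≤ 1 := (PiLp.norm_apply_le y i).trans hy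
        calc _ ≤ ‖fderiv ℝ h y‖ * (rho0 y * 1) := by gcongr
          _ = _ := by ring
  have i2 : ∀ i, Integrable (fun y => h y * fderiv ℝ (G i) y (e i)) := by
    intro i
    simp_rw [hGe]
    apply int_cz
    · exact hd.continuous.mul (continuous_rho0.sub (((continuous_pp.pow 2).const_mul _).mul (by fun_prop)))
    · intro y hy; simp [rho0_zero hy, pp_eq_zero hy]
  have i3 : ∀ i, Integrable (fun y => h y * G i y) := by
    intro i
    apply int_cz
    · exact hd.continuous.mul (continuous_rho0.mul (by fun_prop))
    · intro y hy; simp [hG, rho0_zero hy]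
  have key : ∀ i, ∫ y, h y * fderiv ℝ (G i) y (e i) = - ∫ y, fderiv ℝ h y (e i) * G i y := fun i =>
    integral_mul_fderiv_eq_neg_fderiv_mul_of_integrable (i1 i) (i2 i) (i3 i) (fun x _ => hd x)
      (fun x _ => (hGd i x).differentiableAt)
  have s1 : ∫ y, rho0 y * fderiv ℝ h y y = ∑ i, ∫ y, fderiv ℝ h y (e i) * G i y := by
    rw [← integral_finsetSum _ (fun i _ => i1 i)]
    congr 1; ext y
    rw [← sum_coord (fderiv ℝ h y) y, Finset.mul_sum]
    apply Finset.sum_congr rfl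
    intro i _; simp only [hG, he]; ring
  have s2 : ∫ y, h y * kap0 y = ∑ i, ∫ y, h y * fderiv ℝ (G i) y (e i) := by
    rw [← integral_finsetSum _ (fun i _ => i2 i)]
    congr 1; ext y
    rw [← Finset.mul_sum]
    congr 1
    simp_rw [hGe]
    rw [Finset.sum_sub_distrib, ← Finset.mul_sum, kap0]
    rw [EuclideanSpace.norm_sq_eq]
    simp [pow_two]
  rw [s1, s2]
  simp_rw [key]
  simp

lemma int_kap0 : ∫ y : En n, kap0 y = 0 := by
  have := ibp_radial (n := n) (h := fun _ => (1:ℝ)) (differentiable_const _) (by simp)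
  simpa using this.symm

lemma int_lin_kap0 (a : En n →L[ℝ] ℝ) : ∫ y : En n, a y * kap0 y = 0 := by
  have h1 : ∫ y : En n, a y * kap0 y = ∫ y : En n, a (-y) * kap0 (-y) := (integral_neg_eq_self (fun y => a y * kap0 y) _).symm
  have h2 : ∫ y : En n, a (-y) * kap0 (-y) = - ∫ y : En n, a y * kap0 y := by
    rw [← integral_neg]
    congr 1; ext y
    simp [kap0, rho0, pp]
  linarith

lemma int_abs_kap0 (b : En n →L[ℝ] ℝ) : ∫ y, |b y| * kap0 y = - ∫ y, |b y| * rho0 y := by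
  -- smooth approximation
  have hq : ∀ (d : ℝ), 0 < d → ∀ y, HasFDerivAt (fun y => √(b y ^ 2 + d^2)) ((b y / √(b y ^2 + d^2)) • b) y := by
    intro d hd y
    have hp : 0 < b y ^ 2 + d^2 := by positivity
    have h1 : HasFDerivAt (fun y => b y ^ 2 + d^2) ((2 * b y) • b) y := by
      have := (b.hasFDerivAt (x := y)).pow 2
      refine (this.add_const _).congr_fderiv ?_
      simp
    refine (h1.sqrt hp.ne').congr_fderiv ?_
    rw [smul_smul]
    congr 1
    field_simp
  have h1 : ∀ d : ℝ, 0 < d → ∫ y, rho0 y * (b y / √(b y ^2 + d^2) * b y) = - ∫ y, √(b y ^ 2 + d^2) * kap0 y := by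
    intro d hd
    have h2 := ibp_radial (h := fun y => √(b y ^ 2 + d^2)) (fun y => (hq d hd y).differentiableAt) (by
      simp_rw [fun y => (hq d hd y).fderiv]
      apply int_cz
      · refine continuous_rho0.mul (Continuous.norm ?_)
        have hcd : Continuous (fun y => b y / √(b y ^ 2 + d ^ 2)) := by
          refine Continuous.div (by fun_prop) (by fun_prop) ?_
          intro x; positivity
        exact hcd.smul continuous_const
      · intro y hy; simp [rho0_zero hy])
    simp_rw [fun y => (hq d hd y).fderiv] at h2
    simpa using h2
  have hlim : Tendsto (fun k : ℕ => 1 / ((k:ℝ) + 1)) atTop (nhds 0) := tendsto_one_div_add_atTop_nhds_zero_nat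
  have hpos : ∀ k : ℕ, (0:ℝ) < 1 / ((k:ℝ) + 1) := fun k => by positivity
  have hle1 : ∀ k : ℕ, 1 / ((k:ℝ) + 1) ≤ 1 := fun k => by
    rw [div_le_one (by positivity)]; linarith [(Nat.cast_nonneg k : (0:ℝ) ≤ k)]
  have t1 : Tendsto (fun k : ℕ => ∫ y, √(b y ^ 2 + (1 / ((k:ℝ) + 1))^2) * kap0 y) atTop (nhds (∫ y, |b y| * kap0 y)) := by
    apply tendsto_integral_of_dominated_convergence (fun y => (|b y| + 1) * |kap0 y|)
    · intro k
      exact (Continuous.mul (by fun_prop) continuous_kap0).aestronglyMeasurable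
    · apply int_cz
      · exact (Continuous.mul (by fun_prop) continuous_kap0.abs)
      · intro y hy; simp [kap0_zero hy]
    · intro k
      refine Eventually.of_forall fun y => ?_
      rw [norm_mul, Real.norm_eq_abs, Real.norm_eq_abs, abs_of_nonneg (Real.sqrt_nonneg _)]
      gcongr
      apply Real.sqrt_le_iff.2 ⟨by positivity, ?_⟩
      have := hle1 k; have := hpos k
      have e : 1 / ((k:ℝ) + 1) ^ 2 ≤ 1 := by
        rw [← one_div_pow]; nlinarith
      have := sq_abs (b y)
      have := abs_nonneg (b y)
      nlinarith
    · refine Eventually.of_forall fun y => ?_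
      have : Tendsto (fun d : ℝ => √(b y ^ 2 + d^2) * kap0 y) (nhds 0) (nhds (√(b y ^ 2 + 0^2) * kap0 y)) := by
        apply Continuous.tendsto; fun_prop
      simp only [ne_eq, OfNat.ofNat_ne_zero, not_false_eq_true, zero_pow, add_zero, Real.sqrt_sq_eq_abs] at this
      exact this.comp hlim
  have t2 : Tendsto (fun k : ℕ => ∫ y, rho0 y * (b y / √(b y ^2 + (1 / ((k:ℝ) + 1))^2) * b y)) atTop (nhds (∫ y, |b y| * rho0 y)) := by
    apply tendsto_integral_of_dominated_convergence (fun y => |b y| * |rho0 y|)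
    · intro k
      refine (Continuous.mul continuous_rho0 (Continuous.mul (Continuous.div (by fun_prop) (by fun_prop) ?_) (by fun_prop))).aestronglyMeasurable
      intro x; have := hpos k; positivity
    · apply int_cz
      · exact (Continuous.mul (by fun_prop) continuous_rho0.abs)
      · intro y hy; simp [rho0_zero hy]
    · intro k
      refine Eventually.of_forall fun y => ?_
      rw [norm_mul, norm_mul, norm_div, Real.norm_eq_abs, Real.norm_eq_abs, Real.norm_eq_abs, abs_of_nonneg (Real.sqrt_nonneg _), mul_comm]
      gcongr
      have : |b y| / √(b y ^ 2 + (1 / ((k:ℝ) + 1)) ^ 2) ≤ 1 := by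
        apply div_le_one_of_le₀ _ (Real.sqrt_nonneg _)
        apply Real.abs_le_sqrt; have := hpos k; nlinarith
      exact mul_le_of_le_one_left (abs_nonneg _) this
    · refine Eventually.of_forall fun y => ?_
      rcases eq_or_ne (b y) 0 with e | e
      · simp [e]
      have : Tendsto (fun d : ℝ => rho0 y * (b y / √(b y ^2 + d^2) * b y)) (nhds 0) (nhds (rho0 y * (b y / √(b y ^2 + 0^2) * b y))) := by
        apply ContinuousAt.tendsto
        apply ContinuousAt.mul continuousAt_const
        apply ContinuousAt.mul _ continuousAt_const
        apply ContinuousAt.div continuousAt_const (by fun_prop)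
        have : 0 < b y^2 := by positivity
        simp only [ne_eq, OfNat.ofNat_ne_zero, not_false_eq_true, zero_pow, add_zero]
        positivity
      simp only [ne_eq, OfNat.ofNat_ne_zero, not_false_eq_true, zero_pow, add_zero, Real.sqrt_sq_eq_abs] at this
      have e2 : rho0 y * (b y / |b y| * b y) = |b y| * rho0 y := by
        have : |b y| ≠ 0 := abs_ne_zero.2 e
        field_simp
        rw [sq_abs]
      rw [e2] at this
      exact this.comp hlim
  have t3 := t2.congr (fun k => h1 _ (hpos k))
  have := tendsto_nhds_unique t3 t1.neg
  linarith

lemma int_abs_rho0_pos {b : En n →L[ℝ] ℝ} (hb : b ≠ 0) : 0 < ∫ y, |b y| * rho0 y := by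
  have hc : Continuous (fun y => |b y| * rho0 y) := (Continuous.mul (by fun_prop) continuous_rho0)
  have hr : ∀ y : En n, 0 ≤ rho0 y := fun y => mul_nonneg (by norm_num) (pow_nonneg (pp_nonneg y) _)
  obtain ⟨z, hz⟩ : ∃ z, b z ≠ 0 := by
    by_contra hh; push Not at hh; exact hb (by ext z; simp [hh z])
  have hz0 : z ≠ 0 := by rintro rfl; simp at hz
  have hzn : 0 < ‖z‖ := norm_pos_iff.2 hz0
  refine hc.integral_pos_of_hasCompactSupport_nonneg_nonzero (hcs_of_zero (fun y hy => by simp [rho0_zero hy]))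
    (fun y => mul_nonneg (abs_nonneg _) (hr y)) (x := (2 * ‖z‖)⁻¹ • z) ?_
  have h1 : ‖(2 * ‖z‖)⁻¹ • z‖ = 1/2 := by
    rw [norm_smul, norm_inv, norm_mul, norm_norm]; simp; field_simp
  have h2 : pp ((2 * ‖z‖)⁻¹ • z) = 3/4 := by
    rw [pp, h1]; norm_num
  rw [rho0, h2]
  simp [hz, hzn.ne']

variable {n : ℕ}

lemma dual_expand (a : En n →L[ℝ] ℝ) (t : ℝ) (y : En n) :
    ‖a + t • innerSL ℝ y‖^2 = ‖a‖^2 + 2 * t * a y + t^2 * ‖y‖^2 := by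
  set p := (InnerProductSpace.toDual ℝ (En n)).symm a with hp
  have ha : a = InnerProductSpace.toDual ℝ (En n) p := by simp [hp]
  have h2 : a + t • innerSL ℝ y = InnerProductSpace.toDual ℝ (En n) (p + t • y) := by
    rw [ha]; ext z; simp
  rw [h2, ha, LinearIsometryEquiv.norm_map, LinearIsometryEquiv.norm_map, InnerProductSpace.toDual_apply_apply]
  rw [norm_add_sq_real, norm_smul, inner_smul_right, mul_pow, Real.norm_eq_abs, sq_abs]
  ring

lemma dual_para (a b : En n →L[ℝ] ℝ) : ‖a + b‖^2 + ‖a - b‖^2 = 2 * (‖a‖^2 + ‖b‖^2) := by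
  set p := (InnerProductSpace.toDual ℝ (En n)).symm a with hp
  set q := (InnerProductSpace.toDual ℝ (En n)).symm b with hq
  have ha : a = InnerProductSpace.toDual ℝ (En n) p := by simp [hp]
  have hb : b = InnerProductSpace.toDual ℝ (En n) q := by simp [hq]
  rw [ha, hb, ← map_add, ← map_sub]
  simp only [LinearIsometryEquiv.norm_map]
  have := parallelogram_law_with_norm ℝ p q
  nlinarith

lemma integral_affine (f : En n → ℝ) (x0 : En n) {r : ℝ} (hr : 0 < r) :
    ∫ x, f (r⁻¹ • (x - x0)) = r^n * ∫ y, f y := by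
  rw [integral_sub_right_eq_self (fun x => f (r⁻¹ • x)) x0, integral_scale f (inv_pos.2 hr)]
  simp

lemma integrable_affine {f : En n → ℝ} (hf : Integrable f) (x0 : En n) {r : ℝ} (hr : 0 < r) :
    Integrable (fun x => f (r⁻¹ • (x - x0))) :=
  (hf.comp_smul (inv_pos.2 hr).ne').comp_sub_right x0

/-- The rescaled bump. -/
def phir (x0 : En n) (r : ℝ) (x : En n) : ℝ := phi0 (r⁻¹ • (x - x0))

lemma hasFDerivAt_phir (x0 : En n) (r : ℝ) (x : En n) :
    HasFDerivAt (phir x0 r) ((-(r⁻¹ * rho0 (r⁻¹ • (x - x0)))) • innerSL ℝ (r⁻¹ • (x - x0))) x := by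
  have h1 : HasFDerivAt (fun x : En n => r⁻¹ • (x - x0)) (r⁻¹ • ContinuousLinearMap.id ℝ (En n)) x :=
    ((hasFDerivAt_id x).sub_const x0).const_smul r⁻¹
  have h2 := (hasFDerivAt_phi0 (r⁻¹ • (x - x0))).comp x h1
  refine h2.congr_fderiv ?_
  ext z
  simp; ring

/-- energy expansion. -/
lemma expand {G : En n → ℝ} (hG : H1Box n G) (x0 : En n) {r : ℝ} (hr : 0 < r) (t : ℝ)  :
    Integrable (fun x => ‖fderiv ℝ (fun x => G x + t * phir x0 r x) x‖^2) ∧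
    ∫ x, ‖fderiv ℝ (fun x => G x + t * phir x0 r x) x‖^2 = (∫ x, ‖fderiv ℝ G x‖^2)
      + 2 * t * (r^n * (r⁻¹)^2 * ∫ y, G (x0 + r • y) * kap0 y)
      + t^2 * ((r⁻¹)^2 * r^n * ∫ y : En n, rho0 y ^2 * ‖y‖^2) := by
  set Y : En n → En n := fun x => r⁻¹ • (x - x0) with hY
  have hd : ∀ x, fderiv ℝ (fun x => G x + t * phir x0 r x) x =
      fderiv ℝ G x + (-(t * r⁻¹ * rho0 (Y x))) • innerSL ℝ (Y x) := by
    intro x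
    have := ((hG.diff x).hasFDerivAt.add ((hasFDerivAt_phir x0 r x).const_mul t)).fderiv
    refine Eq.trans this ?_
    rw [smul_smul]
    congr 2
    simp only [hY]; ring
  have hsq : ∀ x, ‖fderiv ℝ (fun x => G x + t * phir x0 r x) x‖^2 = ‖fderiv ℝ G x‖^2
      + (-(2 * t * r⁻¹)) * (rho0 (Y x) * fderiv ℝ G x (Y x)) + (t^2 * (r⁻¹)^2) * (rho0 (Y x)^2 * ‖Y x‖^2) := by
    intro x
    rw [hd, dual_expand]; ring
  have i0 := hG.intD
  have i2 : Integrable (fun x => rho0 (Y x)^2 * ‖Y x‖^2) := by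
    apply integrable_affine (f := fun y => rho0 y ^ 2 * ‖y‖^2) _ x0 hr
    apply int_cz
    · exact (continuous_rho0.pow 2).mul (by fun_prop)
    · intro y hy; simp [rho0_zero hy]
  have cY : Continuous Y := by fun_prop
  have i1' : Integrable (fun x => rho0 (Y x) * ‖fderiv ℝ G x‖) := by
    have ir : Integrable (fun x => rho0 (Y x)^2) := by
      apply integrable_affine (f := fun y => rho0 y ^ 2) _ x0 hr
      apply int_cz (continuous_rho0.pow 2)
      intro y hy; simp [rho0_zero hy]
    refine (ir.add i0).mono' ?_ ?_
    · exact (continuous_rho0.comp cY).aestronglyMeasurable.mul (measurable_fderiv ℝ G).norm.aestronglyMeasurable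
    · refine Eventually.of_forall fun x => ?_
      rw [norm_mul, norm_norm]
      simp only [Pi.add_apply]
      have := sq_abs (rho0 (Y x))
      rw [Real.norm_eq_abs]
      nlinarith [sq_nonneg (|rho0 (Y x)| - ‖fderiv ℝ G x‖), sq_nonneg (|rho0 (Y x)|), sq_nonneg (‖fderiv ℝ G x‖)]
  have i1 : Integrable (fun x => rho0 (Y x) * fderiv ℝ G x (Y x)) := by
    refine i1'.mono' ?_ ?_
    · refine (continuous_rho0.comp cY).aestronglyMeasurable.mul ?_
      apply Measurable.aestronglyMeasurable
      have h1 := measurable_fderiv ℝ G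
      have : Continuous (fun p : (En n →L[ℝ] ℝ) × En n => p.1 p.2) := by fun_prop
      exact this.measurable.comp (h1.prodMk cY.measurable)
    · refine Eventually.of_forall fun x => ?_
      have hr0 : 0 ≤ rho0 (Y x) := mul_nonneg (by norm_num) (pow_nonneg (pp_nonneg _) _)
      rw [norm_mul, Real.norm_eq_abs (rho0 _), abs_of_nonneg hr0]
      rcases le_total 1 ‖Y x‖ with h | h
      · simp [rho0_zero h]
      · gcongr
        exact ((fderiv ℝ G x).le_opNorm _).trans (mul_le_of_le_one_right (norm_nonneg _) h)
  have hI1 : ∫ x, rho0 (Y x) * fderiv ℝ G x (Y x) = - (r^n * r⁻¹ * ∫ y, G (x0 + r • y) * kap0 y) := by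
    set H : En n → ℝ := fun y => G (x0 + r • y) with hH
    have hHd : ∀ y, HasFDerivAt H (r • fderiv ℝ G (x0 + r • y)) y := by
      intro y
      have h1 : HasFDerivAt (fun y : En n => x0 + r • y) (r • ContinuousLinearMap.id ℝ (En n)) y :=
        ((hasFDerivAt_id y).const_smul r).const_add x0
      have h2 := (hG.diff (x0 + r • y)).hasFDerivAt.comp y h1
      refine h2.congr_fderiv ?_
      ext z; simp
    have hxy : ∀ x, x0 + r • Y x = x := by
      intro x; simp only [hY, smul_smul, mul_inv_cancel₀ hr.ne', one_smul]; abel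
    have e1 : ∫ x, rho0 (Y x) * fderiv ℝ G x (Y x) = ∫ x, (fun y => r⁻¹ * (rho0 y * fderiv ℝ H y y)) (Y x) := by
      congr 1; ext x
      simp only [(hHd (Y x)).fderiv, hxy]
      simp; field_simp
    rw [e1]
    refine (integral_affine (fun y => r⁻¹ * (rho0 y * fderiv ℝ H y y)) x0 hr).trans ?_
    rw [integral_const_mul, ibp_radial (fun y => (hHd y).differentiableAt)]
    · ring
    · have := (i1'.const_mul r).comp_add_right x0
      have := this.comp_smul hr.ne'
      refine this.congr (Eventually.of_forall fun y => ?_)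
      simp only [(hHd y).fderiv, norm_smul, hY, add_sub_cancel_right, smul_smul, inv_mul_cancel₀ hr.ne', one_smul,
        Real.norm_eq_abs, abs_of_pos hr, add_comm x0]
      ring
  constructor
  · simp_rw [hsq]
    exact (i0.add (i1.const_mul _)).add (i2.const_mul _)
  · simp_rw [hsq]
    have i01 : Integrable (fun x => ‖fderiv ℝ G x‖^2 + (-(2*t*r⁻¹))*(rho0 (Y x)*fderiv ℝ G x (Y x))) :=
      i0.add (i1.const_mul _)
    have hI2 : ∫ x, rho0 (Y x) ^ 2 * ‖Y x‖^2 = _ := integral_affine (fun y => rho0 y ^ 2 * ‖y‖^2) x0 hr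
    rw [integral_add i01 (i2.const_mul _), integral_add i0 (i1.const_mul _),
      integral_const_mul, integral_const_mul, hI1, hI2]
    ring

lemma phir_mem (x0 : En n) (r : ℝ) (x : En n) : phir x0 r x ∈ Icc (0:ℝ) 1 := phi0_mem _
lemma phir_zero {x0 : En n} {r : ℝ} (hr : 0 < r) {x : En n} (h : r ≤ ‖x - x0‖) : phir x0 r x = 0 := by
  apply phi0_zero
  rw [norm_smul, norm_inv, Real.norm_eq_abs, abs_of_pos hr, inv_mul_eq_div, le_div_iff₀ hr]; linarith
lemma int_phir (x0 : En n) {r : ℝ} (hr : 0 < r) : Integrable (phir x0 r) :=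
  integrable_affine (int_cz continuous_phi0 (fun _ hy => phi0_zero hy)) x0 hr
lemma integral_phir (x0 : En n) {r : ℝ} (hr : 0 < r) : ∫ x, phir x0 r x = r^n * ∫ y : En n, phi0 y :=
  integral_affine phi0 x0 hr
lemma continuous_phir (x0 : En n) (r : ℝ) : Continuous (phir x0 r) :=
  continuous_iff_continuousAt.2 fun x => (hasFDerivAt_phir x0 r x).continuousAt

lemma H1Box.perturb {G : En n → ℝ} (hG : H1Box n G) {x0 : En n} {r : ℝ} (hr : 0 < r) {κ t : ℝ}
    (hb : ∀ x, ‖x - x0‖ < r → G x ∈ Icc κ (1-κ)) (ht : |t| ≤ κ) :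
    H1Box n (fun x => G x + t * phir x0 r x) := by
  refine H1Box.mk' ?_ ?_ ?_ (expand hG x0 hr t).1
  · intro x
    rcases lt_or_ge ‖x - x0‖ r with h | h
    · have h1 := hb x h
      have h2 := phir_mem x0 r x
      have h3 : |t * phir x0 r x| ≤ κ := by
        rw [abs_mul, abs_of_nonneg h2.1]
        exact (mul_le_of_le_one_right (abs_nonneg _) h2.2).trans ht
      have := abs_le.1 h3
      exact ⟨by linarith [h1.1], by linarith [h1.2]⟩
    · rw [phir_zero hr h]; simpa using hG.mem_Icc x
  · exact fun x => (hG.diff x).add ((hasFDerivAt_phir x0 r x).differentiableAt.const_mul t)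
  · have h1 : Integrable (fun x => t * phir x0 r x) := (int_phir x0 hr).const_mul t
    refine ((hG.intSq.const_mul 2).add (((int_phir x0 hr).const_mul (2 * t^2)))).mono' ?_ ?_
    · exact ((hG.cont.add ((continuous_phir x0 r).const_mul t)).pow 2).aestronglyMeasurable
    · refine Eventually.of_forall fun x => ?_
      have h2 := phir_mem x0 r x
      rw [Real.norm_eq_abs, abs_of_nonneg (sq_nonneg _)]
      simp only [Pi.add_apply]
      have : phir x0 r x ^2 ≤ phir x0 r x := by nlinarith [h2.1, h2.2]
      nlinarith [sq_nonneg (G x - t * phir x0 r x), mul_nonneg (sq_nonneg t) (sub_nonneg.2 this)]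

variable {W W1 W2 : ℝ → ℝ}

lemma H1Box.iW {u : En n → ℝ} (h : H1Box n u) (g : GW W W1 W2) (h0 : W1 0 = 0) : Integrable (fun x => W (u x)) := by
  obtain ⟨C, -, hC⟩ := g.upW h0
  exact h.intF g.cW (fun t ht => by rw [abs_of_nonneg (g.nonneg ht)]; exact hC t ht)

lemma H1Box.iV {u : En n → ℝ} (h : H1Box n u) (hn : 2 ≤ n) (g : GW W W1 W2) (h0 : W1 0 = 0) :
    Integrable (fun x => Vpot n W (u x)) := by
  obtain ⟨C, -, hC⟩ := g.upV h0 hn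
  exact h.intF (g.cV hn) (fun t ht => by rw [abs_of_nonneg (g.V_mem hn ht).1]; exact hC t ht)

lemma int_lip_perturb {F : ℝ → ℝ} {M : ℝ}
    (hF : ∀ a ∈ Icc (0:ℝ) 1, ∀ b ∈ Icc (0:ℝ) 1, |F a - F b| ≤ M * |a - b|)
    {G H : En n → ℝ} (hG : H1Box n G) (hH : H1Box n H) (iG : Integrable (fun x => F (G x)))
    (iH : Integrable (fun x => F (H x))) {x0 : En n} {r : ℝ} (hr : 0 < r) {t : ℝ}
    (e : ∀ x, H x = G x + t * phir x0 r x) :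
    |(∫ x, F (H x)) - ∫ x, F (G x)| ≤ M * |t| * (r^n * ∫ y : En n, phi0 y) := by
  rw [← integral_sub iH iG, ← integral_phir x0 hr, ← integral_const_mul]
  refine (abs_integral_le_integral_abs).trans ?_
  refine integral_mono (iH.sub iG).abs ((int_phir x0 hr).const_mul _) (fun x => ?_)
  have := hF _ (hH.mem_Icc x) _ (hG.mem_Icc x)
  refine this.trans (le_of_eq ?_)
  rw [e]; simp only [add_sub_cancel_left, abs_mul, abs_of_nonneg (phir_mem x0 r x).1]; ring

lemma pair_ineq (hn : 2 ≤ n) (g : GW W W1 W2) (h0 : W1 0 = 0) : ∃ M : ℝ, 0 ≤ M ∧ ∀ {ε : ℝ} (_ : 0 < ε) {G G' : En n → ℝ}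
    (_ : H1Box n G) (_ : H1Box n G') {x0 : En n} {r : ℝ} (_ : 0 < r) {κ t : ℝ}
    (_ : ∀ x, ‖x - x0‖ < r → G x ∈ Icc κ (1-κ)) (_ : |t| ≤ κ),
    Psi n W ε 1 * (min 1 ((∫ x, Vpot n W (G x)) - M * |t| * r^n) + min 1 (∫ x, Vpot n W (G' x))) ≤
      ε * ((∫ x, ‖fderiv ℝ G x‖^2) + ∫ x, ‖fderiv ℝ G' x‖^2)
      + ε * (2 * t * (r^n * (r⁻¹)^2 * ∫ y, G (x0 + r • y) * kap0 y)
      + t^2 * ((r⁻¹)^2 * r^n * ∫ y : En n, rho0 y ^2 * ‖y‖^2))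
      + ε⁻¹ * ((∫ x, W (G x)) + (∫ x, W (G' x)) + M * |t| * r^n) := by
  obtain ⟨M1, hM1, hW⟩ := g.lipW
  obtain ⟨M2, hM2, hV⟩ := g.lipV hn
  set P := ∫ y : En n, phi0 y with hP
  have hP0 : 0 ≤ P := integral_nonneg fun y => (phi0_mem y).1
  refine ⟨(M1 + M2) * P, by positivity, ?_⟩
  intro ε hε G G' hG hG' x0 r hr κ t hb ht
  have hH := hG.perturb hr hb ht
  set H := fun x => G x + t * phir x0 r x with hHd
  have e1 := (expand hG x0 hr t).2
  have e2 := int_lip_perturb hW hG hH (hG.iW g h0) (hH.iW g h0) hr (fun x => rfl)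
  have e3 := int_lip_perturb hV hG hH (hG.iV hn g h0) (hH.iV hn g h0) hr (fun x => rfl)
  have f1 := Psi_min hn g hε hH
  have f2 := Psi_min hn g hε hG'
  have hp := Psi_nonneg (n := n) g hε
  have q2 := (abs_le.1 e2).2
  have q3 := (abs_le.1 e3).1
  have hrn : 0 < r^n := by positivity
  have w1 : M1 * |t| * (r^n * P) ≤ (M1 + M2) * P * |t| * r^n := by
    have : 0 ≤ M2 * |t| * (r^n * P) := by positivity
    nlinarith
  have w2 : M2 * |t| * (r^n * P) ≤ (M1 + M2) * P * |t| * r^n := by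
    have : 0 ≤ M1 * |t| * (r^n * P) := by positivity
    nlinarith
  have f3 : Psi n W ε 1 * min 1 ((∫ x, Vpot n W (G x)) - (M1 + M2) * P * |t| * r^n) ≤ Psi n W ε 1 * min 1 (∫ x, Vpot n W (H x)) := by
    apply mul_le_mul_of_nonneg_left _ hp
    apply min_le_min le_rfl
    linarith
  unfold AC at f1 f2
  rw [e1] at f1
  have f4 : ε⁻¹ * (∫ x, W (H x)) ≤ ε⁻¹ * ((∫ x, W (G x)) + (M1 + M2) * P * |t| * r^n) := by
    apply mul_le_mul_of_nonneg_left _ (by positivity)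
    linarith
  rw [mul_add]
  calc _ ≤ _ := add_le_add (f3.trans f1) f2
    _ ≤ _ := by linarith

variable {n : ℕ}

/-- smoothing of the identity, flat at 0. -/
def kd (δ t : ℝ) : ℝ := t - δ * arctan (t / δ)
/-- derivative of `kd`. -/
def kd' (δ t : ℝ) : ℝ := 1 - 1 / (1 + (t/δ)^2)

lemma hasDerivAt_kd {δ : ℝ} (hδ : 0 < δ) (t : ℝ) : HasDerivAt (kd δ) (kd' δ t) t := by
  have h1 : HasDerivAt (fun t : ℝ => t / δ) (1/δ) t := (hasDerivAt_id t).div_const δ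
  have h2 := (hasDerivAt_id t).fun_sub (((hasDerivAt_arctan (t/δ)).comp t h1).const_mul δ)
  refine h2.congr_deriv ?_
  unfold kd'; field_simp

lemma kd'_mem (δ t : ℝ) : kd' δ t ∈ Icc (0:ℝ) 1 := by
  unfold kd'
  have h : 0 ≤ (t/δ)^2 := sq_nonneg _
  constructor
  · rw [sub_nonneg, div_le_one (by positivity)]; linarith
  · have : 0 ≤ 1 / (1 + (t/δ)^2) := by positivity
    linarith

lemma kd_zero (δ : ℝ) : kd δ 0 = 0 := by simp [kd]
lemma kd'_zero (δ : ℝ) : kd' δ 0 = 0 := by simp [kd']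

lemma kd_mono {δ : ℝ} (hδ : 0 < δ) : Monotone (kd δ) :=
  monotone_of_deriv_nonneg (fun t => (hasDerivAt_kd hδ t).differentiableAt)
    (fun t => by rw [(hasDerivAt_kd hδ t).deriv]; exact (kd'_mem δ t).1)

lemma abs_kd {δ : ℝ} (hδ : 0 < δ) (t : ℝ) : |kd δ t| ≤ |t| := by
  rcases le_total 0 t with h | h
  · have h1 : 0 ≤ kd δ t := by rw [← kd_zero δ]; exact kd_mono hδ h
    have h2 : 0 ≤ arctan (t/δ) := arctan_nonneg.2 (by positivity)
    rw [abs_of_nonneg h1, abs_of_nonneg h]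
    unfold kd; nlinarith
  · have h1 : kd δ t ≤ 0 := by rw [← kd_zero δ]; exact kd_mono hδ h
    have h2 : arctan (t/δ) ≤ 0 := by
      rw [← arctan_zero]; exact arctan_strictMono.monotone (div_nonpos_of_nonpos_of_nonneg h hδ.le)
    rw [abs_of_nonpos h1, abs_of_nonpos h]
    unfold kd; nlinarith

lemma kd_sub {δ : ℝ} (hδ : 0 < δ) (t : ℝ) : |kd δ t - t| ≤ 2 * δ := by
  have h1 := arctan_lt_pi_div_two (t/δ)
  have h2 := neg_pi_div_two_lt_arctan (t/δ)
  have h3 := pi_lt_four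
  unfold kd
  rw [sub_sub_cancel_left, abs_neg, abs_mul, abs_of_pos hδ]
  have : |arctan (t/δ)| ≤ 2 := abs_le.2 ⟨by linarith, by linarith⟩
  nlinarith

section crease
variable {u v s : En n → ℝ}

lemma sk_deriv (hu : Differentiable ℝ u) (hv : Differentiable ℝ v) (hs : ∀ x, s x = 1 ∨ s x = -1)
    (hl : ∀ x, u x ≠ v x → ∀ᶠ y in nhds x, s y = s x) {δ : ℝ} (hδ : 0 < δ) (x : En n) :
    HasFDerivAt (fun x => s x * kd δ (u x - v x)) ((s x * kd' δ (u x - v x)) • (fderiv ℝ u x - fderiv ℝ v x)) x := by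
  have hw : HasFDerivAt (fun x => u x - v x) (fderiv ℝ u x - fderiv ℝ v x) x :=
    (hu x).hasFDerivAt.sub (hv x).hasFDerivAt
  have hk := (hasDerivAt_kd hδ (u x - v x)).comp_hasFDerivAt x hw
  by_cases h : u x = v x
  · have e0 : u x - v x = 0 := sub_eq_zero.2 h
    simp only [e0, kd'_zero, mul_zero, zero_smul] at hk ⊢
    rw [hasFDerivAt_iff_isLittleO] at hk ⊢
    simp only [Function.comp, e0, kd_zero, mul_zero, zero_apply, sub_zero] at hk ⊢
    refine (hk.norm_left.congr_left fun y => ?_).of_norm_left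
    rcases hs y with h | h <;> simp [h]
  · have := hk.const_mul (s x)
    rw [smul_smul] at this
    refine this.congr_of_eventuallyEq ?_
    filter_upwards [hl x h] with y hy
    simp [hy]

lemma s_abs (hs : ∀ x, s x = 1 ∨ s x = -1) (x : En n) : |s x| = 1 := by
  rcases hs x with h | h <;> simp [h]

lemma s_sq (hs : ∀ x, s x = 1 ∨ s x = -1) (x : En n) : s x ^ 2 = 1 := by
  rcases hs x with h | h <;> simp [h]

lemma sw_cont (hu : Continuous u) (hv : Continuous v) (hs : ∀ x, s x = 1 ∨ s x = -1)
    (hl : ∀ x, u x ≠ v x → ∀ᶠ y in nhds x, s y = s x) : Continuous (fun x => s x * (u x - v x)) := by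
  rw [continuous_iff_continuousAt]
  intro x
  by_cases h : u x = v x
  · have e0 : u x - v x = 0 := sub_eq_zero.2 h
    unfold ContinuousAt
    simp only [e0, mul_zero]
    rw [tendsto_zero_iff_norm_tendsto_zero]
    have : Tendsto (fun x => ‖u x - v x‖) (nhds x) (nhds ‖u x - v x‖) := ((hu.sub hv).norm).continuousAt
    rw [e0, norm_zero] at this
    refine this.congr fun y => ?_
    rw [norm_mul, Real.norm_eq_abs (s y), s_abs hs, one_mul]
  · have h2 : ContinuousAt (fun y => s x * (u y - v y)) x := ((hu.sub hv).const_mul _).continuousAt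
    refine h2.congr ?_
    filter_upwards [hl x h] with y hy
    simp [hy]

/-- The approximating competitors. -/
def gd (u v s : En n → ℝ) (σ δ : ℝ) (x : En n) : ℝ := (u x + v x + σ * (s x * kd δ (u x - v x))) / 2

lemma gd_between (hs : ∀ x, s x = 1 ∨ s x = -1) {σ δ : ℝ} (hσ : |σ| = 1) (hδ : 0 < δ) (x : En n) :
    gd u v s σ δ x ∈ Icc (min (u x) (v x)) (max (u x) (v x)) := by
  have h1 : |σ * (s x * kd δ (u x - v x))| ≤ |u x - v x| := by
    rw [abs_mul, abs_mul, hσ, s_abs hs, one_mul, one_mul]; exact abs_kd hδ _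
  have h2 := abs_le.1 h1
  unfold gd
  rcases le_total (u x) (v x) with h | h
  · rw [min_eq_left h, max_eq_right h]
    rw [abs_of_nonpos (by linarith)] at h2
    constructor <;> linarith [h2.1, h2.2]
  · rw [min_eq_right h, max_eq_left h]
    rw [abs_of_nonneg (by linarith)] at h2
    constructor <;> linarith [h2.1, h2.2]

lemma gd_deriv (hu : Differentiable ℝ u) (hv : Differentiable ℝ v) (hs : ∀ x, s x = 1 ∨ s x = -1)
    (hl : ∀ x, u x ≠ v x → ∀ᶠ y in nhds x, s y = s x) (σ : ℝ) {δ : ℝ} (hδ : 0 < δ) (x : En n) :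
    HasFDerivAt (gd u v s σ δ) ((1/2:ℝ) • (fderiv ℝ u x + fderiv ℝ v x) +
      (σ * (s x * kd' δ (u x - v x)) / 2) • (fderiv ℝ u x - fderiv ℝ v x)) x := by
  have h1 := (((hu x).hasFDerivAt.add (hv x).hasFDerivAt).add
    ((sk_deriv hu hv hs hl hδ x).const_mul σ)).mul_const (1/2 : ℝ)
  have e : gd u v s σ δ = fun x => ((u + v + fun x => σ * (s x * kd δ (u x - v x))) x) * (1/2) := by
    ext x; simp [gd]; ring
  rw [e]
  refine h1.congr_fderiv ?_
  ext z; simp; ring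

lemma gd_norm (hu : Differentiable ℝ u) (hv : Differentiable ℝ v) (hs : ∀ x, s x = 1 ∨ s x = -1)
    (hl : ∀ x, u x ≠ v x → ∀ᶠ y in nhds x, s y = s x) {δ : ℝ} (hδ : 0 < δ) (x : En n) :
    ‖fderiv ℝ (gd u v s 1 δ) x‖^2 + ‖fderiv ℝ (gd u v s (-1) δ) x‖^2 ≤ ‖fderiv ℝ u x‖^2 + ‖fderiv ℝ v x‖^2 := by
  rw [(gd_deriv hu hv hs hl 1 hδ x).fderiv, (gd_deriv hu hv hs hl (-1) hδ x).fderiv]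
  set a := fderiv ℝ u x
  set b := fderiv ℝ v x
  set k := s x * kd' δ (u x - v x)
  have e1 : (1/2:ℝ) • (a + b) + (-1 * k / 2) • (a - b) = (1/2:ℝ) • (a+b) - (1 * k / 2) • (a - b) := by
    ext z; simp; ring
  rw [e1, dual_para, norm_smul, norm_smul]
  have h2 := dual_para a b
  have hk : k^2 ≤ 1 := by
    simp only [k, mul_pow, s_sq hs, one_mul]
    have := kd'_mem δ (u x - v x)
    exact pow_le_one₀ this.1 this.2
  rw [mul_pow, mul_pow, Real.norm_eq_abs, Real.norm_eq_abs, sq_abs, sq_abs]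
  nlinarith [mul_nonneg (sub_nonneg.2 hk) (sq_nonneg ‖a - b‖)]

lemma gd_H1 (hu : H1Box n u) (hv : H1Box n v) (hs : ∀ x, s x = 1 ∨ s x = -1)
    (hl : ∀ x, u x ≠ v x → ∀ᶠ y in nhds x, s y = s x) {σ δ : ℝ} (hσ : σ = 1 ∨ σ = -1) (hδ : 0 < δ) :
    H1Box n (gd u v s σ δ) := by
  have hd : Differentiable ℝ (gd u v s σ δ) := fun x => (gd_deriv hu.diff hv.diff hs hl σ hδ x).differentiableAt
  have hσ' : |σ| = 1 := by rcases hσ with h | h <;> simp [h]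
  have hm : ∀ x, gd u v s σ δ x ∈ Icc (0:ℝ) 1 := fun x =>
    have h := gd_between (u := u) (v := v) hs hσ' hδ x
    ⟨(le_min (hu.mem_Icc x).1 (hv.mem_Icc x).1).trans h.1, h.2.trans (max_le (hu.mem_Icc x).2 (hv.mem_Icc x).2)⟩
  refine H1Box.mk' hm hd ?_ ?_
  · refine (hu.intSq.add hv.intSq).mono' (hd.continuous.pow 2).aestronglyMeasurable ?_
    refine Eventually.of_forall fun x => ?_
    rw [Real.norm_eq_abs, abs_of_nonneg (sq_nonneg _)]
    have h := (gd_between (u := u) (v := v) hs hσ' hδ x).2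
    have h0 := (hm x).1
    simp only [Pi.add_apply]
    rcases max_choice (u x) (v x) with e | e <;> rw [e] at h
    · nlinarith [sq_nonneg (v x)]
    · nlinarith [sq_nonneg (u x)]
  · refine (hu.intD.add hv.intD).mono' ((measurable_fderiv ℝ _).norm.pow_const 2).aestronglyMeasurable ?_
    refine Eventually.of_forall fun x => ?_
    rw [Real.norm_eq_abs, abs_of_nonneg (sq_nonneg _)]
    have := gd_norm hu.diff hv.diff hs hl hδ x
    simp only [Pi.add_apply]
    rcases hσ with rfl | rfl
    · nlinarith [sq_nonneg ‖fderiv ℝ (gd u v s (-1) δ) x‖]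
    · nlinarith [sq_nonneg ‖fderiv ℝ (gd u v s (1) δ) x‖]

/-- the limit competitor -/
def gz (u v s : En n → ℝ) (σ : ℝ) (x : En n) : ℝ := (u x + v x + σ * (s x * (u x - v x))) / 2

lemma gd_tendsto (hs : ∀ x, s x = 1 ∨ s x = -1) {σ : ℝ} (hσ : |σ| = 1) (x : En n) :
    Tendsto (fun δ => gd u v s σ δ x) (nhdsWithin 0 (Ioi 0)) (nhds (gz u v s σ x)) := by
  rw [tendsto_iff_dist_tendsto_zero]
  have h0 : Tendsto (fun δ : ℝ => δ) (nhdsWithin 0 (Ioi 0)) (nhds 0) := nhdsWithin_le_nhds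
  refine squeeze_zero' (Eventually.of_forall fun _ => dist_nonneg) ?_ h0
  filter_upwards [self_mem_nhdsWithin] with δ hδ
  have := kd_sub hδ (u x - v x)
  rw [Real.dist_eq]
  have e : gd u v s σ δ x - gz u v s σ x = (σ * (s x * (kd δ (u x - v x) - (u x - v x)))) / 2 := by
    unfold gd gz; ring
  rw [e, abs_div, abs_mul, abs_mul, hσ, s_abs hs, abs_of_pos (by norm_num : (0:ℝ) < 2)]
  linarith

lemma gz_cases (hs : ∀ x, s x = 1 ∨ s x = -1) (x : En n) :
    (gz u v s 1 x = u x ∧ gz u v s (-1) x = v x) ∨ (gz u v s 1 x = v x ∧ gz u v s (-1) x = u x) := by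
  unfold gz
  rcases hs x with h | h <;> rw [h]
  · left; constructor <;> ring
  · right; constructor <;> ring

lemma gd_F_tendsto (hu : H1Box n u) (hv : H1Box n v) (hs : ∀ x, s x = 1 ∨ s x = -1)
    (hl : ∀ x, u x ≠ v x → ∀ᶠ y in nhds x, s y = s x) {σ : ℝ} (hσ : σ = 1 ∨ σ = -1) {F : ℝ → ℝ} {C : ℝ}
    (hF : Continuous F) (hC : ∀ t ∈ Icc (0:ℝ) 1, |F t| ≤ C * t^2) (hC0 : 0 ≤ C) :
    Tendsto (fun δ => ∫ x, F (gd u v s σ δ x)) (nhdsWithin 0 (Ioi 0)) (nhds (∫ x, F (gz u v s σ x))) := by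
  have hσ' : |σ| = 1 := by rcases hσ with h | h <;> simp [h]
  refine tendsto_integral_filter_of_dominated_convergence (fun x => C * (u x ^2 + v x ^ 2)) ?_ ?_ ?_ ?_
  · filter_upwards [self_mem_nhdsWithin] with δ hδ
    exact (hF.comp (gd_H1 hu hv hs hl hσ hδ).cont).aestronglyMeasurable
  · filter_upwards [self_mem_nhdsWithin] with δ hδ
    refine Eventually.of_forall fun x => ?_
    rw [Real.norm_eq_abs]
    have hm := (gd_H1 hu hv hs hl hσ hδ).mem_Icc x
    refine (hC _ hm).trans (mul_le_mul_of_nonneg_left ?_ hC0)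
    have h := (gd_between (u := u) (v := v) hs hσ' hδ x).2
    rcases max_choice (u x) (v x) with e | e <;> rw [e] at h
    · nlinarith [sq_nonneg (v x), hm.1]
    · nlinarith [sq_nonneg (u x), hm.1]
  · exact (hu.intSq.add hv.intSq).const_mul C
  · exact Eventually.of_forall fun x => (hF.tendsto _).comp (gd_tendsto hs hσ' x)

lemma gz_F_sum (hs : ∀ x, s x = 1 ∨ s x = -1) {F : ℝ → ℝ} (iu : Integrable (fun x => F (u x)))
    (iv : Integrable (fun x => F (v x))) (i1 : Integrable (fun x => F (gz u v s 1 x))) (i2 : Integrable (fun x => F (gz u v s (-1) x))) :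
    (∫ x, F (gz u v s 1 x)) + ∫ x, F (gz u v s (-1) x) = (∫ x, F (u x)) + ∫ x, F (v x) := by
  rw [← integral_add i1 i2, ← integral_add iu iv]
  congr 1; ext x
  rcases gz_cases (u := u) (v := v) hs x with ⟨h1, h2⟩ | ⟨h1, h2⟩ <;> rw [h1, h2]
  ring

lemma gz_cont (hu : Continuous u) (hv : Continuous v) (hs : ∀ x, s x = 1 ∨ s x = -1)
    (hl : ∀ x, u x ≠ v x → ∀ᶠ y in nhds x, s y = s x) (σ : ℝ) : Continuous (gz u v s σ) :=
  ((hu.add hv).add ((sw_cont hu hv hs hl).const_mul σ)).div_const 2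

lemma gz_F_int (hu : H1Box n u) (hv : H1Box n v) (hs : ∀ x, s x = 1 ∨ s x = -1)
    (hl : ∀ x, u x ≠ v x → ∀ᶠ y in nhds x, s y = s x) {σ : ℝ} (hσ : σ = 1 ∨ σ = -1) {F : ℝ → ℝ} (hF : Continuous F)
    (iu : Integrable (fun x => F (u x)))
    (iv : Integrable (fun x => F (v x))) : Integrable (fun x => F (gz u v s σ x)) := by
  refine (iu.norm.add iv.norm).mono' (hF.comp (gz_cont hu.cont hv.cont hs hl σ)).aestronglyMeasurable ?_
  refine Eventually.of_forall fun x => ?_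
  simp only [Pi.add_apply]
  have a1 := norm_nonneg (F (u x))
  have a2 := norm_nonneg (F (v x))
  rcases hσ with rfl | rfl <;>
  rcases gz_cases (u := u) (v := v) hs x with ⟨h1, h2⟩ | ⟨h1, h2⟩ <;> simp only [h1, h2] <;> linarith

end crease

variable {n : ℕ} {W W1 W2 : ℝ → ℝ} {u v s : En n → ℝ}

lemma crease_bound (hn : 2 ≤ n) (g : GW W W1 W2) (h0 : W1 0 = 0) {ε : ℝ} (hε : 0 < ε)
    (mu : Minimizes n W ε u) (mv : Minimizes n W ε v) (hs : ∀ x, s x = 1 ∨ s x = -1)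
    (hl : ∀ x, u x ≠ v x → ∀ᶠ y in nhds x, s y = s x) (hV : ∫ x, Vpot n W (gz u v s 1 x) = 1) :
    ∃ C : ℝ, ∀ {x0 : En n} {r κ : ℝ} (_ : 0 < r) (_ : 0 < κ)
    (_ : ∀ x, ‖x - x0‖ < r → u x ∈ Icc κ (1-κ) ∧ v x ∈ Icc κ (1-κ)),
    |∫ y, gz u v s 1 (x0 + r • y) * kap0 y| ≤ C * r^2 := by
  obtain ⟨M, hM, H⟩ := pair_ineq hn g h0
  have hu := mu.1
  have hv := mv.1
  set ψ := Psi n W ε 1 with hψ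
  have hψ0 : 0 ≤ ψ := Psi_nonneg g hε
  refine ⟨(ε⁻¹ + ψ) * M * (2 * ε)⁻¹, ?_⟩
  intro x0 r κ hr hκ hb
  have i1V := gz_F_int (σ := 1) hu hv hs hl (Or.inl rfl) (g.cV hn) (hu.iV hn g h0) (hv.iV hn g h0)
  have i2V := gz_F_int (σ := -1) hu hv hs hl (Or.inr rfl) (g.cV hn) (hu.iV hn g h0) (hv.iV hn g h0)
  have i1W := gz_F_int (σ := 1) hu hv hs hl (Or.inl rfl) g.cW (hu.iW g h0) (hv.iW g h0)
  have i2W := gz_F_int (σ := -1) hu hv hs hl (Or.inr rfl) g.cW (hu.iW g h0) (hv.iW g h0)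
  have sV := gz_F_sum (u := u) (v := v) hs (hu.iV hn g h0) (hv.iV hn g h0) i1V i2V
  have sW := gz_F_sum (u := u) (v := v) hs (hu.iW g h0) (hv.iW g h0) i1W i2W
  have hV2 : ∫ x, Vpot n W (gz u v s (-1) x) = 1 := by rw [hV, mu.2.1, mv.2.1] at sV; linarith
  set J := ∫ y, gz u v s 1 (x0 + r • y) * kap0 y with hJ
  set K := ∫ y : En n, rho0 y ^2 * ‖y‖^2 with hK
  set F := nhdsWithin (0:ℝ) (Ioi 0) with hF
  obtain ⟨CW, hCW0, hCW⟩ := g.upW h0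
  obtain ⟨CV, hCV0, hCV⟩ := g.upV h0 hn
  have bW : ∀ t ∈ Icc (0:ℝ) 1, |W t| ≤ CW * t^2 := fun t ht => by rw [abs_of_nonneg (g.nonneg ht)]; exact hCW t ht
  have bV : ∀ t ∈ Icc (0:ℝ) 1, |Vpot n W t| ≤ CV * t^2 := fun t ht => by
    rw [abs_of_nonneg (g.V_mem hn ht).1]; exact hCV t ht
  have t1 := gd_F_tendsto (σ := 1) hu hv hs hl (Or.inl rfl) (g.cV hn) bV (zero_le_one.trans hCV0)
  have t2 := gd_F_tendsto (σ := -1) hu hv hs hl (Or.inr rfl) (g.cV hn) bV (zero_le_one.trans hCV0)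
  have t3 := gd_F_tendsto (σ := 1) hu hv hs hl (Or.inl rfl) g.cW bW (zero_le_one.trans hCW0)
  have t4 := gd_F_tendsto (σ := -1) hu hv hs hl (Or.inr rfl) g.cW bW (zero_le_one.trans hCW0)
  have iκ : Integrable (kap0 (n := n)) := int_cz continuous_kap0 (fun _ => kap0_zero)
  have t5 : Tendsto (fun δ => ∫ y, gd u v s 1 δ (x0 + r • y) * kap0 y) F (nhds J) := by
    refine tendsto_integral_filter_of_dominated_convergence (fun y => |kap0 y|) ?_ ?_ iκ.abs ?_
    · filter_upwards [self_mem_nhdsWithin] with δ hδ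
      have := (gd_H1 hu hv hs hl (σ := 1) (Or.inl rfl) hδ).cont
      exact ((this.comp (by fun_prop)).mul continuous_kap0).aestronglyMeasurable
    · filter_upwards [self_mem_nhdsWithin] with δ hδ
      refine Eventually.of_forall fun y => ?_
      have := (gd_H1 hu hv hs hl (σ := 1) (Or.inl rfl) hδ).mem_Icc (x0 + r • y)
      rw [norm_mul, Real.norm_eq_abs, Real.norm_eq_abs, abs_of_nonneg this.1]
      exact mul_le_of_le_one_left (abs_nonneg _) this.2
    · exact Eventually.of_forall fun y => (gd_tendsto hs (by simp) _).mul_const _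
  -- limiting inequality
  have main : ∀ t : ℝ, |t| ≤ κ → 0 ≤ ε * (2 * t * (r^n * (r⁻¹)^2 * J) + t^2 * ((r⁻¹)^2 * r^n * K))
      + (ε⁻¹ + ψ) * (M * |t| * r^n) := by
    intro t ht
    have h1 : ∀ᶠ δ in F, ψ * (min 1 ((∫ x, Vpot n W (gd u v s 1 δ x)) - M * |t| * r^n) + min 1 (∫ x, Vpot n W (gd u v s (-1) δ x))) ≤
      ε * ((∫ x, ‖fderiv ℝ u x‖^2) + ∫ x, ‖fderiv ℝ v x‖^2)
      + ε * (2 * t * (r^n * (r⁻¹)^2 * ∫ y, gd u v s 1 δ (x0 + r • y) * kap0 y)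
      + t^2 * ((r⁻¹)^2 * r^n * K))
      + ε⁻¹ * ((∫ x, W (gd u v s 1 δ x)) + (∫ x, W (gd u v s (-1) δ x)) + M * |t| * r^n) := by
      filter_upwards [self_mem_nhdsWithin] with δ hδ
      have hG1 := gd_H1 hu hv hs hl (σ := 1) (Or.inl rfl) hδ
      have hG2 := gd_H1 hu hv hs hl (σ := -1) (Or.inr rfl) hδ
      have := H hε hG1 hG2 hr (x0 := x0) (κ := κ) (t := t) (fun x hx => by
        have h := gd_between (u := u) (v := v) hs (σ := 1) (by simp) hδ x
        have h' := hb x hx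
        exact ⟨(le_min h'.1.1 h'.2.1).trans h.1, h.2.trans (max_le h'.1.2 h'.2.2)⟩) ht
      refine this.trans ?_
      have hD : (∫ x, ‖fderiv ℝ (gd u v s 1 δ) x‖^2) + (∫ x, ‖fderiv ℝ (gd u v s (-1) δ) x‖^2)
        ≤ (∫ x, ‖fderiv ℝ u x‖^2) + ∫ x, ‖fderiv ℝ v x‖^2 := by
        rw [← integral_add hG1.intD hG2.intD, ← integral_add hu.intD hv.intD]
        exact integral_mono (hG1.intD.add hG2.intD) (hu.intD.add hv.intD) (gd_norm hu.diff hv.diff hs hl hδ)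
      have := mul_le_mul_of_nonneg_left hD hε.le
      linarith
    have l1 : Tendsto (fun δ => ψ * (min 1 ((∫ x, Vpot n W (gd u v s 1 δ x)) - M * |t| * r^n) + min 1 (∫ x, Vpot n W (gd u v s (-1) δ x)))) F
        (nhds (ψ * (min 1 ((∫ x, Vpot n W (gz u v s 1 x)) - M * |t| * r^n) + min 1 (∫ x, Vpot n W (gz u v s (-1) x))))) :=
      ((tendsto_const_nhds.min (t1.sub_const _)).add (tendsto_const_nhds.min t2)).const_mul _
    have l2 := (((((t5.const_mul (r^n * (r⁻¹)^2)).const_mul (2*t)).add_const (t^2 * ((r⁻¹)^2 * r^n * K))).const_mul ε).const_add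
      (ε * ((∫ x, ‖fderiv ℝ u x‖^2) + ∫ x, ‖fderiv ℝ v x‖^2))).add (((t3.add t4).add_const (M * |t| * r^n)).const_mul ε⁻¹)
    have := le_of_tendsto_of_tendsto l1 l2 h1
    rw [hV, hV2, sW] at this
    have eu : ε * (∫ x, ‖fderiv ℝ u x‖^2) + ε⁻¹ * (∫ x, W (u x)) = ψ := mu.2.2
    have ev : ε * (∫ x, ‖fderiv ℝ v x‖^2) + ε⁻¹ * (∫ x, W (v x)) = ψ := mv.2.2
    have hpos : 0 ≤ M * |t| * r^n := by positivity
    rw [min_self, min_eq_right (by linarith)] at this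
    nlinarith
  have hrn : 0 < r^n * (r⁻¹)^2 := by positivity
  -- choose t
  have key : ∀ σ : ℝ, |σ| = 1 → 2 * ε * (σ * J) ≤ (ε⁻¹ + ψ) * M * r^2 := by
    intro σ hσ
    have hσ2 : σ^2 = 1 := by rw [← sq_abs, hσ, one_pow]
    have h1 : ∀ τ : ℝ, 0 < τ → τ ≤ κ → 2 * ε * (σ * J) ≤ (ε⁻¹ + ψ) * M * r^2 + τ * (ε * K) := by
      intro τ hτ hτκ
      have := main (-σ * τ) (by rw [abs_mul, abs_neg, hσ, one_mul, abs_of_pos hτ]; exact hτκ)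
      rw [abs_mul, abs_neg, hσ, one_mul, abs_of_pos hτ] at this
      have e : ε * (2 * (-σ * τ) * (r^n * (r⁻¹)^2 * J) + (-σ * τ)^2 * ((r⁻¹)^2 * r^n * K)) + (ε⁻¹ + ψ) * (M * τ * r^n)
        = (τ * (r^n * (r⁻¹)^2)) * ((ε⁻¹ + ψ) * M * r^2 + τ * (ε * K) - 2 * ε * (σ * J)) := by
        have : r⁻¹^2 * r^2 = 1 := by field_simp
        have e2 : (ε⁻¹ + ψ) * (M * τ * r^n) = (ε⁻¹ + ψ) * (M * τ * r^n) * (r⁻¹^2 * r^2) := by rw [this, mul_one]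
        rw [e2, mul_pow, neg_sq, hσ2]; ring
      rw [e] at this
      have h3 := nonneg_of_mul_nonneg_right this (by positivity)
      linarith
    have l : Tendsto (fun τ : ℝ => (ε⁻¹ + ψ) * M * r^2 + τ * (ε * K)) F (nhds ((ε⁻¹ + ψ) * M * r^2 + 0 * (ε * K))) :=
      ((tendsto_id.mono_left nhdsWithin_le_nhds).mul_const _).const_add _
    rw [zero_mul, add_zero] at l
    refine ge_of_tendsto l ?_
    filter_upwards [Ioc_mem_nhdsGT hκ] with τ hτ using h1 τ hτ.1 hτ.2
  have k1 := key 1 (by simp)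
  have k2 := key (-1) (by simp)
  have e : (ε⁻¹ + ψ) * M * (2 * ε)⁻¹ * r^2 = ((ε⁻¹ + ψ) * M * r^2) / (2*ε) := by field_simp
  rw [e, le_div_iff₀ (by positivity)]
  rcases abs_cases J with ⟨h, -⟩ | ⟨h, -⟩ <;> rw [h] <;> linarith

lemma crease (hn : 2 ≤ n) (g : GW W W1 W2) (h0 : W1 0 = 0) {ε : ℝ} (hε : 0 < ε)
    (mu : Minimizes n W ε u) (mv : Minimizes n W ε v) (hs : ∀ x, s x = 1 ∨ s x = -1)
    (hl : ∀ x, u x ≠ v x → ∀ᶠ y in nhds x, s y = s x) (hV : ∫ x, Vpot n W (gz u v s 1 x) = 1)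
    {x0 : En n} (he : u x0 = v x0) {τ : ℝ} (hτ : τ ≠ 0)
    (ho : (fun x => s x * (u x - v x) - τ * |(fderiv ℝ u x0 - fderiv ℝ v x0) (x - x0)|) =o[nhds x0] fun x => x - x0) :
    fderiv ℝ u x0 = fderiv ℝ v x0 := by
  have hu := mu.1
  have hv := mv.1
  by_cases c0 : u x0 = 0
  · have a1 : IsLocalMin u x0 := Eventually.of_forall fun x => by rw [c0]; exact (hu.mem_Icc x).1
    have a2 : IsLocalMin v x0 := Eventually.of_forall fun x => by rw [← he, c0]; exact (hv.mem_Icc x).1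
    rw [a1.fderiv_eq_zero, a2.fderiv_eq_zero]
  by_cases c1 : u x0 = 1
  · have a1 : IsLocalMax u x0 := Eventually.of_forall fun x => by rw [c1]; exact (hu.mem_Icc x).2
    have a2 : IsLocalMax v x0 := Eventually.of_forall fun x => by rw [← he, c1]; exact (hv.mem_Icc x).2
    rw [a1.fderiv_eq_zero, a2.fderiv_eq_zero]
  have p0 : 0 < u x0 := lt_of_le_of_ne (hu.mem_Icc x0).1 (Ne.symm c0)
  have p1 : u x0 < 1 := lt_of_le_of_ne (hu.mem_Icc x0).2 c1
  set κ := min (u x0) (1 - u x0) / 2 with hκ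
  have hκ0 : 0 < κ := by have : 0 < min (u x0) (1 - u x0) := lt_min p0 (by linarith)
                         positivity
  have m1 : κ < u x0 := by have := min_le_left (u x0) (1 - u x0); linarith
  have m2 : u x0 < 1 - κ := by have := min_le_right (u x0) (1 - u x0); linarith
  have hnb : ∀ᶠ x in nhds x0, u x ∈ Icc κ (1-κ) ∧ v x ∈ Icc κ (1-κ) := by
    have e1 := hu.cont.continuousAt.eventually (Icc_mem_nhds m1 m2)
    have e2 := (hv.cont.tendsto x0).eventually (by rw [← he]; exact Icc_mem_nhds m1 m2)
    exact e1.and e2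
  obtain ⟨C, hC⟩ := crease_bound hn g h0 hε mu mv hs hl hV
  by_contra hne
  set b := fderiv ℝ u x0 - fderiv ℝ v x0 with hb
  have hb0 : b ≠ 0 := sub_ne_zero.2 hne
  set a := (1/2:ℝ) • (fderiv ℝ u x0 + fderiv ℝ v x0) with ha
  set G := gz u v s 1 with hG
  have hGc : Continuous G := gz_cont hu.cont hv.cont hs hl 1
  have hGx : G x0 = u x0 := by simp only [hG, gz, ← he]; ring
  have hexp : (fun x => G x - G x0 - (a (x - x0) + τ/2 * |b (x - x0)|)) =o[nhds x0] fun x => x - x0 := by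
    have e1 := (hasFDerivAt_iff_isLittleO.1 (hu.diff x0).hasFDerivAt)
    have e2 := (hasFDerivAt_iff_isLittleO.1 (hv.diff x0).hasFDerivAt)
    have := ((e1.add e2).add ho).const_mul_left (1/2)
    refine this.congr_left fun x => ?_
    rw [hGx]
    simp only [hG, gz, ha, ← he, smul_apply, add_apply, smul_eq_mul]
    ring
  have iκ : Integrable (kap0 (n := n)) := int_cz continuous_kap0 (fun _ => kap0_zero)
  have ia : Integrable (fun y : En n => a y * kap0 y) := int_cz (a.continuous.mul continuous_kap0) (fun y hy => by simp [kap0_zero hy])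
  have ib : Integrable (fun y : En n => |b y| * kap0 y) := int_cz (b.continuous.abs.mul continuous_kap0) (fun y hy => by simp [kap0_zero hy])
  set I := ∫ y, |b y| * kap0 y with hI
  have hIneg : I < 0 := by rw [hI, int_abs_kap0]; linarith [int_abs_rho0_pos hb0]
  set K1 := ∫ y : En n, |kap0 y| with hK1
  have hK10 : 0 ≤ K1 := integral_nonneg fun y => abs_nonneg _
  have key : ∀ η : ℝ, 0 < η → |τ/2 * I| ≤ η * K1 := by
    intro η hη
    have h1 := (hexp.bound hη).and hnb
    obtain ⟨ρ, hρ, hball⟩ := Metric.eventually_nhds_iff.1 h1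
    have h2 : ∀ r : ℝ, 0 < r → r < ρ → |τ/2 * I| ≤ η * K1 + C * r := by
      intro r hr hrρ
      have hJ := hC (x0 := x0) hr hκ0 (fun x hx => (hball (by rw [dist_eq_norm]; linarith)).2)
      have iG : Integrable (fun y => G (x0 + r • y) * kap0 y) :=
        int_cz ((hGc.comp (by fun_prop)).mul continuous_kap0) (fun y hy => by simp [kap0_zero hy])
      have e : r * (τ/2 * I) = (∫ y, G (x0 + r • y) * kap0 y) -
          ∫ y, (G (x0 + r • y) - G x0 - (a (r • y) + τ/2 * |b (r • y)|)) * kap0 y := by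
        rw [← integral_sub]
        · have : ∀ y, G (x0 + r • y) * kap0 y - (G (x0 + r • y) - G x0 - (a (r • y) + τ/2 * |b (r • y)|)) * kap0 y
            = (G x0 * kap0 y + r * (a y * kap0 y)) + (r * (τ/2)) * (|b y| * kap0 y) := by
            intro y; simp only [map_smul, smul_eq_mul, abs_mul, abs_of_pos hr]; ring
          simp_rw [this]
          have i1 : Integrable (fun y => G x0 * kap0 y + r * (a y * kap0 y)) := (iκ.const_mul _).add (ia.const_mul _)
          rw [integral_add i1 (ib.const_mul _), integral_add (iκ.const_mul _) (ia.const_mul _),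
            integral_const_mul, integral_const_mul, integral_const_mul, int_kap0, int_lin_kap0]
          ring
        · exact iG
        · apply int_cz
          · refine Continuous.mul ?_ continuous_kap0
            have : Continuous fun y => G (x0 + r • y) := hGc.comp (by fun_prop)
            fun_prop
          · intro y hy; simp [kap0_zero hy]
      have hR : |∫ y, (G (x0 + r • y) - G x0 - (a (r • y) + τ/2 * |b (r • y)|)) * kap0 y| ≤ η * r * K1 := by
        rw [hK1, ← integral_const_mul]
        refine abs_integral_le_integral_abs.trans (integral_mono_of_nonneg (Eventually.of_forall fun _ => abs_nonneg _)
          (iκ.abs.const_mul _) (Eventually.of_forall fun y => ?_))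
        simp only [abs_mul]
        rcases le_or_gt 1 ‖y‖ with hy | hy
        · simp [kap0_zero hy]
        · refine mul_le_mul_of_nonneg_right ?_ (abs_nonneg _)
          have hd : ‖r • y‖ ≤ r := by rw [norm_smul, Real.norm_eq_abs, abs_of_pos hr]; nlinarith [norm_nonneg y]
          have := (hball (y := x0 + r • y) (by rw [dist_eq_norm, add_sub_cancel_left]; linarith)).1
          rw [add_sub_cancel_left, Real.norm_eq_abs] at this
          exact this.trans (mul_le_mul_of_nonneg_left hd hη.le)
      have h3 : |r * (τ/2 * I)| ≤ C * r^2 + η * r * K1 := by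
        rw [e]; exact (abs_sub _ _).trans (add_le_add hJ hR)
      rw [abs_mul, abs_of_pos hr] at h3
      have : r * |τ/2 * I| ≤ r * (η * K1 + C * r) := by nlinarith
      exact le_of_mul_le_mul_left this hr
    have l : Tendsto (fun r : ℝ => η * K1 + C * r) (nhdsWithin 0 (Ioi 0)) (nhds (η * K1 + C * 0)) :=
      ((tendsto_id.mono_left nhdsWithin_le_nhds).const_mul C).const_add _
    rw [mul_zero, add_zero] at l
    refine ge_of_tendsto l ?_
    filter_upwards [Ioo_mem_nhdsGT hρ] with r hr using h2 r hr.1 hr.2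
  have hfin : |τ/2 * I| ≤ 0 := by
    have l : Tendsto (fun η : ℝ => η * K1) (nhdsWithin 0 (Ioi 0)) (nhds (0 * K1)) :=
      (tendsto_id.mono_left nhdsWithin_le_nhds).mul_const _
    rw [zero_mul] at l
    refine ge_of_tendsto l ?_
    filter_upwards [self_mem_nhdsWithin] with η hη using key η hη
  have : τ/2 * I = 0 := abs_eq_zero.1 (le_antisymm hfin (abs_nonneg _))
  rcases mul_eq_zero.1 this with h | h
  · exact hτ (by linarith)
  · exact hIneg.ne h

variable {n : ℕ} {W W1 W2 : ℝ → ℝ} {u v s : En n → ℝ}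

lemma gz_deriv (hu : Differentiable ℝ u) (hv : Differentiable ℝ v) (hs : ∀ x, s x = 1 ∨ s x = -1)
    (hD : ∀ x, (∀ᶠ y in nhds x, s y = s x) ∨ (u x = v x ∧ fderiv ℝ u x = fderiv ℝ v x))
    (σ : ℝ) (x : En n) :
    HasFDerivAt (gz u v s σ) ((1/2:ℝ) • (fderiv ℝ u x + fderiv ℝ v x) +
      (σ * s x / 2) • (fderiv ℝ u x - fderiv ℝ v x)) x := by
  have hsk : HasFDerivAt (fun x => s x * (u x - v x)) ((s x) • (fderiv ℝ u x - fderiv ℝ v x)) x := by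
    have hw : HasFDerivAt (fun x => u x - v x) (fderiv ℝ u x - fderiv ℝ v x) x :=
      (hu x).hasFDerivAt.sub (hv x).hasFDerivAt
    rcases hD x with h | ⟨h, hD⟩
    · refine (hw.const_mul (s x)).congr_of_eventuallyEq ?_
      filter_upwards [h] with y hy
      simp [hy]
    · have e0 : u x - v x = 0 := sub_eq_zero.2 h
      rw [hD, sub_self] at hw
      rw [hD, sub_self, smul_zero]
      rw [hasFDerivAt_iff_isLittleO] at hw ⊢
      simp only [e0, mul_zero, zero_apply, sub_zero] at hw ⊢
      refine (hw.norm_left.congr_left fun y => ?_).of_norm_left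
      rcases hs y with h | h <;> simp [h, abs_sub_comm]
  have h1 := (((hu x).hasFDerivAt.add (hv x).hasFDerivAt).add (hsk.const_mul σ)).mul_const (1/2 : ℝ)
  have e : gz u v s σ = fun x => ((u + v + fun x => σ * (s x * (u x - v x))) x) * (1/2) := by
    ext x; simp [gz]; ring
  rw [e]
  refine h1.congr_fderiv ?_
  ext z; simp; ring

lemma gz_norm (hu : Differentiable ℝ u) (hv : Differentiable ℝ v) (hs : ∀ x, s x = 1 ∨ s x = -1)
    (hD : ∀ x, (∀ᶠ y in nhds x, s y = s x) ∨ (u x = v x ∧ fderiv ℝ u x = fderiv ℝ v x)) (x : En n) :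
    ‖fderiv ℝ (gz u v s 1) x‖^2 + ‖fderiv ℝ (gz u v s (-1)) x‖^2 = ‖fderiv ℝ u x‖^2 + ‖fderiv ℝ v x‖^2 := by
  rw [(gz_deriv hu hv hs hD 1 x).fderiv, (gz_deriv hu hv hs hD (-1) x).fderiv]
  set a := fderiv ℝ u x
  set b := fderiv ℝ v x
  have e1 : (1/2:ℝ) • (a + b) + (-1 * s x / 2) • (a - b) = (1/2:ℝ) • (a+b) - (1 * s x / 2) • (a - b) := by
    ext z; simp; ring
  rw [e1, dual_para, norm_smul, norm_smul]
  have h2 := dual_para a b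
  have hk := s_sq hs x
  rw [mul_pow, mul_pow, Real.norm_eq_abs, Real.norm_eq_abs, sq_abs, sq_abs, div_pow (1 * s x), mul_pow, hk]
  linarith

lemma gz_min (hn : 2 ≤ n) (g : GW W W1 W2) (h0 : W1 0 = 0) {ε : ℝ} (hε : 0 < ε)
    (mu : Minimizes n W ε u) (mv : Minimizes n W ε v) (hs : ∀ x, s x = 1 ∨ s x = -1)
    (hl : ∀ x, u x ≠ v x → ∀ᶠ y in nhds x, s y = s x) (hV : ∫ x, Vpot n W (gz u v s 1 x) = 1)
    (hD : ∀ x, (∀ᶠ y in nhds x, s y = s x) ∨ (u x = v x ∧ fderiv ℝ u x = fderiv ℝ v x)) :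
    Minimizes n W ε (gz u v s 1) ∧ Minimizes n W ε (gz u v s (-1)) := by
  have hu := mu.1
  have hv := mv.1
  have i1V := gz_F_int (σ := 1) hu hv hs hl (Or.inl rfl) (g.cV hn) (hu.iV hn g h0) (hv.iV hn g h0)
  have i2V := gz_F_int (σ := -1) hu hv hs hl (Or.inr rfl) (g.cV hn) (hu.iV hn g h0) (hv.iV hn g h0)
  have i1W := gz_F_int (σ := 1) hu hv hs hl (Or.inl rfl) g.cW (hu.iW g h0) (hv.iW g h0)
  have i2W := gz_F_int (σ := -1) hu hv hs hl (Or.inr rfl) g.cW (hu.iW g h0) (hv.iW g h0)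
  have sV := gz_F_sum (u := u) (v := v) hs (hu.iV hn g h0) (hv.iV hn g h0) i1V i2V
  have sW := gz_F_sum (u := u) (v := v) hs (hu.iW g h0) (hv.iW g h0) i1W i2W
  have hV2 : ∫ x, Vpot n W (gz u v s (-1) x) = 1 := by rw [hV, mu.2.1, mv.2.1] at sV; linarith
  have H : ∀ σ : ℝ, (σ = 1 ∨ σ = -1) → H1Box n (gz u v s σ) := by
    intro σ hσ
    have hd : Differentiable ℝ (gz u v s σ) := fun x => (gz_deriv hu.diff hv.diff hs hD σ x).differentiableAt
    refine H1Box.mk' ?_ hd ?_ ?_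
    · intro x
      rcases hσ with rfl | rfl <;>
      rcases gz_cases (u := u) (v := v) hs x with ⟨h1, h2⟩ | ⟨h1, h2⟩ <;> simp only [h1, h2] <;>
      first | exact hu.mem_Icc x | exact hv.mem_Icc x
    · exact gz_F_int hu hv hs hl hσ (F := fun t => t^2) (by fun_prop) hu.intSq hv.intSq
    · refine (hu.intD.add hv.intD).mono' ((measurable_fderiv ℝ _).norm.pow_const 2).aestronglyMeasurable ?_
      refine Eventually.of_forall fun x => ?_
      rw [Real.norm_eq_abs, abs_of_nonneg (sq_nonneg _)]
      have := gz_norm hu.diff hv.diff hs hD x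
      simp only [Pi.add_apply]
      rcases hσ with rfl | rfl
      · nlinarith [sq_nonneg ‖fderiv ℝ (gz u v s (-1)) x‖]
      · nlinarith [sq_nonneg ‖fderiv ℝ (gz u v s (1)) x‖]
  have H1 := H 1 (Or.inl rfl)
  have H2 := H (-1) (Or.inr rfl)
  have p1 := Psi_le g hε H1 hV
  have p2 := Psi_le g hε H2 hV2
  have sD : (∫ x, ‖fderiv ℝ (gz u v s 1) x‖^2) + (∫ x, ‖fderiv ℝ (gz u v s (-1)) x‖^2) =
      (∫ x, ‖fderiv ℝ u x‖^2) + ∫ x, ‖fderiv ℝ v x‖^2 := by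
    rw [← integral_add H1.intD H2.intD, ← integral_add hu.intD hv.intD]
    congr 1; ext x
    exact gz_norm hu.diff hv.diff hs hD x
  have a1 := mu.2.2
  have a2 := mv.2.2
  have hsum : AC n W ε (gz u v s 1) + AC n W ε (gz u v s (-1)) = 2 * Psi n W ε 1 := by
    have : AC n W ε (gz u v s 1) + AC n W ε (gz u v s (-1)) = AC n W ε u + AC n W ε v := by
      unfold AC
      linear_combination ε * sD + ε⁻¹ * sW
    rw [this, a1, a2]; ring
  exact ⟨⟨H1, hV, by linarith⟩, ⟨H2, hV2, by linarith⟩⟩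

/-! ### half spaces -/

/-- sign with respect to a hyperplane -/
def sH (ν : En n) (c : ℝ) (x : En n) : ℝ := if c < inner ℝ ν x then 1 else -1

lemma sH_cases (ν : En n) (c : ℝ) (x : En n) : sH ν c x = 1 ∨ sH ν c x = -1 := by
  unfold sH; split_ifs <;> simp

lemma sH_loc {ν : En n} {c : ℝ} {x : En n} (h : inner ℝ ν x ≠ c) : ∀ᶠ y in nhds x, sH ν c y = sH ν c x := by
  have hc : Continuous (fun y : En n => inner ℝ ν y) := by fun_prop
  rcases lt_or_gt_of_ne h with h | h
  · filter_upwards [hc.continuousAt.eventually (Iio_mem_nhds h)] with y hy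
    have hy' : inner ℝ ν y < c := hy
    simp [sH, not_lt.2 hy'.le, not_lt.2 h.le]
  · filter_upwards [hc.continuousAt.eventually (Ioi_mem_nhds h)] with y hy
    have hy' : c < inner ℝ ν y := hy
    simp [sH, h, hy']

lemma hrefl_fix {ν : En n} {c : ℝ} {x : En n} (h : inner ℝ ν x = c) : hrefl ν c x = x := by
  simp [hrefl, h]

lemma hyper_null {ν : En n} (hν : ‖ν‖ = 1) (c : ℝ) : volume {x : En n | inner ℝ ν x = c} = 0 := by
  set A : AffineSubspace ℝ (En n) := AffineSubspace.mk' (c • ν) (ℝ ∙ ν)ᗮ with hA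
  have hmem : ∀ x, x ∈ A ↔ inner ℝ ν x = c := by
    intro x
    rw [hA, AffineSubspace.mem_mk', Submodule.mem_orthogonal_singleton_iff_inner_right, vsub_eq_sub, inner_sub_right,
      inner_smul_right, real_inner_self_eq_norm_sq, hν]
    constructor <;> intro h <;> linarith
  have h1 := Measure.addHaar_affineSubspace (volume : Measure (En n)) A (by
    intro h
    have : (c+1) • ν ∈ A := by rw [h]; trivial
    rw [hmem, inner_smul_right, real_inner_self_eq_norm_sq, hν] at this
    linarith)
  convert h1 using 2
  ext x; exact (hmem x).symm

lemma integral_hrefl (f : En n → ℝ) {ν : En n} (hν : ‖ν‖ = 1) (c : ℝ) : ∫ x, f (hrefl ν c x) = ∫ x, f x := by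
  simp_rw [hrefl_eq hν]; exact integral_isom f _ _

lemma half_meas (ν : En n) (c : ℝ) : MeasurableSet {x : En n | c < inner ℝ ν x} :=
  (isOpen_lt continuous_const (by fun_prop)).measurableSet

lemma gz_half {F : ℝ → ℝ} {ν : En n} (hν : ‖ν‖ = 1) {c : ℝ} (iF : Integrable (fun x => F (u x)))
    {T : ℝ} (hh : ∫ x in {x : En n | c < inner ℝ ν x}, F (u x) = T) :
    ∫ x, F (gz u (fun x => u (hrefl ν c x)) (sH ν c) 1 x) = 2 * T := by
  set S := {x : En n | c < inner ℝ ν x} with hS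
  set S' := {x : En n | c ≤ inner ℝ ν x} with hS'
  have mS : MeasurableSet S := half_meas ν c
  have mS' : MeasurableSet S' := (isClosed_le continuous_const (by fun_prop)).measurableSet
  have e : ∀ x, F (gz u (fun x => u (hrefl ν c x)) (sH ν c) 1 x) =
      S.indicator (fun x => F (u x)) x + S'.indicator (fun x => F (u x)) (hrefl ν c x) := by
    intro x
    have hi := inner_hrefl hν c x
    by_cases h : c < inner ℝ ν x
    · have h1 : hrefl ν c x ∉ S' := by intro h'; have : c ≤ inner ℝ ν (hrefl ν c x) := h'; linarith
      rw [indicator_of_mem (show x ∈ S from h), indicator_of_notMem h1]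
      simp [gz, sH, h]
    · have h1 : hrefl ν c x ∈ S' := by show c ≤ inner ℝ ν (hrefl ν c x); push Not at h; linarith
      rw [indicator_of_notMem (show x ∉ S from h), indicator_of_mem h1]
      simp [gz, sH, h]
      congr 1; ring
  simp_rw [e]
  have iS : Integrable (S.indicator (fun x => F (u x))) := iF.indicator mS
  have iS' : Integrable (S'.indicator (fun x => F (u x))) := iF.indicator mS'
  have iS'' : Integrable (fun x => S'.indicator (fun x => F (u x)) (hrefl ν c x)) := by
    simp_rw [hrefl_eq hν]; exact integrable_isom iS' _ _
  rw [integral_add iS iS'', integral_hrefl _ hν, integral_indicator mS, integral_indicator mS', hh]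
  have : ∫ x in S', F (u x) = T := by
    rw [← hh]
    apply setIntegral_congr_set
    have : S' =ᵐ[volume] S := by
      have hz := hyper_null hν c
      rw [ae_eq_set]
      constructor
      · refine measure_mono_null ?_ hz
        intro x hx
        have h1 : c ≤ inner ℝ ν x := hx.1
        have h2 : ¬ c < inner ℝ ν x := hx.2
        exact le_antisymm (not_lt.1 h2) h1
      · have : S \ S' = ∅ := by
          ext x
          constructor
          · intro hx
            have h1 : c < inner ℝ ν x := hx.1
            exact absurd (show x ∈ S' from h1.le) hx.2
          · intro hx; exact absurd hx (notMem_empty x)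
        simp [this]
    exact this
  rw [this]; ring

lemma exists_half {f : En n → ℝ} (hf : Integrable f) (h1 : ∫ x, f x = 1) {ν : En n} (hν : ‖ν‖ = 1) :
    ∃ c, ∫ x in {x : En n | c < inner ℝ ν x}, f x = 1/2 := by
  have key : ∀ (l : Filter ℝ) [l.IsCountablyGenerated] (S : Set (En n)), MeasurableSet S →
      (∀ᵐ x : En n, ∀ᶠ c in l, (c < inner ℝ ν x ↔ x ∈ S)) →
      Tendsto (fun c => ∫ x in {x : En n | c < inner ℝ ν x}, f x) l (nhds (∫ x in S, f x)) := by
    intro l _ S mS hS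
    simp_rw [← integral_indicator (half_meas ν _), ← integral_indicator mS]
    refine tendsto_integral_filter_of_dominated_convergence (fun x => |f x|) ?_ ?_ hf.abs ?_
    · exact Eventually.of_forall fun c => (hf.indicator (half_meas ν c)).aestronglyMeasurable
    · exact Eventually.of_forall fun c => Eventually.of_forall fun x => by
        rw [← Real.norm_eq_abs]; exact norm_indicator_le_norm_self _ _
    · filter_upwards [hS] with x hx
      refine tendsto_const_nhds.congr' ?_
      filter_upwards [hx] with c hc
      by_cases h : x ∈ S
      · rw [indicator_of_mem h, indicator_of_mem (show x ∈ {x : En n | c < inner ℝ ν x} from hc.2 h)]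
      · rw [indicator_of_notMem h, indicator_of_notMem (show x ∉ {x : En n | c < inner ℝ ν x} from fun h' => h (hc.1 h'))]
  have hcont : Continuous (fun c => ∫ x in {x : En n | c < inner ℝ ν x}, f x) := by
    rw [continuous_iff_continuousAt]
    intro c0
    refine key (nhds c0) _ (half_meas ν c0) ?_
    have hz : ∀ᵐ x : En n, inner ℝ ν x ≠ c0 := by
      rw [ae_iff]; simpa using hyper_null hν c0
    filter_upwards [hz] with x hx
    rcases lt_or_gt_of_ne hx with h | h
    · filter_upwards [Ioi_mem_nhds h] with c hc
      have hc' : inner ℝ ν x < c := hc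
      simp [not_lt.2 hc'.le, not_lt.2 h.le]
    · filter_upwards [Iio_mem_nhds h] with c hc
      have hc' : c < inner ℝ ν x := hc
      simp [hc', h]
  have hbot := key atBot univ MeasurableSet.univ (Eventually.of_forall fun x => by
    filter_upwards [eventually_lt_atBot (inner ℝ ν x)] with c hc; simp [hc])
  have htop := key atTop ∅ MeasurableSet.empty (Eventually.of_forall fun x => by
    filter_upwards [eventually_ge_atTop (inner ℝ ν x)] with c hc; simp [hc])
  rw [setIntegral_univ, h1] at hbot
  rw [setIntegral_empty] at htop
  have e1 : ∃ a, 1/2 ≤ ∫ x in {x : En n | a < inner ℝ ν x}, f x :=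
    (hbot.eventually (Ici_mem_nhds (by norm_num : (1/2:ℝ) < 1))).exists
  have e2 : ∃ a, ∫ x in {x : En n | a < inner ℝ ν x}, f x ≤ 1/2 :=
    (htop.eventually (Iic_mem_nhds (by norm_num : (0:ℝ) < 1/2))).exists
  exact mem_range_of_exists_le_of_exists_ge hcont e2 e1

lemma fderiv_hrefl (hu : Differentiable ℝ u) {ν : En n} (hν : ‖ν‖ = 1) (c : ℝ) (x h : En n) :
    fderiv ℝ (fun x => u (hrefl ν c x)) x h = fderiv ℝ u (hrefl ν c x) (reflL ν h) := by
  simp_rw [hrefl_eq hν]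
  rw [fderiv_isom hu]; rfl

/-- reflection lemma -/
lemma reflect (hn : 2 ≤ n) (g : GW W W1 W2) (h0 : W1 0 = 0) {ε : ℝ} (hε : 0 < ε)
    (mu : Minimizes n W ε u) {ν : En n} (hν : ‖ν‖ = 1) {c : ℝ}
    (hh : ∫ x in {x : En n | c < inner ℝ ν x}, Vpot n W (u x) = 1/2) :
    (∀ x, inner ℝ ν x = c → fderiv ℝ u x ν = 0) ∧
    Minimizes n W ε (gz u (fun x => u (hrefl ν c x)) (sH ν c) 1) ∧
    Minimizes n W ε (gz u (fun x => u (hrefl ν c x)) (sH ν c) (-1)) := by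
  set v : En n → ℝ := fun x => u (hrefl ν c x) with hv
  have mv : Minimizes n W ε v := mu.hrefl hν c
  have hs := sH_cases ν c
  have hl : ∀ x, u x ≠ v x → ∀ᶠ y in nhds x, sH ν c y = sH ν c x := by
    intro x hx
    apply sH_loc
    intro h; apply hx; rw [hv]; simp only [hrefl_fix h]
  have hV : ∫ x, Vpot n W (gz u v (sH ν c) 1 x) = 1 := by
    rw [gz_half hν (mu.1.iV hn g h0) hh]; norm_num
  have hDv : ∀ x h, fderiv ℝ v x h = fderiv ℝ u (hrefl ν c x) (reflL ν h) := fderiv_hrefl mu.1.diff hν c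
  have hb : ∀ x, inner ℝ ν x = c → ∀ h, (fderiv ℝ u x - fderiv ℝ v x) h = 2 * inner ℝ ν h * fderiv ℝ u x ν := by
    intro x hx h
    rw [sub_apply, hDv, hrefl_fix hx, reflL_apply hν, map_sub, map_smul, smul_eq_mul]; ring
  have hDD : ∀ x, inner ℝ ν x = c → fderiv ℝ u x = fderiv ℝ v x := by
    intro x hx
    by_cases hz : fderiv ℝ u x ν = 0
    · rw [← sub_eq_zero]; ext h; rw [hb x hx, hz]; simp
    set d := fderiv ℝ u x ν with hd
    refine crease hn g h0 hε mu mv hs hl hV (x0 := x) (by rw [hv]; simp only [hrefl_fix hx]) (τ := d / |d|) (by positivity) ?_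
    have e1 := (hasFDerivAt_iff_isLittleO.1 (mu.1.diff x).hasFDerivAt)
    have e2 := (hasFDerivAt_iff_isLittleO.1 (mv.1.diff x).hasFDerivAt)
    have e3 := e1.sub e2
    have hx' : v x = u x := by rw [hv]; simp only [hrefl_fix hx]
    refine (e3.norm_left.congr_left fun y => ?_).of_norm_left
    have : sH ν c y * (u y - v y) - d / |d| * |(fderiv ℝ u x - fderiv ℝ v x) (y - x)| = sH ν c y *
      (u y - u x - fderiv ℝ u x (y - x) - (v y - v x - fderiv ℝ v x (y - x))) := by
      have h3 := hb x hx (y - x)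
      have h4 : u y - u x - fderiv ℝ u x (y - x) - (v y - v x - fderiv ℝ v x (y - x)) =
        u y - v y - (fderiv ℝ u x - fderiv ℝ v x) (y - x) := by rw [hx', sub_apply]; ring
      rw [h4, h3, abs_mul, abs_mul, inner_sub_right, hx, abs_of_pos (by norm_num : (0:ℝ) < 2)]
      have h5 : d / |d| * |d| = d := by field_simp
      unfold sH
      split_ifs with hc
      · rw [abs_of_pos (show 0 < inner ℝ ν y - c by linarith)]; linear_combination (-2 * (inner ℝ ν y - c)) * h5
      · push Not at hc
        rw [abs_of_nonpos (show inner ℝ ν y - c ≤ 0 by linarith)]; linear_combination (2 * (inner ℝ ν y - c)) * h5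
    rw [this, norm_mul, Real.norm_eq_abs (sH ν c y), s_abs hs, one_mul]
  refine ⟨fun x hx => ?_, gz_min hn g h0 hε mu mv hs hl hV ?_⟩
  · have := hb x hx ν
    rw [hDD x hx, sub_self, real_inner_self_eq_norm_sq, hν] at this
    simp at this; rw [hDD x hx]; exact this
  · intro x
    by_cases hx : inner ℝ ν x = c
    · right; exact ⟨by rw [hv]; simp only [hrefl_fix hx], hDD x hx⟩
    · left; exact sH_loc hx

/-- polarization lemma -/
lemma polar (hn : 2 ≤ n) (g : GW W W1 W2) (h0 : W1 0 = 0) {ε : ℝ} (hε : 0 < ε)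
    (mu : Minimizes n W ε u) {ν : En n} (hν : ‖ν‖ = 1) {c : ℝ} {x : En n} (hx : inner ℝ ν x ≠ c)
    (he : u x = u (hrefl ν c x)) (h : En n) : fderiv ℝ u x h = fderiv ℝ u (hrefl ν c x) (reflL ν h) := by
  set v : En n → ℝ := fun x => u (hrefl ν c x) with hv
  have mv : Minimizes n W ε v := mu.hrefl hν c
  rw [← fderiv_hrefl mu.1.diff hν c]
  set s : En n → ℝ := fun x => sH ν c x * (if v x < u x then 1 else -1) with hsd
  have hs : ∀ x, s x = 1 ∨ s x = -1 := by
    intro x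
    simp only [hsd]
    rcases sH_cases ν c x with h | h <;> rw [h] <;> split_ifs <;> simp
  have hsw : ∀ x, s x * (u x - v x) = sH ν c x * |u x - v x| := by
    intro x
    simp only [hsd]
    split_ifs with h
    · rw [abs_of_pos (by linarith)]; ring
    · rw [abs_of_nonpos (by linarith)]; ring
  have hvx : ∀ x, inner ℝ ν x = c → v x = u x := fun x h => by rw [hv]; simp only [hrefl_fix h]
  have hl : ∀ x, u x ≠ v x → ∀ᶠ y in nhds x, s y = s x := by
    intro x hx
    have h1 : inner ℝ ν x ≠ c := fun h => hx (hvx x h).symm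
    have hiff : ∀ᶠ y in nhds x, (v y < u y ↔ v x < u x) := by
      rcases lt_or_gt_of_ne hx with h | h
      · filter_upwards [mu.1.cont.continuousAt.eventually_lt mv.1.cont.continuousAt h] with y hy
        simp [not_lt.2 hy.le, not_lt.2 h.le]
      · filter_upwards [mv.1.cont.continuousAt.eventually_lt mu.1.cont.continuousAt h] with y hy
        simp [h, hy]
    filter_upwards [sH_loc h1, hiff] with y h2 h3
    simp only [hsd, h2, h3]
  have hV : ∫ x, Vpot n W (gz u v s 1 x) = 1 := by
    have hu := mu.1
    have i1V := gz_F_int (σ := 1) hu mv.1 hs hl (Or.inl rfl) (g.cV hn) (hu.iV hn g h0) (mv.1.iV hn g h0)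
    have i2V := gz_F_int (σ := -1) hu mv.1 hs hl (Or.inr rfl) (g.cV hn) (hu.iV hn g h0) (mv.1.iV hn g h0)
    have sV := gz_F_sum (u := u) (v := v) hs (hu.iV hn g h0) (mv.1.iV hn g h0) i1V i2V
    rw [mu.2.1, mv.2.1] at sV
    have e := integral_hrefl (fun x => Vpot n W (gz u v s 1 x)) hν c
    have e2 : ∀ x, gz u v s 1 (hrefl ν c x) = gz u v s (-1) x := by
      intro x
      unfold gz
      have a1 : v (hrefl ν c x) = u x := by simp only [hv, hrefl_hrefl hν]
      have a2 : u (hrefl ν c x) = v x := rfl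
      rw [hsw, hsw, a1, a2, abs_sub_comm (v x)]
      by_cases hx : inner ℝ ν x = c
      · rw [hvx x hx]; simp
      · have hi := inner_hrefl hν c x
        have : sH ν c (hrefl ν c x) = - sH ν c x := by
          unfold sH
          rcases lt_or_gt_of_ne hx with h | h
          · rw [if_pos (by linarith), if_neg (by linarith)]; norm_num
          · rw [if_neg (by linarith), if_pos (by linarith)]
        rw [this]; ring
    simp only [e2] at e
    linarith
  have hD : fderiv ℝ u x = fderiv ℝ v x := by
    refine crease hn g h0 hε mu mv hs hl hV (x0 := x) he (τ := sH ν c x) (by rcases sH_cases ν c x with h | h <;> rw [h] <;> norm_num) ?_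
    have e1 := (hasFDerivAt_iff_isLittleO.1 (mu.1.diff x).hasFDerivAt)
    have e2 := (hasFDerivAt_iff_isLittleO.1 (mv.1.diff x).hasFDerivAt)
    have e3 := e1.sub e2
    refine Asymptotics.IsBigO.trans_isLittleO ?_ e3
    apply Asymptotics.IsBigO.of_bound 1
    filter_upwards [sH_loc hx] with y hy
    rw [hsw, hy, ← mul_sub, norm_mul, Real.norm_eq_abs (sH ν c x), s_abs (sH_cases ν c), Real.norm_eq_abs]
    refine mul_le_mul_of_nonneg_left ?_ zero_le_one
    refine (abs_abs_sub_abs_le _ _).trans (le_of_eq ?_)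
    rw [Real.norm_eq_abs, sub_apply]; congr 1
    have : v x = u x := he.symm
    rw [this]; ring
  rw [hD]


variable {n : ℕ} {W W1 W2 : ℝ → ℝ} {u v : En n → ℝ}

def RadAnt (n : ℕ) (u : En n → ℝ) : Prop :=
  ∃ z : En n, ∃ ζ : ℝ → ℝ, AntitoneOn ζ (Ici 0) ∧ ∀ x, u x = ζ ‖x - z‖

lemma vol_univ (hn : 2 ≤ n) : volume (univ : Set (En n)) = ⊤ := by
  have : Nonempty (Fin n) := ⟨⟨0, by omega⟩⟩
  have : Nontrivial (En n) := inferInstance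
  have : NoncompactSpace (En n) := NormedSpace.noncompactSpace ℝ (En n)
  exact measure_univ_of_isAddLeftInvariant _

lemma exists_small (hn : 2 ≤ n) (hu : H1Box n u) (z : En n) (b : ℝ) {η : ℝ} (hη : 0 < η) :
    ∃ x, b < ‖x - z‖ ∧ u x < η := by
  by_contra hc
  push Not at hc
  have h1 := hu.intSq.measure_ge_lt_top (ε := η ^ 2) (by positivity)
  have h2 : (univ : Set (En n)) ⊆ {x | η ^ 2 ≤ u x ^ 2} ∪ Metric.closedBall z b := by
    intro x _
    by_cases h : b < ‖x - z‖
    · left; exact pow_le_pow_left₀ hη.le (hc x h) 2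
    · right; rw [mem_closedBall_iff_norm]; linarith
  have h3 := (measure_mono (μ := volume) h2).trans (measure_union_le _ _)
  rw [vol_univ hn] at h3
  exact absurd h3 (not_le.2 (ENNReal.add_lt_top.2 ⟨h1, (isCompact_closedBall z b).measure_lt_top⟩))

lemma even_deriv {φ : ℝ → ℝ} {d : ℝ} (h : HasDerivAt φ d 0) (he : ∀ t, φ (-t) = φ t) : d = 0 := by
  have h1 : HasDerivAt (fun t => φ (-t)) (-d) 0 := by
    have := HasDerivAt.comp (x := (0:ℝ)) (h₂ := φ) (h := fun t => -t) (h₂' := d) (h' := -1) (by simpa using h) (hasDerivAt_neg 0)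
    simpa [Function.comp_def] using this
  have h2 : HasDerivAt φ (-d) 0 := h1.congr_of_eventuallyEq (Eventually.of_forall fun t => (he t).symm)
  linarith [h.unique h2]

lemma line_deriv (hu : Differentiable ℝ u) (p h : En n) (t : ℝ) :
    HasDerivAt (fun t : ℝ => u (p + t • h)) (fderiv ℝ u (p + t • h) h) t := by
  have h1 : HasDerivAt (fun t : ℝ => p + t • h) h t := by
    simpa using ((hasDerivAt_id t).smul_const h).const_add p
  exact (hu _).hasFDerivAt.comp_hasDerivAt t h1

lemma rad_tan {ζ : ℝ → ℝ} {z : En n} (hu : Differentiable ℝ u) (hz : ∀ x, u x = ζ ‖x - z‖) {p h : En n}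
    (hp : inner ℝ p h = 0) : fderiv ℝ u (z + p) h = 0 := by
  have h1 := line_deriv hu (z + p) h 0
  simp only [zero_smul, add_zero] at h1
  refine even_deriv h1 fun t => ?_
  rw [hz, hz]
  congr 1
  have a1 : z + p + (-t) • h - z = p - t • h := by rw [neg_smul]; abel
  have a2 : z + p + t • h - z = p + t • h := by abel
  rw [a1, a2]
  have b1 := norm_sub_sq_real p (t • h)
  have b2 := norm_add_sq_real p (t • h)
  rw [inner_smul_right, hp] at b1 b2
  rw [← sq_eq_sq₀ (norm_nonneg _) (norm_nonneg _)]; linarith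

lemma rad_crease (hn : 2 ≤ n) (g : GW W W1 W2) (h0 : W1 0 = 0) {ε : ℝ} (hε : 0 < ε)
    (mu : Minimizes n W ε u) {ζ : ℝ → ℝ} {z : En n} (hz : ∀ x, u x = ζ ‖x - z‖) {e1 e2 : En n}
    (h1 : ‖e1‖ = 1) (h2 : ‖e2‖ = 1) (h12 : inner ℝ e1 e2 = 0) {r s : ℝ} (hr : 0 < r) (hs : 0 < s)
    (hrs : r ≠ s) (he : ζ r = ζ s) : fderiv ℝ u (z + s • e2) e2 = 0 := by
  set l := √(r ^ 2 + s ^ 2) with hl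
  have hl2 : l ^ 2 = r ^ 2 + s ^ 2 := Real.sq_sqrt (by positivity)
  have hl0 : 0 < l := Real.sqrt_pos.2 (by positivity)
  have i11 : inner ℝ e1 e1 = (1:ℝ) := by rw [real_inner_self_eq_norm_sq, h1]; norm_num
  have i22 : inner ℝ e2 e2 = (1:ℝ) := by rw [real_inner_self_eq_norm_sq, h2]; norm_num
  have i21 : inner ℝ e2 e1 = (0:ℝ) := by rw [real_inner_comm, h12]
  set ν : En n := (1 / l) • (r • e1 - s • e2) with hνd
  have hν : ‖ν‖ = 1 := by
    have : ‖ν‖ ^ 2 = 1 := by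
      rw [← real_inner_self_eq_norm_sq, hνd]
      simp only [inner_smul_left, inner_smul_right, inner_sub_left, inner_sub_right, i11, i22, i21, h12]
      simp
      field_simp
      linarith
    nlinarith [norm_nonneg ν]
  set c := inner ℝ ν z + (r ^ 2 - s ^ 2) / (2 * l) with hc
  have hx : inner ℝ ν (z + r • e1) - c = l / 2 := by
    have : inner ℝ ν (r • e1) = r ^ 2 / l := by
      rw [hνd]
      simp only [inner_smul_left, inner_smul_right, inner_sub_left, i11, i21]
      simp
      field_simp
    rw [inner_add_right, this, hc]
    field_simp
    linarith
  have hy : hrefl ν c (z + r • e1) = z + s • e2 := by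
    unfold hrefl
    rw [hx, hνd, smul_smul]
    have : 2 * (l / 2) * (1 / l) = 1 := by field_simp
    rw [this, one_smul]; abel
  have hp := polar hn g h0 hε mu hν (x := z + r • e1) (c := c) (by intro h; rw [h] at hx; linarith)
    (by rw [hy, hz, hz]; simp [norm_smul, h1, h2, abs_of_pos hr, abs_of_pos hs, he]) e2
  rw [hy, rad_tan mu.1.diff hz (by rw [inner_smul_left, h12]; simp), reflL_apply hν] at hp
  have hr : fderiv ℝ u (z + s • e2) e1 = 0 := rad_tan mu.1.diff hz (by rw [inner_smul_left, i21]; simp)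
  have hν2 : inner ℝ ν e2 = - s / l := by
    rw [hνd]
    simp only [inner_smul_left, inner_sub_left, i22, h12]
    simp
    field_simp
  rw [hν2, hνd] at hp
  simp only [map_sub, map_smul, hr, smul_eq_mul] at hp
  have : ((r ^ 2 - s ^ 2) / l ^ 2) * fderiv ℝ u (z + s • e2) e2 = 0 := by
    rw [hp]
    field_simp
    rw [hl2]; ring
  rcases mul_eq_zero.1 this with h | h
  · exfalso
    rw [div_eq_zero_iff] at h
    rcases h with h | h
    · apply hrs
      have : (r - s) * (r + s) = 0 := by linarith
      rcases mul_eq_zero.1 this with h | h <;> linarith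
    · nlinarith
  · exact h

lemma orth_pair (hn : 2 ≤ n) : ∃ e1 e2 : En n, ‖e1‖ = 1 ∧ ‖e2‖ = 1 ∧ inner ℝ e1 e2 = (0:ℝ) := by
  refine ⟨EuclideanSpace.single ⟨0, by omega⟩ 1, EuclideanSpace.single ⟨1, by omega⟩ 1, by simp, by simp, ?_⟩
  rw [EuclideanSpace.inner_single_left]; simp

lemma rad_anti (hn : 2 ≤ n) (g : GW W W1 W2) (h0 : W1 0 = 0) {ε : ℝ} (hε : 0 < ε)
    (mu : Minimizes n W ε u) {ζ : ℝ → ℝ} {z : En n} (hz : ∀ x, u x = ζ ‖x - z‖) : AntitoneOn ζ (Ici 0) := by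
  obtain ⟨e1, e2, h1, h2, h12⟩ := orth_pair hn
  set f : ℝ → ℝ := fun t => u (z + t • e2) with hf
  have hfz : ∀ t, 0 ≤ t → f t = ζ t := by
    intro t ht; simp only [hf]; rw [hz]; simp [norm_smul, h2, abs_of_nonneg ht]
  have hd : ∀ t, HasDerivAt f (fderiv ℝ u (z + t • e2) e2) t := fun t => line_deriv mu.1.diff z e2 t
  have hfc : Continuous f := continuous_iff_continuousAt.2 fun t => (hd t).continuousAt
  have hcr : ∀ r s, 0 < r → 0 < s → r ≠ s → f r = f s → HasDerivAt f 0 s := by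
    intro r s hr hs hrs he
    rw [hfz r hr.le, hfz s hs.le] at he
    have := hd s
    rwa [rad_crease hn g h0 hε mu hz h1 h2 h12 hr hs hrs he] at this
  intro a ha b0 hb0 hab0
  rw [mem_Ici] at ha hb0
  by_contra hlt
  push Not at hlt
  rw [← hfz a ha, ← hfz b0 hb0] at hlt
  have hf0 : ∀ t, 0 ≤ f t := fun t => (mu.1.mem_Icc _).1
  obtain ⟨x, hx1, hx2⟩ := exists_small hn mu.1 z b0 (lt_of_le_of_lt (hf0 a) hlt)
  set c := ‖x - z‖
  have hfcc : f c = u x := by rw [hfz c (norm_nonneg _), hz]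
  rw [← hfcc] at hx2
  obtain ⟨b, hb, hbm⟩ := isCompact_Icc.exists_isMaxOn (nonempty_Icc.2 (hab0.trans hx1.le)) hfc.continuousOn
  have hbb : f b0 ≤ f b := hbm ⟨hab0, hx1.le⟩
  have hab : a < b := lt_of_le_of_ne hb.1 (by rintro rfl; linarith)
  have hbc : b < c := lt_of_le_of_ne hb.2 (by rintro h; rw [h] at hbb; linarith)
  set lo := max (f a) (f c) with hlo
  have hlob : lo < f b := max_lt (by linarith) (by linarith)
  set θ : ℝ → ℝ := fun t => max (f t - lo) 0 ^ (0 + 2) with hθ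
  have hθd : ∀ t ∈ Ioo a b, HasDerivAt θ 0 t := by
    intro t ht
    have k1 := hasDerivAt_max_pow 0 (f t - lo)
    have k2 := HasDerivAt.comp t k1 ((hd t).sub_const lo)
    have : HasDerivAt θ _ t := k2
    convert this using 1
    symm
    by_cases hle : f t ≤ lo
    · rw [max_eq_right (by linarith)]; simp
    push Not at hle
    have : fderiv ℝ u (z + t • e2) e2 = 0 := by
      have hft : f t ≤ f b := hbm ⟨ht.1.le, by linarith [ht.2]⟩
      rcases eq_or_lt_of_le hft with h | h
      · have hm : IsLocalMax f t := by
          filter_upwards [Ioo_mem_nhds ht.1 ht.2] with y hy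
          rw [h]; exact hbm ⟨hy.1.le, by linarith [hy.2]⟩
        exact hm.hasDerivAt_eq_zero (hd t)
      · obtain ⟨s, hs, hs2⟩ := intermediate_value_Icc' hbc.le hfc.continuousOn ⟨(le_max_right _ _).trans hle.le, hft⟩
        exact (hd t).unique (hcr s t (by linarith [hs.1]) (by linarith [ht.1]) (by linarith [ht.2, hs.1] |> fun h : t < s => h.ne') hs2)
    rw [this]; simp
  have hθc : ContinuousOn θ (Icc a b) := by simp only [hθ]; fun_prop
  obtain ⟨t, ht, htt⟩ := exists_hasDerivAt_eq_slope θ (fun _ => 0) hab hθc hθd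
  have : θ b = θ a := by
    have hba : b - a ≠ 0 := by linarith
    field_simp at htt
    linarith
  have e1 : θ a = 0 := by simp only [hθ]; rw [max_eq_right (by linarith [le_max_left (f a) (f c)])]; simp
  have e2 : 0 < θ b := by simp only [hθ]; rw [max_eq_left (by linarith)]; exact pow_pos (by linarith) _
  linarith


variable {n : ℕ} {W W1 W2 : ℝ → ℝ} {u v : En n → ℝ}

lemma half_of_sym {f : En n → ℝ} (hf : Integrable f) (h1 : ∫ x, f x = 1) {z : En n}
    (hs : ∀ x, f (-x + (2:ℝ) • z) = f x) {ν : En n} (hν : ‖ν‖ = 1) :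
    ∫ x in {x : En n | inner ℝ ν z < inner ℝ ν x}, f x = 1/2 := by
  set S := {x : En n | inner ℝ ν z < inner ℝ ν x} with hS
  have hSm : MeasurableSet S := half_meas ν _
  set F := S.indicator f with hF
  have e1 := integral_isom F (LinearIsometryEquiv.neg ℝ) ((2:ℝ) • z)
  simp only [LinearIsometryEquiv.coe_neg] at e1
  have iF : Integrable F := hf.indicator hSm
  have hae : ∀ᵐ x : En n, F (-x + (2:ℝ) • z) + F x = f x := by
    have : {x : En n | inner ℝ ν x = inner ℝ ν z}ᶜ ∈ ae volume := by
      rw [mem_ae_iff, compl_compl]; exact hyper_null hν _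
    filter_upwards [this] with x hx
    have hx' : inner ℝ ν x ≠ inner ℝ ν z := hx
    have hi : inner ℝ ν (-x + (2:ℝ) • z) = - inner ℝ ν x + 2 * inner ℝ ν z := by
      rw [inner_add_right, inner_neg_right, inner_smul_right]
    simp only [hF, indicator_apply, hS, mem_ofPred_eq, hi, hs]
    rcases lt_or_gt_of_ne hx' with h | h
    · rw [if_pos (by linarith), if_neg (by linarith)]; ring
    · rw [if_neg (by linarith), if_pos (by linarith)]; ring
  have iF2 : Integrable (fun x => F (-x + (2:ℝ) • z)) := by
    have := integrable_isom iF (LinearIsometryEquiv.neg ℝ) ((2:ℝ) • z)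
    simpa only [LinearIsometryEquiv.coe_neg] using this
  have e2 := integral_congr_ae hae
  rw [integral_add iF2 iF, h1, e1] at e2
  rw [← integral_indicator hSm]
  linarith

lemma base_rad (hn : 2 ≤ n) (g : GW W W1 W2) (h0 : W1 0 = 0) {ε : ℝ} (hε : 0 < ε)
    (mu : Minimizes n W ε u) {z : En n} (hs : ∀ x, u (-x + (2:ℝ) • z) = u x) : RadAnt n u := by
  have ht : ∀ p h : En n, inner ℝ h p = 0 → fderiv ℝ u (z + p) h = 0 := by
    intro p h hph
    by_cases hh : h = 0
    · rw [hh]; simp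
    have hn0 : ‖h‖ ≠ 0 := norm_ne_zero_iff.2 hh
    set ν := (‖h‖)⁻¹ • h with hν
    have hν1 : ‖ν‖ = 1 := by rw [hν, norm_smul]; simp [hn0]
    have := (reflect hn g h0 hε mu hν1 (half_of_sym (mu.1.iV hn g h0) mu.2.1 (z := z) (fun x => by rw [hs]) hν1)).1 (z + p)
      (by rw [inner_add_right, hν, inner_smul_left, inner_smul_left, hph]; simp)
    rw [hν, map_smul, smul_eq_mul] at this
    rcases mul_eq_zero.1 this with h | h
    · exact absurd (inv_eq_zero.1 h) hn0
    · exact h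
  have hc : ∀ p q : En n, ‖p‖ = ‖q‖ → u (z + p) = u (z + q) := by
    intro p q hpq
    by_cases hq : q = -p
    · rw [hq, ← hs]; congr 1; module
    set m : ℝ → En n := fun t => p + t • (q - p) with hm
    have hm0 : ∀ t, m t ≠ 0 := by
      intro t h
      apply hq
      have e1 : (1 - t) • p = (-t) • q := by
        have : m t = (1 - t) • p - (-t) • q := by simp only [hm]; module
        rw [this] at h; exact sub_eq_zero.1 h
      have e2 : ‖(1 - t) • p‖ = ‖(-t) • q‖ := by rw [e1]
      rw [norm_smul, norm_smul, hpq, norm_neg] at e2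
      by_cases hq0 : ‖q‖ = 0
      · have a1 : q = 0 := norm_eq_zero.1 hq0
        have a2 : p = 0 := norm_eq_zero.1 (hpq.trans hq0)
        rw [a1, a2]; simp
      have e3 : ‖1 - t‖ = ‖t‖ := mul_right_cancel₀ hq0 e2
      have e4 : t = 1/2 := by
        rw [Real.norm_eq_abs, Real.norm_eq_abs, abs_eq_abs] at e3
        rcases e3 with h | h <;> linarith
      rw [e4] at e1
      have := congrArg (fun x : En n => (-2 : ℝ) • x) e1
      simp only [smul_smul] at this
      norm_num at this
      rw [← this]
    have hmd : Differentiable ℝ m := by simp only [hm]; fun_prop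
    set γ : ℝ → En n := fun t => (‖p‖ * ‖m t‖⁻¹) • m t with hγ
    have hγd : Differentiable ℝ γ := by
      intro t
      have h1 : DifferentiableAt ℝ (fun t => ‖m t‖) t := (hmd t).norm ℝ (hm0 t)
      have h2 : DifferentiableAt ℝ (fun t => ‖m t‖⁻¹) t := h1.fun_inv (norm_ne_zero_iff.2 (hm0 t))
      exact (h2.const_mul _).smul (hmd t)
    have hγn : ∀ t, ‖γ t‖ = ‖p‖ := by
      intro t
      have := norm_ne_zero_iff.2 (hm0 t)
      simp only [hγ, norm_smul, norm_mul, norm_inv, norm_norm]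
      field_simp
    have hort : ∀ t, inner ℝ (deriv γ t) (γ t) = 0 := by
      intro t
      have h1 := (hγd t).hasDerivAt.inner ℝ (hγd t).hasDerivAt
      have h2 : (fun t => inner ℝ (γ t) (γ t)) = fun _ => ‖p‖ ^ 2 := by
        funext t; rw [real_inner_self_eq_norm_sq, hγn]
      rw [h2] at h1
      have h3 := h1.unique (hasDerivAt_const t _)
      rw [real_inner_comm] at h3
      linarith
    have hd : ∀ t, HasDerivAt (fun t => u (z + γ t)) 0 t := by
      intro t
      have h1 := (mu.1.diff (z + γ t)).hasFDerivAt.comp_hasDerivAt t ((hγd t).hasDerivAt.const_add z)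
      rw [ht _ _ (hort t)] at h1
      exact h1
    have := is_const_of_deriv_eq_zero (fun t => (hd t).differentiableAt) (fun t => (hd t).deriv) 0 1
    by_cases hp0 : ‖p‖ = 0
    · rw [norm_eq_zero.1 hp0, norm_eq_zero.1 (hpq.symm.trans hp0)]
    have g0 : γ 0 = p := by simp [hγ, hm, hp0]
    have g1 : γ 1 = q := by simp only [hγ, hm, one_smul]; rw [add_sub_cancel, hpq, mul_inv_cancel₀ (hpq ▸ hp0), one_smul]
    simpa only [g0, g1] using this
  obtain ⟨e1, e2, h1, h2, h12⟩ := orth_pair hn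
  have hz : ∀ x, u x = (fun r : ℝ => u (z + r • e1)) ‖x - z‖ := by
    intro x
    have := hc (x - z) (‖x - z‖ • e1) (by rw [norm_smul, h1]; simp)
    simpa using this
  exact ⟨z, fun r : ℝ => u (z + r • e1), rad_anti hn g h0 hε mu hz, hz⟩

lemma not_const (hn : 2 ≤ n) (g : GW W W1 W2) {ε : ℝ} (mu : Minimizes n W ε u) {C : ℝ} (hC : ∀ x, u x = C) : False := by
  have h0 : C = 0 := by
    by_contra h
    have : 0 ≤ C := by rw [← hC 0]; exact (mu.1.mem_Icc 0).1
    obtain ⟨x, _, hx⟩ := exists_small hn mu.1 0 0 (lt_of_le_of_ne this (Ne.symm h))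
    rw [hC] at hx; exact lt_irrefl _ hx
  have := mu.2.1
  simp only [hC, h0, GW.V_zero hn] at this
  simp at this

lemma two_centers (hn : 2 ≤ n) (g : GW W W1 W2) {ε : ℝ} (mu : Minimizes n W ε u) {ζ1 ζ2 : ℝ → ℝ}
    {z1 z2 : En n} (ha : AntitoneOn ζ1 (Ici 0)) (hz : ∀ x, u x = ζ1 ‖x - z1‖)
    (hl : ∀ t : ℝ, u (z1 + t • (z2 - z1)) = ζ2 ‖z1 + t • (z2 - z1) - z2‖) : z1 = z2 := by
  by_contra hne
  set L := ‖z2 - z1‖ with hL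
  have hL0 : 0 < L := norm_pos_iff.2 (sub_ne_zero.2 (Ne.symm hne))
  have h1 : ∀ t : ℝ, ζ1 (|t| * L) = ζ2 (|t - 1| * L) := by
    intro t
    have := hl t
    rw [hz] at this
    have e1 : z1 + t • (z2 - z1) - z1 = t • (z2 - z1) := by abel
    have e2 : z1 + t • (z2 - z1) - z2 = (t - 1) • (z2 - z1) := by module
    rwa [e1, e2, norm_smul, norm_smul, Real.norm_eq_abs, Real.norm_eq_abs] at this
  have h2 : ∀ s : ℝ, 0 ≤ s → ζ1 ((s + 2) * L) = ζ1 (s * L) := by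
    intro s hs
    have a1 := h1 (-s)
    have a2 := h1 (s + 2)
    rw [abs_neg, abs_of_nonneg hs, show -s - 1 = -(s + 1) by ring, abs_neg] at a1
    rw [abs_of_nonneg (by linarith), show s + 2 - 1 = s + 1 by ring] at a2
    rw [a1, a2]
  have h3 : ∀ k : ℕ, ζ1 ((2 * k : ℝ) * L) = ζ1 0 := by
    intro k
    induction k with
    | zero => simp
    | succ k ih => rw [← ih, ← h2 (2 * k) (by positivity)]; push_cast; ring_nf
  refine not_const hn g mu (C := ζ1 0) fun x => ?_
  rw [hz]
  obtain ⟨k, hk⟩ := exists_nat_gt (‖x - z1‖ / L)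
  have hk' : ‖x - z1‖ ≤ (2 * k : ℝ) * L := by
    rw [div_lt_iff₀ hL0] at hk
    have : (0:ℝ) ≤ k * L := by positivity
    linarith
  apply le_antisymm
  · exact ha (mem_Ici.2 le_rfl) (mem_Ici.2 (norm_nonneg _)) (norm_nonneg _)
  · rw [← h3 k]; exact ha (mem_Ici.2 (norm_nonneg _)) (mem_Ici.2 (by positivity)) hk'

lemma norm_hrefl {ν : En n} (hν : ‖ν‖ = 1) (c : ℝ) (x y : En n) : ‖hrefl ν c x - y‖ = ‖x - hrefl ν c y‖ := by
  conv_lhs => rw [← hrefl_hrefl hν c y]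
  rw [hrefl_eq hν, hrefl_eq hν c (hrefl ν c y), add_sub_add_right_eq_sub, ← map_sub, LinearIsometryEquiv.norm_map]

lemma gz_plus (ν : En n) (c : ℝ) (x : En n) : gz u (fun x => u (hrefl ν c x)) (sH ν c) 1 x =
    if c < inner ℝ ν x then u x else u (hrefl ν c x) := by
  unfold gz sH; split_ifs <;> ring

lemma gz_minus (ν : En n) (c : ℝ) (x : En n) : gz u (fun x => u (hrefl ν c x)) (sH ν c) (-1) x =
    if c < inner ℝ ν x then u (hrefl ν c x) else u x := by
  unfold gz sH; split_ifs <;> ring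

lemma gz_sym {ν : En n} (hν : ‖ν‖ = 1) (c σ : ℝ) (hσ : σ = 1 ∨ σ = -1) (x : En n) :
    gz u (fun x => u (hrefl ν c x)) (sH ν c) σ (hrefl ν c x) = gz u (fun x => u (hrefl ν c x)) (sH ν c) σ x := by
  have hi := inner_hrefl hν c x
  rcases eq_or_ne (inner ℝ ν x) c with h | h
  · rw [hrefl_fix h]
  · rcases hσ with rfl | rfl
    · rw [gz_plus, gz_plus, hrefl_hrefl hν]
      rcases lt_or_gt_of_ne h with h | h
      · rw [if_pos (by linarith), if_neg (by linarith)]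
      · rw [if_neg (by linarith), if_pos (by linarith)]
    · rw [gz_minus, gz_minus, hrefl_hrefl hν]
      rcases lt_or_gt_of_ne h with h | h
      · rw [if_pos (by linarith), if_neg (by linarith)]
      · rw [if_neg (by linarith), if_pos (by linarith)]

lemma rad_center (hn : 2 ≤ n) (g : GW W W1 W2) {ε : ℝ} (mu : Minimizes n W ε u) {ζ : ℝ → ℝ}
    {z : En n} (ha : AntitoneOn ζ (Ici 0)) (hz : ∀ x, u x = ζ ‖x - z‖) {ν : En n} (hν : ‖ν‖ = 1) {c : ℝ}
    (hs : ∀ x, u (hrefl ν c x) = u x) : inner ℝ ν z = c := by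
  have h := two_centers hn g mu (z2 := hrefl ν c z) (ζ2 := ζ) ha hz (fun t => by
    rw [← hs, hz, norm_hrefl hν])
  have := inner_hrefl hν c z
  rw [← h] at this
  linarith

def flipk (k : ℕ) (z x : En n) : En n := WithLp.toLp 2 fun i => if k ≤ (i : ℕ) then 2 * z i - x i else x i

lemma rad_step (hn : 2 ≤ n) (g : GW W W1 W2) (h0 : W1 0 = 0) {ε : ℝ} (hε : 0 < ε) (k : ℕ) (hk : k ≤ n) :
    ∀ (u : En n → ℝ), Minimizes n W ε u → (∃ z, ∀ x, u (flipk k z x) = u x) → RadAnt n u := by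
  induction k with
  | zero =>
    rintro u mu ⟨z, hz⟩
    refine base_rad hn g h0 hε mu (z := z) fun x => ?_
    rw [← hz x]; congr 1; ext i; simp [flipk]; ring
  | succ k ih =>
    rintro u mu ⟨z, hz⟩
    set i : Fin n := ⟨k, by omega⟩ with hi
    set ν : En n := EuclideanSpace.single i 1 with hνd
    have hν : ‖ν‖ = 1 := by simp [hνd]
    have hin : ∀ x : En n, inner ℝ ν x = x i := fun x => by rw [hνd, EuclideanSpace.inner_single_left]; simp
    obtain ⟨c, hc⟩ := exists_half (mu.1.iV hn g h0) mu.2.1 hν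
    obtain ⟨-, mp, mm⟩ := reflect hn g h0 hε mu hν hc
    set z' : En n := WithLp.toLp 2 (Function.update z i c) with hz'
    have hrc : ∀ x j, hrefl ν c x j = if j = i then 2 * c - x i else x j := by
      intro x j
      unfold hrefl
      rw [hin, hνd]
      simp only [PiLp.sub_apply, PiLp.smul_apply, PiLp.single_apply, smul_eq_mul]
      split_ifs with h
      · rw [h]; ring
      · ring
    have hf1 : ∀ x, flipk k z' x = hrefl ν c (flipk (k+1) z x) := by
      intro x; ext j
      rw [hrc]
      simp only [flipk, hz', Function.update_apply]
      by_cases hj : j = i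
      · rw [if_pos hj, hj]; simp [hi]
      · have : (j : ℕ) ≠ k := fun h => hj (Fin.ext h)
        by_cases h2 : k ≤ (j : ℕ)
        · have h3 : k + 1 ≤ (j : ℕ) := by omega
          simp only [hj, h2, h3, if_true, if_false]
        · have h3 : ¬ (k + 1 ≤ (j : ℕ)) := by omega
          simp only [hj, h2, h3, if_false]
    have hf2 : ∀ x, flipk (k+1) z (hrefl ν c x) = hrefl ν c (flipk (k+1) z x) := by
      intro x; ext j
      rw [hrc]
      simp only [flipk, hrc]
      by_cases hj : j = i
      · rw [if_pos hj, hj]; simp [hi]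
      · rw [if_neg hj, if_neg hj]
    have hf3 : ∀ x, inner ℝ ν (flipk (k+1) z x) = inner ℝ ν x := by
      intro x; rw [hin, hin]; simp [flipk, hi]
    have hu2 : ∀ x, u (hrefl ν c (flipk (k+1) z x)) = u (hrefl ν c x) := fun x => by rw [← hf2, hz]
    obtain ⟨zp, ζp, hap, hzp⟩ := ih (by omega) _ mp ⟨z', fun x => by
      rw [hf1, gz_sym hν c 1 (Or.inl rfl), gz_plus, gz_plus, hf3, hz, hu2]⟩
    obtain ⟨zm, ζm, ham, hzm⟩ := ih (by omega) _ mm ⟨z', fun x => by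
      rw [hf1, gz_sym hν c (-1) (Or.inr rfl), gz_minus, gz_minus, hf3, hz, hu2]⟩
    have hcp := rad_center hn g mp hap hzp hν (gz_sym hν c 1 (Or.inl rfl))
    have hcm := rad_center hn g mm ham hzm hν (gz_sym hν c (-1) (Or.inr rfl))
    have hH : ∀ x, inner ℝ ν x = c → ζp ‖x - zp‖ = ζm ‖x - zm‖ := by
      intro x hx
      rw [← hzp, ← hzm, gz_plus, gz_minus, hrefl_fix hx]
    have hzz : zp = zm := two_centers hn g mp (ζ2 := ζm) hap hzp fun t => by
      rw [hzp]; apply hH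
      rw [inner_add_right, inner_smul_right, inner_sub_right, hcp, hcm]; ring
    obtain ⟨j, hj⟩ : ∃ j : Fin n, j ≠ i := by
      have : Nontrivial (Fin n) := Fin.nontrivial_iff_two_le.2 hn
      exact exists_ne i
    have hζ : ∀ r, 0 ≤ r → ζp r = ζm r := by
      intro r hr
      have := hH (zp + r • EuclideanSpace.single j 1) (by
        rw [inner_add_right, hcp, hin]; simp [PiLp.single_apply, hj.symm])
      rw [← hzz] at this
      simpa [norm_smul, abs_of_nonneg hr] using this
    refine ⟨zp, ζp, hap, fun x => ?_⟩
    by_cases hx : c < inner ℝ ν x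
    · rw [← hzp, gz_plus, if_pos hx]
    · rw [hζ _ (norm_nonneg _), hzz, ← hzm, gz_minus, if_neg hx]

/-- every minimizer is radially decreasing about some point -/
lemma minimizer_rad (hn : 2 ≤ n) (g : GW W W1 W2) (h0 : W1 0 = 0) {ε : ℝ} (hε : 0 < ε)
    (mu : Minimizes n W ε u) : RadAnt n u := by
  refine rad_step hn g h0 hε n le_rfl u mu ⟨0, fun x => ?_⟩
  congr 1; ext i; simp [flipk]


variable {n : ℕ} {W W1 W2 : ℝ → ℝ} {u v : En n → ℝ}

lemma const_of_ae (hn : 2 ≤ n) (hu : Differentiable ℝ u) (h : ∀ᵐ x : En n, fderiv ℝ u x = 0) : ∀ x, u x = u 0 := by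
  have key : ∀ e : En n, ∀ x, u (x + e) = u x := by
    intro e
    have h1 : ∀ᵐ t : ℝ, ∀ᵐ x : En n, fderiv ℝ u (x + t • e) e = 0 := by
      refine Eventually.of_forall fun t => ?_
      have := (measurePreserving_add_right (volume : Measure (En n)) (t • e)).quasiMeasurePreserving.ae h
      filter_upwards [this] with x hx
      rw [hx]; simp
    have hm : MeasurableSet {p : ℝ × En n | fderiv ℝ u (p.2 + p.1 • e) e = 0} := by
      have : Measurable fun p : ℝ × En n => fderiv ℝ u (p.2 + p.1 • e) e :=
        (measurable_fderiv_apply_const ℝ u e).comp (by fun_prop : Continuous fun p : ℝ × En n => p.2 + p.1 • e).measurable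
      exact measurableSet_eq_fun this measurable_const
    have h2 := (Measure.ae_ae_comm (μ := (volume : Measure ℝ)) (ν := (volume : Measure (En n)))
      (p := fun t x => fderiv ℝ u (x + t • e) e = 0) hm).1 h1
    have h3 : ∀ᵐ x : En n, u (x + e) = u x := by
      filter_upwards [h2] with x hx
      have hd : ∀ t : ℝ, HasDerivAt (fun t : ℝ => u (x + t • e)) (fderiv ℝ u (x + t • e) e) t := fun t => line_deriv hu x e t
      have hi : IntervalIntegrable (fun t : ℝ => fderiv ℝ u (x + t • e) e) volume 0 1 := by
        apply Integrable.intervalIntegrable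
        exact (integrable_zero ℝ ℝ volume).congr (by filter_upwards [hx] with t ht; rw [ht]; rfl)
      have := intervalIntegral.integral_eq_sub_of_hasDerivAt (fun t _ => hd t) hi
      rw [intervalIntegral.integral_congr_ae (g := fun _ => (0:ℝ)) (by filter_upwards [hx] with t ht _; exact ht)] at this
      simp at this
      linarith
    have h4 := Continuous.ae_eq_iff_eq (volume : Measure (En n)) (f := fun x => u (x + e)) (g := u) (by have := hu.continuous; fun_prop) hu.continuous
    exact fun x => congrFun (h4.1 h3) x
  intro x
  have := key x 0
  rwa [zero_add] at this

def jw (x : En n) : ℝ := (1 + ‖x‖ ^ 2) ^ (-(n:ℝ) / 2)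

lemma jw_pos (x : En n) : 0 < jw x := Real.rpow_pos_of_pos (by positivity) _

lemma jw_le (x : En n) : jw x ≤ 1 := by
  apply Real.rpow_le_one_of_one_le_of_nonpos
  · nlinarith [norm_nonneg x]
  · have : (0:ℝ) ≤ n := by positivity
    linarith

lemma jw_rpow (x : En n) (p : ℝ) : jw x ^ p = (1 + ‖x‖ ^ 2) ^ (-(n * p) / 2) := by
  unfold jw
  rw [← Real.rpow_mul (by positivity)]; congr 1; ring

lemma jw_int (hn : 2 ≤ n) {p : ℝ} (hp : 1 < p) : Integrable (fun x : En n => jw x ^ p) := by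
  simp_rw [jw_rpow]
  apply integrable_rpow_neg_one_add_norm_sq
  have : (2:ℝ) ≤ n := by exact_mod_cast hn
  simp
  nlinarith

lemma jw_deriv (x : En n) : ∃ L : En n →L[ℝ] ℝ, HasFDerivAt (jw (n := n)) L x ∧ ‖L‖ ≤ n * jw x := by
  have h1 : HasFDerivAt (fun x : En n => 1 + ‖x‖ ^ 2) (2 • innerSL ℝ x) x := by
    simpa using (hasStrictFDerivAt_norm_sq x).hasFDerivAt.const_add 1
  have h2 := h1.rpow_const (p := -(n:ℝ)/2) (Or.inl (by positivity))
  refine ⟨_, h2, ?_⟩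
  rw [norm_smul]
  have h3 : ‖(2 • innerSL ℝ x : En n →L[ℝ] ℝ)‖ ≤ 2 * ‖x‖ := by
    rw [← Nat.cast_smul_eq_nsmul ℝ, norm_smul, innerSL_apply_norm]; simp
  have hp : (0:ℝ) < 1 + ‖x‖ ^ 2 := by positivity
  have h4 : (1 + ‖x‖ ^ 2) ^ (-(n:ℝ)/2 - 1) = jw x / (1 + ‖x‖ ^ 2) := by
    rw [Real.rpow_sub hp, Real.rpow_one]; rfl
  rw [h4, norm_mul, Real.norm_eq_abs, Real.norm_eq_abs, abs_of_pos (div_pos (jw_pos x) hp),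
    show -(n:ℝ)/2 = -((n:ℝ)/2) by ring, abs_neg, abs_of_nonneg (by positivity)]
  calc _ ≤ (n:ℝ)/2 * (jw x / (1 + ‖x‖^2)) * (2 * ‖x‖) := by
        apply mul_le_mul_of_nonneg_left h3
        have := jw_pos x
        positivity
    _ = n * jw x * (‖x‖ / (1 + ‖x‖^2)) := by ring
    _ ≤ n * jw x * 1 := by
        apply mul_le_mul_of_nonneg_left
        · rw [div_le_one hp]; nlinarith [norm_nonneg x, sq_nonneg (‖x‖ - 1)]
        · have := jw_pos x
          positivity
    _ = _ := by ring

lemma jw_not_int (hn : 2 ≤ n) : ¬ Integrable (fun x : En n => jw x) := by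
  intro h
  have hne : Nonempty (Fin n) := ⟨⟨0, by omega⟩⟩
  have : Nontrivial (En n) := inferInstance
  have h1 := (integrable_fun_norm_addHaar (volume : Measure (En n)) (f := fun r : ℝ => (1 + r ^ 2) ^ (-(n:ℝ)/2))).1 h
  simp only [finrank_euclideanSpace, Fintype.card_fin, smul_eq_mul] at h1
  have h2 : IntegrableOn (fun r : ℝ => (2:ℝ) ^ ((n:ℝ)/2) * (r ^ (n-1) * (1 + r ^ 2) ^ (-(n:ℝ)/2))) (Ioi 1) :=
    (h1.mono_set (Ioi_subset_Ioi zero_le_one)).const_mul _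
  apply not_integrableOn_Ioi_inv (a := 1)
  refine Integrable.mono' h2 (measurable_inv.aestronglyMeasurable) ?_
  refine (ae_restrict_iff' measurableSet_Ioi).2 (Eventually.of_forall fun r hr => ?_)
  have hr : 1 < r := hr
  have hr0 : 0 < r := by linarith
  rw [norm_inv, Real.norm_eq_abs, abs_of_pos hr0]
  have e1 : (2 * r ^ 2) ^ (-(n:ℝ)/2) ≤ (1 + r ^ 2) ^ (-(n:ℝ)/2) := by
    apply Real.rpow_le_rpow_of_nonpos (by positivity) (by nlinarith)
    have : (0:ℝ) ≤ n := by positivity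
    linarith
  have e2 : (2 * r ^ 2) ^ (-(n:ℝ)/2) = (2:ℝ) ^ (-((n:ℝ)/2)) * (r ^ n)⁻¹ := by
    rw [Real.mul_rpow (by norm_num) (by positivity), ← Real.rpow_natCast r 2, ← Real.rpow_mul hr0.le, ← Real.rpow_natCast r n,
      ← Real.rpow_neg hr0.le]
    congr 1
    · congr 1; ring
    · congr 1; push_cast; ring
  have e3 : r⁻¹ = (2:ℝ) ^ ((n:ℝ)/2) * (r ^ (n-1) * (2 * r ^ 2) ^ (-(n:ℝ)/2)) := by
    rw [e2, Real.rpow_neg (by norm_num)]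
    have : r ^ n = r ^ (n-1) * r := by rw [← pow_succ]; congr 1; omega
    rw [this]
    have : (2:ℝ) ^ ((n:ℝ)/2) ≠ 0 := by positivity
    field_simp
  rw [e3]
  gcongr

lemma psi_zero (hn : 2 ≤ n) (g : GW W W1 W2) (h0 : 0 < W1 0) {ε : ℝ} (hε : 0 < ε) : Psi n W ε 1 ≤ 0 := by
  have hn2 : (2:ℝ) ≤ n := by exact_mod_cast hn
  have hn1 : (0:ℝ) < (n:ℝ) - 1 := by linarith
  set q := (n:ℝ) / ((n:ℝ) - 1) with hq
  have hq1 : 1 < q := (GW.np1 hn).1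
  -- W ≥ c t near 0
  obtain ⟨δ, hδ0, hδ1, hWlow⟩ : ∃ δ > (0:ℝ), δ ≤ 1 ∧ ∀ t ∈ Icc 0 δ, W1 0 / 2 * t ≤ W t := by
    have := (g.cW1.continuousAt (x := 0)).eventually (Ioi_mem_nhds (show W1 0 / 2 < W1 0 by linarith))
    obtain ⟨d, hd, hd2⟩ := Metric.eventually_nhds_iff.1 this
    refine ⟨min (d/2) 1, by positivity, min_le_right _ _, fun t ht => ?_⟩
    have hm : MonotoneOn (fun t => W t - W1 0 / 2 * t) (Icc 0 (min (d/2) 1)) := by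
      apply monotoneOn_of_deriv_nonneg (convex_Icc _ _)
      · have := g.cW; fun_prop
      · intro t _; exact ((g.hd1 t).differentiableAt.sub (by fun_prop)).differentiableWithinAt
      · intro t ht2
        rw [interior_Icc] at ht2
        have e : HasDerivAt (fun t => W t - W1 0 / 2 * t) (W1 t - W1 0 / 2 * 1) t := (g.hd1 t).fun_sub ((hasDerivAt_id t).const_mul _)
        rw [e.deriv]
        have : W1 0 / 2 < W1 t := hd2 (by rw [Real.dist_eq, sub_zero, abs_of_pos ht2.1]; linarith [ht2.2, min_le_left (d/2) 1])
        linarith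
    have := hm ⟨le_rfl, by positivity⟩ ht ht.1
    simp only [g.zero] at this
    linarith
  obtain ⟨B, hB⟩ := isCompact_Icc.exists_bound_of_continuousOn (s := Icc (0:ℝ) 1) g.cG.continuousOn
  have hB0 : 0 ≤ B := (norm_nonneg _).trans (hB 0 ⟨le_rfl, zero_le_one⟩)
  have hPhi : ∀ t ∈ Icc (0:ℝ) 1, Phi W t ≤ B * t := by
    intro t ht
    have := Convex.norm_image_sub_le_of_norm_hasDerivWithin_le (f := Phi W) (s := Icc (0:ℝ) 1)
      (fun x _ => (g.dPhi' x).hasDerivWithinAt) (fun x hx => hB x hx) (convex_Icc 0 1) (x := 0) (y := t) ⟨le_rfl, zero_le_one⟩ ht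
    rw [GW.Phi_zero, sub_zero, sub_zero, Real.norm_eq_abs, Real.norm_eq_abs, abs_of_nonneg ht.1] at this
    exact (le_abs_self _).trans this
  obtain ⟨c, hc, hcl⟩ := g.Phi_low
  have iq : Integrable (fun x : En n => jw x ^ q) := jw_int hn hq1
  have i2q : Integrable (fun x : En n => jw x ^ (2 * q)) := jw_int hn (by linarith)
  have i2 : Integrable (fun x : En n => jw x ^ 2) := by
    have := jw_int hn (p := 2) (by norm_num)
    simpa using this
  set J := ∫ x : En n, jw x ^ (2 * q) with hJ
  have hJ0 : 0 < J := by
    rw [hJ, integral_pos_iff_support_of_nonneg (fun x => (Real.rpow_pos_of_pos (jw_pos x) _).le) i2q]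
    have : Function.support (fun x : En n => jw x ^ (2 * q)) = univ := by
      ext x; simp [(Real.rpow_pos_of_pos (jw_pos x) (2*q)).ne']
    rw [this, vol_univ hn]; simp
  set K := ∫ x : En n, jw x ^ 2 with hK
  have hK0 : 0 ≤ K := integral_nonneg fun x => by positivity
  set p := ((n:ℝ) - 2) / n with hp
  have hp0 : 0 ≤ p := by rw [hp]; apply div_nonneg <;> linarith
  have key : ∀ τ, 0 < τ → τ ≤ δ → Psi n W ε 1 ≤ (c ^ q * J) ^ (-p) * (ε * (n ^ 2 * K)) * τ ^ (2 / ((n:ℝ) - 1)) := by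
    intro τ hτ hτδ
    set f : En n → ℝ := fun x => τ * jw x with hf
    have hf0 : ∀ x, 0 < f x := fun x => mul_pos hτ (jw_pos x)
    have hfδ : ∀ x, f x ≤ δ := fun x => (mul_le_of_le_one_right hτ.le (jw_le x)).trans hτδ
    have hf1 : ∀ x, f x ∈ Icc (0:ℝ) 1 := fun x => ⟨(hf0 x).le, (hfδ x).trans hδ1⟩
    have hd : ∀ x, ∃ L : En n →L[ℝ] ℝ, HasFDerivAt f L x ∧ ‖L‖ ≤ τ * (n * jw x) := by
      intro x
      obtain ⟨L, hL, hLn⟩ := jw_deriv x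
      refine ⟨τ • L, hL.const_mul τ, ?_⟩
      rw [norm_smul, Real.norm_eq_abs, abs_of_pos hτ]
      gcongr
    have hfd : Differentiable ℝ f := fun x => by obtain ⟨L, hL, _⟩ := hd x; exact hL.differentiableAt
    have hDn : ∀ x, ‖fderiv ℝ f x‖ ^ 2 ≤ τ ^ 2 * n ^ 2 * jw x ^ 2 := by
      intro x
      obtain ⟨L, hL, hLn⟩ := hd x
      rw [hL.fderiv]
      calc ‖L‖ ^ 2 ≤ (τ * (n * jw x)) ^ 2 := pow_le_pow_left₀ (norm_nonneg _) hLn 2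
        _ = _ := by ring
    have iD : Integrable (fun x => ‖fderiv ℝ f x‖ ^ 2) := by
      refine Integrable.mono' (i2.const_mul (τ ^ 2 * n ^ 2)) ?_ (Eventually.of_forall fun x => ?_)
      · exact ((measurable_fderiv ℝ f).norm.pow_const 2).aestronglyMeasurable
      · rw [Real.norm_eq_abs, abs_of_nonneg (by positivity)]; exact hDn x
    have hbox : H1Box n f := by
      refine H1Box.mk' hf1 hfd ?_ iD
      have : (fun x => f x ^ 2) = fun x => τ ^ 2 * jw x ^ 2 := by funext x; simp only [hf]; ring
      rw [this]; exact i2.const_mul _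
    have iV : Integrable (fun x => Vpot n W (f x)) := by
      refine Integrable.mono' (iq.const_mul ((B * τ) ^ q)) (((g.cV hn).comp hfd.continuous).aestronglyMeasurable) (Eventually.of_forall fun x => ?_)
      rw [Real.norm_eq_abs, abs_of_nonneg (g.V_mem hn (hf1 x)).1, ← Real.mul_rpow (by positivity) (jw_pos x).le]
      unfold Vpot
      apply Real.rpow_le_rpow (g.Phi_mem (hf1 x)).1 _ (by linarith)
      rw [mul_assoc]; exact hPhi _ (hf1 x)
    have hVlow : (τ ^ 2) ^ q * (c ^ q * J) ≤ ∫ x, Vpot n W (f x) := by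
      have : (τ ^ 2) ^ q * (c ^ q * J) = ∫ x : En n, (τ ^ 2) ^ q * c ^ q * jw x ^ (2 * q) := by
        rw [integral_const_mul]; ring
      rw [this]
      refine integral_mono (i2q.const_mul _) iV fun x => ?_
      simp only
      have e1 : jw x ^ (2 * q) = (jw x ^ 2) ^ q := by
        rw [Real.rpow_mul (jw_pos x).le]; norm_num
      rw [e1, ← Real.mul_rpow (by positivity) hc.le, ← Real.mul_rpow (by positivity) (by positivity)]
      unfold Vpot
      apply Real.rpow_le_rpow (by positivity) _ (by linarith)
      refine le_trans (le_of_eq ?_) (hcl _ (hf1 x))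
      simp only [hf]; ring
    have hpos : 0 < (τ ^ 2) ^ q * (c ^ q * J) := by positivity
    have hm : 0 < ∫ x, Vpot n W (f x) := lt_of_lt_of_le hpos hVlow
    have hs := Psi_scale hn g hε hbox hm
    have hW : ∫ x, W (f x) = 0 := by
      apply integral_undef
      intro hi
      apply jw_not_int hn
      refine Integrable.mono' (hi.const_mul ((W1 0 / 2 * τ)⁻¹)) ?_ (Eventually.of_forall fun x => ?_)
      · have : Differentiable ℝ (jw (n := n)) := fun x => by obtain ⟨L, hL, _⟩ := jw_deriv x; exact hL.differentiableAt
        exact this.continuous.aestronglyMeasurable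
      · rw [Real.norm_eq_abs, abs_of_pos (jw_pos x)]
        have := hWlow (f x) ⟨(hf0 x).le, hfδ x⟩
        rw [le_inv_mul_iff₀ (by positivity)]
        refine le_trans (le_of_eq ?_) this
        simp only [hf]; ring
    rw [hW, mul_zero, mul_zero, add_zero] at hs
    refine hs.trans ?_
    have hD : ∫ x, ‖fderiv ℝ f x‖ ^ 2 ≤ τ ^ 2 * n ^ 2 * K := by
      rw [hK, ← integral_const_mul]
      exact integral_mono iD (i2.const_mul _) hDn
    have hm2 : (∫ x, Vpot n W (f x)) ^ (-p) ≤ ((τ ^ 2) ^ q * (c ^ q * J)) ^ (-p) :=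
      Real.rpow_le_rpow_of_nonpos hpos hVlow (by linarith)
    have hD0 : 0 ≤ ∫ x, ‖fderiv ℝ f x‖ ^ 2 := integral_nonneg fun x => by positivity
    calc _ ≤ ((τ ^ 2) ^ q * (c ^ q * J)) ^ (-p) * (ε * (τ ^ 2 * n ^ 2 * K)) := by gcongr
      _ = (c ^ q * J) ^ (-p) * (ε * (n ^ 2 * K)) * (((τ ^ 2) ^ q) ^ (-p) * τ ^ 2) := by
          rw [Real.mul_rpow (by positivity) (by positivity)]; ring
      _ = _ := by
          congr 1
          rw [← Real.rpow_natCast τ 2, ← Real.rpow_mul hτ.le, ← Real.rpow_mul hτ.le, ← Real.rpow_add hτ]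
          congr 1
          rw [hq, hp]; push_cast; field_simp; ring
  have ht : Tendsto (fun τ : ℝ => (c ^ q * J) ^ (-p) * (ε * (n ^ 2 * K)) * τ ^ (2 / ((n:ℝ) - 1))) (nhdsWithin 0 (Ioi 0)) (nhds 0) := by
    have hr : 0 < 2 / ((n:ℝ) - 1) := by positivity
    have := ((Real.continuous_rpow_const hr.le).continuousAt (x := 0)).tendsto
    rw [Real.zero_rpow hr.ne'] at this
    have h2 := (this.mono_left (nhdsWithin_le_nhds (s := Ioi 0))).const_mul ((c ^ q * J) ^ (-p) * (ε * (n ^ 2 * K)))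
    simpa using h2
  refine ge_of_tendsto ht ?_
  filter_upwards [Ioc_mem_nhdsGT hδ0] with τ hτ
  exact key τ hτ.1 hτ.2

lemma no_minimizer (hn : 2 ≤ n) (g : GW W W1 W2) (h0 : 0 < W1 0) {ε : ℝ} (hε : 0 < ε)
    (mu : Minimizes n W ε u) : False := by
  have h1 := psi_zero hn g h0 hε
  have h2 := mu.2.2
  unfold AC at h2
  have a1 : 0 ≤ ∫ x, ‖fderiv ℝ u x‖ ^ 2 := integral_nonneg fun x => by positivity
  have a2 : 0 ≤ ∫ x, W (u x) := integral_nonneg fun x => g.nonneg (mu.1.mem_Icc x)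
  have a3 : 0 ≤ ε⁻¹ * ∫ x, W (u x) := by positivity
  have a4 : ∫ x, ‖fderiv ℝ u x‖ ^ 2 = 0 := by nlinarith
  have a5 := (integral_eq_zero_iff_of_nonneg (fun x => by positivity) mu.1.intD).1 a4
  refine not_const hn g mu (const_of_ae hn mu.1.diff ?_)
  filter_upwards [a5] with x hx
  simpa using hx

variable {n : ℕ} {W W1 W2 : ℝ → ℝ} {u v : En n → ℝ}

def Asph (n : ℕ) : ℝ := n * ballVol n

lemma En_nontriv (hn : 2 ≤ n) : Nontrivial (En n) := by
  obtain ⟨e1, -, h, -⟩ := orth_pair hn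
  exact ⟨e1, 0, fun h' => by simp [h'] at h⟩

lemma ballVol_pos (n : ℕ) : 0 < ballVol n := by
  unfold ballVol
  exact ENNReal.toReal_pos (Metric.measure_ball_pos _ _ one_pos).ne' measure_ball_lt_top.ne

lemma Asph_pos (hn : 2 ≤ n) : 0 < Asph n := by
  have := ballVol_pos n
  have : (0:ℝ) < n := by exact_mod_cast (by omega : 0 < n)
  unfold Asph; positivity

lemma rad_int (hn : 2 ≤ n) (f : ℝ → ℝ) :
    ∫ x : En n, f ‖x‖ = Asph n * ∫ r in Ioi (0:ℝ), r^(n-1) * f r := by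
  have := En_nontriv hn
  rw [integral_fun_norm_addHaar]
  simp [Asph, ballVol, Measure.real, mul_assoc]

lemma rad_integrable (hn : 2 ≤ n) {f : ℝ → ℝ} :
    Integrable (fun x : En n => f ‖x‖) ↔ IntegrableOn (fun r => r^(n-1) * f r) (Ioi (0:ℝ)) := by
  have := En_nontriv hn
  rw [integrable_fun_norm_addHaar]
  simp

lemma rad_norm_fderiv {f : ℝ → ℝ} {d : ℝ} {x : En n} (hx : x ≠ 0) (h : HasDerivAt f d ‖x‖) :
    ‖fderiv ℝ (fun x : En n => f ‖x‖) x‖ = |d| := by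
  have h1 : DifferentiableAt ℝ (fun x : En n => ‖x‖) x := DifferentiableAt.norm ℝ differentiableAt_id hx
  have h2 := h.comp_hasFDerivAt x h1.hasFDerivAt
  have h3 : HasFDerivAt (fun x : En n => f ‖x‖) (d • fderiv ℝ (fun x : En n => ‖x‖) x) x := h2
  have : Nontrivial (En n) := ⟨x, 0, hx⟩
  rw [h3.fderiv, norm_smul, norm_fderiv_norm h1]; simp

lemma rad_D (hn : 2 ≤ n) {f d : ℝ → ℝ} (h : ∀ r > 0, HasDerivAt f (d r) r) :
    (fun x : En n => ‖fderiv ℝ (fun x : En n => f ‖x‖) x‖^2) =ᵐ[volume] fun x => (d ‖x‖)^2 := by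
  have := En_nontriv hn
  have h0 : ∀ᵐ x : En n, x ≠ 0 := by simp [ae_iff]
  filter_upwards [h0] with x hx
  rw [rad_norm_fderiv hx (h _ (norm_pos_iff.2 hx)), sq_abs]

structure RM (n : ℕ) (W : ℝ → ℝ) (ε : ℝ) (ζ d : ℝ → ℝ) : Prop where
  hd : ∀ r, HasDerivAt ζ (d r) r
  mem : ∀ r, ζ r ∈ Icc (0:ℝ) 1
  anti : AntitoneOn ζ (Ici 0)
  h1 : H1Box n (fun x => ζ ‖x‖)
  iD : IntegrableOn (fun r => r^(n-1) * d r^2) (Ioi 0)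
  iS : IntegrableOn (fun r => r^(n-1) * ζ r^2) (Ioi 0)
  iW : IntegrableOn (fun r => r^(n-1) * W (ζ r)) (Ioi 0)
  iV : IntegrableOn (fun r => r^(n-1) * Vpot n W (ζ r)) (Ioi 0)
  vol : Asph n * ∫ r in Ioi (0:ℝ), r^(n-1) * Vpot n W (ζ r) = 1
  en : ε * (Asph n * ∫ r in Ioi (0:ℝ), r^(n-1) * d r^2)
    + ε⁻¹ * (Asph n * ∫ r in Ioi (0:ℝ), r^(n-1) * W (ζ r)) = Psi n W ε 1

lemma RM_of_min (hn : 2 ≤ n) (g : GW W W1 W2) (h0 : W1 0 = 0) {ε : ℝ}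
    (mu : Minimizes n W ε u) {ζ0 : ℝ → ℝ} (ha : AntitoneOn ζ0 (Ici 0)) (hz : ∀ x, u x = ζ0 ‖x‖) :
    ∃ ζ d, RM n W ε ζ d ∧ ∀ x, u x = ζ ‖x‖ := by
  obtain ⟨e, -, he, -⟩ := orth_pair hn
  obtain ⟨hu, hV, hA⟩ := mu
  set ζ : ℝ → ℝ := fun r => u (r • e) with hζ
  have hn' : ∀ r : ℝ, ‖r • e‖ = |r| := fun r => by rw [norm_smul, he]; simp
  have hd : ∀ r, HasDerivAt ζ (fderiv ℝ u (r • e) e) r := fun r => by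
    simpa using line_deriv hu.diff 0 e r
  set d : ℝ → ℝ := fun r => fderiv ℝ u (r • e) e
  have hζz : ∀ r, ζ r = ζ0 |r| := fun r => by simp only [hζ]; rw [hz, hn']
  have hux : ∀ x, u x = ζ ‖x‖ := fun x => by rw [hζz, hz]; simp
  have huf : u = fun x => ζ ‖x‖ := funext hux
  have hD := rad_D (n := n) hn (f := ζ) (d := d) (fun r _ => hd r)
  have hiD : Integrable (fun x : En n => (d ‖x‖)^2) := by
    refine Integrable.congr ?_ hD
    have := hu.intD
    rwa [huf] at this
  have hiS := hu.intSq
  have hiW := hu.iW g h0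
  have hiV := hu.iV hn g h0
  have hDi : ∫ x : En n, ‖fderiv ℝ u x‖^2 = ∫ x : En n, (d ‖x‖)^2 := by
    rw [← integral_congr_ae hD, ← huf]
  simp only [hux] at hiS hiW hiV hV
  unfold AC at hA
  rw [hDi, rad_int hn (fun r => d r^2)] at hA
  simp only [hux] at hA
  rw [rad_int hn (fun r => W (ζ r))] at hA
  rw [rad_int hn (fun r => Vpot n W (ζ r))] at hV
  exact ⟨ζ, d, ⟨hd, fun r => hu.mem_Icc _, fun a ha' b hb hab => by
    rw [hζz, hζz, abs_of_nonneg (show 0 ≤ a from ha'), abs_of_nonneg (show 0 ≤ b from hb)]; exact ha ha' hb hab, huf ▸ hu,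
    (rad_integrable hn (f := fun r => d r^2)).1 hiD, (rad_integrable hn (f := fun r => ζ r^2)).1 hiS,
    (rad_integrable hn (f := fun r => W (ζ r))).1 hiW, (rad_integrable hn (f := fun r => Vpot n W (ζ r))).1 hiV, hV, hA⟩, hux⟩

variable {n : ℕ} {W W1 W2 : ℝ → ℝ} {u v : En n → ℝ}

lemma meas_of_deriv {f d : ℝ → ℝ} (h : ∀ r, HasDerivAt f (d r) r) : Measurable d := by
  have : d = deriv f := funext fun r => (h r).deriv.symm
  rw [this]; exact measurable_deriv f

lemma cont_of_deriv {f d : ℝ → ℝ} (h : ∀ r, HasDerivAt f (d r) r) : Continuous f :=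
  continuous_iff_continuousAt.2 fun r => (h r).continuousAt

/-- products of weighted L² functions are integrable -/
lemma int_prod {N : ℕ} {f h : ℝ → ℝ} {s : Set ℝ} (hs : s ⊆ Ioi 0) (hms : MeasurableSet s) (mf : Measurable f) (mh : Measurable h)
    (hf : IntegrableOn (fun r => r^N * f r^2) s) (hh : IntegrableOn (fun r => r^N * h r^2) s) :
    IntegrableOn (fun r => r^N * (f r * h r)) s := by
  refine Integrable.mono' (g := fun r => r^N * f r^2 + r^N * h r^2) (Integrable.fun_add hf hh) (by fun_prop) ?_
  filter_upwards [ae_restrict_mem hms] with r hr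
  have hr0 : 0 < r := hs hr
  have : 0 ≤ r^N := by positivity
  rw [norm_mul, Real.norm_eq_abs, Real.norm_eq_abs, abs_of_nonneg this, ← mul_add]
  refine mul_le_mul_of_nonneg_left ?_ this
  rw [abs_le]; constructor <;> nlinarith [sq_nonneg (f r - h r), sq_nonneg (f r + h r)]

lemma int_bdd {N : ℕ} {f : ℝ → ℝ} {a b M : ℝ} (ha : 0 < a) (mf : Measurable f) (hM : ∀ r, |f r| ≤ M)
    (hf : ∀ r, r ∉ Icc a b → f r = 0) : IntegrableOn (fun r => r^N * f r) (Ioi 0) := by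
  refine Integrable.mono' (g := (Icc a b).indicator (fun r => b^N * M)) ?_ (by fun_prop) ?_
  · exact (((integrable_indicator_iff measurableSet_Icc).2 continuousOn_const.integrableOn_Icc)).integrableOn
  · filter_upwards with r
    by_cases hr : r ∈ Icc a b
    · rw [indicator_of_mem hr]
      have : 0 ≤ r^N := pow_nonneg (ha.le.trans hr.1) _
      rw [norm_mul, Real.norm_eq_abs, Real.norm_eq_abs, abs_of_nonneg this]
      have hr1 := ha.le.trans hr.1
      have := hr.2
      exact mul_le_mul (by gcongr) (hM r) (abs_nonneg _) (pow_nonneg (hr1.trans hr.2) _)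
    · rw [indicator_of_notMem hr, hf r hr]; simp

lemma var_deriv {F F1 ζ φ : ℝ → ℝ} {N : ℕ} {ra rb B : ℝ} (hra : 0 < ra) (hF : ∀ t, HasDerivAt F (F1 t) t) (hF1 : Continuous F1)
    (cζ : Continuous ζ) (hζ : ∀ r, ζ r ∈ Icc (0:ℝ) 1) (cφ : Continuous φ) (hφ : ∀ r, r ∉ Icc ra rb → φ r = 0) (hB : ∀ r, |φ r| ≤ B)
    (hi : IntegrableOn (fun r => r^N * F (ζ r)) (Ioi 0)) :
    HasDerivAt (fun t => ∫ r in Ioi (0:ℝ), r^N * F (ζ r + t * φ r)) (∫ r in Ioi (0:ℝ), r^N * (F1 (ζ r) * φ r)) 0 := by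
  have cF := cont_of_deriv hF
  have hB0 : 0 ≤ B := (abs_nonneg _).trans (hB 0)
  obtain ⟨M, hM⟩ := isCompact_Icc.exists_bound_of_continuousOn (s := Icc (-B:ℝ) (1+B)) hF1.continuousOn
  have hM0 : 0 ≤ M := (abs_nonneg _).trans (hM 0 ⟨by linarith, by linarith⟩)
  have := (hasDerivAt_integral_of_dominated_loc_of_deriv_le (μ := volume.restrict (Ioi (0:ℝ)))
    (F := fun t r => r^N * F (ζ r + t * φ r)) (F' := fun t r => r^N * (F1 (ζ r + t * φ r) * φ r)) (x₀ := (0:ℝ))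
    (s := Metric.ball 0 1)
    (bound := (Icc ra rb).indicator (fun r => rb^N * (M * B))) (Metric.ball_mem_nhds _ one_pos) ?_ ?_ ?_ ?_ ?_ ?_).2
  · simpa using this
  · filter_upwards with t
    fun_prop
  · simp only [zero_mul, add_zero]; exact hi
  · fun_prop
  · filter_upwards with r t ht
    rw [Metric.mem_ball, dist_zero_right, Real.norm_eq_abs] at ht
    by_cases hr : r ∈ Icc ra rb
    · rw [indicator_of_mem hr]
      have hr1 := hra.le.trans hr.1
      have : 0 ≤ r^N := pow_nonneg hr1 _
      rw [norm_mul, norm_mul, Real.norm_eq_abs (r^N), abs_of_nonneg this]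
      have h2 : |t * φ r| ≤ B := by
        rw [abs_mul]
        have := hB r
        nlinarith [abs_nonneg t, abs_nonneg (φ r)]
      have h3 := hM (ζ r + t * φ r) ⟨by linarith [(abs_le.1 h2).1, (hζ r).1], by linarith [(abs_le.1 h2).2, (hζ r).2]⟩
      exact mul_le_mul (pow_le_pow_left₀ hr1 hr.2 _) (mul_le_mul h3 (hB r) (abs_nonneg _) hM0) (by positivity) (pow_nonneg (hr1.trans hr.2) _)
    · rw [indicator_of_notMem hr, hφ r hr]; simp
  · exact (((integrable_indicator_iff measurableSet_Icc).2 continuousOn_const.integrableOn_Icc)).integrableOn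
  · filter_upwards with r t ht
    have h1 := (hF (ζ r + t * φ r)).comp t (((hasDerivAt_id t).mul_const (φ r)).const_add (ζ r))
    simpa using h1.const_mul (r^N)

def lam (n : ℕ) (W : ℝ → ℝ) (ε : ℝ) (ζ d : ℝ → ℝ) : ℝ :=
  ((n:ℝ)-2)/n * (ε * (Asph n * ∫ r in Ioi (0:ℝ), r^(n-1) * d r^2))
    + ε⁻¹ * (Asph n * ∫ r in Ioi (0:ℝ), r^(n-1) * W (ζ r))

lemma first_var (hn : 2 ≤ n) (g : GW W W1 W2) {ε : ℝ} (hε : 0 < ε) {ζ d : ℝ → ℝ}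
    (rm : RM n W ε ζ d) {ra rb : ℝ} (hra : 0 < ra) (hab : ra ≤ rb) (h1 : ζ ra < 1) (h2 : 0 < ζ rb)
    {φ φ' : ℝ → ℝ} (hφ : ∀ r, HasDerivAt φ (φ' r) r) (hφ0 : ∀ r, r ∉ Icc ra rb → φ r = 0)
    (hφ2 : IntegrableOn (fun r => r^(n-1) * φ' r^2) (Ioi 0)) :
    2 * ε * (∫ r in Ioi (0:ℝ), r^(n-1) * (d r * φ' r)) + ε⁻¹ * (∫ r in Ioi (0:ℝ), r^(n-1) * (W1 (ζ r) * φ r))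
      - lam n W ε ζ d * (∫ r in Ioi (0:ℝ), r^(n-1) * (V1 n W (ζ r) * φ r)) = 0 := by
  have cφ := cont_of_deriv hφ
  have cζ := cont_of_deriv rm.hd
  have md := meas_of_deriv rm.hd
  have mφ := meas_of_deriv hφ
  have hA := Asph_pos hn
  obtain ⟨B, hB1, hB⟩ : ∃ B, 1 ≤ B ∧ ∀ r, |φ r| ≤ B := by
    obtain ⟨B, hB⟩ := isCompact_Icc.exists_bound_of_continuousOn (s := Icc ra rb) cφ.continuousOn
    refine ⟨max B 1, le_max_right _ _, fun r => ?_⟩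
    by_cases hr : r ∈ Icc ra rb
    · exact (hB r hr).trans (le_max_left _ _)
    · rw [hφ0 r hr]; simp
  set η := min (ζ rb) (1 - ζ ra) / B with hη
  have hη0 : 0 < η := div_pos (lt_min h2 (by linarith)) (by linarith)
  have hmem : ∀ t, |t| < η → ∀ r, ζ r + t * φ r ∈ Icc (0:ℝ) 1 := by
    intro t ht r
    by_cases hr : r ∈ Icc ra rb
    · have h3 : |t * φ r| ≤ min (ζ rb) (1 - ζ ra) := by
        rw [abs_mul]
        rw [hη, lt_div_iff₀ (by linarith)] at ht
        have := hB r
        nlinarith [abs_nonneg t]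
      have h4 := rm.anti (show 0 ≤ ra from hra.le) (show 0 ≤ r from hra.le.trans hr.1) hr.1
      have h5 := rm.anti (show 0 ≤ r from hra.le.trans hr.1) (show 0 ≤ rb from hra.le.trans hab) hr.2
      have h6 := abs_le.1 h3
      have h7 := min_le_left (ζ rb) (1 - ζ ra)
      have h8 := min_le_right (ζ rb) (1 - ζ ra)
      constructor <;> linarith
    · rw [hφ0 r hr]; simpa using rm.mem r
  have hdt : ∀ t r, HasDerivAt (fun r => ζ r + t * φ r) (d r + t * φ' r) r := fun t r =>
    (rm.hd r).fun_add ((hφ r).const_mul t)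
  have idp := int_prod (N := n-1) subset_rfl measurableSet_Ioi md mφ rm.iD hφ2
  have hDexp : ∀ t r, r^(n-1) * (d r + t * φ' r)^2 =
      r^(n-1) * d r^2 + (2*t*(r^(n-1)*(d r * φ' r)) + t^2 * (r^(n-1) * φ' r^2)) := fun t r => by ring
  have i2 : ∀ t : ℝ, IntegrableOn (fun r => 2*t*(r^(n-1)*(d r * φ' r)) + t^2 * (r^(n-1) * φ' r^2)) (Ioi 0) := fun t =>
    Integrable.fun_add (Integrable.const_mul idp _) (Integrable.const_mul hφ2 _)
  have iDt : ∀ t : ℝ, IntegrableOn (fun r => r^(n-1) * (d r + t * φ' r)^2) (Ioi 0) := fun t => by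
    simp only [hDexp]
    exact Integrable.fun_add rm.iD (i2 t)
  have hDt : ∀ t : ℝ, ∫ r in Ioi (0:ℝ), r^(n-1) * (d r + t * φ' r)^2 =
      (∫ r in Ioi (0:ℝ), r^(n-1) * d r^2) + (2*t*(∫ r in Ioi (0:ℝ), r^(n-1)*(d r * φ' r)) + t^2 * ∫ r in Ioi (0:ℝ), r^(n-1) * φ' r^2) := fun t => by
    simp only [hDexp]
    rw [integral_add rm.iD (i2 t), integral_add (Integrable.const_mul idp _) (Integrable.const_mul hφ2 _),
      integral_const_mul, integral_const_mul]
  have iφ2 : IntegrableOn (fun r => r^(n-1) * φ r^2) (Ioi 0) := by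
    refine int_bdd (M := B^2) (b := rb) hra (by fun_prop) (fun r => ?_) (fun r hr => by rw [hφ0 r hr]; simp)
    rw [abs_pow]; exact pow_le_pow_left₀ (abs_nonneg _) (hB r) _
  have iSt : ∀ t : ℝ, IntegrableOn (fun r => r^(n-1) * (ζ r + t * φ r)^2) (Ioi 0) := fun t => by
    have hi := int_prod (N := n-1) subset_rfl measurableSet_Ioi cζ.measurable cφ.measurable rm.iS iφ2
    have : ∀ r, r^(n-1) * (ζ r + t * φ r)^2 =
      r^(n-1) * ζ r^2 + (2*t*(r^(n-1)*(ζ r * φ r)) + t^2 * (r^(n-1) * φ r^2)) := fun r => by ring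
    simp only [this]
    exact Integrable.fun_add rm.iS (Integrable.fun_add (Integrable.const_mul hi _) (Integrable.const_mul iφ2 _))
  have hH : ∀ t, |t| < η → H1Box n (fun x => ζ ‖x‖ + t * φ ‖x‖) := by
    intro t ht
    refine H1Box.mk' (fun x => hmem t ht _) (fun x => ?_) ((rad_integrable hn (f := fun r => (ζ r + t * φ r)^2)).2 (iSt t)) ?_
    · by_cases hx : x = 0
      · have : (fun x : En n => ζ ‖x‖ + t * φ ‖x‖) =ᶠ[nhds x] fun x => ζ ‖x‖ := by
          rw [hx]
          filter_upwards [Metric.ball_mem_nhds (0 : En n) hra] with y hy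
          rw [Metric.mem_ball, dist_zero_right] at hy
          rw [hφ0 _ (fun h => by linarith [h.1])]; simp
        exact this.differentiableAt_iff.2 (rm.h1.diff x)
      · exact ((hdt t ‖x‖).differentiableAt.comp (𝕜 := ℝ) x (DifferentiableAt.norm ℝ differentiableAt_id hx) :)
    · refine Integrable.congr ?_ (rad_D hn (f := fun r => ζ r + t * φ r) (d := fun r => d r + t * φ' r) fun r _ => hdt t r).symm
      exact (rad_integrable hn (f := fun r => (d r + t * φ' r)^2)).2 (iDt t)
  have dm := (var_deriv (N := n-1) hra (g.dV hn) (g.cV1 hn) cζ rm.mem cφ hφ0 hB rm.iV).const_mul (Asph n)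
  have dw := (var_deriv (N := n-1) hra g.hd1 g.cW1 cζ rm.mem cφ hφ0 hB rm.iW).const_mul (Asph n)
  set m : ℝ → ℝ := fun t => Asph n * ∫ r in Ioi (0:ℝ), r^(n-1) * Vpot n W (ζ r + t * φ r) with hm
  set w : ℝ → ℝ := fun t => Asph n * ∫ r in Ioi (0:ℝ), r^(n-1) * W (ζ r + t * φ r) with hw
  have hm0 : m 0 = 1 := by simp only [hm, zero_mul, add_zero]; exact rm.vol
  set D0 := ∫ r in Ioi (0:ℝ), r^(n-1) * d r^2
  set D1 := ∫ r in Ioi (0:ℝ), r^(n-1) * (d r * φ' r)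
  set D2 := ∫ r in Ioi (0:ℝ), r^(n-1) * φ' r^2
  set p := ((n:ℝ)-2)/n
  set Dt : ℝ → ℝ := fun t => Asph n * (D0 + (2*t*D1 + t^2*D2)) with hDt'
  have dD : HasDerivAt Dt (Asph n * (2*D1)) 0 := by
    have h := ((((hasDerivAt_id (0:ℝ)).const_mul 2).mul_const D1).fun_add ((hasDerivAt_pow 2 (0:ℝ)).mul_const D2)).const_add D0 |>.const_mul (Asph n)
    exact h.congr_deriv (by simp)
  set F : ℝ → ℝ := fun t => m t ^ (-p) * (ε * Dt t) + (m t)⁻¹ * (ε⁻¹ * w t) with hF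
  have hw0 : w 0 = Asph n * ∫ r in Ioi (0:ℝ), r^(n-1) * W (ζ r) := by simp only [hw, zero_mul, add_zero]
  have hD00 : Dt 0 = Asph n * D0 := by simp [hDt']
  have hF0 : F 0 = Psi n W ε 1 := by
    simp only [hF, hm0, hw0, hD00]
    rw [← rm.en]; simp only [Real.one_rpow, one_mul, inv_one]; rfl
  have hloc : IsLocalMin F 0 := by
    have e1 : ∀ᶠ t in nhds (0:ℝ), 0 < m t := dm.continuousAt.eventually_const_lt (by rw [hm0]; exact one_pos)
    filter_upwards [e1, Metric.ball_mem_nhds (0:ℝ) hη0] with t h1 h2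
    rw [Metric.mem_ball, dist_zero_right, Real.norm_eq_abs] at h2
    rw [hF0]
    have e2 := rad_int hn (fun r => Vpot n W (ζ r + t * φ r))
    have e3 := rad_int hn (fun r => W (ζ r + t * φ r))
    have e4 := integral_congr_ae (rad_D hn (f := fun r => ζ r + t * φ r) (d := fun r => d r + t * φ' r) fun r _ => hdt t r)
    rw [rad_int hn (fun r => (d r + t * φ' r)^2), hDt t] at e4
    have := Psi_scale hn g hε (hH t h2) (by rw [e2]; exact h1)
    rw [e2, e3, e4] at this
    exact this
  have dF : HasDerivAt F _ 0 := ((dm.rpow_const (p := -p) (Or.inl (by rw [hm0]; norm_num))).fun_mul (dD.const_mul ε)).fun_add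
    ((dm.fun_inv (by rw [hm0]; norm_num)).fun_mul (dw.const_mul ε⁻¹))
  have hz := hloc.hasDerivAt_eq_zero dF
  rw [hm0, hw0, hD00] at hz
  simp only [Real.one_rpow] at hz
  have : Asph n * (2 * ε * D1 + ε⁻¹ * (∫ r in Ioi (0:ℝ), r^(n-1) * (W1 (ζ r) * φ r))
      - lam n W ε ζ d * (∫ r in Ioi (0:ℝ), r^(n-1) * (V1 n W (ζ r) * φ r))) = 0 := by
    have hl : lam n W ε ζ d = p * (ε * (Asph n * D0)) + ε⁻¹ * (Asph n * ∫ r in Ioi (0:ℝ), r^(n-1) * W (ζ r)) := rfl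
    rw [hl]; linear_combination hz
  exact (mul_eq_zero.1 this).resolve_left hA.ne'

variable {n : ℕ} {W W1 W2 : ℝ → ℝ} {u v : En n → ℝ}

def gf (n : ℕ) (W W1 : ℝ → ℝ) (ε l t : ℝ) : ℝ := (W1 t - ε * l * V1 n W t) / 2

lemma GW.cgf (g : GW W W1 W2) (hn : 2 ≤ n) (ε l : ℝ) : Continuous (gf n W W1 ε l) := by
  have := g.cW1
  have := g.cV1 hn
  unfold gf; fun_prop

lemma trunc_deriv {f f' : ℝ → ℝ} {a b : ℝ} (hf : ∀ r, HasDerivAt f (f' r) r)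
    (ha : f a = 0) (hb : f b = 0) (ha' : f' a = 0) (hb' : f' b = 0) (r : ℝ) :
    HasDerivAt ((Icc a b).indicator f) ((Icc a b).indicator f' r) r := by
  by_cases hin : r ∈ Ioo a b
  · rw [indicator_of_mem (Ioo_subset_Icc_self hin)]
    refine (hf r).congr_of_eventuallyEq ?_
    filter_upwards [isOpen_Ioo.mem_nhds hin] with s hs
    rw [indicator_of_mem (Ioo_subset_Icc_self hs)]
  by_cases hout : r ∈ Icc a b
  · have hab : r = a ∨ r = b := by
      by_contra h; push Not at h
      exact hin ⟨lt_of_le_of_ne hout.1 (Ne.symm h.1), lt_of_le_of_ne hout.2 h.2⟩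
    have h0 : f r = 0 := by rcases hab with h | h <;> rw [h] <;> assumption
    have h0' : f' r = 0 := by rcases hab with h | h <;> rw [h] <;> assumption
    rw [indicator_of_mem hout, h0']
    have h1 := hf r
    rw [h0', hasDerivAt_iff_isLittleO, h0] at h1
    rw [hasDerivAt_iff_isLittleO, indicator_of_mem hout, h0]
    refine Asymptotics.IsBigO.trans_isLittleO (Asymptotics.isBigO_of_le _ fun s => ?_) h1
    simp only [smul_zero, sub_zero]
    exact norm_indicator_le_norm_self _ _
  · rw [indicator_of_notMem hout]
    have : (Icc a b).indicator f =ᶠ[nhds r] fun _ => 0 := by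
      filter_upwards [isClosed_Icc.isOpen_compl.mem_nhds hout] with s hs
      rw [indicator_of_notMem hs]
    exact (hasDerivAt_const r (0:ℝ)).congr_of_eventuallyEq this

lemma aux_sq {x y d B M : ℝ} (hx : 0 ≤ x) (hxy : x ≤ y) (hB : |B| ≤ M) (c : ℝ) :
    (x * d - B - c)^2 ≤ 2 * y^2 * d^2 + 2*(M+|c|)^2 := by
  have h1 : (B + c)^2 ≤ (M+|c|)^2 := by
    rw [← sq_abs (B + c)]
    exact pow_le_pow_left₀ (abs_nonneg _) ((abs_add_le _ _).trans (by linarith)) _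
  have h2 : x^2 ≤ y^2 := by gcongr
  have h3 := mul_le_mul_of_nonneg_right h2 (sq_nonneg d)
  nlinarith [sq_nonneg (x * d + (B + c))]

lemma aux_P {p q Y Z D X : ℝ} (hZ : 0 ≤ Z) (hD : 0 ≤ D) (hY : 0 ≤ Y) (hX : 0 ≤ X) (hpq : p ≤ q) (h : X ≤ 2 * Z * D + 2 * Y) (hq : 0 ≤ q := by positivity) :
    9 * p * X ≤ (9 * q) * (2 * Z + 2 * Y) * D + (9 * q) * (2 * Z + 2 * Y) * 1 := by
  have h1 : p * X ≤ q * X := by gcongr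
  have h2 : q * X ≤ q * (2 * Z * D + 2 * Y) := by gcongr
  have h3 : 0 ≤ q * Y * D := by positivity
  have h4 : 0 ≤ q * Z := by positivity
  nlinarith

set_option maxHeartbeats 1600000 in
lemma el_interior (hn : 2 ≤ n) (g : GW W W1 W2) {ε : ℝ} (hε : 0 < ε) {ζ d : ℝ → ℝ}
    (rm : RM n W ε ζ d) {ra rb : ℝ} (hra : 0 < ra) (hab : ra < rb) (h1 : ζ ra < 1) (h2 : 0 < ζ rb) :
    ∀ r ∈ Ioo ra rb, HasDerivAt (fun r => ε^2 * (r^(n-1) * d r)) (r^(n-1) * gf n W W1 ε (lam n W ε ζ d) (ζ r)) r := by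
  set l := lam n W ε ζ d with hl
  have cζ := cont_of_deriv rm.hd
  have md := meas_of_deriv rm.hd
  have cg := g.cgf hn ε l
  set b : ℝ → ℝ := fun r => r^(n-1) * gf n W W1 ε l (ζ r) with hb
  have cb : Continuous b := by fun_prop
  set B : ℝ → ℝ := fun r => ∫ s in ra..r, b s with hB
  have dB : ∀ r, HasDerivAt B (b r) r := fun r => intervalIntegral.integral_hasDerivAt_right (cb.intervalIntegrable _ _) (cb.stronglyMeasurableAtFilter _ _) cb.continuousAt
  have cB := cont_of_deriv dB
  set e : ℝ → ℝ := fun s => ((n-1:ℕ):ℝ) * s^(n-1-1) * ζ s with he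
  have ce : Continuous e := by fun_prop
  set k : ℝ → ℝ := fun r => ε^2 * (r^(n-1) * d r) - B r with hk
  have dK : ∀ r, HasDerivAt (fun r => ε^2 * (r^(n-1) * ζ r - ∫ s in ra..r, e s) - ∫ s in ra..r, B s) (k r) r := by
    intro r
    have e1 : HasDerivAt (fun r => ∫ s in ra..r, e s) (e r) r := intervalIntegral.integral_hasDerivAt_right (ce.intervalIntegrable _ _) (ce.stronglyMeasurableAtFilter _ _) ce.continuousAt
    have e2 : HasDerivAt (fun r => ∫ s in ra..r, B s) (B r) r := intervalIntegral.integral_hasDerivAt_right (cB.intervalIntegrable _ _) (cB.stronglyMeasurableAtFilter _ _) cB.continuousAt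
    have := (((((hasDerivAt_pow (n-1) r).fun_mul (rm.hd r)).fun_sub e1).const_mul (ε^2)).fun_sub e2)
    refine this.congr_deriv ?_
    simp only [he, hk]; ring
  set K : ℝ → ℝ := fun r => ε^2 * (r^(n-1) * ζ r - ∫ s in ra..r, e s) - ∫ s in ra..r, B s
  set c := (K rb - K ra) / (rb - ra) with hc
  set φ0 : ℝ → ℝ := fun r => K r - K ra - c * (r - ra) with hφ0
  have dφ0 : ∀ r, HasDerivAt φ0 (k r - c) r := fun r => by
    have := ((dK r).sub_const (K ra)).fun_sub (((hasDerivAt_id r).sub_const ra).const_mul c)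
    exact this.congr_deriv (by simp)
  have z1 : φ0 ra = 0 := by simp [hφ0]
  have z2 : φ0 rb = 0 := by
    simp only [hφ0, hc]; rw [div_mul_cancel₀ _ (by linarith)]; ring
  clear_value φ0 c K k B b e l
  have cφ0 := cont_of_deriv dφ0
  have mk : Measurable fun r => k r - c := meas_of_deriv dφ0
  set f' : ℝ → ℝ := fun r => 3 * φ0 r^2 * (k r - c) with hf'
  have df : ∀ r, HasDerivAt (fun r => φ0 r^3) (f' r) r := fun r => by
    have := (dφ0 r).fun_pow 3
    exact this.congr_deriv (by simp [hf'])
  have dφ := trunc_deriv (a := ra) (b := rb) df (by simp [z1]) (by simp [z2]) (by simp [hf', z1]) (by simp [hf', z2])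
  set φ := (Icc ra rb).indicator (fun r => φ0 r^3) with hφ
  set φ' := (Icc ra rb).indicator f' with hφ'
  clear_value φ φ' f'
  have mφ' : Measurable φ' := meas_of_deriv dφ
  have cφ := cont_of_deriv dφ
  obtain ⟨M1, hM1⟩ := isCompact_Icc.exists_bound_of_continuousOn (s := Icc ra rb) cφ0.continuousOn
  obtain ⟨M2, hM2⟩ := isCompact_Icc.exists_bound_of_continuousOn (s := Icc ra rb) cB.continuousOn
  obtain ⟨P, hP0, hP⟩ : ∃ P, 0 ≤ P ∧ ∀ r, φ' r^2 ≤ P * (d r^2) + P * ((Icc ra rb).indicator (fun _ => 1) r) := by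
    have hM10 : 0 ≤ M1 := (norm_nonneg _).trans (hM1 ra ⟨le_rfl, hab.le⟩)
    have hM20 : 0 ≤ M2 := (norm_nonneg _).trans (hM2 ra ⟨le_rfl, hab.le⟩)
    refine ⟨(9 * M1^4) * (2*(ε^2*rb^(n-1))^2 + 2*(M2+|c|)^2), by positivity, fun r => ?_⟩
    by_cases hr : r ∈ Icc ra rb
    · rw [hφ', indicator_of_mem hr, indicator_of_mem hr]
      have a1 := hM1 r hr
      have a2 := hM2 r hr
      rw [Real.norm_eq_abs] at a1 a2
      have hr0 := hra.le.trans hr.1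
      have a3 : r^(n-1) ≤ rb^(n-1) := pow_le_pow_left₀ hr0 hr.2 _
      have a4 : (k r - c)^2 ≤ 2*(ε^2*rb^(n-1))^2 * d r^2 + 2*(M2+|c|)^2 := by
        have h5 : ε^2*r^(n-1) ≤ ε^2*rb^(n-1) := by gcongr
        have := aux_sq (d := d r) (by positivity : 0 ≤ ε^2*r^(n-1)) h5 a2 c
        have e : k r - c = ε^2*r^(n-1)*d r - B r - c := by simp only [hk]; ring
        rw [e]; exact this
      have a5 : φ0 r^4 ≤ M1^4 := by
        rw [← Even.pow_abs (by decide : Even 4)]; exact pow_le_pow_left₀ (abs_nonneg _) a1 _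
      have a6 : f' r^2 = 9 * φ0 r^4 * (k r - c)^2 := by simp only [hf']; ring
      rw [a6]
      have hx := sq_nonneg (k r - c)
      generalize (k r - c)^2 = X at a4 hx ⊢
      exact aux_P (sq_nonneg _) (sq_nonneg _) (by positivity) hx a5 a4
    · rw [hφ', indicator_of_notMem hr, indicator_of_notMem hr]
      simp; positivity
  have iI : IntegrableOn (fun r => r^(n-1) * ((Icc ra rb).indicator (fun _ => (1:ℝ)) r)) (Ioi 0) := by
    refine int_bdd (M := 1) (b := rb) hra (measurable_const.indicator measurableSet_Icc) (fun r => ?_) (fun r hr => indicator_of_notMem hr _)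
    by_cases hr : r ∈ Icc ra rb
    · rw [indicator_of_mem hr]; simp
    · rw [indicator_of_notMem hr]; simp
  have iφ2 : IntegrableOn (fun r => r^(n-1) * φ' r^2) (Ioi 0) := by
    refine Integrable.mono' (g := fun r => P * (r^(n-1) * d r^2) + P * (r^(n-1) * ((Icc ra rb).indicator (fun _ => (1:ℝ)) r)))
      (Integrable.fun_add (Integrable.const_mul rm.iD _) (Integrable.const_mul iI _)) (by fun_prop) ?_
    filter_upwards [ae_restrict_mem measurableSet_Ioi] with r hr
    have hr0 : 0 ≤ r^(n-1) := pow_nonneg (le_of_lt hr) _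
    rw [norm_mul, Real.norm_eq_abs, Real.norm_eq_abs, abs_of_nonneg hr0, abs_of_nonneg (sq_nonneg _)]
    nlinarith [mul_le_mul_of_nonneg_left (hP r) hr0]
  have fv := first_var hn g hε rm hra hab.le h1 h2 dφ (fun r hr => by rw [hφ]; exact indicator_of_notMem hr _) iφ2
  rw [← hl] at fv
  have mra : ra ∈ Icc ra rb := ⟨le_rfl, hab.le⟩
  have mrb : rb ∈ Icc ra rb := ⟨hab.le, le_rfl⟩
  have hφra : φ ra = 0 := by rw [hφ, indicator_of_mem mra]; simp [z1]
  have hφrb : φ rb = 0 := by rw [hφ, indicator_of_mem mrb]; simp [z2]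
  have hφ0' : ∀ r, r ∉ Ioc ra rb → φ r = 0 := fun r hr => by
    by_cases h : r = ra
    · rw [h]; exact hφra
    · rw [hφ]; exact indicator_of_notMem (fun h' : r ∈ Icc ra rb => hr ⟨lt_of_le_of_ne h'.1 (Ne.symm h), h'.2⟩) _
  have hφ'0' : ∀ r, r ∉ Ioc ra rb → φ' r = 0 := fun r hr => by
    by_cases h : r = ra
    · rw [h, hφ', indicator_of_mem mra]; simp [hf', z1]
    · rw [hφ']; exact indicator_of_notMem (fun h' : r ∈ Icc ra rb => hr ⟨lt_of_le_of_ne h'.1 (Ne.symm h), h'.2⟩) _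
  have conv : ∀ F : ℝ → ℝ, (∀ r, r ∉ Ioc ra rb → F r = 0) → ∫ r in Ioi (0:ℝ), F r = ∫ r in ra..rb, F r := by
    intro F hF
    rw [intervalIntegral.integral_of_le hab.le]
    exact setIntegral_eq_of_subset_of_forall_sdiff_eq_zero measurableSet_Ioi (fun r hr => hra.trans hr.1) fun r hr => hF r hr.2
  have hsub : Ioc ra rb ⊆ Ioi 0 := fun r hr => hra.trans hr.1
  rw [conv _ (fun r hr => by rw [hφ'0' r hr]; simp), conv _ (fun r hr => by rw [hφ0' r hr]; simp), conv _ (fun r hr => by rw [hφ0' r hr]; simp)] at fv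
  have cW1 := g.cW1
  have cV1 := g.cV1 hn
  have i1 : IntervalIntegrable (fun r => r^(n-1) * (d r * φ' r)) volume ra rb :=
    (intervalIntegrable_iff_integrableOn_Ioc_of_le hab.le).2 ((int_prod subset_rfl measurableSet_Ioi md mφ' rm.iD iφ2).mono_set hsub)
  have i2 : IntervalIntegrable (fun r => b r * φ r) volume ra rb := (by fun_prop : Continuous (fun r => b r * φ r)).intervalIntegrable _ _
  have iφ' : IntervalIntegrable φ' volume ra rb := by
    have h3 : IntegrableOn (fun r => r^(n-1) * (((Icc ra rb).indicator (fun _ => (1:ℝ)) r) * φ' r)) (Ioi 0) := by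
      refine int_prod subset_rfl measurableSet_Ioi (measurable_const.indicator measurableSet_Icc) mφ' ?_ iφ2
      refine iI.congr (ae_of_all _ fun r => ?_)
      by_cases hr : r ∈ Icc ra rb
      · simp [indicator_of_mem hr]
      · simp [indicator_of_notMem hr]
    have h4 : IntervalIntegrable (fun r => r^(n-1) * (((Icc ra rb).indicator (fun _ => (1:ℝ)) r) * φ' r)) volume ra rb :=
      (intervalIntegrable_iff_integrableOn_Ioc_of_le hab.le).2 (h3.mono_set hsub)
    have h5 := h4.continuousOn_mul (g := fun r => (r^(n-1))⁻¹) (by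
      rw [uIcc_of_le hab.le]
      exact ContinuousOn.inv₀ (by fun_prop) fun r hr => (pow_pos (hra.trans_le hr.1) _).ne')
    refine h5.congr ?_
    intro r hr
    rw [uIoc_of_le hab.le] at hr
    have : r^(n-1) ≠ 0 := (pow_pos (hra.trans hr.1) _).ne'
    simp only
    rw [indicator_of_mem (Ioc_subset_Icc_self hr)]
    field_simp
  have ft := intervalIntegral.integral_eq_sub_of_hasDerivAt (f := fun r => (B r + c) * φ r) (f' := fun r => b r * φ r + (B r + c) * φ' r) (a := ra) (b := rb)
    (fun r _ => ((dB r).add_const c).fun_mul (dφ r)) (i2.add (iφ'.continuousOn_mul (by fun_prop)))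
  rw [hφra, hφrb, intervalIntegral.integral_add i2 (iφ'.continuousOn_mul (by fun_prop))] at ft
  have sp : ∫ r in ra..rb, b r * φ r = 1/2 * (∫ r in ra..rb, r^(n-1) * (W1 (ζ r) * φ r)) - ε*l/2 * ∫ r in ra..rb, r^(n-1) * (V1 n W (ζ r) * φ r) := by
    rw [← intervalIntegral.integral_const_mul, ← intervalIntegral.integral_const_mul, ← intervalIntegral.integral_sub
      ((by fun_prop : Continuous _).intervalIntegrable _ _) ((by fun_prop : Continuous _).intervalIntegrable _ _)]
    congr 1; ext r; simp only [hb, gf]; ring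
  have key : ∫ r in ra..rb, (k r - c) * φ' r = 0 := by
    have : ∫ r in ra..rb, (k r - c) * φ' r = ε^2 * (∫ r in ra..rb, r^(n-1) * (d r * φ' r)) - ∫ r in ra..rb, (B r + c) * φ' r := by
      rw [← intervalIntegral.integral_const_mul, ← intervalIntegral.integral_sub (i1.const_mul _) (iφ'.continuousOn_mul (by fun_prop))]
      congr 1; ext r; simp only [hk]; ring
    rw [this]
    have hee : ε * ε⁻¹ = 1 := mul_inv_cancel₀ hε.ne'
    linear_combination (ε/2) * fv - ft + sp - (1/2) * (∫ r in ra..rb, r^(n-1) * (W1 (ζ r) * φ r)) * hee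
  have hnn : ∀ r, 0 ≤ (k r - c) * φ' r := fun r => by
    by_cases hr : r ∈ Icc ra rb
    · rw [hφ', indicator_of_mem hr]
      have : (k r - c) * f' r = 3 * (φ0 r * (k r - c))^2 := by simp only [hf']; ring
      rw [this]; positivity
    · rw [hφ', indicator_of_notMem hr]; simp
  have ikey : IntervalIntegrable (fun r => (k r - c) * φ' r) volume ra rb := by
    refine ((i1.const_mul (ε^2)).sub (iφ'.continuousOn_mul (g := fun r => B r + c) (by fun_prop))).congr ?_
    intro r _; simp only [hk, Pi.sub_apply]; ring
  have hae : ∀ᵐ r ∂(volume.restrict (Ioc ra rb)), (k r - c) * φ' r = 0 := by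
    rw [intervalIntegral.integral_of_le hab.le] at key
    exact (integral_eq_zero_iff_of_nonneg (fun r => hnn r) ((intervalIntegrable_iff_integrableOn_Ioc_of_le hab.le).1 ikey)).1 key
  have hae2 : (fun r => 2 * φ0 r * (k r - c)) =ᵐ[volume.restrict (Ioc ra rb)] fun _ => 0 := by
    filter_upwards [hae, ae_restrict_mem measurableSet_Ioc] with r hr hr2
    rw [hφ', indicator_of_mem (Ioc_subset_Icc_self hr2)] at hr
    have : (k r - c) * f' r = 3 * (φ0 r * (k r - c))^2 := by simp only [hf']; ring
    rw [this] at hr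
    have : φ0 r * (k r - c) = 0 := by
      have := (mul_eq_zero.1 hr).resolve_left (by norm_num)
      exact pow_eq_zero_iff (by norm_num) |>.1 this
    linear_combination 2 * this
  have hφz : ∀ r ∈ Icc ra rb, φ0 r = 0 := by
    intro r hr
    have hs : Ioc ra r ⊆ Ioc ra rb := Ioc_subset_Ioc_right hr.2
    have hae3 := ae_restrict_of_ae_restrict_of_subset hs hae2
    have ii : IntervalIntegrable (fun r => 2 * φ0 r * (k r - c)) volume ra r :=
      (intervalIntegrable_iff_integrableOn_Ioc_of_le hr.1).2 ((integrable_zero _ _ _).congr (EventuallyEq.symm hae3))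
    have h3 := intervalIntegral.integral_eq_sub_of_hasDerivAt (f := fun r => φ0 r^2) (f' := fun r => 2 * φ0 r * (k r - c)) (a := ra) (b := r)
      (fun r _ => ((dφ0 r).fun_pow 2).congr_deriv (by simp)) ii
    rw [intervalIntegral.integral_of_le hr.1, integral_congr_ae hae3, z1] at h3
    simp at h3
    exact pow_eq_zero_iff (by norm_num) |>.1 h3.symm
  have hkc : ∀ r ∈ Ioo ra rb, k r = c := by
    intro r hr
    have h3 : HasDerivAt φ0 0 r := by
      refine (hasDerivAt_const r (0:ℝ)).congr_of_eventuallyEq ?_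
      filter_upwards [isOpen_Ioo.mem_nhds hr] with s hs
      exact hφz s (Ioo_subset_Icc_self hs)
    linarith [(dφ0 r).unique h3]
  intro r hr
  rw [show r^(n-1) * gf n W W1 ε l (ζ r) = b r by rw [hb]]
  refine ((dB r).add_const c).congr_of_eventuallyEq ?_
  filter_upwards [isOpen_Ioo.mem_nhds hr] with s hs
  have := hkc s hs
  simp only [hk] at this
  linarith

variable {n : ℕ} {W W1 W2 : ℝ → ℝ} {u v : En n → ℝ}

lemma darboux_seq {f f' : ℝ → ℝ} (hf : ∀ r, HasDerivAt f (f' r) r) (a : ℝ) :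
    ∃ c : ℝ → ℝ, (∀ s, a < s → c s ∈ Ioo a s) ∧ (∀ s, s < a → c s ∈ Ioo s a) ∧
      Tendsto (fun s => f' (c s)) (nhdsWithin a {a}ᶜ) (nhds (f' a)) ∧ Tendsto c (nhdsWithin a {a}ᶜ) (nhds a) := by
  have cf := cont_of_deriv hf
  have : ∀ s, ∃ c, s ≠ a → ((a < s → c ∈ Ioo a s) ∧ (s < a → c ∈ Ioo s a) ∧ f' c = slope f a s) := by
    intro s
    rcases lt_trichotomy s a with h | h | h
    · obtain ⟨c, hc, e⟩ := mvt_eq h cf.continuousOn (fun x _ => hf x)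
      refine ⟨c, fun _ => ⟨fun h' => absurd h' (not_lt.2 h.le), fun _ => hc, ?_⟩⟩
      rw [slope_def_field, eq_div_iff (by linarith)]; linarith
    · exact ⟨0, fun h' => absurd h h'⟩
    · obtain ⟨c, hc, e⟩ := mvt_eq h cf.continuousOn (fun x _ => hf x)
      refine ⟨c, fun _ => ⟨fun _ => hc, fun h' => absurd h' (not_lt.2 h.le), ?_⟩⟩
      rw [slope_def_field, eq_div_iff (by linarith)]; linarith
  choose c hc using this
  refine ⟨c, fun s hs => (hc s hs.ne').1 hs, fun s hs => (hc s hs.ne).2.1 hs, ?_, ?_⟩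
  · refine (hasDerivAt_iff_tendsto_slope.1 (hf a)).congr' ?_
    filter_upwards [self_mem_nhdsWithin] with s hs
    exact ((hc s hs).2.2).symm
  · rw [tendsto_iff_dist_tendsto_zero]
    have h0 : Tendsto (fun s => dist s a) (nhdsWithin a {a}ᶜ) (nhds 0) :=
      (tendsto_iff_dist_tendsto_zero.1 tendsto_id).mono_left nhdsWithin_le_nhds
    refine squeeze_zero' (Eventually.of_forall fun _ => dist_nonneg) ?_ h0
    filter_upwards [self_mem_nhdsWithin] with s hs
    rw [Real.dist_eq, Real.dist_eq]
    rcases lt_or_gt_of_ne hs with h | h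
    · have := (hc s hs).2.1 h
      rw [abs_of_neg (by linarith [this.2]), abs_of_neg (by linarith)]; linarith [this.1]
    · have := (hc s hs).1 h
      rw [abs_of_pos (by linarith [this.1]), abs_of_pos (by linarith)]; linarith [this.2]

lemma glue {f f' Q q w : ℝ → ℝ} (hf : ∀ r, HasDerivAt f (f' r) r) (cw : Continuous w) (hQ : ∀ r, Q r = w r * f' r)
    {a b M : ℝ} (hM : ∀ r ∈ Ioo a b, HasDerivAt Q (q r) r ∧ |q r| ≤ M) {r : ℝ} (hr : r ∈ Ioo a b) :
    |Q r - Q a| ≤ M * (r - a) ∧ |Q r - Q b| ≤ M * (b - r) := by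
  have lip : ∀ s ∈ Ioo a b, |Q r - Q s| ≤ M * |r - s| := by
    intro s hs
    have := Convex.norm_image_sub_le_of_norm_hasDerivWithin_le (s := Ioo a b) (C := M)
      (fun x hx => (hM x hx).1.hasDerivWithinAt) (fun x hx => (hM x hx).2) (convex_Ioo a b) hs hr
    simpa [Real.norm_eq_abs] using this
  constructor
  · obtain ⟨c, hc, -, t1, t2⟩ := darboux_seq hf a
    have le : nhdsWithin a (Ioi a) ≤ nhdsWithin a {a}ᶜ := nhdsWithin_mono _ fun x hx => ne_of_gt hx
    have t3 : Tendsto (fun s => Q (c s)) (nhdsWithin a (Ioi a)) (nhds (Q a)) := by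
      simp only [hQ]
      exact (((cw.tendsto a).comp t2).mul t1).mono_left le
    have t4 := t2.mono_left le
    have : ∀ᶠ s in nhdsWithin a (Ioi a), |Q r - Q (c s)| ≤ M * |r - c s| := by
      filter_upwards [Ioo_mem_nhdsGT (hr.1.trans hr.2)] with s hs
      have := hc s hs.1
      exact lip _ ⟨this.1, this.2.trans hs.2⟩
    have := le_of_tendsto_of_tendsto ((tendsto_const_nhds.sub t3).abs) (((tendsto_const_nhds.sub t4).abs).const_mul M) this
    rwa [abs_of_pos (by linarith [hr.1] : 0 < r - a)] at this
  · obtain ⟨c, -, hc, t1, t2⟩ := darboux_seq hf b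
    have le : nhdsWithin b (Iio b) ≤ nhdsWithin b {b}ᶜ := nhdsWithin_mono _ fun x hx => ne_of_lt hx
    have t3 : Tendsto (fun s => Q (c s)) (nhdsWithin b (Iio b)) (nhds (Q b)) := by
      simp only [hQ]
      exact (((cw.tendsto b).comp t2).mul t1).mono_left le
    have t4 := t2.mono_left le
    have : ∀ᶠ s in nhdsWithin b (Iio b), |Q r - Q (c s)| ≤ M * |r - c s| := by
      filter_upwards [Ioo_mem_nhdsLT (hr.1.trans hr.2)] with s hs
      have := hc s hs.2
      exact lip _ ⟨hs.1.trans this.1, this.2⟩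
    have := le_of_tendsto_of_tendsto ((tendsto_const_nhds.sub t3).abs) (((tendsto_const_nhds.sub t4).abs).const_mul M) this
    rwa [abs_of_neg (by linarith [hr.2] : r - b < 0), neg_sub] at this

def Gt (n : ℕ) (W W1 : ℝ → ℝ) (ε l t : ℝ) : ℝ := if t < 1 then gf n W W1 ε l t else 0

structure Sol (n : ℕ) (W W1 : ℝ → ℝ) (ε l κ : ℝ) (ζ d : ℝ → ℝ) : Prop where
  hd : ∀ r, HasDerivAt ζ (d r) r
  mem : ∀ r, ζ r ∈ Icc (0:ℝ) 1
  anti : AntitoneOn ζ (Ici 0)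
  cQ : ContinuousOn (fun r => ε^2 * (r^(n-1) * d r)) (Ioi 0)
  dQ1 : ∀ r > 0, ζ r < 1 → HasDerivAt (fun r => ε^2 * (r^(n-1) * d r)) (r^(n-1) * (κ * Gt n W W1 ε l (ζ r))) r
  dQ : ∃ r1, ∀ r > 0, r ≠ r1 → HasDerivAt (fun r => ε^2 * (r^(n-1) * d r)) (r^(n-1) * (κ * Gt n W W1 ε l (ζ r))) r

lemma Sol_of_RM (hn : 2 ≤ n) (g : GW W W1 W2) (h0 : W1 0 = 0) {ε : ℝ} (hε : 0 < ε) {ζ d : ℝ → ℝ}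
    (rm : RM n W ε ζ d) : Sol n W W1 ε (lam n W ε ζ d) 1 ζ d := by
  set l := lam n W ε ζ d with hl
  have cζ := cont_of_deriv rm.hd
  have cg := g.cgf hn ε l
  set Q : ℝ → ℝ := fun r => ε^2 * (r^(n-1) * d r) with hQ
  have hQw : ∀ r, Q r = (ε^2 * r^(n-1)) * d r := fun r => by simp only [hQ]; ring
  have cw : Continuous fun r : ℝ => ε^2 * r^(n-1) := by fun_prop
  have d1 : ∀ r, ζ r = 1 → d r = 0 := fun r hr =>
    IsLocalMax.hasDerivAt_eq_zero (Eventually.of_forall fun s => by rw [hr]; exact (rm.mem s).2) (rm.hd r)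
  have d0 : ∀ r, ζ r = 0 → d r = 0 := fun r hr =>
    IsLocalMin.hasDerivAt_eq_zero (Eventually.of_forall fun s => by rw [hr]; exact (rm.mem s).1) (rm.hd r)
  have Q1 : ∀ r, ζ r = 1 → Q r = 0 := fun r hr => by simp [hQ, d1 r hr]
  have Q0 : ∀ r, ζ r = 0 → Q r = 0 := fun r hr => by simp [hQ, d0 r hr]
  have an : ∀ a b, 0 < a → a ≤ b → ζ b ≤ ζ a := fun a b ha hab => rm.anti (show 0 ≤ a from ha.le) (show 0 ≤ b from ha.le.trans hab) hab
  have Dint : ∀ r > 0, 0 < ζ r → ζ r < 1 → HasDerivAt Q (r^(n-1) * gf n W W1 ε l (ζ r)) r := by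
    intro r hr hr0 hr1
    have e1 : ∀ᶠ s in nhds r, 0 < s ∧ 0 < ζ s ∧ ζ s < 1 := by
      filter_upwards [lt_mem_nhds hr, cζ.continuousAt.eventually_const_lt hr0, cζ.continuousAt.eventually_lt_const hr1] with s h1 h2 h3
      exact ⟨h1, h2, h3⟩
    obtain ⟨η, hη, H⟩ := Metric.eventually_nhds_iff.1 e1
    have Ha := H (y := r - η/2) (by rw [Real.dist_eq]; rw [abs_of_neg] <;> linarith)
    have Hb := H (y := r + η/2) (by rw [Real.dist_eq]; rw [abs_of_pos] <;> linarith)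
    exact el_interior hn g hε rm Ha.1 (by linarith) Ha.2.2 Hb.2.1 r ⟨by linarith, by linarith⟩
  have gf0 : gf n W W1 ε l 0 = 0 := by simp [gf, h0, g.V1_zero]
  obtain ⟨Cg, hCg0, hCg⟩ : ∃ C, 0 ≤ C ∧ ∀ t ∈ Icc (0:ℝ) 1, |gf n W W1 ε l t| ≤ C * t := by
    obtain ⟨C1, hC1, H1⟩ := g.upW1 h0
    obtain ⟨C2, hC2, H2⟩ := g.upV1 h0 hn
    refine ⟨C1 + |ε*l| * C2, by positivity, fun t ht => ?_⟩
    have a1 := H1 t ht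
    have a2 := H2 t ht
    unfold gf
    rw [abs_div, abs_two]
    have a3 : |W1 t - ε * l * V1 n W t| ≤ |W1 t| + |ε*l| * |V1 n W t| := by
      rw [← abs_mul]; exact abs_sub _ _
    have a4 := mul_le_mul_of_nonneg_left a2 (abs_nonneg (ε*l))
    rw [div_le_iff₀ two_pos]
    nlinarith [abs_nonneg (W1 t), mul_nonneg (abs_nonneg (ε*l)) (abs_nonneg (V1 n W t))]
  have D0 : ∀ r > 0, ζ r = 0 → HasDerivAt Q 0 r := by
    intro r hr hr0
    rw [hasDerivAt_iff_isLittleO, Q0 r hr0]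
    have hb : ∀ᶠ s in nhds r, |Q s| ≤ (r^(n-1) * Cg) * ζ s * |s - r| := by
      have e1 : ∀ᶠ s in nhds r, ζ s < 1 := cζ.continuousAt.eventually_lt_const (by rw [hr0]; exact one_pos)
      filter_upwards [lt_mem_nhds hr, e1] with s hs hs1
      have hz := (rm.mem s).1
      rcases hz.eq_or_lt with h | h
      · rw [Q0 s h.symm]; simp; positivity
      · have hsr : s < r := by
          by_contra hh; push Not at hh
          have := an r s hr hh
          linarith
        obtain ⟨r', ⟨⟨hr'1, hr'2⟩, hr'3⟩, hmin⟩ := ((isCompact_Icc (a := s) (b := r)).inter_right (isClosed_singleton.preimage cζ : IsClosed (ζ ⁻¹' {0}))).exists_isLeast ⟨r, ⟨hsr.le, le_rfl⟩, hr0⟩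
        have hr'3 : ζ r' = 0 := hr'3
        have hsr' : s < r' := lt_of_le_of_ne hr'1 (fun h' => by rw [h', hr'3] at h; exact lt_irrefl _ h)
        have hpos : ∀ τ, s ≤ τ → τ < r' → 0 < ζ τ := fun τ h1 h2 => by
          refine lt_of_le_of_ne (rm.mem τ).1 fun h3 => ?_
          exact absurd (hmin ⟨⟨h1, h2.le.trans hr'2⟩, h3.symm⟩) (not_le.2 h2)
        -- work on (s - η, r')
        have hcl : ∀ τ ∈ Ioo s r', |Q τ - 0| ≤ (r^(n-1) * Cg) * ζ s * (r' - τ) := by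
          intro τ hτ
          rw [← Q0 r' hr'3]
          refine (glue rm.hd cw hQw (a := s) (b := r') (q := fun τ => τ^(n-1) * gf n W W1 ε l (ζ τ)) (fun σ hσ => ⟨Dint σ (hs.trans hσ.1) (hpos σ hσ.1.le hσ.2) (lt_of_le_of_lt (an s σ hs hσ.1.le) hs1), ?_⟩) hτ).2
          have hσ0 := hs.trans hσ.1
          have h5 : σ^(n-1) ≤ r^(n-1) := pow_le_pow_left₀ hσ0.le (hσ.2.le.trans hr'2) _
          have h6 := hCg _ (rm.mem σ)
          have h7 := an s σ hs hσ.1.le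
          rw [abs_mul, abs_of_pos (pow_pos hσ0 _), mul_assoc]
          refine mul_le_mul h5 (h6.trans (by gcongr)) (abs_nonneg _) (by positivity)
        have hQs : ContinuousAt Q s := (Dint s hs h hs1).continuousAt
        have : |Q s - 0| ≤ (r^(n-1) * Cg) * ζ s * (r' - s) := by
          have c1 : ContinuousWithinAt (fun τ => |Q τ - 0|) (Ioi s) s := ((hQs.sub continuousAt_const).abs).continuousWithinAt
          have c2 : ContinuousWithinAt (fun τ => (r^(n-1) * Cg) * ζ s * (r' - τ)) (Ioi s) s := by fun_prop
          refine le_of_tendsto_of_tendsto c1 c2 ?_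
          filter_upwards [Ioo_mem_nhdsGT hsr'] with τ hτ
          exact hcl τ hτ
        rw [sub_zero] at this
        refine this.trans (mul_le_mul_of_nonneg_left ?_ (by positivity))
        rw [abs_of_neg (by linarith)]; linarith
    rw [Asymptotics.isLittleO_iff]
    intro η hη
    have e2 : Tendsto (fun s => (r^(n-1) * Cg) * ζ s) (nhds r) (nhds 0) := by
      have := (cζ.tendsto r).const_mul (r^(n-1) * Cg)
      rwa [hr0, mul_zero] at this
    filter_upwards [hb, e2.eventually_lt_const hη] with s h1 h2
    simp only [smul_zero, sub_zero, Real.norm_eq_abs]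
    exact h1.trans (mul_le_mul_of_nonneg_right h2.le (abs_nonneg _))
  have Dall : ∀ r > 0, ζ r < 1 → HasDerivAt Q (r^(n-1) * (1 * Gt n W W1 ε l (ζ r))) r := by
    intro r hr h1
    rw [Gt, if_pos h1, one_mul]
    rcases (rm.mem r).1.eq_or_lt with h | h
    · rw [← h, gf0, mul_zero]; exact D0 r hr h.symm
    · exact Dint r hr h h1
  have lt1 : ∀ r, ζ r ≠ 1 → ζ r < 1 := fun r h => lt_of_le_of_ne (rm.mem r).2 h
  by_cases hex : ∃ r > 0, ζ r = 1
  · obtain ⟨x0, hx0, hx1⟩ := hex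
    obtain ⟨x, hx⟩ : ∃ x, ∀ r, x ≤ r → ζ r < 1 := by
      obtain ⟨e, -, he, -⟩ := orth_pair hn
      by_contra hcon
      push Not at hcon
      have hc : ∀ r, 0 ≤ r → ζ r = 1 := fun r hr => by
        obtain ⟨s, hs1, hs2⟩ := hcon r
        exact le_antisymm (rm.mem r).2 (hs2.trans (rm.anti hr (show 0 ≤ s from hr.trans hs1) hs1))
      have hi := rm.h1.intSq
      simp only [hc _ (norm_nonneg _)] at hi
      have := (integrable_const_iff (μ := (volume : Measure (En n))) (c := (1:ℝ)^2)).1 hi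
      rcases this with h | h
      · norm_num at h
      · have := h.measure_univ_lt_top
        rw [vol_univ hn] at this; exact lt_irrefl _ this
    have hcl : IsClosed (ζ ⁻¹' {1}) := isClosed_singleton.preimage cζ
    obtain ⟨r1, ⟨⟨hr1a, hr1b⟩, hr1⟩, hmax⟩ := ((isCompact_Icc (a := x0) (b := max x x0)).inter_right hcl).exists_isGreatest ⟨x0, ⟨le_rfl, le_max_right _ _⟩, hx1⟩
    have hr1 : ζ r1 = 1 := hr1
    have hr10 : 0 < r1 := hx0.trans_le hr1a
    have hgt : ∀ r, r1 < r → ζ r < 1 := fun r hr => by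
      by_contra hh
      have h1 : ζ r = 1 := le_antisymm (rm.mem r).2 (not_lt.1 hh)
      have h2 : r ≤ max x x0 := by
        by_contra h3; push Not at h3
        exact hh (hx r ((le_max_left _ _).trans h3.le))
      exact absurd (hmax ⟨⟨hr1a.trans hr.le, h2⟩, h1⟩) (not_le.2 hr)
    have hle : ∀ r, 0 < r → r ≤ r1 → ζ r = 1 := fun r h1 h2 =>
      le_antisymm (rm.mem r).2 (by rw [← hr1]; exact an r r1 h1 h2)
    have hD : ∀ r > 0, r ≠ r1 → HasDerivAt Q (r^(n-1) * (1 * Gt n W W1 ε l (ζ r))) r := by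
      intro r hr hne
      rcases lt_or_gt_of_ne hne with h | h
      · rw [hle r hr h.le, Gt, if_neg (lt_irrefl _), mul_zero, mul_zero]
        refine (hasDerivAt_const r (0:ℝ)).congr_of_eventuallyEq ?_
        filter_upwards [Ioo_mem_nhds hr h] with s hs
        exact Q1 s (hle s hs.1 hs.2.le)
      · exact Dall r hr (hgt r h)
    refine ⟨rm.hd, rm.mem, rm.anti, fun r hr => ?_, Dall, r1, hD⟩
    by_cases hne : r = r1
    · refine ContinuousAt.continuousWithinAt ?_
      have e1 : ∀ᶠ s in nhds r1, 0 < ζ s := cζ.continuousAt.eventually_const_lt (by rw [hr1]; exact one_pos)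
      obtain ⟨η, hη, H⟩ := Metric.eventually_nhds_iff.1 e1
      have hb : ∀ s ∈ Ioo 0 (r1+η), |Q s - Q r1| ≤ ((r1+η)^(n-1) * Cg) * |s - r1| := by
        intro s hs
        rcases le_or_gt s r1 with h | h
        · rw [Q1 s (hle s hs.1 h), Q1 r1 hr1]; simp; positivity
        · rw [abs_of_pos (by linarith : 0 < s - r1)]
          refine (glue rm.hd cw hQw (a := r1) (b := r1+η) (q := fun τ => τ^(n-1) * gf n W W1 ε l (ζ τ)) (fun σ hσ => ⟨?_, ?_⟩) ⟨h, hs.2⟩).1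
          · exact Dint σ (hr10.trans hσ.1) (H (by rw [Real.dist_eq, abs_of_pos] <;> linarith [hσ.1, hσ.2])) (hgt σ hσ.1)
          · have hσ0 := hr10.trans hσ.1
            have h5 : σ^(n-1) ≤ (r1+η)^(n-1) := pow_le_pow_left₀ hσ0.le hσ.2.le _
            have h6 := hCg _ (rm.mem σ)
            rw [abs_mul, abs_of_pos (pow_pos hσ0 _)]
            refine mul_le_mul h5 (h6.trans ?_) (abs_nonneg _) (by positivity)
            have := (rm.mem σ).2
            nlinarith
      rw [hne, ContinuousAt, tendsto_iff_dist_tendsto_zero]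
      have e3 : Tendsto (fun s => ((r1+η)^(n-1) * Cg) * |s - r1|) (nhds r1) (nhds 0) := by
        have : Continuous fun s => ((r1+η)^(n-1) * Cg) * |s - r1| := by fun_prop
        simpa using this.tendsto r1
      refine squeeze_zero' (Eventually.of_forall fun _ => dist_nonneg) ?_ e3
      filter_upwards [Ioo_mem_nhds hr10 (by linarith : r1 < r1 + η)] with s hs
      exact hb s hs
    · exact (hD r hr hne).continuousAt.continuousWithinAt
  · push Not at hex
    exact ⟨rm.hd, rm.mem, rm.anti, fun r hr => (Dall r hr (lt1 r (hex r hr))).continuousAt.continuousWithinAt, Dall, 0,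
      fun r hr _ => Dall r hr (lt1 r (hex r hr))⟩

lemma Sol.scale {ε l : ℝ} {ζ d : ℝ → ℝ} (h : Sol n W W1 ε l 1 ζ d) {μ : ℝ} (hμ : 0 < μ) :
    Sol n W W1 ε l (μ^2) (fun r => ζ (μ * r)) (fun r => μ * d (μ * r)) := by
  have hdm : ∀ r : ℝ, HasDerivAt (fun r => μ * r) μ r := fun r => by simpa using (hasDerivAt_id r).const_mul μ
  have hQ : (fun r => ε^2 * (r^(n-1) * (μ * d (μ * r)))) = fun r => (μ / μ^(n-1)) * (ε^2 * ((μ*r)^(n-1) * d (μ * r))) := by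
    ext r; rw [mul_pow]; field_simp
  obtain ⟨r1, hr1⟩ := h.dQ
  refine ⟨fun r => ?_, fun r => h.mem _, fun a ha b hb hab => ?_, ?_, fun r hr hne => ?_, r1/μ, fun r hr hne => ?_⟩
  · exact ((h.hd (μ * r)).comp r (hdm r)).congr_deriv (by ring)
  · exact h.anti (show 0 ≤ μ * a from mul_nonneg hμ.le ha) (show 0 ≤ μ * b from mul_nonneg hμ.le hb) (by gcongr)
  · rw [hQ]
    refine continuousOn_const.mul (h.cQ.comp (f := fun r => μ * r) (by fun_prop) fun r hr => mul_pos hμ hr)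
  · rw [hQ]
    have := ((h.dQ1 (μ * r) (by positivity) hne).comp r (hdm r)).const_mul (μ / μ^(n-1))
    refine this.congr_deriv ?_
    rw [mul_pow]; field_simp
  · rw [hQ]
    have := ((hr1 (μ * r) (by positivity) (fun e => hne (by rw [← e]; field_simp))).comp r (hdm r)).const_mul (μ / μ^(n-1))
    refine this.congr_deriv ?_
    rw [mul_pow]; field_simp

variable {n : ℕ} {W W1 W2 : ℝ → ℝ} {u v : En n → ℝ}

lemma GW.mGt (g : GW W W1 W2) (hn : 2 ≤ n) (ε l : ℝ) : Measurable (Gt n W W1 ε l) := by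
  unfold Gt
  exact Measurable.ite (measurableSet_lt measurable_id measurable_const) (g.cgf hn ε l).measurable measurable_const

/-- universal bound for Gt -/
lemma GW.Gt_bd (g : GW W W1 W2) (h0 : W1 0 = 0) (hn : 2 ≤ n) (C0 : ℝ) : ∃ M, 1 ≤ M ∧ ∀ ε l, |ε * l| ≤ C0 →
    ∀ t ∈ Icc (0:ℝ) 1, |Gt n W W1 ε l t| ≤ M * t := by
  obtain ⟨C1, hC1, H1⟩ := g.upW1 h0
  obtain ⟨C2, hC2, H2⟩ := g.upV1 h0 hn
  refine ⟨C1 + |C0| * C2, by nlinarith [abs_nonneg C0], fun ε l hl t ht => ?_⟩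
  have a1 := H1 t ht
  have a2 := H2 t ht
  unfold Gt
  split_ifs
  · unfold gf
    rw [abs_div, abs_two]
    have a3 : |W1 t - ε * l * V1 n W t| ≤ |W1 t| + |ε*l| * |V1 n W t| := by
      rw [← abs_mul]; exact abs_sub _ _
    have a4 : |ε*l| * |V1 n W t| ≤ |C0| * (C2 * t) := mul_le_mul (hl.trans (le_abs_self _)) a2 (abs_nonneg _) (abs_nonneg _)
    rw [div_le_iff₀ two_pos]
    nlinarith [abs_nonneg (W1 t), mul_nonneg (abs_nonneg (ε*l)) (abs_nonneg (V1 n W t))]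
  · rw [abs_zero]; have := ht.1; positivity

namespace Sol
variable {ε l κ : ℝ} {ζ d : ℝ → ℝ}

lemma ib (hn : 2 ≤ n) (g : GW W W1 W2) (h0 : W1 0 = 0) (h : Sol n W W1 ε l κ ζ d) (a b : ℝ) :
    IntervalIntegrable (fun r => r^(n-1) * (κ * Gt n W W1 ε l (ζ r))) volume a b := by
  obtain ⟨M, hM1, hM⟩ := g.Gt_bd h0 hn (|ε * l|)
  have m1 : Measurable fun r => κ * Gt n W W1 ε l (ζ r) := by
    have := (g.mGt hn ε l).comp (cont_of_deriv h.hd).measurable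
    exact this.const_mul κ
  have : IntervalIntegrable (fun r => κ * Gt n W W1 ε l (ζ r)) volume a b := by
    refine (intervalIntegrable_const (c := |κ| * M)).mono_fun m1.aestronglyMeasurable (ae_of_all _ fun r => ?_)
    have h1 := hM ε l le_rfl _ (h.mem r)
    have h2 := (h.mem r).2
    show ‖κ * Gt n W W1 ε l (ζ r)‖ ≤ ‖|κ| * M‖
    rw [Real.norm_eq_abs, Real.norm_eq_abs, abs_mul κ (Gt n W W1 ε l (ζ r)), abs_of_nonneg (by positivity : 0 ≤ |κ| * M)]
    refine mul_le_mul_of_nonneg_left (h1.trans (by nlinarith)) (abs_nonneg _)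
  exact this.continuousOn_mul (by fun_prop)

lemma ftc_pos (hn : 2 ≤ n) (g : GW W W1 W2) (h0 : W1 0 = 0) (h : Sol n W W1 ε l κ ζ d) {a b : ℝ} (ha : 0 < a) (hab : a ≤ b) :
    ∫ r in a..b, r^(n-1) * (κ * Gt n W W1 ε l (ζ r)) = ε^2 * (b^(n-1) * d b) - ε^2 * (a^(n-1) * d a) := by
  obtain ⟨r1, hr1⟩ := h.dQ
  exact MeasureTheory.integral_eq_of_hasDerivAt_off_countable_of_le (fun r => ε^2 * (r^(n-1) * d r)) _ hab (countable_singleton r1)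
    (h.cQ.mono fun r hr => ha.trans_le hr.1) (fun r hr => hr1 r (ha.trans hr.1.1) hr.2) (h.ib hn g h0 a b)

lemma lip_pos (hn : 2 ≤ n) (g : GW W W1 W2) (h0 : W1 0 = 0) (h : Sol n W W1 ε l κ ζ d) {a b M : ℝ} (ha : 0 < a) (hab : a ≤ b)
    (hM0 : 0 ≤ M) (hM : ∀ t ∈ Icc (0:ℝ) 1, |κ * Gt n W W1 ε l t| ≤ M) :
    |ε^2 * (b^(n-1) * d b) - ε^2 * (a^(n-1) * d a)| ≤ M * b^(n-1) * (b - a) := by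
  rw [← h.ftc_pos hn g h0 ha hab]
  have := intervalIntegral.norm_integral_le_of_norm_le_const (a := a) (b := b) (C := M * b^(n-1)) (f := fun r => r^(n-1) * (κ * Gt n W W1 ε l (ζ r))) (fun r hr => ?_)
  · rwa [abs_of_nonneg (by linarith : 0 ≤ b - a)] at this
  · rw [uIoc_of_le hab] at hr
    have hr0 : 0 < r := ha.trans hr.1
    rw [norm_mul, Real.norm_eq_abs, Real.norm_eq_abs, abs_of_pos (pow_pos hr0 _), mul_comm]
    exact mul_le_mul (hM _ (h.mem r)) (pow_le_pow_left₀ hr0.le hr.2 _) (by positivity) hM0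

lemma lip (hn : 2 ≤ n) (g : GW W W1 W2) (h0 : W1 0 = 0) (h : Sol n W W1 ε l κ ζ d) {a b M : ℝ} (ha : 0 ≤ a) (hab : a ≤ b)
    (hM0 : 0 ≤ M) (hM : ∀ t ∈ Icc (0:ℝ) 1, |κ * Gt n W W1 ε l t| ≤ M) :
    |ε^2 * (b^(n-1) * d b) - ε^2 * (a^(n-1) * d a)| ≤ M * b^(n-1) * (b - a) := by
  rcases ha.eq_or_lt with e | ha
  · subst e
    rcases hab.eq_or_lt with e | hb
    · subst e; simp
    obtain ⟨c, hc, -, t1, t2⟩ := darboux_seq h.hd 0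
    have le : nhdsWithin (0:ℝ) (Ioi 0) ≤ nhdsWithin 0 {0}ᶜ := nhdsWithin_mono _ fun x hx => ne_of_gt hx
    have t3 := (((t2.pow (n-1)).mul t1).const_mul (ε^2)).mono_left le
    have t4 := t2.mono_left le
    refine le_of_tendsto_of_tendsto ((tendsto_const_nhds.sub t3).abs) ((tendsto_const_nhds.sub t4).const_mul (M * b^(n-1))) ?_
    filter_upwards [Ioo_mem_nhdsGT hb] with s hs
    have := hc s hs.1
    exact h.lip_pos hn g h0 this.1 (this.2.le.trans hs.2.le) hM0 hM
  · exact h.lip_pos hn g h0 ha hab hM0 hM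

lemma cQ0 (hn : 2 ≤ n) (g : GW W W1 W2) (h0 : W1 0 = 0) (h : Sol n W W1 ε l κ ζ d) :
    ContinuousOn (fun r => ε^2 * (r^(n-1) * d r)) (Ici 0) := by
  intro r hr
  rcases (show (0:ℝ) ≤ r from hr).eq_or_lt with e | hr
  · subst e
    obtain ⟨M, hM1, hM⟩ := g.Gt_bd h0 hn (|ε * l|)
    have hM2 : ∀ t ∈ Icc (0:ℝ) 1, |κ * Gt n W W1 ε l t| ≤ |κ| * M := fun t ht => by
      rw [abs_mul]
      exact mul_le_mul_of_nonneg_left ((hM ε l le_rfl t ht).trans (by nlinarith [ht.1, ht.2])) (abs_nonneg _)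
    rw [ContinuousWithinAt, tendsto_iff_dist_tendsto_zero]
    have e3 : Tendsto (fun s : ℝ => |κ| * M * s^(n-1) * (s - 0)) (nhdsWithin 0 (Ici 0)) (nhds 0) := by
      have : Continuous fun s : ℝ => |κ| * M * s^(n-1) * (s - 0) := by fun_prop
      simpa using (this.tendsto 0).mono_left nhdsWithin_le_nhds
    refine squeeze_zero' (Eventually.of_forall fun _ => dist_nonneg) ?_ e3
    filter_upwards [self_mem_nhdsWithin] with s hs
    exact h.lip hn g h0 le_rfl hs (by positivity) hM2
  · exact (h.cQ.continuousAt (Ioi_mem_nhds hr)).continuousWithinAt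

lemma ftc (hn : 2 ≤ n) (g : GW W W1 W2) (h0 : W1 0 = 0) (h : Sol n W W1 ε l κ ζ d) {a b : ℝ} (ha : 0 ≤ a) (hab : a ≤ b) :
    ∫ r in a..b, r^(n-1) * (κ * Gt n W W1 ε l (ζ r)) = ε^2 * (b^(n-1) * d b) - ε^2 * (a^(n-1) * d a) := by
  obtain ⟨r1, hr1⟩ := h.dQ
  exact MeasureTheory.integral_eq_of_hasDerivAt_off_countable_of_le (fun r => ε^2 * (r^(n-1) * d r)) _ hab (countable_singleton r1)
    ((h.cQ0 hn g h0).mono fun r hr => ha.trans hr.1) (fun r hr => hr1 r (ha.trans_lt hr.1.1) hr.2) (h.ib hn g h0 a b)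

lemma d_nonpos (h : Sol n W W1 ε l κ ζ d) {r : ℝ} (hr : 0 < r) : d r ≤ 0 := by
  by_contra hc; push Not at hc
  have h1 := (hasDerivAt_iff_tendsto_slope.1 (h.hd r)).mono_left (nhdsWithin_mono r (fun x (hx : x ∈ Ioi r) => ne_of_gt hx))
  have h2 : ∀ᶠ s in nhdsWithin r (Ioi r), slope ζ r s ≤ 0 := by
    filter_upwards [self_mem_nhdsWithin] with s hs
    have hs : r < s := hs
    rw [slope_def_field]
    exact div_nonpos_of_nonpos_of_nonneg (by linarith [h.anti (show 0 ≤ r from hr.le) (show 0 ≤ s from hr.le.trans hs.le) hs.le]) (by linarith)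
  linarith [le_of_tendsto h1 h2]

/-- gradient bound -/
lemma grad_bd (hn : 2 ≤ n) (g : GW W W1 W2) (h0 : W1 0 = 0) (h : Sol n W W1 ε l κ ζ d) (hε : 0 < ε) (hε1 : ε ≤ 1) {M ra rb : ℝ} (hra : 0 < ra)
    (hM0 : 0 ≤ M) (hM : ∀ t ∈ Icc (0:ℝ) 1, |κ * Gt n W W1 ε l t| ≤ M) {r : ℝ} (hr : r ∈ Icc ra rb) :
    |ε * d r| ≤ (1 + M) * (rb + 1)^(n-1) / ra^(n-1) := by
  obtain ⟨c, hc, e⟩ := mvt_eq (by linarith : r < r + ε) (cont_of_deriv h.hd).continuousOn (fun x _ => h.hd x)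
  have hr0 : 0 < r := hra.trans_le hr.1
  have h1 : |ε * d c| ≤ 1 := by
    have : ε * d c = ζ (r+ε) - ζ r := by rw [e]; ring
    rw [this, abs_le]
    constructor <;> linarith [(h.mem r).1, (h.mem r).2, (h.mem (r+ε)).1, (h.mem (r+ε)).2]
  have h2 := h.lip_pos hn g h0 hr0 hc.1.le hM0 hM
  have h3 : c^(n-1) ≤ (rb+1)^(n-1) := pow_le_pow_left₀ (hr0.trans hc.1).le (by linarith [hc.2, hr.2]) _
  have h4 : ra^(n-1) ≤ r^(n-1) := pow_le_pow_left₀ hra.le hr.1 _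
  have hp := pow_pos hra (n-1)
  have hc0 : 0 < c^(n-1) := pow_pos (hr0.trans hc.1) _
  have h5 : ε * (r^(n-1) * |ε * d r|) ≤ ε * ((1 + M) * (rb+1)^(n-1)) := by
    have e1 : ε * (r^(n-1) * |ε * d r|) = |ε^2 * (r^(n-1) * d r)| := by
      rw [show ε^2 * (r^(n-1) * d r) = ε * (r^(n-1) * (ε * d r)) by ring, abs_mul ε (r^(n-1) * (ε * d r)), abs_mul (r^(n-1)) (ε * d r), abs_of_pos hε, abs_of_pos (pow_pos hr0 _)]
    have e2 : ε * (c^(n-1) * |ε * d c|) = |ε^2 * (c^(n-1) * d c)| := by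
      rw [show ε^2 * (c^(n-1) * d c) = ε * (c^(n-1) * (ε * d c)) by ring, abs_mul ε (c^(n-1) * (ε * d c)), abs_mul (c^(n-1)) (ε * d c), abs_of_pos hε, abs_of_pos hc0]
    rw [e1]
    have e3 : |ε^2 * (r^(n-1) * d r)| ≤ |ε^2 * (c^(n-1) * d c)| + M * c^(n-1) * (c - r) := by
      have := abs_sub_abs_le_abs_sub (ε^2 * (r^(n-1) * d r)) (ε^2 * (c^(n-1) * d c))
      rw [abs_sub_comm] at this; linarith
    rw [← e2] at e3
    have e4 : M * c^(n-1) * (c - r) ≤ M * (rb+1)^(n-1) * ε := by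
      apply mul_le_mul
      · gcongr
      · linarith [hc.2]
      · linarith [hc.1]
      · have := hc0.le.trans h3; positivity
    have e5 : c^(n-1) * |ε * d c| ≤ (rb+1)^(n-1) * 1 := mul_le_mul h3 h1 (abs_nonneg _) (hc0.le.trans h3)
    have e6 := mul_le_mul_of_nonneg_left e5 hε.le
    nlinarith
  have h6 := le_of_mul_le_mul_left h5 hε
  rw [le_div_iff₀ hp, mul_comm]
  exact (mul_le_mul_of_nonneg_right h4 (abs_nonneg _)).trans h6

end Sol

variable {n : ℕ} {W W1 W2 : ℝ → ℝ} {u v : En n → ℝ}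

lemma exists_R (hn : 2 ≤ n) : ∃ R : ℝ, 0 < R ∧ Asph n * (R^n / n) = 1 := by
  have hb := ballVol_pos n
  have hn0 : (n:ℝ) ≠ 0 := by positivity
  refine ⟨(1 / ballVol n) ^ ((1:ℝ)/n), by positivity, ?_⟩
  rw [← Real.rpow_natCast, ← Real.rpow_mul (by positivity), one_div_mul_cancel hn0, Real.rpow_one]
  unfold Asph; field_simp

/-- A bounded function supported in a shell. -/
lemma shell {N : ℕ} {φ : ℝ → ℝ} (mφ : Measurable φ) {a T B : ℝ} (ha : 0 ≤ a) (haT : a ≤ T) (hB : ∀ r, 0 ≤ φ r ∧ φ r ≤ B)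
    (hz : ∀ r, r ∉ Ioc a T → φ r = 0) : IntegrableOn (fun r => r^N * φ r) (Ioi 0) ∧
    ∫ r in Ioi (0:ℝ), r^N * φ r ≤ T^N * B * (T - a) := by
  have hB0 : 0 ≤ B := (hB 0).1.trans (hB 0).2
  have hT : 0 ≤ T := ha.trans haT
  have hle : ∀ r ∈ Ioi (0:ℝ), r^N * φ r ≤ (Ioc a T).indicator (fun _ => T^N * B) r := fun r hr => by
    have hr : 0 < r := hr
    by_cases h : r ∈ Ioc a T
    · rw [indicator_of_mem h]
      exact mul_le_mul (pow_le_pow_left₀ hr.le h.2 _) (hB r).2 (hB r).1 (by positivity)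
    · rw [indicator_of_notMem h, hz r h]; simp
  have hi : IntegrableOn ((Ioc a T).indicator (fun _ => T^N * B)) (Ioi 0) := by
    apply Integrable.integrableOn
    rw [integrable_indicator_iff measurableSet_Ioc]
    exact integrableOn_const (by simp)
  have h1 : IntegrableOn (fun r => r^N * φ r) (Ioi 0) := by
    refine hi.mono' ((measurable_id.pow_const N).mul mφ).aestronglyMeasurable ?_
    refine (ae_restrict_iff' measurableSet_Ioi).2 (ae_of_all _ fun r hr => ?_)
    rw [Real.norm_of_nonneg (mul_nonneg (pow_nonneg (le_of_lt hr) _) (hB r).1)]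
    exact hle r hr
  refine ⟨h1, (setIntegral_mono_on h1 hi measurableSet_Ioi hle).trans ?_⟩
  rw [setIntegral_indicator measurableSet_Ioc, inter_eq_right.2 (show Ioc a T ⊆ Ioi 0 from fun r hr => ha.trans_lt hr.1)]
  simp [haT]; nlinarith

def qf (s : ℝ) : ℝ := max (1 - max s 0 ^ 2) 0 ^ 2
def qd (s : ℝ) : ℝ := 2 * max (1 - max s 0 ^ 2) 0 * (-(2 * max s 0))

lemma qf_deriv (s : ℝ) : HasDerivAt qf (qd s) s := by
  have h1 := (hasDerivAt_max_pow 0 s).const_sub 1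
  have h2 := (hasDerivAt_max_pow 0 (1 - max s 0 ^ 2)).comp s h1
  refine h2.congr_deriv ?_
  simp [qd]

lemma qf_le (s : ℝ) (hs : s ≤ 0) : qf s = 1 := by simp [qf, max_eq_right hs]
lemma qf_ge (s : ℝ) (hs : 1 ≤ s) : qf s = 0 := by
  rw [qf, max_eq_left (by linarith : 0 ≤ s), max_eq_right (by nlinarith)]; simp
lemma qd_le (s : ℝ) (hs : s ≤ 0) : qd s = 0 := by simp [qd, max_eq_right hs]
lemma qd_ge (s : ℝ) (hs : 1 ≤ s) : qd s = 0 := by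
  rw [qd, max_eq_left (by linarith : 0 ≤ s), max_eq_right (by nlinarith)]; simp
lemma qf_mem (s : ℝ) : qf s ∈ Icc (0:ℝ) 1 := by
  refine ⟨by unfold qf; positivity, ?_⟩
  unfold qf
  have : max (1 - max s 0 ^ 2) 0 ≤ 1 := max_le (by nlinarith [sq_nonneg (max s 0)]) zero_le_one
  have h0 : 0 ≤ max (1 - max s 0 ^ 2) 0 := le_max_right _ _
  nlinarith
lemma qd_bd (s : ℝ) : qd s ^ 2 ≤ 16 := by
  rcases le_or_gt 1 s with h | h
  · rw [qd_ge s h]; norm_num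
  have h1 : max (1 - max s 0 ^ 2) 0 ≤ 1 := max_le (by nlinarith [sq_nonneg (max s 0)]) zero_le_one
  have h0 : 0 ≤ max (1 - max s 0 ^ 2) 0 := le_max_right _ _
  have h2 : max s 0 ≤ 1 := max_le h.le zero_le_one
  have h3 : 0 ≤ max s 0 := le_max_right _ _
  have h4 : max (1 - max s 0 ^ 2) 0 * max s 0 ≤ 1 := mul_le_one₀ h1 h3 h2
  have h5 := mul_nonneg h0 h3
  unfold qd
  nlinarith
lemma qd_meas : Measurable qd := by unfold qd; fun_prop

lemma psi_bound (hn : 2 ≤ n) (g : GW W W1 W2) (h0 : W1 0 = 0) : ∃ C0 : ℝ, 1 ≤ C0 ∧ ∀ ε, 0 < ε → ε ≤ 1 → Psi n W ε 1 ≤ C0 := by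
  obtain ⟨R, hR, hRn⟩ := exists_R hn
  obtain ⟨C, hC, hW⟩ := g.upW h0
  have hA := Asph_pos hn
  refine ⟨1 + Asph n * ((R+1)^(n-1) * 16) + Asph n * ((R+1)^(n-1) * C), by nlinarith [show 0 ≤ Asph n * ((R+1)^(n-1) * 16) by positivity, show 0 ≤ Asph n * ((R+1)^(n-1) * C) by positivity], fun ε hε hε1 => ?_⟩
  set f : ℝ → ℝ := fun r => qf ((r - R)/ε) with hf
  set d : ℝ → ℝ := fun r => qd ((r - R)/ε) * (1/ε) with hd
  have hfd : ∀ r, HasDerivAt f (d r) r := fun r => by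
    have h1 : HasDerivAt (fun r : ℝ => (r - R)/ε) (1/ε) r := ((hasDerivAt_id r).sub_const R).div_const ε
    exact (qf_deriv _).comp r h1
  have fm : ∀ r, f r ∈ Icc (0:ℝ) 1 := fun r => qf_mem _
  have f1 : ∀ r, r ≤ R → f r = 1 := fun r hr => qf_le _ (div_nonpos_of_nonpos_of_nonneg (by linarith) hε.le)
  have f0 : ∀ r, R + ε ≤ r → f r = 0 := fun r hr => qf_ge _ (by rw [le_div_iff₀ hε]; linarith)
  have d1 : ∀ r, r ≤ R → d r = 0 := fun r hr => by
    simp only [hd]; rw [qd_le _ (div_nonpos_of_nonpos_of_nonneg (by linarith) hε.le), zero_mul]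
  have d0 : ∀ r, R + ε ≤ r → d r = 0 := fun r hr => by
    simp only [hd]; rw [qd_ge _ (by rw [le_div_iff₀ hε]; linarith), zero_mul]
  have cf : Continuous f := cont_of_deriv hfd
  have md : Measurable d := by
    exact (qd_meas.comp (by fun_prop : Measurable fun r : ℝ => (r - R)/ε)).mul_const _
  have out : ∀ r, r ∉ Ioc R (R+ε) → r ≤ R ∨ R + ε ≤ r := fun r hr => by
    by_contra hc; push Not at hc; exact hr ⟨hc.1, hc.2.le⟩
  have sD := shell (N := n-1) (φ := fun r => d r^2) (md.pow_const 2) (a := R) (T := R+ε) (B := 16 * (1/ε)^2) hR.le (by linarith)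
    (fun r => ⟨sq_nonneg _, by simp only [hd]; rw [mul_pow]; exact mul_le_mul_of_nonneg_right (qd_bd _) (sq_nonneg _)⟩)
    (fun r hr => by rcases out r hr with h | h; · simp [d1 r h]
                    · simp [d0 r h])
  have sW := shell (N := n-1) (φ := fun r => W (f r)) (g.cW.comp cf).measurable (a := R) (T := R+ε) (B := C) hR.le (by linarith)
    (fun r => ⟨g.nonneg (fm r), (hW _ (fm r)).trans (by nlinarith [pow_le_one₀ (fm r).1 (fm r).2 (n := 2)])⟩)
    (fun r hr => by rcases out r hr with h | h; · simp [f1 r h, g.one]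
                    · simp [f0 r h, g.zero])
  have sV := shell (N := n-1) (φ := fun r => if 0 < r then Vpot n W (f r) else 0)
    (Measurable.ite measurableSet_Ioi ((g.cV hn).comp cf).measurable measurable_const) (a := 0) (T := R+ε) (B := 1) le_rfl (by linarith)
    (fun r => by
      split_ifs
      · exact g.V_mem hn (fm r)
      · simp)
    (fun r hr => by
      split_ifs with h
      · rw [f0 r (by by_contra hc; exact hr ⟨h, by linarith⟩), GW.V_zero hn]
      · rfl)
  have sS := shell (N := n-1) (φ := fun r => if 0 < r then f r^2 else 0)
    (Measurable.ite measurableSet_Ioi (cf.pow 2).measurable measurable_const) (a := 0) (T := R+ε) (B := 1) le_rfl (by linarith)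
    (fun r => by
      split_ifs
      · exact ⟨sq_nonneg _, by nlinarith [(fm r).1, (fm r).2]⟩
      · simp)
    (fun r hr => by
      split_ifs with h
      · rw [f0 r (by by_contra hc; exact hr ⟨h, by linarith⟩)]; simp
      · rfl)
  have iV : IntegrableOn (fun r => r^(n-1) * Vpot n W (f r)) (Ioi 0) := sV.1.congr_fun (fun r (hr : 0 < r) => by simp [hr]) measurableSet_Ioi
  have iS : IntegrableOn (fun r => r^(n-1) * f r^2) (Ioi 0) := sS.1.congr_fun (fun r (hr : 0 < r) => by simp [hr]) measurableSet_Ioi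
  have hrad := rad_D hn (f := f) (d := d) (fun r _ => hfd r)
  have hdiff : Differentiable ℝ (fun x : En n => f ‖x‖) := fun x => by
    by_cases hx : x = 0
    · have : (fun x : En n => f ‖x‖) =ᶠ[nhds x] fun _ => 1 := by
        filter_upwards [Metric.ball_mem_nhds x hR] with y hy
        rw [hx, mem_ball_zero_iff] at hy
        exact f1 _ hy.le
      exact this.differentiableAt_iff.2 (differentiableAt_const _)
    · exact (hfd _).differentiableAt.comp x (DifferentiableAt.norm ℝ differentiableAt_id hx)
  have hb : H1Box n (fun x => f ‖x‖) := H1Box.mk' (fun x => fm _) hdiff ((rad_integrable hn).2 iS)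
    (((rad_integrable hn (f := fun r => d r^2)).2 sD.1).congr hrad.symm)
  have hm : 1 ≤ ∫ x : En n, Vpot n W (f ‖x‖) := by
    rw [rad_int hn (fun r => Vpot n W (f r)), ← hRn]
    refine mul_le_mul_of_nonneg_left ?_ hA.le
    have e : ∫ r in Ioc 0 R, r^(n-1) * Vpot n W (f r) = R^n/n := by
      rw [setIntegral_congr_fun (g := fun r => r^(n-1)) measurableSet_Ioc (fun r hr => by simp [f1 r hr.2, g.V_one]), ← intervalIntegral.integral_of_le hR.le, integral_pow]
      have : n - 1 + 1 = n := by omega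
      rw [this, zero_pow (by omega)]
      have h3 : ((n-1:ℕ):ℝ) + 1 = n := by exact_mod_cast this
      rw [h3]; ring
    rw [← e]
    refine setIntegral_mono_set iV ?_ (Ioc_subset_Ioi_self.eventuallyLE)
    refine (ae_restrict_iff' measurableSet_Ioi).2 (ae_of_all _ fun r hr => ?_)
    exact mul_nonneg (pow_nonneg (le_of_lt hr) _) (g.V_mem hn (fm r)).1
  have h1 := Psi_min hn g hε hb
  rw [min_eq_left hm, mul_one] at h1
  refine h1.trans ?_
  unfold AC
  rw [integral_congr_ae hrad, rad_int hn (fun r => d r^2), rad_int hn (fun r => W (f r))]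
  have hp : (R+ε)^(n-1) ≤ (R+1)^(n-1) := pow_le_pow_left₀ (by linarith) (by linarith) _
  have a1 : ε * (Asph n * ∫ r in Ioi (0:ℝ), r^(n-1) * d r^2) ≤ Asph n * ((R+1)^(n-1) * 16) := by
    calc _ ≤ ε * (Asph n * ((R+ε)^(n-1) * (16 * (1/ε)^2) * (R + ε - R))) := by gcongr; exact sD.2
      _ = Asph n * ((R+ε)^(n-1) * 16) := by field_simp; ring
      _ ≤ _ := by gcongr
  have a2 : ε⁻¹ * (Asph n * ∫ r in Ioi (0:ℝ), r^(n-1) * W (f r)) ≤ Asph n * ((R+1)^(n-1) * C) := by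
    calc _ ≤ ε⁻¹ * (Asph n * ((R+ε)^(n-1) * C * (R + ε - R))) := by gcongr; exact sW.2
      _ = Asph n * ((R+ε)^(n-1) * C) := by field_simp; ring
      _ ≤ _ := by gcongr
  linarith

variable {n : ℕ} {W W1 W2 : ℝ → ℝ} {u v : En n → ℝ}

lemma int_pow_Ioc (hn : 2 ≤ n) {r : ℝ} (hr : 0 ≤ r) : ∫ s in Ioc 0 r, s^(n-1) = r^n/n := by
  rw [← intervalIntegral.integral_of_le hr, integral_pow]
  have : n - 1 + 1 = n := by omega
  rw [this, zero_pow (by omega)]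
  have h3 : ((n-1:ℕ):ℝ) + 1 = n := by exact_mod_cast this
  rw [h3]; ring

lemma pow_gap (hn : 2 ≤ n) {a b : ℝ} (ha : 0 ≤ a) (hab : a ≤ b) {m : ℝ} (hm : 0 ≤ m) (hmb : m ≤ b) : m^(n-1) * (b - a) ≤ b^n - a^n := by
  have e : ∀ t : ℝ, t^n = t^(n-1) * t := fun t => by rw [← pow_succ]; congr 1; omega
  rw [e, e]
  have h1 : m^(n-1) ≤ b^(n-1) := pow_le_pow_left₀ hm hmb _
  have h2 : a^(n-1) ≤ b^(n-1) := pow_le_pow_left₀ ha hab _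
  nlinarith

lemma nn_int {f : ℝ → ℝ} (hf : ∀ r > 0, 0 ≤ f r) {N : ℕ} : 0 ≤ ∫ r in Ioi (0:ℝ), r^N * f r :=
  setIntegral_nonneg measurableSet_Ioi fun r (hr : 0 < r) => mul_nonneg (pow_nonneg hr.le _) (hf r hr)

lemma GW.sq_le (g : GW W W1 W2) (hn : 2 ≤ n) : ∃ C : ℝ, 0 < C ∧ ∀ t ∈ Icc (0:ℝ) 1, t^2 ≤ C * (W t + Vpot n W t) := by
  obtain ⟨δ, c, hδ, hδ4, hc, -, -, H⟩ := g.bot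
  have hV := g.V_pos (n := n) hδ (by linarith)
  refine ⟨1/c + 1/Vpot n W δ, by positivity, fun t ht => ?_⟩
  have hW := g.nonneg ht
  have hV0 := (g.V_mem hn ht).1
  rcases le_or_gt t δ with h | h
  · have h1 := H t ⟨ht.1, h⟩
    have : t^2 ≤ 1/c * W t := by rw [div_mul_eq_mul_div, le_div_iff₀ hc]; linarith
    have h2 : 0 ≤ 1/c * Vpot n W t := by positivity
    have h3 : 0 ≤ 1/Vpot n W δ * (W t + Vpot n W t) := by positivity
    nlinarith
  · have h1 := g.V_mono hn hδ.le h.le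
    have h2 : 1 ≤ 1/Vpot n W δ * Vpot n W t := by rw [div_mul_eq_mul_div, le_div_iff₀ hV]; linarith
    have h3 : t^2 ≤ 1 := pow_le_one₀ ht.1 ht.2
    have h4 : 0 ≤ 1/c * (W t + Vpot n W t) := by positivity
    have h5 : 0 ≤ 1/Vpot n W δ * W t := by positivity
    nlinarith

/-- basic bounds for minimizers -/
lemma basic (hn : 2 ≤ n) (g : GW W W1 W2) (h0 : W1 0 = 0) {R : ℝ} (hRn : Asph n * (R^n / n) = 1) :
    ∃ C : ℝ, 1 ≤ C ∧ ∀ ε, 0 < ε → ε ≤ 1 → ∀ ζ d, RM n W ε ζ d →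
      (ε * ∫ r in Ioi (0:ℝ), r^(n-1) * d r^2) ≤ C ∧ (∫ r in Ioi (0:ℝ), r^(n-1) * W (ζ r)) ≤ C * ε ∧
      0 ≤ lam n W ε ζ d ∧ lam n W ε ζ d ≤ C ∧ (∫ r in Ioi (0:ℝ), r^(n-1) * Vpot n W (ζ r)) = R^n/n ∧
      (∫ r in Ioi (0:ℝ), r^(n-1) * ζ r^2) ≤ C ∧
      lam n W ε ζ d = Psi n W ε 1 - 2/n * (ε * (Asph n * ∫ r in Ioi (0:ℝ), r^(n-1) * d r^2)) := by
  obtain ⟨C0, hC0, hψ⟩ := psi_bound hn g h0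
  obtain ⟨C1, hC1, hsq⟩ := g.sq_le hn
  have hA := Asph_pos hn
  have hn2 : (2:ℝ) ≤ n := by exact_mod_cast hn
  have hRp : 0 ≤ R^n/n := by by_contra h; push Not at h; nlinarith
  have nC : 0 ≤ C0/Asph n := by positivity
  refine ⟨C0 + C0/Asph n + C1 * (C0/Asph n + R^n/n), by nlinarith [mul_nonneg hC1.le (add_nonneg nC hRp)], fun ε hε hε1 ζ d rm => ?_⟩
  have hp := hψ ε hε hε1
  have he := rm.en
  have nD : 0 ≤ ∫ r in Ioi (0:ℝ), r^(n-1) * d r^2 := nn_int fun r _ => sq_nonneg _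
  have nW : 0 ≤ ∫ r in Ioi (0:ℝ), r^(n-1) * W (ζ r) := nn_int fun r _ => g.nonneg (rm.mem r)
  have hv : (∫ r in Ioi (0:ℝ), r^(n-1) * Vpot n W (ζ r)) = R^n/n := by
    have := rm.vol; rw [← hRn] at this; exact mul_left_cancel₀ hA.ne' this
  have hS : (∫ r in Ioi (0:ℝ), r^(n-1) * ζ r^2) ≤ C1 * ((∫ r in Ioi (0:ℝ), r^(n-1) * W (ζ r)) + ∫ r in Ioi (0:ℝ), r^(n-1) * Vpot n W (ζ r)) := by
    rw [← integral_add rm.iW rm.iV, ← integral_const_mul]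
    refine setIntegral_mono_on rm.iS ((rm.iW.add rm.iV).const_mul C1) measurableSet_Ioi fun r (hr : 0 < r) => ?_
    have := mul_le_mul_of_nonneg_left (hsq _ (rm.mem r)) (pow_nonneg hr.le (n-1))
    linarith
  unfold lam
  rw [hv] at hS
  generalize (∫ r in Ioi (0:ℝ), r^(n-1) * d r^2) = D at *
  generalize (∫ r in Ioi (0:ℝ), r^(n-1) * W (ζ r)) = w at *
  have a1 : 0 ≤ ε * (Asph n * D) := by positivity
  have a2 : 0 ≤ ε⁻¹ * (Asph n * w) := by positivity
  have b1 : ε * D ≤ C0/Asph n := by rw [le_div_iff₀ hA]; linarith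
  have b2 : w ≤ C0/Asph n * ε := by
    have : ε * (ε⁻¹ * (Asph n * w)) = Asph n * w := by field_simp
    rw [div_mul_eq_mul_div, le_div_iff₀ hA]
    nlinarith
  have hX : 0 ≤ C1 * (C0/Asph n + R^n/n) := by positivity
  have c1 : ((n:ℝ)-2)/n ≤ 1 := by rw [div_le_one (by linarith)]; linarith
  have c0 : 0 ≤ ((n:ℝ)-2)/n := div_nonneg (by linarith) (by linarith)
  refine ⟨by linarith, by nlinarith, by positivity, by nlinarith, hv, ?_, ?_⟩
  · have : w ≤ C0/Asph n := b2.trans (by nlinarith)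
    nlinarith
  · have : ((n:ℝ)-2)/n = 1 - 2/n := by field_simp
    rw [this]; linarith

/-- location of the transition layer -/
lemma location (hn : 2 ≤ n) (g : GW W W1 W2) (h0 : W1 0 = 0) {R : ℝ} (hR : 0 < R) (hRn : Asph n * (R^n / n) = 1) {δ : ℝ} (hδ : 0 < δ) :
    ∃ K : ℝ, 1 ≤ K ∧ ∀ ε, 0 < ε → ε ≤ 1 → ∀ ζ d, RM n W ε ζ d →
      (∀ r, 0 ≤ r → r ≤ R - K * ε → 1 - δ ≤ ζ r) ∧ (∀ r, R + K * ε ≤ r → ζ r ≤ δ) := by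
  obtain ⟨C, hC, HB⟩ := basic hn g h0 hRn
  obtain ⟨C1, hC1, H1⟩ := g.V_le_W h0 hn hδ
  obtain ⟨C2, hC2, H2⟩ := g.V_top_W hn hδ
  have hp := pow_pos hR (n-1)
  have hn0 : (0:ℝ) < n := by positivity
  have nX1 : 0 ≤ n * (C1 * C) / R^(n-1) := by positivity
  have nX2 : 0 ≤ n * (C2 * C) / R^(n-1) := by positivity
  refine ⟨1 + n * (C1 * C) / R^(n-1) + n * (C2 * C) / R^(n-1), by linarith, fun ε hε hε1 ζ d rm => ?_⟩
  obtain ⟨-, bW, -, -, hv, -, -⟩ := HB ε hε hε1 ζ d rm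
  have split : ∀ r, 0 ≤ r → ∀ f : ℝ → ℝ, IntegrableOn f (Ioi 0) → ∫ s in Ioi 0, f s = (∫ s in Ioc 0 r, f s) + ∫ s in Ioi r, f s := fun r hr f hf => by
    rw [← Ioc_union_Ioi_eq_Ioi hr]
    exact setIntegral_union Ioc_disjoint_Ioi_same measurableSet_Ioi (hf.mono_set Ioc_subset_Ioi_self) (hf.mono_set (Ioi_subset_Ioi hr))
  have ip : ∀ r : ℝ, IntegrableOn (fun s : ℝ => s^(n-1)) (Ioc 0 r) := fun r => (by fun_prop : Continuous fun s : ℝ => s^(n-1)).integrableOn_Ioc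
  set K := 1 + n * (C1 * C) / R^(n-1) + n * (C2 * C) / R^(n-1) with hK
  have nW : ∀ s > 0, 0 ≤ s^(n-1) * W (ζ s) := fun s hs => mul_nonneg (pow_nonneg hs.le _) (g.nonneg (rm.mem s))
  have aux : ∀ Ci, 0 < Ci → n * (Ci * C) / R^(n-1) + 1 ≤ K → ¬ (R^(n-1) * (K * ε) ≤ n * (Ci * (C * ε))) := fun Ci hCi hle hh => by
    have h1 : R^(n-1) * (n * (Ci * C) / R^(n-1)) = n * (Ci * C) := by field_simp
    have h2 : R^(n-1) * (n * (Ci * C) / R^(n-1) + 1) ≤ R^(n-1) * K := mul_le_mul_of_nonneg_left hle hp.le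
    nlinarith
  constructor
  · intro r hr hrR
    by_contra hlt; push Not at hlt
    have e1 := split r hr _ rm.iV
    have e2 : ∫ s in Ioc 0 r, s^(n-1) * Vpot n W (ζ s) ≤ r^n/n := by
      rw [← int_pow_Ioc hn hr]
      refine setIntegral_mono_on (rm.iV.mono_set Ioc_subset_Ioi_self) (ip r) measurableSet_Ioc fun s hs => ?_
      exact mul_le_of_le_one_right (pow_nonneg hs.1.le _) (g.V_mem hn (rm.mem s)).2
    have e3 : ∫ s in Ioi r, s^(n-1) * Vpot n W (ζ s) ≤ C1 * ∫ s in Ioi r, s^(n-1) * W (ζ s) := by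
      rw [← integral_const_mul]
      refine setIntegral_mono_on (rm.iV.mono_set (Ioi_subset_Ioi hr)) ((rm.iW.mono_set (Ioi_subset_Ioi hr)).const_mul C1) measurableSet_Ioi fun s hs => ?_
      have hs : r < s := hs
      have := H1 _ (rm.mem s) ((rm.anti (show 0 ≤ r from hr) (show 0 ≤ s by linarith) hs.le).trans hlt.le)
      have := mul_le_mul_of_nonneg_left this (pow_nonneg (by linarith : 0 ≤ s) (n-1))
      linarith
    have e4 : ∫ s in Ioi r, s^(n-1) * W (ζ s) ≤ ∫ s in Ioi 0, s^(n-1) * W (ζ s) :=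
      setIntegral_mono_set rm.iW ((ae_restrict_iff' measurableSet_Ioi).2 (ae_of_all _ nW)) (Ioi_subset_Ioi hr).eventuallyLE
    have e5 := pow_gap hn hr (by nlinarith : r ≤ R) hR.le le_rfl
    refine aux C1 hC1 (by linarith) ?_
    have e6 : R^n/n - r^n/n ≤ C1 * (C * ε) := by nlinarith
    rw [← sub_div, div_le_iff₀ hn0] at e6
    nlinarith
  · intro r hrR
    have hr : 0 ≤ r := by nlinarith
    by_contra hlt; push Not at hlt
    have i1 := rm.iV.mono_set (Ioc_subset_Ioi_self : Ioc 0 r ⊆ Ioi 0)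
    have i2 := rm.iW.mono_set (Ioc_subset_Ioi_self : Ioc 0 r ⊆ Ioi 0)
    have e1 := split r hr _ rm.iV
    have e2 : 0 ≤ ∫ s in Ioi r, s^(n-1) * Vpot n W (ζ s) := setIntegral_nonneg measurableSet_Ioi fun s (hs : r < s) =>
      mul_nonneg (pow_nonneg (by linarith) _) (g.V_mem hn (rm.mem s)).1
    have e3 : r^n/n - ∫ s in Ioc 0 r, s^(n-1) * Vpot n W (ζ s) ≤ C2 * ∫ s in Ioc 0 r, s^(n-1) * W (ζ s) := by
      rw [← int_pow_Ioc hn hr, ← integral_const_mul, ← integral_sub (ip r) i1]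
      refine setIntegral_mono_on ((ip r).sub i1) (i2.const_mul C2) measurableSet_Ioc fun s hs => ?_
      have := H2 _ (rm.mem s) (hlt.le.trans (rm.anti (show 0 ≤ s from hs.1.le) (show 0 ≤ r from hr) hs.2))
      have := mul_le_mul_of_nonneg_left this (pow_nonneg hs.1.le (n-1))
      linarith
    have e4 : ∫ s in Ioc 0 r, s^(n-1) * W (ζ s) ≤ ∫ s in Ioi 0, s^(n-1) * W (ζ s) :=
      setIntegral_mono_set rm.iW ((ae_restrict_iff' measurableSet_Ioi).2 (ae_of_all _ nW)) Ioc_subset_Ioi_self.eventuallyLE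
    have e5 := pow_gap hn hR.le (by nlinarith : R ≤ r) hR.le (by nlinarith)
    refine aux C2 hC2 (by linarith) ?_
    have e6 : r^n/n - R^n/n ≤ C2 * (C * ε) := by nlinarith
    rw [← sub_div, div_le_iff₀ hn0] at e6
    nlinarith

variable {n : ℕ} {W W1 W2 : ℝ → ℝ} {u v : En n → ℝ}

/-- pointwise structure of the nonlinearity -/
structure PW (n : ℕ) (W W1 : ℝ → ℝ) (δ δb c0 L η : ℝ) : Prop where
  δ0 : 0 < δ
  δ4 : δ < 1/4
  b0 : 0 < δb
  b4 : δb < 1/4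
  hc0 : 0 < c0
  hc1 : c0 ≤ 1
  L1 : 1 ≤ L
  η0 : 0 < η
  P1 : ∀ ε l, 0 ≤ ε * l → ε * l ≤ η → ∀ a ∈ Icc (1-δ) 1, ∀ b ∈ Icc (1-δ) 1, c0 * (a - b)^2 ≤ (a - b) * (Gt n W W1 ε l a - Gt n W W1 ε l b)
  P2 : ∀ ε l, 0 ≤ ε * l → ε * l ≤ η → ∀ a ∈ Icc 0 δb, ∀ b ∈ Icc 0 δb, c0 * (a - b)^2 ≤ (a - b) * (Gt n W W1 ε l a - Gt n W W1 ε l b)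
  P3 : ∀ ε l, 0 ≤ ε * l → ε * l ≤ η → ∀ a ∈ Icc 0 (1-δ/2), ∀ b ∈ Icc 0 (1-δ/2), |Gt n W W1 ε l a - Gt n W W1 ε l b| ≤ L * |a - b|
  P4 : ∀ ε l, 0 ≤ ε * l → ∀ t ∈ Icc (1-δ) 1, Gt n W W1 ε l t ≤ 0

lemma exists_PW (g : GW W W1 W2) (h0 : W1 0 = 0) (hn : 2 ≤ n) : ∃ δ δb c0 L η : ℝ, PW n W W1 δ δb c0 L η := by
  obtain ⟨δ, c, C, hδ, hδ4, hc, hC, t1, t2, -, t3⟩ := g.top hn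
  obtain ⟨δb, cb, hb, hb4, hcb, b1, -, -⟩ := g.bot
  obtain ⟨C1, hC1, v1⟩ := g.lipV1 h0 hn (half_pos hδ)
  obtain ⟨M, hM, w1⟩ := g.lipW1
  have core : ∀ x y D c' C' s : ℝ, 0 ≤ s → s * C' ≤ c' → 2 * c' * D^2 ≤ x * D → y * D ≤ C' * D^2 → c'/2 * D^2 ≤ D * ((x - s * y)/2) := by
    intro x y D c' C' s hs h1 h2 h3
    have h4 : s * (y * D) ≤ s * (C' * D^2) := mul_le_mul_of_nonneg_left h3 hs
    have h5 : s * C' * D^2 ≤ c' * D^2 := mul_le_mul_of_nonneg_right h1 (sq_nonneg _)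
    nlinarith
  have ge : ∀ ε l a b, gf n W W1 ε l a - gf n W W1 ε l b = ((W1 a - W1 b) - ε * l * (V1 n W a - V1 n W b))/2 := fun ε l a b => by
    unfold gf; ring
  have sml : ∀ s, s ≤ min 1 (min (c/C) (cb/C1)) → s ≤ 1 ∧ s * C ≤ c ∧ s * C1 ≤ cb := fun s hs =>
    ⟨hs.trans (min_le_left _ _), (le_div_iff₀ hC).1 (hs.trans ((min_le_right _ _).trans (min_le_left _ _))),
      (le_div_iff₀ hC1).1 (hs.trans ((min_le_right _ _).trans (min_le_right _ _)))⟩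
  refine ⟨δ, δb, min 1 (min (c/2) (cb/2)), M + C1 + 1, min 1 (min (c/C) (cb/C1)), hδ, hδ4, hb, hb4, by positivity, min_le_left _ _, by linarith, by positivity, ?_, ?_, ?_, ?_⟩
  · intro ε l hs0 hs a ha b hb
    obtain ⟨-, hs1, -⟩ := sml _ hs
    have hle : min 1 (min (c/2) (cb/2)) ≤ c/2 := (min_le_right _ _).trans (min_le_left _ _)
    refine (mul_le_mul_of_nonneg_right hle (sq_nonneg _)).trans ?_
    have hd1 := g.d1
    have one : (1:ℝ) ∈ Icc (1-δ) 1 := ⟨by linarith, le_rfl⟩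
    have ct : ∀ t ∈ Icc (1-δ) 1, t < 1 → c/2 * (1 - t)^2 ≤ (1 - t) * (0 - gf n W W1 ε l t) := fun t ht ht1 => by
      have q1 := t1 1 one t ht
      have q2 := g.V1_nonneg hn (t := t) ⟨by linarith [ht.1], ht.2⟩
      unfold gf
      have q3 : 0 ≤ ε * l * V1 n W t := mul_nonneg hs0 q2
      have q4 : 0 ≤ (1 - t) * (ε * l * V1 n W t) := mul_nonneg (by linarith) q3
      have q5 : 0 ≤ (1 - t) * (- W1 1) := mul_nonneg (by linarith) (by linarith)
      nlinarith [mul_nonneg hc.le (sq_nonneg (1-t))]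
    unfold Gt
    split_ifs with ha1 hb1 hb1
    · rw [ge]; exact core _ _ _ _ _ _ hs0 hs1 (t1 a ha b hb) (t3 a ha b hb)
    · have : b = 1 := le_antisymm hb.2 (not_lt.1 hb1)
      subst this
      have := ct a ha ha1
      linarith
    · have : a = 1 := le_antisymm ha.2 (not_lt.1 ha1)
      subst this
      exact ct b hb hb1
    · have e1 : a = 1 := le_antisymm ha.2 (not_lt.1 ha1)
      have e2 : b = 1 := le_antisymm hb.2 (not_lt.1 hb1)
      simp [e1, e2]
  · intro ε l hs0 hs a ha b hb
    obtain ⟨-, -, hs1⟩ := sml _ hs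
    have hle : min 1 (min (c/2) (cb/2)) ≤ cb/2 := (min_le_right _ _).trans (min_le_right _ _)
    refine (mul_le_mul_of_nonneg_right hle (sq_nonneg _)).trans ?_
    unfold Gt
    rw [if_pos (by linarith [ha.2]), if_pos (by linarith [hb.2]), ge]
    refine core _ _ _ _ _ _ hs0 hs1 (b1 a ha b hb) ?_
    have := v1 a ⟨ha.1, by linarith [ha.2]⟩ b ⟨hb.1, by linarith [hb.2]⟩
    calc _ ≤ |(V1 n W a - V1 n W b) * (a - b)| := le_abs_self _
      _ = |V1 n W a - V1 n W b| * |a - b| := abs_mul _ _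
      _ ≤ C1 * |a - b| * |a - b| := mul_le_mul_of_nonneg_right this (abs_nonneg _)
      _ = C1 * (a - b)^2 := by rw [← sq_abs]; ring
  · intro ε l hs0 hs a ha b hb
    obtain ⟨hs1, -, -⟩ := sml _ hs
    unfold Gt
    rw [if_pos (by linarith [ha.2]), if_pos (by linarith [hb.2]), ge, abs_div, abs_two]
    have q1 := v1 a ha b hb
    have q2 := w1 a ⟨ha.1, by linarith [ha.2]⟩ b ⟨hb.1, by linarith [hb.2]⟩
    have q3 := abs_sub (W1 a - W1 b) (ε * l * (V1 n W a - V1 n W b))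
    rw [abs_mul (ε * l) (V1 n W a - V1 n W b), abs_of_nonneg hs0] at q3
    have q4 : ε * l * |V1 n W a - V1 n W b| ≤ 1 * (C1 * |a - b|) := mul_le_mul hs1 q1 (abs_nonneg _) zero_le_one
    rw [div_le_iff₀ two_pos]
    nlinarith [abs_nonneg (a-b)]
  · intro ε l hs0 t ht
    unfold Gt
    split_ifs
    · unfold gf
      have := t2 t ht
      have := mul_nonneg hs0 (g.V1_nonneg hn (t := t) ⟨by linarith [ht.1], ht.2⟩)
      linarith
    · rfl

/-- a minimizer with all its bounds -/
structure Good (n : ℕ) (W W1 : ℝ → ℝ) (R K C δ δb ε l : ℝ) (ζ d : ℝ → ℝ) (ϱ : ℝ) : Prop where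
  sol : Sol n W W1 ε l 1 ζ d
  l0 : 0 ≤ l
  l1 : l ≤ C
  iD : IntegrableOn (fun r => r^(n-1) * d r^2) (Ioi 0)
  iS : IntegrableOn (fun r => r^(n-1) * ζ r^2) (Ioi 0)
  iW : IntegrableOn (fun r => r^(n-1) * W (ζ r)) (Ioi 0)
  iV : IntegrableOn (fun r => r^(n-1) * Vpot n W (ζ r)) (Ioi 0)
  iG : IntegrableOn (fun r => r^(n-1) * Gt n W W1 ε l (ζ r)^2) (Ioi 0)
  bD : (ε * ∫ r in Ioi (0:ℝ), r^(n-1) * d r^2) ≤ C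
  bS : (∫ r in Ioi (0:ℝ), r^(n-1) * ζ r^2) ≤ C
  bW : (∫ r in Ioi (0:ℝ), r^(n-1) * W (ζ r)) ≤ C * ε
  bG : (∫ r in Ioi (0:ℝ), r^(n-1) * Gt n W W1 ε l (ζ r)^2) ≤ C * ε
  vV : (∫ r in Ioi (0:ℝ), r^(n-1) * Vpot n W (ζ r)) = R^n/n
  ll : l = Psi n W ε 1 - 2/n * (ε * (Asph n * ∫ r in Ioi (0:ℝ), r^(n-1) * d r^2))
  ρ1 : R - K * ε ≤ ϱ
  ρ2 : ϱ ≤ R + K * ε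
  zρ : ζ ϱ = 1 - δ
  tail : ∀ r, R + K * ε ≤ r → ζ r ≤ δb
  Gb : ∀ t ∈ Icc (0:ℝ) 1, |Gt n W W1 ε l t| ≤ C

lemma e3_top {P G M : ℝ} (hP : 0 < P) (h1 : G ≤ 0) (h2 : -M ≤ G) : P * G^2 ≤ -M * (P * (1 * G)) := by
  have h3 : G^2 ≤ -M * G := by nlinarith
  nlinarith

lemma e3_bot {P G M c δ w t : ℝ} (hP : 0 < P) (hc : 0 < c) (hδ : 0 < δ) (ht : 0 ≤ t) (h1 : t ≤ 1 - δ)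
    (h2 : c * (t * (1 - t))^2 ≤ w) (h3 : G^2 ≤ (M * t)^2) : P * G^2 ≤ M^2/(c*δ^2) * (P * w) := by
  have h4 : c * δ^2 * t^2 ≤ w := by
    refine le_trans ?_ h2
    have : (t * δ)^2 ≤ (t * (1 - t))^2 := pow_le_pow_left₀ (mul_nonneg ht hδ.le) (mul_le_mul_of_nonneg_left (by linarith) ht) 2
    nlinarith
  have h5 : G^2 ≤ M^2/(c*δ^2) * w := by
    rw [div_mul_eq_mul_div, le_div_iff₀ (by positivity)]
    nlinarith [mul_le_mul_of_nonneg_left h4 (sq_nonneg M), mul_le_mul_of_nonneg_left h3 (by positivity : 0 ≤ c * δ^2)]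
  nlinarith

set_option maxHeartbeats 1000000 in
lemma exists_good (hn : 2 ≤ n) (g : GW W W1 W2) (h0 : W1 0 = 0) {R : ℝ} (hR : 0 < R) (hRn : Asph n * (R^n / n) = 1)
    {δ δb c0 L η : ℝ} (p : PW n W W1 δ δb c0 L η) : ∃ K C : ℝ, 1 ≤ K ∧ 1 ≤ C ∧ ∀ ε, 0 < ε → ε ≤ 1 → K * ε ≤ R/8 → ∀ ζ d, RM n W ε ζ d →
      ∃ ϱ, Good n W W1 R K C δ δb ε (lam n W ε ζ d) ζ d ϱ := by
  obtain ⟨C0, hC0, HB⟩ := basic hn g h0 hRn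
  obtain ⟨K1, hK1, HL1⟩ := location hn g h0 hR hRn p.δ0
  obtain ⟨K2, hK2, HL2⟩ := location hn g h0 hR hRn p.b0
  obtain ⟨M, hM, HM⟩ := g.Gt_bd h0 hn C0
  obtain ⟨c, hc, HW⟩ := g.lowW
  have hδ := p.δ0
  have hM0 : 0 ≤ M := by linarith
  set X := (1 + M) * (2*R + 1)^(n-1) / (R/2)^(n-1) with hX
  have nX : 0 ≤ X := by positivity
  set Y := M^2 / (c * δ^2) * C0 + M * ((2*R)^(n-1) * X) with hY
  have nY : 0 ≤ Y := by positivity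
  refine ⟨max K1 K2, C0 + M + Y, le_max_of_le_left hK1, by linarith, fun ε hε hε1 hKε ζ d rm => ?_⟩
  have hk1 : K1 * ε ≤ max K1 K2 * ε := mul_le_mul_of_nonneg_right (le_max_left _ _) hε.le
  have hk2 : K2 * ε ≤ max K1 K2 * ε := mul_le_mul_of_nonneg_right (le_max_right _ _) hε.le
  set K := max K1 K2
  obtain ⟨bD, bW, l0, l1, vV, bS, ll⟩ := HB ε hε hε1 ζ d rm
  have sol := Sol_of_RM hn g h0 hε rm
  set l := lam n W ε ζ d
  have hεl : |ε * l| ≤ C0 := by rw [abs_of_nonneg (by positivity)]; nlinarith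
  have hG := HM ε l hεl
  have cζ := cont_of_deriv rm.hd
  have hG1 : ∀ t ∈ Icc (0:ℝ) 1, |Gt n W W1 ε l t| ≤ M := fun t ht => (hG t ht).trans (by nlinarith [ht.1, ht.2])
  have K0 : 0 < K * ε := by have : 1 ≤ K := le_max_of_le_left hK1; positivity
  obtain ⟨ϱ, hϱ, zϱ⟩ : ∃ ϱ ∈ Icc (R - K*ε) (R + K*ε), ζ ϱ = 1 - δ := by
    have h1 := (HL1 ε hε hε1 ζ d rm).1 (R - K*ε) (by linarith) (by linarith)
    have h2 := (HL1 ε hε hε1 ζ d rm).2 (R + K*ε) (by linarith)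
    exact intermediate_value_Icc' (by linarith) cζ.continuousOn ⟨by linarith [p.δ4], h1⟩
  have ϱ0 : 0 < ϱ := by linarith [hϱ.1]
  have mG : Measurable fun r => Gt n W W1 ε l (ζ r) := (g.mGt hn ε l).comp cζ.measurable
  have iG : IntegrableOn (fun r => r^(n-1) * Gt n W W1 ε l (ζ r)^2) (Ioi 0) := by
    refine (rm.iS.const_mul (M^2)).mono' ((measurable_id.pow_const _).mul (mG.pow_const 2)).aestronglyMeasurable ?_
    refine (ae_restrict_iff' measurableSet_Ioi).2 (ae_of_all _ fun r (hr : 0 < r) => ?_)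
    have hp := pow_pos hr (n-1)
    rw [Real.norm_of_nonneg (by positivity)]
    have h1 := sq_le_sq' (by linarith [hG _ (rm.mem r), abs_nonneg (Gt n W W1 ε l (ζ r))]) (hG _ (rm.mem r))
    rw [sq_abs] at h1
    nlinarith
  have dM : |ε * d ϱ| ≤ X := sol.grad_bd hn g h0 hε hε1 (half_pos hR) hM0 (fun t ht => by rw [one_mul]; exact hG1 t ht) (r := ϱ) (rb := 2*R)
      ⟨by linarith [hϱ.1], by linarith [hϱ.2]⟩
  have hF := sol.ftc hn g h0 le_rfl ϱ0.le
  rw [intervalIntegral.integral_of_le ϱ0.le, zero_pow (by omega : n - 1 ≠ 0)] at hF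
  have bF : -(∫ r in Ioc 0 ϱ, r^(n-1) * (1 * Gt n W W1 ε l (ζ r))) ≤ ε * ((2*R)^(n-1) * X) := by
    rw [hF]
    have q1 : ϱ^(n-1) ≤ (2*R)^(n-1) := pow_le_pow_left₀ ϱ0.le (by linarith [hϱ.2]) _
    have q2 : ϱ^(n-1) * (-(ε * d ϱ)) ≤ (2*R)^(n-1) * X :=
      (mul_le_mul_of_nonneg_left (neg_le_of_abs_le dM |> fun h => by linarith : -(ε * d ϱ) ≤ X) (by positivity)).trans (mul_le_mul_of_nonneg_right q1 nX)
    nlinarith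
  have iI := (sol.ib hn g h0 0 ϱ).1
  have bG : (∫ r in Ioi (0:ℝ), r^(n-1) * Gt n W W1 ε l (ζ r)^2) ≤ Y * ε := by
    have e1 : ∫ r in Ioi (0:ℝ), r^(n-1) * Gt n W W1 ε l (ζ r)^2 = (∫ r in Ioc 0 ϱ, r^(n-1) * Gt n W W1 ε l (ζ r)^2) + ∫ r in Ioi ϱ, r^(n-1) * Gt n W W1 ε l (ζ r)^2 := by
      rw [← Ioc_union_Ioi_eq_Ioi ϱ0.le]
      exact setIntegral_union Ioc_disjoint_Ioi_same measurableSet_Ioi (iG.mono_set Ioc_subset_Ioi_self) (iG.mono_set (Ioi_subset_Ioi ϱ0.le))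
    have e2 : ∫ r in Ioc 0 ϱ, r^(n-1) * Gt n W W1 ε l (ζ r)^2 ≤ ∫ r in Ioc 0 ϱ, (-M) * (r^(n-1) * (1 * Gt n W W1 ε l (ζ r))) := by
      refine setIntegral_mono_on (iG.mono_set Ioc_subset_Ioi_self) (iI.const_mul (-M)) measurableSet_Ioc fun r hr => ?_
      have h1 := p.P4 ε l (by positivity) (ζ r) ⟨by rw [← zϱ]; exact sol.anti (show 0 ≤ r from hr.1.le) (show 0 ≤ ϱ from ϱ0.le) hr.2, (rm.mem r).2⟩
      have h2 := neg_le_of_abs_le (hG1 _ (rm.mem r))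
      exact e3_top (pow_pos hr.1 (n-1)) h1 h2
    rw [integral_const_mul] at e2
    have e3 : ∫ r in Ioi ϱ, r^(n-1) * Gt n W W1 ε l (ζ r)^2 ≤ ∫ r in Ioi ϱ, (M^2/(c*δ^2)) * (r^(n-1) * W (ζ r)) := by
      refine setIntegral_mono_on (iG.mono_set (Ioi_subset_Ioi ϱ0.le)) ((rm.iW.mono_set (Ioi_subset_Ioi ϱ0.le)).const_mul _) measurableSet_Ioi fun r (hr : ϱ < r) => ?_
      have h1 : ζ r ≤ 1 - δ := by rw [← zϱ]; exact sol.anti (show 0 ≤ ϱ from ϱ0.le) (show 0 ≤ r by linarith) hr.le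
      have h2 := HW _ (rm.mem r)
      have h3 := sq_le_sq' (by linarith [hG _ (rm.mem r), abs_nonneg (Gt n W W1 ε l (ζ r))]) (hG _ (rm.mem r))
      rw [sq_abs] at h3
      exact e3_bot (pow_pos (ϱ0.trans hr) (n-1)) hc hδ (rm.mem r).1 h1 h2 h3
    rw [integral_const_mul] at e3
    have e4 : ∫ s in Ioi ϱ, s^(n-1) * W (ζ s) ≤ ∫ s in Ioi 0, s^(n-1) * W (ζ s) :=
      setIntegral_mono_set rm.iW ((ae_restrict_iff' measurableSet_Ioi).2 (ae_of_all _ fun s (hs : 0 < s) => mul_nonneg (pow_nonneg hs.le _) (g.nonneg (rm.mem s)))) (Ioi_subset_Ioi ϱ0.le).eventuallyLE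
    have e5 := mul_le_mul_of_nonneg_left (e4.trans bW) (by positivity : 0 ≤ M^2/(c*δ^2))
    have e6 := mul_le_mul_of_nonneg_left bF hM0
    rw [e1, hY]
    nlinarith
  refine ⟨ϱ, sol, l0, by linarith, rm.iD, rm.iS, rm.iW, rm.iV, iG, by linarith, by linarith, bW.trans ?_, bG.trans ?_, vV, ll, hϱ.1, hϱ.2, zϱ, ?_, fun t ht => (hG1 t ht).trans (by linarith)⟩
  · nlinarith
  · nlinarith
  · intro r hr
    exact (HL2 ε hε hε1 ζ d rm).2 r (by linarith)

variable {n : ℕ} {W W1 W2 : ℝ → ℝ} {u v : En n → ℝ}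

lemma int_sub_sq {N : ℕ} {f h : ℝ → ℝ} (mf : Measurable f) (mh : Measurable h)
    (hf : IntegrableOn (fun r => r^N * f r^2) (Ioi 0)) (hh : IntegrableOn (fun r => r^N * h r^2) (Ioi 0)) :
    IntegrableOn (fun r => r^N * (f r - h r)^2) (Ioi 0) ∧ IntegrableOn (fun r => r^N * (f r + h r)^2) (Ioi 0) := by
  have i0 : IntegrableOn (fun r => 2 * (r^N * f r^2) + 2 * (r^N * h r^2)) (Ioi 0) := Integrable.fun_add (hf.const_mul 2) (hh.const_mul 2)
  constructor
  · refine i0.mono' ((measurable_id.pow_const _).mul ((mf.sub mh).pow_const 2)).aestronglyMeasurable ?_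
    refine (ae_restrict_iff' measurableSet_Ioi).2 (ae_of_all _ fun r (hr : 0 < r) => ?_)
    have hp := pow_pos hr N
    rw [Real.norm_of_nonneg (by positivity)]
    nlinarith [mul_nonneg hp.le (sq_nonneg (f r + h r))]
  · refine i0.mono' ((measurable_id.pow_const _).mul ((mf.add mh).pow_const 2)).aestronglyMeasurable ?_
    refine (ae_restrict_iff' measurableSet_Ioi).2 (ae_of_all _ fun r (hr : 0 < r) => ?_)
    have hp := pow_pos hr N
    rw [Real.norm_of_nonneg (by positivity)]
    nlinarith [mul_nonneg hp.le (sq_nonneg (f r - h r))]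

/-- A pair of solutions to be compared. -/
structure Pr (n : ℕ) (W W1 : ℝ → ℝ) (ε l1 l2 κ : ℝ) (ζ d1 S d2 : ℝ → ℝ) (Δ : ℝ) (B : ℝ → ℝ) : Prop where
  s1 : Sol n W W1 ε l1 1 ζ d1
  s2 : Sol n W W1 ε l2 κ S d2
  iD1 : IntegrableOn (fun r => r^(n-1) * d1 r^2) (Ioi 0)
  iD2 : IntegrableOn (fun r => r^(n-1) * d2 r^2) (Ioi 0)
  iS1 : IntegrableOn (fun r => r^(n-1) * ζ r^2) (Ioi 0)
  iS2 : IntegrableOn (fun r => r^(n-1) * S r^2) (Ioi 0)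
  iB : IntegrableOn (fun r => r^(n-1) * B r) (Ioi 0)
  hB : ∀ r, 0 ≤ B r
  hE : ∀ r, (Gt n W W1 ε l1 (S r) - κ * Gt n W W1 ε l2 (S r))^2 ≤ Δ^2 * B r

namespace Pr
variable {ε l1 l2 κ Δ : ℝ} {ζ d1 S d2 B : ℝ → ℝ}

lemma md1 (h : Pr n W W1 ε l1 l2 κ ζ d1 S d2 Δ B) : Measurable d1 := meas_of_deriv h.s1.hd
lemma md2 (h : Pr n W W1 ε l1 l2 κ ζ d1 S d2 Δ B) : Measurable d2 := meas_of_deriv h.s2.hd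
lemma c1 (h : Pr n W W1 ε l1 l2 κ ζ d1 S d2 Δ B) : Continuous ζ := cont_of_deriv h.s1.hd
lemma c2 (h : Pr n W W1 ε l1 l2 κ ζ d1 S d2 Δ B) : Continuous S := cont_of_deriv h.s2.hd
lemma iz' (h : Pr n W W1 ε l1 l2 κ ζ d1 S d2 Δ B) : IntegrableOn (fun r => r^(n-1) * (d1 r - d2 r)^2) (Ioi 0) :=
  (int_sub_sq h.md1 h.md2 h.iD1 h.iD2).1
lemma iz (h : Pr n W W1 ε l1 l2 κ ζ d1 S d2 Δ B) : IntegrableOn (fun r => r^(n-1) * (ζ r - S r)^2) (Ioi 0) :=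
  (int_sub_sq h.c1.measurable h.c2.measurable h.iS1 h.iS2).1

lemma alg {P e zp z G1 G1S kG2 c m A : ℝ} (hP : 0 ≤ P) (hc : 0 < c) (hm : c * z^2 - m ≤ z * (G1 - G1S)) (hA : (G1S - kG2)^2 ≤ A) :
    P * (e^2 * zp^2 + c/2 * z^2) ≤ zp * (e^2 * (P * zp)) + z * (P * (1 * G1) - P * kG2) + P * (m + A/(2*c)) := by
  have h1 : 0 ≤ c/2 * z^2 + z * (G1S - kG2) + (G1S - kG2)^2/(2*c) := by
    have : c/2 * z^2 + z * (G1S - kG2) + (G1S - kG2)^2/(2*c) = (c * z + (G1S - kG2))^2/(2*c) := by field_simp; ring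
    rw [this]; positivity
  have h2 : (G1S - kG2)^2/(2*c) ≤ A/(2*c) := by gcongr
  have h3 : 0 ≤ z * (G1 - kG2) - c/2 * z^2 + m + A/(2*c) := by nlinarith
  have := mul_nonneg hP h3
  linarith

lemma energy (hn : 2 ≤ n) (g : GW W W1 W2) (h0 : W1 0 = 0) (h : Pr n W W1 ε l1 l2 κ ζ d1 S d2 Δ B) {c0 b : ℝ} (hc0 : 0 < c0) (hb : 0 < b) {m : ℝ → ℝ}
    (im : IntervalIntegrable (fun r => r^(n-1) * m r) volume 0 b)
    (hm : ∀ r ∈ Ioc 0 b, c0 * (ζ r - S r)^2 - m r ≤ (ζ r - S r) * (Gt n W W1 ε l1 (ζ r) - Gt n W W1 ε l1 (S r))) :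
    ∫ r in (0:ℝ)..b, r^(n-1) * (ε^2 * (d1 r - d2 r)^2 + c0/2 * (ζ r - S r)^2) ≤
      (ζ b - S b) * (ε^2 * (b^(n-1) * (d1 b - d2 b))) + ∫ r in (0:ℝ)..b, r^(n-1) * (m r + Δ^2 * B r/(2*c0)) := by
  obtain ⟨ra, hra⟩ := h.s1.dQ
  obtain ⟨rb, hrb⟩ := h.s2.dQ
  have toI : ∀ f : ℝ → ℝ, IntegrableOn f (Ioi 0) → IntervalIntegrable f volume 0 b := fun f hf => by
    rw [intervalIntegrable_iff_integrableOn_Ioc_of_le hb.le]; exact hf.mono_set Ioc_subset_Ioi_self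
  set F' : ℝ → ℝ := fun r => (d1 r - d2 r) * (ε^2 * (r^(n-1) * (d1 r - d2 r))) + (ζ r - S r) * (r^(n-1) * (1 * Gt n W W1 ε l1 (ζ r)) - r^(n-1) * (κ * Gt n W W1 ε l2 (S r))) with hF'
  have i1 : IntervalIntegrable F' volume 0 b := by
    refine IntervalIntegrable.add ?_ ?_
    · refine (toI _ (h.iz'.const_mul (ε^2))).congr ?_
      exact fun r _ => by ring
    · exact ((h.s1.ib hn g h0 0 b).sub (h.s2.ib hn g h0 0 b)).continuousOn_mul (h.c1.sub h.c2).continuousOn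
  have ftc : ∫ r in (0:ℝ)..b, F' r = (ζ b - S b) * (ε^2 * (b^(n-1) * (d1 b - d2 b))) := by
    have := MeasureTheory.integral_eq_of_hasDerivAt_off_countable_of_le (fun r => (ζ r - S r) * (ε^2 * (r^(n-1) * (d1 r - d2 r)))) F' hb.le (s := {ra, rb}) (by simp)
      ?_ ?_ i1
    · rw [this, zero_pow (by omega : n - 1 ≠ 0)]; ring
    · refine (h.c1.sub h.c2).continuousOn.mul ?_
      refine (((h.s1.cQ0 hn g h0).sub (h.s2.cQ0 hn g h0)).mono (fun r hr => hr.1)).congr fun r _ => ?_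
      simp only [Pi.sub_apply]; ring
    · intro r hr
      have hr2 := hr.2
      simp only [mem_insert_iff, mem_singleton_iff, not_or] at hr2
      have e1 := (hra r hr.1.1 hr2.1).fun_sub (hrb r hr.1.1 hr2.2)
      have e2 := (((h.s1.hd r).fun_sub (h.s2.hd r)).fun_mul e1)
      refine (e2.congr_deriv ?_).congr_of_eventuallyEq (Eventually.of_forall fun s => ?_)
      · simp only [hF']; ring
      · ring
  have iB := toI _ h.iB
  have iL : IntervalIntegrable (fun r => r^(n-1) * (ε^2 * (d1 r - d2 r)^2 + c0/2 * (ζ r - S r)^2)) volume 0 b :=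
    ((toI _ (h.iz'.const_mul (ε^2))).add (toI _ (h.iz.const_mul (c0/2)))).congr (fun r _ => by ring)
  have iR : IntervalIntegrable (fun r => r^(n-1) * (m r + Δ^2 * B r/(2*c0))) volume 0 b :=
    (im.add (iB.const_mul (Δ^2/(2*c0)))).congr (fun r _ => by ring)
  rw [← ftc, ← intervalIntegral.integral_add i1 iR]
  refine intervalIntegral.integral_mono_on_of_le_Ioo hb.le iL (i1.add iR) fun r hr => ?_
  exact alg (pow_nonneg hr.1.le _) hc0 (hm r ⟨hr.1, hr.2.le⟩) (h.hE r)
end Pr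

variable {n : ℕ} {W W1 W2 : ℝ → ℝ} {u v : En n → ℝ}

lemma gron {f f' : ℝ → ℝ} {a b k : ℝ} (cf : ContinuousOn f (Icc a b)) (hd : ∀ r ∈ Ioo a b, HasDerivAt f (f' r) r)
    (hle : ∀ r ∈ Ioo a b, f' r ≤ k * f r) : ∀ r ∈ Icc a b, f r ≤ f a * exp (k * (r - a)) := by
  intro r hr
  have an : AntitoneOn (fun s => f s * exp (-(k * s))) (Icc a b) := by
    have hD : ∀ s ∈ Ioo a b, HasDerivAt (fun s => f s * exp (-(k * s))) (f' s * exp (-(k * s)) + f s * (exp (-(k * s)) * (-(k * 1)))) s := fun s hs =>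
      (hd s hs).fun_mul ((((hasDerivAt_id s).const_mul k).fun_neg).exp)
    refine antitoneOn_of_deriv_nonpos (convex_Icc a b) (cf.mul (by fun_prop)) ?_ ?_
    · rw [interior_Icc]; exact fun s hs => (hD s hs).differentiableAt.differentiableWithinAt
    · rw [interior_Icc]; intro s hs
      rw [(hD s hs).deriv]
      have := mul_le_mul_of_nonneg_right (hle s hs) (exp_pos (-(k * s))).le
      linarith
  have h1 := an ⟨le_rfl, hr.1.trans hr.2⟩ hr hr.1
  simp only at h1
  have h2 := mul_le_mul_of_nonneg_right h1 (exp_pos (k * r)).le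
  rw [mul_assoc, mul_assoc, ← exp_add, ← exp_add] at h2
  simpa [show -(k * a) + k * r = k * (r - a) by ring] using h2

lemma small_pt {f : ℝ → ℝ} (hf : IntegrableOn f (Ioi 0)) {η : ℝ} (hη : 0 < η) (T : ℝ) : ∃ b, T < b ∧ f b ≤ η := by
  by_contra hc; push Not at hc
  have h1 : IntegrableOn f (Ioi (max T 0)) := hf.mono_set (Ioi_subset_Ioi (le_max_right _ _))
  have h2 : IntegrableOn (fun _ : ℝ => η) (Ioi (max T 0)) := by
    refine Integrable.mono' h1 aestronglyMeasurable_const ?_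
    refine (ae_restrict_iff' measurableSet_Ioi).2 (ae_of_all _ fun r hr => ?_)
    rw [Real.norm_of_nonneg hη.le]
    exact (hc r ((le_max_left _ _).trans_lt hr)).le
  rw [integrableOn_const_iff] at h2
  simp [hη.ne'] at h2

lemma mid_alg {z y zp P pa pb e L C G E Δ : ℝ} (he : 0 < e) (hpa : 0 < pa) (h1 : pa ≤ P) (h2 : P ≤ pb) (hL : 0 ≤ L) (hC : 0 ≤ C)
    (hy : y = e * (P * zp)) (hG : |G| ≤ L * |z|) (hE : E^2 ≤ Δ^2 * C) :
    2 * z * zp + 2 * y * (P * (G + E)/e) ≤ (1/pa + pb * L + pb + pb * C)/e * (z^2 + y^2 + Δ^2) := by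
  have hP : 0 < P := hpa.trans_le h1
  have hpb : 0 < pb := hP.trans_le h2
  have e1 : 2 * z * zp = (2 * z * y / P)/e := by rw [hy]; field_simp
  have e2 : 2 * z * y / P ≤ 1/pa * (z^2 + y^2) := by
    calc 2 * z * y / P ≤ (z^2 + y^2)/P := by gcongr; nlinarith [sq_nonneg (z - y)]
      _ ≤ (z^2+y^2)/pa := by gcongr
      _ = _ := by ring
  have e3 : 2 * y * G ≤ L * (z^2 + y^2) := by
    have : y * G ≤ |y| * (L * |z|) := by
      calc y * G ≤ |y * G| := le_abs_self _
        _ = |y| * |G| := abs_mul _ _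
        _ ≤ _ := mul_le_mul_of_nonneg_left hG (abs_nonneg _)
    have h3 : 2 * (|y| * |z|) ≤ z^2 + y^2 := by nlinarith [sq_nonneg (|y| - |z|), sq_abs y, sq_abs z]
    nlinarith
  have e4 : 2 * y * E ≤ y^2 + Δ^2 * C := by nlinarith [sq_nonneg (y - E)]
  have e5 : P * (2 * y * G + 2 * y * E) ≤ pb * (L * (z^2 + y^2) + (y^2 + Δ^2 * C)) := by
    have nn : 0 ≤ L * (z^2 + y^2) + (y^2 + Δ^2 * C) := by positivity
    calc _ ≤ P * (L * (z^2 + y^2) + (y^2 + Δ^2 * C)) := mul_le_mul_of_nonneg_left (by linarith) hP.le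
      _ ≤ _ := mul_le_mul_of_nonneg_right h2 nn
  have e6 : 2 * z * y / P + P * (2 * y * G + 2 * y * E) ≤ (1/pa + pb * L + pb + pb * C) * (z^2 + y^2 + Δ^2) := by
    have n1 : 0 ≤ 1/pa * Δ^2 := by positivity
    have n2 : 0 ≤ pb * L * Δ^2 := by positivity
    have n3 : 0 ≤ pb * (z^2 + Δ^2) := by positivity
    have n4 : 0 ≤ pb * C * (z^2 + y^2) := by positivity
    nlinarith
  calc _ = (2 * z * y / P + P * (2 * y * G + 2 * y * E))/e := by rw [e1]; ring
    _ ≤ ((1/pa + pb * L + pb + pb * C) * (z^2 + y^2 + Δ^2))/e := by gcongr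
    _ = _ := by ring

namespace Pr
variable {ε l1 l2 κ Δ : ℝ} {ζ d1 S d2 B : ℝ → ℝ}

/-- energy estimate in the inner region -/
lemma topE (hn : 2 ≤ n) (g : GW W W1 W2) (h0 : W1 0 = 0) (h : Pr n W W1 ε l1 l2 κ ζ d1 S d2 Δ B) {δ δb c0 L η C ϱ : ℝ}
    (p : PW n W W1 δ δb c0 L η) (hl0 : 0 ≤ ε * l1) (hl : ε * l1 ≤ η) (hϱ : 0 < ϱ) (z1 : ζ ϱ = 1 - δ) (z2 : S ϱ = 1 - δ)
    (bB : ∫ r in Ioi (0:ℝ), r^(n-1) * B r ≤ C * ε) :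
    ∫ r in (0:ℝ)..ϱ, r^(n-1) * (ε^2 * (d1 r - d2 r)^2 + c0/2 * (ζ r - S r)^2) ≤ Δ^2/(2*c0) * (C * ε) := by
  have hc0 := p.hc0
  have := h.energy hn g h0 hc0 hϱ (m := fun _ => 0) (by simp) (fun r hr => by
    have a1 := h.s1.anti (show 0 ≤ r from hr.1.le) (show 0 ≤ ϱ from hϱ.le) hr.2
    have a2 := h.s2.anti (show 0 ≤ r from hr.1.le) (show 0 ≤ ϱ from hϱ.le) hr.2
    rw [sub_zero]
    exact p.P1 ε l1 hl0 hl _ ⟨by linarith, (h.s1.mem r).2⟩ _ ⟨by linarith, (h.s2.mem r).2⟩)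
  refine this.trans ?_
  rw [z1, z2, sub_self, zero_mul, zero_add]
  have e : ∫ r in (0:ℝ)..ϱ, r^(n-1) * (0 + Δ^2 * B r/(2*c0)) = Δ^2/(2*c0) * ∫ r in Ioc 0 ϱ, r^(n-1) * B r := by
    rw [intervalIntegral.integral_of_le hϱ.le, ← integral_const_mul]
    congr 1; ext r; ring
  rw [e]
  refine mul_le_mul_of_nonneg_left (le_trans ?_ bB) (by positivity)
  exact setIntegral_mono_set h.iB ((ae_restrict_iff' measurableSet_Ioi).2 (ae_of_all _ fun s (hs : 0 < s) => mul_nonneg (pow_nonneg hs.le _) (h.hB s))) Ioc_subset_Ioi_self.eventuallyLE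

lemma goodpt (h : Pr n W W1 ε l1 l2 κ ζ d1 S d2 Δ B) {c0 X a ϱ : ℝ} (hc0 : 0 < c0) (ha : 0 < a) (haϱ : a < ϱ)
    (hX : ∫ r in (0:ℝ)..ϱ, r^(n-1) * (ε^2 * (d1 r - d2 r)^2 + c0/2 * (ζ r - S r)^2) ≤ X) :
    ∃ r ∈ Ioc a ϱ, r^(n-1) * (ε^2 * (d1 r - d2 r)^2 + c0/2 * (ζ r - S r)^2) ≤ X / (ϱ - a) := by
  have i0 : IntegrableOn (fun r => r^(n-1) * (ε^2 * (d1 r - d2 r)^2 + c0/2 * (ζ r - S r)^2)) (Ioi 0) :=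
    (Integrable.fun_add (h.iz'.const_mul (ε^2)) (h.iz.const_mul (c0/2))).congr (ae_of_all _ fun r => by ring)
  obtain ⟨r, hr, hle⟩ := exists_le_setAverage (μ := volume) (s := Ioc a ϱ) (by simp [haϱ]) (by simp) (i0.mono_set fun r hr => ha.trans hr.1)
  refine ⟨r, hr, hle.trans ?_⟩
  rw [setAverage_eq, smul_eq_mul, Real.volume_real_Ioc_of_le haϱ.le, div_eq_inv_mul X]
  refine mul_le_mul_of_nonneg_left (le_trans ?_ hX) (inv_nonneg.2 (by linarith : (0:ℝ) ≤ ϱ - a))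
  rw [intervalIntegral.integral_of_le (ha.trans haϱ).le]
  refine setIntegral_mono_set (i0.mono_set Ioc_subset_Ioi_self) ((ae_restrict_iff' measurableSet_Ioc).2 (ae_of_all _ fun s hs => ?_)) (Ioc_subset_Ioc_left ha.le).eventuallyLE
  have := pow_pos hs.1 (n-1)
  simp only [Pi.zero_apply]
  positivity

/-- Gronwall estimate -/
lemma middle (h : Pr n W W1 ε l1 l2 κ ζ d1 S d2 Δ B) {δ δb c0 L η C pa pb a b : ℝ}
    (p : PW n W W1 δ δb c0 L η) (hl0 : 0 ≤ ε * l1) (hl : ε * l1 ≤ η) (hε : 0 < ε) (ha : 0 < a)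
    (hpa : 0 < pa) (h1 : pa ≤ a^(n-1)) (h2 : b^(n-1) ≤ pb) (hC : 0 ≤ C) (hBC : ∀ r, B r ≤ C)
    (z1 : ζ a ≤ 1 - δ/2) (z2 : S a ≤ 1 - δ/2) : ∀ r ∈ Icc a b,
    (ζ r - S r)^2 ≤ ((ζ a - S a)^2 + (ε * (a^(n-1) * (d1 a - d2 a)))^2 + Δ^2) * exp ((1/pa + pb * L + pb + pb * C)/ε * (r - a)) := by
  intro r hr
  have pos : ∀ s ∈ Icc a b, 0 < s := fun s hs => ha.trans_le hs.1
  have le1 : ∀ s ∈ Icc a b, ζ s ≤ 1 - δ/2 := fun s hs => (h.s1.anti (show 0 ≤ a from ha.le) (show 0 ≤ s from (pos s hs).le) hs.1).trans z1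
  have le2 : ∀ s ∈ Icc a b, S s ≤ 1 - δ/2 := fun s hs => (h.s2.anti (show 0 ≤ a from ha.le) (show 0 ≤ s from (pos s hs).le) hs.1).trans z2
  have hδ := p.δ0
  have dq : ∀ s ∈ Icc a b, HasDerivAt (fun r => ε * (r^(n-1) * (d1 r - d2 r)))
      (s^(n-1) * ((Gt n W W1 ε l1 (ζ s) - Gt n W W1 ε l1 (S s)) + (Gt n W W1 ε l1 (S s) - κ * Gt n W W1 ε l2 (S s)))/ε) s := fun s hs => by
    have e1 := (h.s1.dQ1 s (pos s hs) (by linarith [le1 s hs])).fun_sub (h.s2.dQ1 s (pos s hs) (by linarith [le2 s hs]))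
    refine ((e1.div_const ε).congr_deriv (by ring)).congr_of_eventuallyEq (Eventually.of_forall fun t => ?_)
    field_simp
  have hD : ∀ s ∈ Icc a b, HasDerivAt (fun r => (ζ r - S r)^2 + (ε * (r^(n-1) * (d1 r - d2 r)))^2 + Δ^2)
      (2 * (ζ s - S s) * (d1 s - d2 s) + 2 * (ε * (s^(n-1) * (d1 s - d2 s))) * (s^(n-1) * ((Gt n W W1 ε l1 (ζ s) - Gt n W W1 ε l1 (S s)) + (Gt n W W1 ε l1 (S s) - κ * Gt n W W1 ε l2 (S s)))/ε)) s := fun s hs => by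
    have e1 := (((h.s1.hd s).fun_sub (h.s2.hd s)).fun_pow 2).fun_add ((dq s hs).fun_pow 2)
    refine (e1.add_const (Δ^2)).congr_deriv ?_
    simp only [Nat.cast_ofNat]; ring
  have := gron (k := (1/pa + pb * L + pb + pb * C)/ε) (fun s hs => (hD s hs).continuousAt.continuousWithinAt) (fun s hs => hD s (Ioo_subset_Icc_self hs)) (fun s hs => ?_) r hr
  · refine le_trans ?_ this
    nlinarith [sq_nonneg (ε * (r^(n-1) * (d1 r - d2 r))), sq_nonneg Δ]
  · have hs' := Ioo_subset_Icc_self hs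
    refine mid_alg (C := C) hε hpa (h1.trans (pow_le_pow_left₀ ha.le hs.1.le _)) ((pow_le_pow_left₀ (pos s hs').le hs.2.le _).trans h2) (by linarith [p.L1]) hC rfl ?_ ?_
    · exact p.P3 ε l1 hl0 hl _ ⟨(h.s1.mem s).1, le1 s hs'⟩ _ ⟨(h.s2.mem s).1, le2 s hs'⟩
    · exact (h.hE s).trans (mul_le_mul_of_nonneg_left (hBC s) (sq_nonneg _))

/-- global energy estimate -/
lemma total (hn : 2 ≤ n) (g : GW W W1 W2) (h0 : W1 0 = 0) (h : Pr n W W1 ε l1 l2 κ ζ d1 S d2 Δ B) {δ δb c0 L η C ϱ r2 Y : ℝ}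
    (p : PW n W W1 δ δb c0 L η) (hl0 : 0 ≤ ε * l1) (hl : ε * l1 ≤ η) (hε : 0 < ε) (hε1 : ε ≤ 1) (hϱ : 0 < ϱ) (z1 : ζ ϱ = 1 - δ) (z2 : S ϱ = 1 - δ)
    (bB : ∫ r in Ioi (0:ℝ), r^(n-1) * B r ≤ C * ε) (hr2 : ϱ ≤ r2) (hY : 0 ≤ Y) (hmid : ∀ r ∈ Icc ϱ r2, (ζ r - S r)^2 ≤ Y)
    (t1 : ζ r2 ≤ δb) (t2 : S r2 ≤ δb) :
    ∫ r in Ioi (0:ℝ), r^(n-1) * (ε^2 * (d1 r - d2 r)^2 + c0/2 * (ζ r - S r)^2) ≤ r2^(n-1) * ((1+L) * Y) * (r2 - ϱ) + Δ^2/(2*c0) * (C * ε) := by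
  have hc0 := p.hc0
  have hL := p.L1
  set m : ℝ → ℝ := (Ioc ϱ r2).indicator fun _ => (1+L) * Y with hm
  have sh := shell (N := n-1) (φ := m) (measurable_const.indicator measurableSet_Ioc) (a := ϱ) (T := r2) (B := (1+L) * Y) hϱ.le hr2
    (fun r => by
      by_cases hr : r ∈ Ioc ϱ r2
      · simp only [hm, indicator_of_mem hr]; exact ⟨by positivity, le_rfl⟩
      · simp only [hm, indicator_of_notMem hr]; exact ⟨le_rfl, by positivity⟩)
    (fun r hr => by simp only [hm, indicator_of_notMem hr])
  have m0 : ∀ r, 0 ≤ m r := fun r => indicator_nonneg (fun _ _ => by positivity) r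
  have hmr : ∀ r > 0, c0 * (ζ r - S r)^2 - m r ≤ (ζ r - S r) * (Gt n W W1 ε l1 (ζ r) - Gt n W W1 ε l1 (S r)) := fun r hr => by
    have an1 : ∀ a b, 0 < a → a ≤ b → ζ b ≤ ζ a := fun a b ha hab => h.s1.anti (show 0 ≤ a from ha.le) (show 0 ≤ b from ha.le.trans hab) hab
    have an2 : ∀ a b, 0 < a → a ≤ b → S b ≤ S a := fun a b ha hab => h.s2.anti (show 0 ≤ a from ha.le) (show 0 ≤ b from ha.le.trans hab) hab
    rcases le_or_gt r ϱ with hle | hgt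
    · have a1 := an1 r ϱ hr hle
      have a2 := an2 r ϱ hr hle
      have := p.P1 ε l1 hl0 hl _ ⟨by linarith, (h.s1.mem r).2⟩ _ ⟨by linarith, (h.s2.mem r).2⟩
      linarith [m0 r]
    rcases le_or_gt r r2 with hle | hgt2
    · have a1 := an1 ϱ r hϱ hgt.le
      have a2 := an2 ϱ r hϱ hgt.le
      have hδ := p.δ0
      have q := p.P3 ε l1 hl0 hl _ ⟨(h.s1.mem r).1, by linarith⟩ _ ⟨(h.s2.mem r).1, by linarith⟩
      have q2 := hmid r ⟨hgt.le, hle⟩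
      have hmem : r ∈ Ioc ϱ r2 := ⟨hgt, hle⟩
      have q3 : m r = (1+L) * Y := by simp only [hm, indicator_of_mem hmem]
      rw [q3]
      have q4 : -((ζ r - S r) * (Gt n W W1 ε l1 (ζ r) - Gt n W W1 ε l1 (S r))) ≤ L * (ζ r - S r)^2 := by
        calc _ ≤ |(ζ r - S r) * (Gt n W W1 ε l1 (ζ r) - Gt n W W1 ε l1 (S r))| := neg_le_abs _
          _ = |ζ r - S r| * |Gt n W W1 ε l1 (ζ r) - Gt n W W1 ε l1 (S r)| := abs_mul _ _
          _ ≤ |ζ r - S r| * (L * |ζ r - S r|) := mul_le_mul_of_nonneg_left q (abs_nonneg _)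
          _ = _ := by rw [← sq_abs]; ring
      have := p.hc1
      nlinarith [sq_nonneg (ζ r - S r)]
    · have a1 := an1 r2 r (by linarith) hgt2.le
      have a2 := an2 r2 r (by linarith) hgt2.le
      have := p.P2 ε l1 hl0 hl _ ⟨(h.s1.mem r).1, by linarith⟩ _ ⟨(h.s2.mem r).1, by linarith⟩
      linarith [m0 r]
  have i0 : IntegrableOn (fun r => r^(n-1) * (ε^2 * (d1 r - d2 r)^2 + c0/2 * (ζ r - S r)^2)) (Ioi 0) :=
    (Integrable.fun_add (h.iz'.const_mul (ε^2)) (h.iz.const_mul (c0/2))).congr (ae_of_all _ fun r => by ring)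
  have iR : IntegrableOn (fun r => r^(n-1) * m r + Δ^2/(2*c0) * (r^(n-1) * B r)) (Ioi 0) := Integrable.fun_add sh.1 (h.iB.const_mul _)
  have izz := Integrable.fun_add h.iz' h.iz
  have key : ∀ T > 0, ∫ r in (0:ℝ)..T, r^(n-1) * (ε^2 * (d1 r - d2 r)^2 + c0/2 * (ζ r - S r)^2) ≤ r2^(n-1) * ((1+L) * Y) * (r2 - ϱ) + Δ^2/(2*c0) * (C * ε) := by
    intro T hT
    refine le_of_forall_pos_le_add fun θ hθ => ?_
    obtain ⟨b, hTb, hb⟩ := small_pt izz hθ T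
    have hb0 : 0 < b := hT.trans hTb
    have e1 := h.energy hn g h0 hc0 hb0 (m := m) (by
      rw [intervalIntegrable_iff_integrableOn_Ioc_of_le hb0.le]; exact sh.1.mono_set Ioc_subset_Ioi_self) (fun r hr => hmr r hr.1)
    have e2 : ∫ r in (0:ℝ)..T, r^(n-1) * (ε^2 * (d1 r - d2 r)^2 + c0/2 * (ζ r - S r)^2) ≤ ∫ r in (0:ℝ)..b, r^(n-1) * (ε^2 * (d1 r - d2 r)^2 + c0/2 * (ζ r - S r)^2) := by
      rw [intervalIntegral.integral_of_le hT.le, intervalIntegral.integral_of_le hb0.le]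
      refine setIntegral_mono_set (i0.mono_set Ioc_subset_Ioi_self) ((ae_restrict_iff' measurableSet_Ioc).2 (ae_of_all _ fun s hs => ?_)) (Ioc_subset_Ioc_right hTb.le).eventuallyLE
      have := pow_pos hs.1 (n-1)
      simp only [Pi.zero_apply]
      positivity
    have e3 : ∫ r in (0:ℝ)..b, r^(n-1) * (m r + Δ^2 * B r/(2*c0)) ≤ r2^(n-1) * ((1+L) * Y) * (r2 - ϱ) + Δ^2/(2*c0) * (C * ε) := by
      rw [intervalIntegral.integral_of_le hb0.le]
      calc _ = ∫ r in Ioc 0 b, (r^(n-1) * m r + Δ^2/(2*c0) * (r^(n-1) * B r)) := by congr 1; ext r; ring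
        _ ≤ ∫ r in Ioi 0, (r^(n-1) * m r + Δ^2/(2*c0) * (r^(n-1) * B r)) := by
          refine setIntegral_mono_set iR ((ae_restrict_iff' measurableSet_Ioi).2 (ae_of_all _ fun s (hs : 0 < s) => ?_)) Ioc_subset_Ioi_self.eventuallyLE
          have := pow_pos hs (n-1)
          have := m0 s
          have := h.hB s
          simp only [Pi.zero_apply]
          positivity
        _ ≤ _ := by
          rw [integral_add sh.1 (h.iB.const_mul _), integral_const_mul]
          exact add_le_add sh.2 (mul_le_mul_of_nonneg_left bB (by positivity))
    have e4 : (ζ b - S b) * (ε^2 * (b^(n-1) * (d1 b - d2 b))) ≤ θ := by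
      refine le_trans ?_ hb
      have hp := pow_pos hb0 (n-1)
      have hε2 : ε^2 ≤ 1 := pow_le_one₀ hε.le hε1
      have w1 : ε^2 * ((ζ b - S b) * (d1 b - d2 b)) ≤ (d1 b - d2 b)^2 + (ζ b - S b)^2 := by
        have : (ζ b - S b) * (d1 b - d2 b) ≤ (d1 b - d2 b)^2 + (ζ b - S b)^2 := by
          nlinarith [sq_nonneg ((ζ b - S b) - (d1 b - d2 b)), sq_nonneg (ζ b - S b), sq_nonneg (d1 b - d2 b)]
        nlinarith [sq_nonneg (ζ b - S b), sq_nonneg (d1 b - d2 b), mul_le_mul_of_nonneg_left this (sq_nonneg ε), mul_le_mul_of_nonneg_right hε2 (add_nonneg (sq_nonneg (d1 b - d2 b)) (sq_nonneg (ζ b - S b)))]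
      calc _ = b^(n-1) * (ε^2 * ((ζ b - S b) * (d1 b - d2 b))) := by ring
        _ ≤ b^(n-1) * ((d1 b - d2 b)^2 + (ζ b - S b)^2) := mul_le_mul_of_nonneg_left w1 hp.le
        _ = _ := by ring
    linarith
  refine le_of_tendsto (intervalIntegral_tendsto_integral_Ioi 0 i0 tendsto_id) ?_
  filter_upwards [eventually_gt_atTop 0] with T hT using key T hT
end Pr

variable {n : ℕ} {W W1 W2 : ℝ → ℝ} {u v : En n → ℝ}

lemma Sol.near (hn : 2 ≤ n) (g : GW W W1 W2) (h0 : W1 0 = 0) {ε l κ δ X c ra ϱ r : ℝ} {ζ d : ℝ → ℝ} (h : Sol n W W1 ε l κ ζ d) (hε : 0 < ε)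
    (hX : 0 < X) (hg : ∀ r ∈ Icc ra ϱ, |ε * d r| ≤ X) (hc : c = δ/(2*X)) (hz : ζ ϱ = 1 - δ) (hra : ra ≤ r) (h1 : ϱ - c * ε ≤ r) (h2 : r ≤ ϱ) (hδ : 0 < δ) :
    ζ r ≤ 1 - δ/2 := by
  rcases h2.eq_or_lt with rfl | hlt
  · linarith
  obtain ⟨s, hs, e⟩ := mvt_eq hlt (cont_of_deriv h.hd).continuousOn (fun t _ => h.hd t)
  have b := hg s ⟨by linarith [hs.1], hs.2.le⟩
  have b2 : -(ε * d s) ≤ X := (neg_le_abs _).trans b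
  have b3 : (-(ε * d s)) * (ϱ - r) ≤ X * (c * ε) := by
    calc _ ≤ X * (ϱ - r) := mul_le_mul_of_nonneg_right b2 (by linarith)
      _ ≤ _ := mul_le_mul_of_nonneg_left (by linarith) hX.le
  have e2 : X * (c * ε) = δ/2 * ε := by rw [hc]; field_simp
  have b4 : ε * (ζ r - ζ ϱ) ≤ ε * (δ/2) := by
    have : ζ r - ζ ϱ = -(d s * (ϱ - r)) := by linarith
    rw [this]; linarith
  have := le_of_mul_le_mul_left b4 hε
  linarith

lemma cmp_alg {P pa pb e zp z c0 Q : ℝ} (hpa : 0 < pa) (h1 : pa ≤ P) (h2 : P ≤ pb) (hc : 0 < c0)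
    (h : P * (e^2 * zp^2 + c0/2 * z^2) ≤ Q) : z^2 + (e * (P * zp))^2 ≤ (2/(pa*c0) + pb) * Q := by
  have hP : 0 < P := hpa.trans_le h1
  have n1 : 0 ≤ P * (e^2 * zp^2) := by positivity
  have n2 : 0 ≤ P * (c0/2 * z^2) := by positivity
  have hQ : 0 ≤ Q := by linarith
  have a1 : pa * (c0/2 * z^2) ≤ Q := by
    have : pa * (c0/2 * z^2) ≤ P * (c0/2 * z^2) := mul_le_mul_of_nonneg_right h1 (by positivity)
    linarith
  have a2 : z^2 ≤ 2/(pa*c0) * Q := by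
    rw [div_mul_eq_mul_div, le_div_iff₀ (by positivity)]; linarith
  have a3 : (e * (P * zp))^2 ≤ pb * Q := by
    calc _ = P * (P * (e^2 * zp^2)) := by ring
      _ ≤ P * Q := mul_le_mul_of_nonneg_left (by linarith) hP.le
      _ ≤ _ := mul_le_mul_of_nonneg_right h2 hQ
  linarith

/-- quantitative comparison of two solutions -/
lemma compare (hn : 2 ≤ n) (g : GW W W1 W2) (h0 : W1 0 = 0) {δ δb c0 L η R C K : ℝ} (p : PW n W W1 δ δb c0 L η)
    (hR : 0 < R) (hC : 1 ≤ C) (hK : 1 ≤ K) : ∃ Cc e0 : ℝ, 1 ≤ Cc ∧ 0 < e0 ∧ e0 ≤ 1 ∧ ∀ ε, 0 < ε → ε ≤ e0 →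
    ∀ (l1 l2 κ Δ ϱ : ℝ) (ζ d1 S d2 B : ℝ → ℝ), Pr n W W1 ε l1 l2 κ ζ d1 S d2 Δ B → 0 ≤ ε * l1 → ε * l1 ≤ η →
    (∀ t ∈ Icc (0:ℝ) 1, |1 * Gt n W W1 ε l1 t| ≤ C) → (∀ t ∈ Icc (0:ℝ) 1, |κ * Gt n W W1 ε l2 t| ≤ C) →
    (∀ r, B r ≤ C) → (∫ r in Ioi (0:ℝ), r^(n-1) * B r ≤ C * ε) → R/2 ≤ ϱ → ϱ ≤ 2*R → ζ ϱ = 1 - δ → S ϱ = 1 - δ →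
    ζ (ϱ + K * ε) ≤ δb → S (ϱ + K * ε) ≤ δb →
    ∫ r in Ioi (0:ℝ), r^(n-1) * (ε^2 * (d1 r - d2 r)^2 + c0/2 * (ζ r - S r)^2) ≤ Cc * ε * Δ^2 := by
  have hδ := p.δ0
  have hc0 := p.hc0
  have hL := p.L1
  obtain ⟨pa, hpa⟩ : ∃ pa, pa = (R/4)^(n-1) := ⟨_, rfl⟩
  obtain ⟨pb, hpb⟩ : ∃ pb, pb = (3*R)^(n-1) := ⟨_, rfl⟩
  have pa0 : 0 < pa := by rw [hpa]; positivity
  have pb0 : 0 < pb := by rw [hpb]; positivity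
  obtain ⟨X, hX⟩ : ∃ X, X = (1+C) * (3*R+1)^(n-1)/(R/4)^(n-1) := ⟨_, rfl⟩
  have X0 : 0 < X := by rw [hX]; positivity
  obtain ⟨c, hc⟩ : ∃ c, c = δ/(2*X) := ⟨_, rfl⟩
  have c00 : 0 < c := by rw [hc]; positivity
  obtain ⟨E, hE⟩ : ∃ E, E = 1/pa + pb * L + pb + pb * C := ⟨_, rfl⟩
  have E0 : 0 < E := by rw [hE]; positivity
  obtain ⟨q, hq⟩ : ∃ q, q = C/(2*c0*c) := ⟨_, rfl⟩
  have q0 : 0 < q := by rw [hq]; positivity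
  obtain ⟨M, hM⟩ : ∃ M, M = ((2/(pa*c0) + pb) * q + 1) * exp (E * (K + c)) := ⟨_, rfl⟩
  have M0 : 0 < M := by rw [hM]; positivity
  refine ⟨pb * ((1+L) * M) * K + C/(2*c0) + 1, min 1 (min (R/4/c) (R/K)), ?_, by positivity, min_le_left _ _, ?_⟩
  · have : 0 ≤ pb * ((1+L) * M) * K + C/(2*c0) := by positivity
    linarith
  intro ε hε hεe l1 l2 κ Δ ϱ ζ d1 S d2 B h hl0 hl G1 G2 BC bB ϱ1 ϱ2 z1 z2 t1 t2
  have hε1 : ε ≤ 1 := hεe.trans (min_le_left _ _)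
  have hε2 : c * ε ≤ R/4 := by
    have : ε ≤ R/4/c := hεe.trans ((min_le_right _ _).trans (min_le_left _ _))
    rw [le_div_iff₀ c00] at this; linarith
  have hε3 : K * ε ≤ R := by
    have : ε ≤ R/K := hεe.trans ((min_le_right _ _).trans (min_le_right _ _))
    rw [le_div_iff₀ (by linarith)] at this; linarith
  have hce : 0 < c * ε := by positivity
  have hKe : 0 < K * ε := by positivity
  have ϱ0 : 0 < ϱ := by linarith
  have gr1 : ∀ r ∈ Icc (R/4) ϱ, |ε * d1 r| ≤ X := fun r hr => by
    rw [hX]; exact h.s1.grad_bd hn g h0 hε hε1 (by positivity) (by linarith) G1 ⟨hr.1, by linarith [hr.2]⟩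
  have gr2 : ∀ r ∈ Icc (R/4) ϱ, |ε * d2 r| ≤ X := fun r hr => by
    rw [hX]; exact h.s2.grad_bd hn g h0 hε hε1 (by positivity) (by linarith) G2 ⟨hr.1, by linarith [hr.2]⟩
  have top := h.topE hn g h0 p hl0 hl ϱ0 z1 z2 bB
  obtain ⟨a, ha, hgood⟩ := h.goodpt (a := ϱ - c * ε) hc0 (by linarith) (by linarith) top
  have haR : R/4 ≤ a := by linarith [ha.1]
  have a0 : 0 < a := by linarith
  have eQ : Δ^2/(2*c0) * (C * ε)/(ϱ - (ϱ - c * ε)) = q * Δ^2 := by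
    rw [hq, sub_sub_cancel]; field_simp
  rw [eQ] at hgood
  have Pa : pa ≤ a^(n-1) := by rw [hpa]; exact pow_le_pow_left₀ (by positivity) haR _
  have Pb : a^(n-1) ≤ pb := by rw [hpb]; exact pow_le_pow_left₀ a0.le (by linarith [ha.2]) _
  have Pc : (ϱ + K * ε)^(n-1) ≤ pb := by rw [hpb]; exact pow_le_pow_left₀ (by linarith) (by linarith) _
  have st := cmp_alg pa0 Pa Pb hc0 hgood
  have n1 := Sol.near hn g h0 h.s1 hε X0 gr1 hc z1 haR ha.1.le ha.2 hδ
  have n2 := Sol.near hn g h0 h.s2 hε X0 gr2 hc z2 haR ha.1.le ha.2 hδ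
  have mid := h.middle (b := ϱ + K * ε) p hl0 hl hε a0 pa0 Pa Pc (by linarith) BC n1 n2
  rw [← hE] at mid
  have tot := h.total hn g h0 p hl0 hl hε hε1 ϱ0 z1 z2 bB (r2 := ϱ + K * ε) (Y := M * Δ^2) (by linarith) (by positivity) (fun r hr => by
    refine (mid r ⟨ha.2.trans hr.1, hr.2⟩).trans ?_
    have e1 : E/ε * (r - a) ≤ E * (K + c) := by
      rw [div_mul_eq_mul_div, div_le_iff₀ hε, mul_assoc]
      refine mul_le_mul_of_nonneg_left ?_ E0.le
      linarith [hr.2, ha.1]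
    calc _ ≤ (((2/(pa*c0) + pb) * q + 1) * Δ^2) * exp (E * (K + c)) := by
          refine mul_le_mul ?_ (exp_le_exp.2 e1) (exp_pos _).le (by positivity)
          linarith
      _ = _ := by rw [hM]; ring) t1 t2
  refine tot.trans ?_
  have f1 : (ϱ + K * ε)^(n-1) * ((1+L) * (M * Δ^2)) * (ϱ + K * ε - ϱ) ≤ pb * ((1+L) * (M * Δ^2)) * (ϱ + K * ε - ϱ) := by
    refine mul_le_mul_of_nonneg_right (mul_le_mul_of_nonneg_right Pc (by positivity)) (by linarith)
  have f2 : 0 ≤ ε * Δ^2 := by positivity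
  calc _ ≤ pb * ((1+L) * (M * Δ^2)) * (ϱ + K * ε - ϱ) + Δ^2/(2*c0) * (C * ε) := by linarith
    _ = (pb * ((1+L) * M) * K + C/(2*c0)) * (ε * Δ^2) := by ring
    _ ≤ _ := by linarith

variable {n : ℕ} {W W1 W2 : ℝ → ℝ} {u v : En n → ℝ}

lemma scale_eq (hn : 2 ≤ n) {μ : ℝ} (hμ : 0 < μ) (f : ℝ → ℝ) :
    ∫ r in Ioi (0:ℝ), r^(n-1) * f (μ * r) = (μ^n)⁻¹ * ∫ r in Ioi (0:ℝ), r^(n-1) * f r := by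
  have e := integral_comp_mul_left_Ioi (fun r => r^(n-1) * f r) 0 hμ
  rw [mul_zero, smul_eq_mul] at e
  have e2 : ∀ r, r^(n-1) * f (μ * r) = (μ^(n-1))⁻¹ * ((μ*r)^(n-1) * f (μ * r)) := fun r => by
    rw [mul_pow]; field_simp
  simp_rw [e2]
  rw [integral_const_mul, e, ← mul_assoc, ← mul_inv, ← pow_succ, Nat.sub_add_cancel (by omega)]

lemma scale_int {μ : ℝ} (hμ : 0 < μ) {f : ℝ → ℝ} (hf : IntegrableOn (fun r => r^(n-1) * f r) (Ioi 0)) :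
    IntegrableOn (fun r => r^(n-1) * f (μ * r)) (Ioi 0) := by
  have e := (integrableOn_Ioi_comp_mul_left_iff (fun r => r^(n-1) * f r) 0 hμ).2 (by rwa [mul_zero])
  refine (e.const_mul (μ^(n-1))⁻¹).congr (ae_of_all _ fun r => ?_)
  simp only [mul_pow]; field_simp

lemma inv_pow_le {μ : ℝ} (h1 : 1/2 ≤ μ) : (μ^n)⁻¹ ≤ 2^n := by
  rw [← inv_pow]
  refine pow_le_pow_left₀ (by positivity) ?_ _
  rw [inv_le_comm₀ (by linarith) (by norm_num)]; linarith

lemma mu_up {μ : ℝ} (h1 : 1/2 ≤ μ) (h2 : μ ≤ 2) (k : ℕ) : |μ^k - 1| ≤ 4^k * |1 - μ| := by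
  induction k with
  | zero => simp
  | succ k ih =>
    have e : μ^(k+1) - 1 = μ * (μ^k - 1) + (μ - 1) := by ring
    have a : |μ * (μ^k - 1)| ≤ 2 * (4^k * |1 - μ|) := by
      rw [abs_mul, abs_of_pos (by linarith : 0 < μ)]
      exact mul_le_mul h2 ih (abs_nonneg _) (by norm_num)
    have b : |1 - μ| ≤ 4^k * |1 - μ| := le_mul_of_one_le_left (abs_nonneg _) (one_le_pow₀ (by norm_num))
    rw [e]
    refine (abs_add_le _ _).trans ?_
    rw [abs_sub_comm μ 1, pow_succ]
    have := abs_nonneg (1 - μ)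
    nlinarith

lemma mu_low (hn : 2 ≤ n) {μ : ℝ} (h1 : 1/2 ≤ μ) (h2 : μ ≤ 2) : |1 - μ| / 2^n ≤ |(μ^n)⁻¹ - 1| := by
  have h0 : 0 < μ := by linarith
  have hp := pow_pos h0 n
  have hp2 : μ^n ≤ 2^n := pow_le_pow_left₀ h0.le h2 _
  have e : |(μ^n)⁻¹ - 1| = |1 - μ^n| / μ^n := by
    have : (μ^n)⁻¹ - 1 = (1 - μ^n) / μ^n := by field_simp
    rw [this, abs_div, abs_of_pos hp]
  have a : |1 - μ| ≤ |1 - μ^n| := by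
    rcases le_total μ 1 with h | h
    · have : μ^n ≤ μ := by simpa using pow_le_pow_of_le_one h0.le h (by omega : 1 ≤ n)
      rw [abs_of_nonneg (by linarith), abs_of_nonneg (by linarith)]; linarith
    · have : μ ≤ μ^n := by simpa using pow_le_pow_right₀ h (by omega : 1 ≤ n)
      rw [abs_of_nonpos (by linarith), abs_of_nonpos (by linarith)]; linarith
  rw [e]
  exact div_le_div₀ (abs_nonneg _) a hp hp2

lemma mu_D {μ : ℝ} (h1 : 1/2 ≤ μ) (h2 : μ ≤ 2) : |μ^2 * (μ^n)⁻¹ - 1| ≤ 2^n * ((4^n + 16) * |1 - μ|) := by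
  have h0 : 0 < μ := by linarith
  have hp := pow_pos h0 n
  have e : μ^2 * (μ^n)⁻¹ - 1 = (μ^n)⁻¹ * ((μ^2 - 1) - (μ^n - 1)) := by field_simp; ring
  rw [e, abs_mul, abs_of_pos (inv_pos.2 hp)]
  refine mul_le_mul (inv_pow_le h1) ?_ (abs_nonneg _) (by positivity)
  have a := mu_up h1 h2 2
  have b := mu_up h1 h2 n
  have := abs_sub (μ^2 - 1) (μ^n - 1)
  norm_num at a
  linarith

lemma pr_alg {x y G w D : ℝ} (hD : |x| + |y| = D) : (x * G - y * w)^2 ≤ D^2 * (2 * w^2 + 2 * G^2) := by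
  have a : x^2 ≤ D^2 := by rw [← sq_abs x]; exact pow_le_pow_left₀ (abs_nonneg _) (by linarith [abs_nonneg y]) 2
  have b : y^2 ≤ D^2 := by rw [← sq_abs y]; exact pow_le_pow_left₀ (abs_nonneg _) (by linarith [abs_nonneg x]) 2
  have c := mul_le_mul_of_nonneg_right a (sq_nonneg G)
  have d := mul_le_mul_of_nonneg_right b (sq_nonneg w)
  nlinarith [sq_nonneg (x * G + y * w)]

lemma Gt_diff (hn : 2 ≤ n) (g : GW W W1 W2) {ε l1 l2 κ t : ℝ} (hε : 0 < ε) (ht : t ∈ Icc (0:ℝ) 1) :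
    (Gt n W W1 ε l1 t - κ * Gt n W W1 ε l2 t)^2 ≤ (|1 - κ| + ε * |l1 - l2|)^2 * (2 * W t + 2 * Gt n W W1 ε l2 t^2) := by
  have hW := g.nonneg ht
  by_cases h : t < 1
  · have e : Gt n W W1 ε l1 t - κ * Gt n W W1 ε l2 t = (1 - κ) * Gt n W W1 ε l2 t - (ε * (l1 - l2)) * (V1 n W t / 2) := by
      simp only [Gt, if_pos h, gf]; ring
    rw [e]
    refine (pr_alg (D := |1 - κ| + ε * |l1 - l2|) (by rw [abs_mul ε, abs_of_pos hε])).trans ?_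
    refine mul_le_mul_of_nonneg_left ?_ (sq_nonneg _)
    have := g.V1_sq hn ht
    nlinarith
  · simp only [Gt, if_neg h]
    have : 0 ≤ (|1 - κ| + ε * |l1 - l2|)^2 * (2 * W t + 2 * 0^2) := by positivity
    simpa using this

lemma Good.pair (hn : 2 ≤ n) (g : GW W W1 W2) {R K C δ δb ε l1 l2 ϱ1 ϱ2 μ : ℝ} {ζ1 e1 ζ2 e2 : ℝ → ℝ}
    (G1 : Good n W W1 R K C δ δb ε l1 ζ1 e1 ϱ1) (G2 : Good n W W1 R K C δ δb ε l2 ζ2 e2 ϱ2) (hε : 0 < ε) (hμ : 0 < μ) :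
    Pr n W W1 ε l1 l2 (μ^2) ζ1 e1 (fun r => ζ2 (μ * r)) (fun r => μ * e2 (μ * r)) (|1 - μ^2| + ε * |l1 - l2|)
      (fun r => 2 * W (ζ2 (μ * r)) + 2 * Gt n W W1 ε l2 (ζ2 (μ * r))^2) where
  s1 := G1.sol
  s2 := G2.sol.scale hμ
  iD1 := G1.iD
  iD2 := ((scale_int hμ (f := fun r => e2 r^2) G2.iD).const_mul (μ^2)).congr (ae_of_all _ fun r => by ring)
  iS1 := G1.iS
  iS2 := scale_int hμ (f := fun r => ζ2 r^2) G2.iS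
  iB := (Integrable.fun_add ((scale_int hμ (f := fun r => W (ζ2 r)) G2.iW).const_mul 2)
    ((scale_int hμ (f := fun r => Gt n W W1 ε l2 (ζ2 r)^2) G2.iG).const_mul 2)).congr (ae_of_all _ fun r => by ring)
  hB := fun r => by
    have := g.nonneg (G2.sol.mem (μ * r))
    positivity
  hE := fun r => Gt_diff hn g hε (G2.sol.mem (μ * r))

lemma Good.bB (hn : 2 ≤ n) {R K C δ δb ε l2 ϱ2 μ : ℝ} {ζ2 e2 : ℝ → ℝ}
    (G2 : Good n W W1 R K C δ δb ε l2 ζ2 e2 ϱ2) (hε : 0 < ε) (hC : 0 ≤ C) (hμ : 1/2 ≤ μ) :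
    ∫ r in Ioi (0:ℝ), r^(n-1) * (2 * W (ζ2 (μ * r)) + 2 * Gt n W W1 ε l2 (ζ2 (μ * r))^2) ≤ 2^n * (4 * C) * ε := by
  have h0 : 0 < μ := by linarith
  rw [scale_eq hn h0 (fun s => 2 * W (ζ2 s) + 2 * Gt n W W1 ε l2 (ζ2 s)^2)]
  have e : ∫ r in Ioi (0:ℝ), r^(n-1) * (2 * W (ζ2 r) + 2 * Gt n W W1 ε l2 (ζ2 r)^2) =
      2 * (∫ r in Ioi (0:ℝ), r^(n-1) * W (ζ2 r)) + 2 * ∫ r in Ioi (0:ℝ), r^(n-1) * Gt n W W1 ε l2 (ζ2 r)^2 := by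
    rw [← integral_const_mul, ← integral_const_mul, ← integral_add (G2.iW.const_mul 2) (G2.iG.const_mul 2)]
    congr 1; ext r; ring
  rw [e]
  have b1 := G2.bW
  have b2 := G2.bG
  have hp := pow_pos h0 n
  calc _ ≤ (μ^n)⁻¹ * (4 * C * ε) := mul_le_mul_of_nonneg_left (by linarith) (inv_pos.2 hp).le
    _ ≤ 2^n * (4 * C * ε) := mul_le_mul_of_nonneg_right (inv_pow_le hμ) (by positivity)
    _ = _ := by ring

namespace Pr
variable {ε l1 l2 κ Δ : ℝ} {ζ d1 S d2 B : ℝ → ℝ}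

lemma split (h : Pr n W W1 ε l1 l2 κ ζ d1 S d2 Δ B) {c0 X : ℝ} (hc0 : 0 < c0)
    (hX : ∫ r in Ioi (0:ℝ), r^(n-1) * (ε^2 * (d1 r - d2 r)^2 + c0/2 * (ζ r - S r)^2) ≤ X) :
    ε^2 * (∫ r in Ioi (0:ℝ), r^(n-1) * (d1 r - d2 r)^2) ≤ X ∧ c0/2 * (∫ r in Ioi (0:ℝ), r^(n-1) * (ζ r - S r)^2) ≤ X := by
  have e : ∫ r in Ioi (0:ℝ), r^(n-1) * (ε^2 * (d1 r - d2 r)^2 + c0/2 * (ζ r - S r)^2) =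
      ε^2 * (∫ r in Ioi (0:ℝ), r^(n-1) * (d1 r - d2 r)^2) + c0/2 * (∫ r in Ioi (0:ℝ), r^(n-1) * (ζ r - S r)^2) := by
    rw [← integral_const_mul, ← integral_const_mul, ← integral_add (h.iz'.const_mul _) (h.iz.const_mul _)]
    congr 1; ext r; ring
  have n1 : 0 ≤ ∫ r in Ioi (0:ℝ), r^(n-1) * (d1 r - d2 r)^2 := setIntegral_nonneg measurableSet_Ioi fun r (hr : 0 < r) => by positivity
  have n2 : 0 ≤ ∫ r in Ioi (0:ℝ), r^(n-1) * (ζ r - S r)^2 := setIntegral_nonneg measurableSet_Ioi fun r (hr : 0 < r) => by positivity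
  rw [e] at hX
  have m1 : 0 ≤ ε^2 * (∫ r in Ioi (0:ℝ), r^(n-1) * (d1 r - d2 r)^2) := by positivity
  have m2 : 0 ≤ c0/2 * (∫ r in Ioi (0:ℝ), r^(n-1) * (ζ r - S r)^2) := by positivity
  exact ⟨by linarith, by linarith⟩
end Pr

/-- Cauchy-Schwarz/Young -/
lemma young_int {N : ℕ} {a b θ C : ℝ} {F H f h : ℝ → ℝ} (hθ : 0 < θ) (hC : 0 ≤ C) (mf : Measurable f) (mh : Measurable h)
    (iF : IntegrableOn (fun r => r^N * F r) (Ioi 0)) (iH : IntegrableOn (fun r => r^N * H r) (Ioi 0))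
    (jf : IntegrableOn (fun r => r^N * f r^2) (Ioi 0)) (jh : IntegrableOn (fun r => r^N * h r^2) (Ioi 0))
    (hFH : ∀ r, |F r - H r| ≤ C * |f r + h r| * |f r - h r|)
    (ha : (∫ r in Ioi (0:ℝ), r^N * f r^2) + (∫ r in Ioi (0:ℝ), r^N * h r^2) ≤ a) (hb : ∫ r in Ioi (0:ℝ), r^N * (f r - h r)^2 ≤ b) :
    |(∫ r in Ioi (0:ℝ), r^N * F r) - ∫ r in Ioi (0:ℝ), r^N * H r| ≤ C * (θ * a + b/(2*θ)) := by
  have iz := (int_sub_sq mf mh jf jh).1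
  rw [← integral_sub iF iH]
  have i1 : IntegrableOn (fun r => θ * (r^N * f r^2 + r^N * h r^2)) (Ioi 0) := (Integrable.fun_add jf jh).const_mul θ
  have i2 : IntegrableOn (fun r => C * (θ * (r^N * f r^2 + r^N * h r^2) + 1/(2*θ) * (r^N * (f r - h r)^2))) (Ioi 0) :=
    (Integrable.fun_add i1 (iz.const_mul (1/(2*θ)))).const_mul C
  have hle : ‖∫ r in Ioi (0:ℝ), (r^N * F r - r^N * H r)‖ ≤ ∫ r in Ioi (0:ℝ), C * (θ * (r^N * f r^2 + r^N * h r^2) + 1/(2*θ) * (r^N * (f r - h r)^2)) := by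
    refine norm_integral_le_of_norm_le i2 ((ae_restrict_iff' measurableSet_Ioi).2 (ae_of_all _ fun r (hr : 0 < r) => ?_))
    have hp := pow_pos hr N
    have y : |f r + h r| * |f r - h r| ≤ θ * (f r^2 + h r^2) + 1/(2*θ) * (f r - h r)^2 := by
      have y1 : |f r + h r| * |f r - h r| ≤ θ/2 * (f r + h r)^2 + 1/(2*θ) * (f r - h r)^2 := by
        rw [← sq_abs (f r + h r), ← sq_abs (f r - h r)]
        have : θ/2 * |f r + h r|^2 + 1/(2*θ) * |f r - h r|^2 - |f r + h r| * |f r - h r| = (θ * |f r + h r| - |f r - h r|)^2/(2*θ) := by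
          field_simp; ring
        have : 0 ≤ (θ * |f r + h r| - |f r - h r|)^2/(2*θ) := by positivity
        linarith
      have : θ * (f r + h r)^2 ≤ θ * (2 * (f r^2 + h r^2)) := mul_le_mul_of_nonneg_left (by nlinarith [sq_nonneg (f r - h r)]) hθ.le
      linarith
    rw [← mul_sub, norm_mul, Real.norm_of_nonneg hp.le, Real.norm_eq_abs]
    calc _ ≤ r^N * (C * |f r + h r| * |f r - h r|) := mul_le_mul_of_nonneg_left (hFH r) hp.le
      _ = r^N * C * (|f r + h r| * |f r - h r|) := by ring
      _ ≤ r^N * C * (θ * (f r^2 + h r^2) + 1/(2*θ) * (f r - h r)^2) := mul_le_mul_of_nonneg_left y (by positivity)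
      _ = _ := by ring
  rw [← Real.norm_eq_abs]
  refine hle.trans ?_
  rw [integral_const_mul, integral_add i1 (iz.const_mul _), integral_const_mul, integral_const_mul, integral_add jf jh]
  refine mul_le_mul_of_nonneg_left (add_le_add (mul_le_mul_of_nonneg_left ha hθ.le) ?_) hC
  calc _ ≤ 1/(2*θ) * b := mul_le_mul_of_nonneg_left hb (by positivity)
    _ = _ := by ring

variable {n : ℕ} {W W1 W2 : ℝ → ℝ} {u v : En n → ℝ}

lemma D_scale (hn : 2 ≤ n) {μ : ℝ} (hμ : 0 < μ) (e2 : ℝ → ℝ) :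
    ∫ r in Ioi (0:ℝ), r^(n-1) * (μ * e2 (μ * r))^2 = μ^2 * (μ^n)⁻¹ * ∫ r in Ioi (0:ℝ), r^(n-1) * e2 r^2 := by
  rw [mul_assoc, ← scale_eq hn hμ (fun s => e2 s^2), ← integral_const_mul]
  congr 1; ext r; ring

lemma Good.lam_est (hn : 2 ≤ n) (g : GW W W1 W2) {R K C δ δb c0 ε l1 l2 ϱ1 ϱ2 μ Δ Cc : ℝ} {ζ1 e1 ζ2 e2 : ℝ → ℝ}
    (G1 : Good n W W1 R K C δ δb ε l1 ζ1 e1 ϱ1) (G2 : Good n W W1 R K C δ δb ε l2 ζ2 e2 ϱ2) (hε : 0 < ε) (hC : 1 ≤ C) (hCc : 1 ≤ Cc) (hc0 : 0 < c0)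
    (h1 : 1/2 ≤ μ) (h2 : μ ≤ 2) (hΔ : Δ = |1 - μ^2| + ε * |l1 - l2|)
    (hX : ∫ r in Ioi (0:ℝ), r^(n-1) * (ε^2 * (e1 r - μ * e2 (μ * r))^2 + c0/2 * (ζ1 r - ζ2 (μ * r))^2) ≤ Cc * ε * Δ^2) :
    |l1 - l2| ≤ (Asph n * (C + 4 * 2^n * C + Cc/2 + C * (2^n * (4^n+16)))) * (Δ + |1 - μ|) := by
  have μ0 : 0 < μ := by linarith
  have hA := Asph_pos hn
  have hν := abs_nonneg (1 - μ)
  have hΔ0 : 0 ≤ Δ := by rw [hΔ]; positivity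
  rcases hΔ0.eq_or_lt with hz | hpos
  · have : ε * |l1 - l2| = 0 := by
      have := abs_nonneg (1 - μ^2)
      have : 0 ≤ ε * |l1 - l2| := by positivity
      linarith
    have hl : |l1 - l2| = 0 := by
      rcases mul_eq_zero.1 this with h | h
      · exact absurd h hε.ne'
      · exact h
    rw [hl]; positivity
  have pr := G1.pair hn g G2 hε μ0
  have sp := (pr.split hc0 hX).1
  set D1 := ∫ r in Ioi (0:ℝ), r^(n-1) * e1 r^2 with hD1
  set D2 := ∫ r in Ioi (0:ℝ), r^(n-1) * e2 r^2 with hD2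
  have D20 : 0 ≤ D2 := setIntegral_nonneg measurableSet_Ioi fun r (hr : 0 < r) => by positivity
  have eS := D_scale hn μ0 e2
  rw [← hD2] at eS
  have b1 : D1 ≤ C/ε := by rw [le_div_iff₀ hε]; linarith [G1.bD]
  have b2 : D2 ≤ C/ε := by rw [le_div_iff₀ hε]; linarith [G2.bD]
  have fac : μ^2 * (μ^n)⁻¹ ≤ 4 * 2^n := mul_le_mul (by nlinarith) (inv_pow_le h1) (by positivity) (by norm_num)
  have b3 : μ^2 * (μ^n)⁻¹ * D2 ≤ 4 * 2^n * (C/ε) := mul_le_mul fac b2 D20 (by positivity)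
  have y := young_int (N := n-1) (C := 1) (θ := Δ) (F := fun r => e1 r^2) (H := fun r => (μ * e2 (μ * r))^2) (f := e1) (h := fun r => μ * e2 (μ * r))
    (a := C/ε + 4 * 2^n * (C/ε)) (b := Cc * Δ^2/ε) hpos zero_le_one pr.md1 pr.md2 pr.iD1 pr.iD2 pr.iD1 pr.iD2
    (fun r => by rw [one_mul, ← abs_mul]; exact le_of_eq (congrArg _ (by ring))) (by rw [eS]; linarith)
    (by rw [le_div_iff₀ hε]; nlinarith)
  rw [eS, ← hD1] at y
  have e3 : 1 * (Δ * (C/ε + 4 * 2^n * (C/ε)) + Cc * Δ^2/ε/(2*Δ)) = (C + 4 * 2^n * C + Cc/2) * Δ/ε := by field_simp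
  rw [e3, le_div_iff₀ hε] at y
  have y2 : |μ^2 * (μ^n)⁻¹ * D2 - D2| * ε ≤ C * (2^n * (4^n+16)) * |1 - μ| := by
    have e4 : μ^2 * (μ^n)⁻¹ * D2 - D2 = (μ^2 * (μ^n)⁻¹ - 1) * D2 := by ring
    rw [e4, abs_mul, abs_of_nonneg D20]
    have := mul_le_mul (mu_D (n := n) h1 h2) (show D2 * ε ≤ C by linarith [G2.bD]) (by positivity) (by positivity)
    linarith
  have y3 : |D1 - D2| * ε ≤ (C + 4 * 2^n * C + Cc/2) * Δ + C * (2^n * (4^n+16)) * |1 - μ| := by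
    have : |D1 - D2| ≤ |D1 - μ^2 * (μ^n)⁻¹ * D2| + |μ^2 * (μ^n)⁻¹ * D2 - D2| := abs_sub_le _ _ _
    have := mul_le_mul_of_nonneg_right this hε.le
    linarith
  have el : l1 - l2 = -(2/n * Asph n * ((D1 - D2) * ε)) := by
    rw [G1.ll, G2.ll]; ring
  have hn2 : (2:ℝ)/n ≤ 1 := by rw [div_le_one (by positivity)]; exact_mod_cast hn
  have q1 : 0 ≤ C * (2^n * (4^n+16)) := by positivity
  have q2 : 0 ≤ C + 4 * 2^n * C + Cc/2 := by positivity
  calc |l1 - l2| = 2/n * (Asph n * (|D1 - D2| * ε)) := by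
        rw [el, abs_neg, abs_mul, abs_mul (D1 - D2), abs_of_pos hε, abs_of_nonneg (by positivity)]; ring
    _ ≤ 1 * (Asph n * (|D1 - D2| * ε)) := mul_le_mul_of_nonneg_right hn2 (by positivity)
    _ ≤ Asph n * ((C + 4 * 2^n * C + Cc/2) * Δ + C * (2^n * (4^n+16)) * |1 - μ|) := by
        rw [one_mul]; exact mul_le_mul_of_nonneg_left y3 hA.le
    _ ≤ Asph n * ((C + 4 * 2^n * C + Cc/2 + C * (2^n * (4^n+16))) * (Δ + |1 - μ|)) := by
        refine mul_le_mul_of_nonneg_left ?_ hA.le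
        have := mul_nonneg q1 hΔ0
        have := mul_nonneg q2 hν
        linarith
    _ = _ := by ring

lemma Good.vol_est (hn : 2 ≤ n) (g : GW W W1 W2) {R K C δ δb c0 ε l1 l2 ϱ1 ϱ2 μ Δ Cc Cv θ : ℝ} {ζ1 e1 ζ2 e2 : ℝ → ℝ}
    (G1 : Good n W W1 R K C δ δb ε l1 ζ1 e1 ϱ1) (G2 : Good n W W1 R K C δ δb ε l2 ζ2 e2 ϱ2) (hR : 0 < R) (hε : 0 < ε) (hC : 1 ≤ C) (hc0 : 0 < c0)
    (hCv : 1 ≤ Cv) (hV : ∀ a ∈ Icc (0:ℝ) 1, ∀ b ∈ Icc (0:ℝ) 1, |Vpot n W a - Vpot n W b| ≤ Cv * (a + b) * |a - b|)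
    (h1 : 1/2 ≤ μ) (h2 : μ ≤ 2) (hθ : 0 < θ)
    (hX : ∫ r in Ioi (0:ℝ), r^(n-1) * (ε^2 * (e1 r - μ * e2 (μ * r))^2 + c0/2 * (ζ1 r - ζ2 (μ * r))^2) ≤ Cc * ε * Δ^2) :
    |1 - μ|/2^n * (R^n/n) ≤ Cv * (θ * (C + 2^n * C) + (2 * Cc * ε * Δ^2/c0)/(2*θ)) := by
  have μ0 : 0 < μ := by linarith
  have pr := G1.pair hn g G2 hε μ0
  have sp := (pr.split hc0 hX).2
  have S2 : ∫ r in Ioi (0:ℝ), r^(n-1) * ζ2 (μ * r)^2 ≤ 2^n * C := by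
    rw [scale_eq hn μ0 (fun s => ζ2 s^2)]
    refine mul_le_mul (inv_pow_le h1) G2.bS ?_ (by positivity)
    exact setIntegral_nonneg measurableSet_Ioi fun r (hr : 0 < r) => by positivity
  have y := young_int (N := n-1) (C := Cv) (θ := θ) (F := fun r => Vpot n W (ζ1 r)) (H := fun r => Vpot n W (ζ2 (μ * r))) (f := ζ1) (h := fun r => ζ2 (μ * r))
    (a := C + 2^n * C) (b := 2 * Cc * ε * Δ^2/c0) hθ (by linarith) pr.c1.measurable pr.c2.measurable G1.iV (scale_int μ0 (f := fun s => Vpot n W (ζ2 s)) G2.iV) pr.iS1 pr.iS2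
    (fun r => by
      have m1 := G1.sol.mem r
      have m2 := G2.sol.mem (μ * r)
      rw [abs_of_nonneg (by linarith [m1.1, m2.1] : 0 ≤ ζ1 r + ζ2 (μ * r))]
      exact hV _ m1 _ m2) (add_le_add G1.bS S2) (by rw [le_div_iff₀ hc0]; linarith)
  refine le_trans ?_ y
  rw [scale_eq hn μ0 (fun s => Vpot n W (ζ2 s)), G1.vV, G2.vV]
  have hω : 0 < R^n/n := by positivity
  have e : R^n/n - (μ^n)⁻¹ * (R^n/n) = -(((μ^n)⁻¹ - 1) * (R^n/n)) := by ring
  rw [e, abs_neg, abs_mul, abs_of_pos hω]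
  exact mul_le_mul_of_nonneg_right (mu_low hn h1 h2) hω.le

lemma fin_arith {ν Λ Δ x ε Q : ℝ} (hν : 0 ≤ ν) (hε : 0 < ε) (hΛ : 0 ≤ Λ) (hD : Δ = x + ε * Λ) (hx : x ≤ 3 * ν)
    (h : Λ ≤ Q * (Δ + ν)) (hQ : 0 < Q) (hεQ : ε * Q ≤ 1/2) : Δ ≤ 7 * ν := by
  have h1 : Q * (Δ + ν) ≤ Q * (4 * ν + ε * Λ) := mul_le_mul_of_nonneg_left (by linarith) hQ.le
  have h2 : (ε * Q) * Λ ≤ 1/2 * Λ := mul_le_mul_of_nonneg_right hεQ hΛ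
  have h3 : Λ ≤ 8 * Q * ν := by linarith
  have h4 : ε * Λ ≤ ε * (8 * Q * ν) := mul_le_mul_of_nonneg_left h3 hε.le
  have h5 : (ε * Q) * ν ≤ 1/2 * ν := mul_le_mul_of_nonneg_right hεQ hν
  linarith

lemma fin_contra {ν Δ ε P ω Cv a Cc c0 τ : ℝ} (hν : 0 < ν) (hε : 0 < ε) (hP : 0 < P) (hω : 0 < ω) (hCv : 0 < Cv) (ha : 0 < a) (hCc : 0 < Cc) (hc0 : 0 < c0)
    (hτ : τ = ω/(4*P*Cv*a)) (hε2 : ε ≤ ω * c0 * τ/(4*P*49*Cv*Cc)) (hΔ0 : 0 ≤ Δ) (hΔ : Δ ≤ 7 * ν)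
    (h : ν/P * ω ≤ Cv * ((τ * ν) * a + (2 * Cc * ε * Δ^2/c0)/(2*(τ * ν)))) : False := by
  have τ0 : 0 < τ := by rw [hτ]; positivity
  have d2 : Δ^2 ≤ 49 * ν^2 := by nlinarith
  have s1 : (2 * Cc * ε * Δ^2/c0)/(2*(τ * ν)) ≤ (2 * Cc * ε * (49 * ν^2)/c0)/(2*(τ * ν)) := by gcongr
  have s2 : (2 * Cc * ε * (49 * ν^2)/c0)/(2*(τ * ν)) = 49 * Cc * ν/(c0 * τ) * ε := by field_simp
  have s3 : 49 * Cc * ν/(c0 * τ) * ε ≤ 49 * Cc * ν/(c0 * τ) * (ω * c0 * τ/(4*P*49*Cv*Cc)) := mul_le_mul_of_nonneg_left hε2 (by positivity)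
  have s4 : 49 * Cc * ν/(c0 * τ) * (ω * c0 * τ/(4*P*49*Cv*Cc)) = (ν/P * ω)/(4*Cv) := by field_simp
  have s5 : (τ * ν) * a = (ν/P * ω)/(4*Cv) := by rw [hτ]; field_simp
  have s6 : Cv * ((ν/P * ω)/(4*Cv) + (ν/P * ω)/(4*Cv)) = (ν/P * ω)/2 := by field_simp; ring
  have s7 : Cv * ((τ * ν) * a + (2 * Cc * ε * Δ^2/c0)/(2*(τ * ν))) ≤ Cv * ((ν/P * ω)/(4*Cv) + (ν/P * ω)/(4*Cv)) :=
    mul_le_mul_of_nonneg_left (by linarith) hCv.le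
  have : 0 < ν/P * ω := by positivity
  linarith

lemma uniq_good (hn : 2 ≤ n) (g : GW W W1 W2) (h0 : W1 0 = 0) {δ δb c0 L η R C K : ℝ} (p : PW n W W1 δ δb c0 L η)
    (hR : 0 < R) (hC : 1 ≤ C) (hK : 1 ≤ K) : ∃ e0 : ℝ, 0 < e0 ∧ ∀ ε, 0 < ε → ε ≤ e0 →
    ∀ (l1 l2 ϱ1 ϱ2 : ℝ) (ζ1 d1 ζ2 d2 : ℝ → ℝ), Good n W W1 R K C δ δb ε l1 ζ1 d1 ϱ1 → Good n W W1 R K C δ δb ε l2 ζ2 d2 ϱ2 →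
    ∀ r, 0 ≤ r → ζ1 r = ζ2 r := by
  obtain ⟨M, hM, lip⟩ := g.lipW
  have WM : ∀ t ∈ Icc (0:ℝ) 1, W t ≤ M := fun t ht => by
    have := lip t ht 0 (by simp)
    rw [g.zero, sub_zero, sub_zero, abs_of_nonneg ht.1] at this
    have := le_abs_self (W t)
    nlinarith [ht.2]
  obtain ⟨C', hC'⟩ : ∃ C', C' = 2^n * (4 * C) + 2 * M + 2 * C^2 + 4 * C := ⟨_, rfl⟩
  have p1 : 0 ≤ 2^n * (4 * C) := by positivity
  have p2 : 0 ≤ C^2 := by positivity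
  obtain ⟨Cc, ec, hCc, hec, hec1, cmp⟩ := compare (n := n) hn g h0 p hR (C := C') (by linarith) (K := 4 * K) (by linarith)
  obtain ⟨Cv, hCv, hV⟩ := g.difV h0 hn
  have hc0 := p.hc0
  have hη := p.η0
  have hA := Asph_pos hn
  obtain ⟨Q, hQ⟩ : ∃ Q, Q = Asph n * (C + 4 * 2^n * C + Cc/2 + C * (2^n * (4^n+16))) := ⟨_, rfl⟩
  have Q0 : 0 < Q := by rw [hQ]; positivity
  have hω : 0 < R^n/n := by positivity
  obtain ⟨τ, hτ⟩ : ∃ τ, τ = (R^n/n)/(4*2^n*Cv*(C + 2^n * C)) := ⟨_, rfl⟩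
  have τ0 : 0 < τ := by rw [hτ]; positivity
  refine ⟨min (min ec (η/C)) (min (min (R/(8*K)) (1/(2*Q))) ((R^n/n) * c0 * τ/(4*2^n*49*Cv*Cc))), by positivity, ?_⟩
  intro ε hε hεe l1 l2 ϱ1 ϱ2 ζ1 d1 ζ2 d2 G1 G2
  simp only [le_min_iff] at hεe
  obtain ⟨⟨q1, q2⟩, ⟨q3, q4⟩, q5⟩ := hεe
  have q2' : ε * C ≤ η := by rwa [le_div_iff₀ (by linarith)] at q2
  have q3' : K * ε ≤ R/8 := by rw [le_div_iff₀ (by linarith)] at q3; linarith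
  have q4' : ε * Q ≤ 1/2 := by rw [le_div_iff₀ (by linarith)] at q4; linarith
  have a1 := G1.ρ1
  have a2 := G1.ρ2
  have a3 := G2.ρ1
  have a4 := G2.ρ2
  have ϱ0 : 0 < ϱ1 := by linarith
  obtain ⟨μ, hμ⟩ : ∃ μ, μ = ϱ2/ϱ1 := ⟨_, rfl⟩
  have eμ : μ * ϱ1 = ϱ2 := by rw [hμ]; field_simp
  have h1 : 1/2 ≤ μ := by rw [hμ, le_div_iff₀ ϱ0]; linarith
  have h2 : μ ≤ 2 := by rw [hμ, div_le_iff₀ ϱ0]; linarith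
  have μ0 : 0 < μ := by linarith
  have pr := G1.pair hn g G2 hε μ0
  have hKe : 0 < K * ε := by positivity
  obtain ⟨Δ, hΔ⟩ : ∃ Δ, Δ = |1 - μ^2| + ε * |l1 - l2| := ⟨_, rfl⟩
  rw [← hΔ] at pr
  have hΔ0 : 0 ≤ Δ := by rw [hΔ]; positivity
  have X := cmp ε hε q1 l1 l2 (μ^2) Δ ϱ1 _ _ _ _ _ pr (mul_nonneg hε.le G1.l0)
    ((mul_le_mul_of_nonneg_left G1.l1 hε.le).trans q2')
    (fun t ht => by rw [one_mul]; linarith [G1.Gb t ht])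
    (fun t ht => by
      have b := G2.Gb t ht
      rw [abs_mul, abs_of_pos (by positivity)]
      have m4 : μ^2 ≤ 4 := by nlinarith
      have := mul_le_mul m4 b (abs_nonneg _) (by norm_num)
      linarith)
    (fun r => by
      have m := G2.sol.mem (μ * r)
      have w := WM _ m
      have b := G2.Gb _ m
      have b2 := pow_le_pow_left₀ (abs_nonneg _) b 2
      rw [sq_abs] at b2
      linarith)
    (by
      have b := G2.bB hn hε (by linarith) h1
      have : 2^n * (4 * C) * ε ≤ C' * ε := mul_le_mul_of_nonneg_right (by linarith) hε.le
      linarith)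
    (by linarith) (by linarith) G1.zρ (by simp only [eμ]; exact G2.zρ)
    (G1.tail _ (by linarith)) (G2.tail _ (by rw [mul_add, eμ]; nlinarith))
  have lamE := G1.lam_est hn g G2 hε hC hCc hc0 h1 h2 hΔ X
  rw [← hQ] at lamE
  have hx : |1 - μ^2| ≤ 3 * |1 - μ| := by
    have e : 1 - μ^2 = (1 + μ) * (1 - μ) := by ring
    rw [e, abs_mul, abs_of_pos (by linarith : 0 < 1 + μ)]
    exact mul_le_mul_of_nonneg_right (by linarith) (abs_nonneg _)
  have hΔ7 := fin_arith (abs_nonneg (1 - μ)) hε (abs_nonneg (l1 - l2)) hΔ hx lamE Q0 q4'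
  have hν : |1 - μ| = 0 := by
    by_contra hne
    have hpos : 0 < |1 - μ| := lt_of_le_of_ne (abs_nonneg _) (Ne.symm hne)
    have vol := G1.vol_est hn g G2 hR hε hC hc0 hCv hV h1 h2 (mul_pos τ0 hpos) X
    exact fin_contra hpos hε (by positivity) hω (by linarith) (by positivity) (by linarith) hc0 hτ q5 hΔ0 hΔ7 vol
  have hμ1 : μ = 1 := by linarith [abs_eq_zero.1 hν]
  have hΔz : Δ = 0 := by linarith
  have sp := (pr.split hc0 X).2
  rw [hΔz] at sp
  have iz := pr.iz
  simp only [hμ1, one_mul] at sp iz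
  have Z : ∫ r in Ioi (0:ℝ), r^(n-1) * (ζ1 r - ζ2 r)^2 = 0 := by
    refine le_antisymm ?_ (setIntegral_nonneg measurableSet_Ioi fun r (hr : 0 < r) => by positivity)
    by_contra hcon
    push Not at hcon
    have := mul_pos (half_pos hc0) hcon
    linarith
  have cz : Continuous fun r => r^(n-1) * (ζ1 r - ζ2 r)^2 :=
    (continuous_id.pow _).mul (((cont_of_deriv G1.sol.hd).sub (cont_of_deriv G2.sol.hd)).pow 2)
  rw [setIntegral_eq_zero_iff_of_nonneg_ae ((ae_restrict_iff' measurableSet_Ioi).2 (ae_of_all _ fun r (hr : 0 < r) => by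
    simp only [Pi.zero_apply]; positivity)) iz] at Z
  have eqOn := Measure.eqOn_open_of_ae_eq Z isOpen_Ioi cz.continuousOn continuousOn_const
  have eq0 : EqOn ζ1 ζ2 (Ioi 0) := fun r hr => by
    have := eqOn hr
    simp only [Pi.zero_apply] at this
    have hr' : (0:ℝ) < r := hr
    rcases mul_eq_zero.1 this with h | h
    · exact absurd h (by positivity)
    · exact sub_eq_zero.1 (pow_eq_zero_iff (two_ne_zero) |>.1 h)
  have := eq0.closure (cont_of_deriv G1.sol.hd) (cont_of_deriv G2.sol.hd)
  rw [closure_Ioi] at this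
  exact fun r hr => this hr

variable {n : ℕ} {W W1 W2 : ℝ → ℝ} {u v : En n → ℝ}

lemma main_GW (hn : 2 ≤ n) (g : GW W W1 W2) : ∃ ε₀ > (0:ℝ), ∀ ε : ℝ, 0 < ε → ε < ε₀ →
      ∀ u v : En n → ℝ, Minimizes n W ε u → Minimizes n W ε v → ∃ x₀ : En n, ∀ x : En n, v x = u (x - x₀) := by
  rcases g.d0.lt_or_eq with h0 | h0
  · exact ⟨1, one_pos, fun ε hε _ u v mu _ => (no_minimizer hn g h0 hε mu).elim⟩
  have h0 := h0.symm
  obtain ⟨δ, δb, c0, L, η, p⟩ := exists_PW g h0 hn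
  obtain ⟨R, hR, hRn⟩ := exists_R hn
  obtain ⟨K, C, hK, hC, good⟩ := exists_good hn g h0 hR hRn p
  obtain ⟨e0, he0, uniq⟩ := uniq_good hn g h0 p hR hC hK
  refine ⟨min e0 (min 1 (R/(8*K))), by positivity, fun ε hε hlt u v mu mv => ?_⟩
  have hle := hlt.le
  simp only [le_min_iff] at hle
  obtain ⟨q1, q2, q3⟩ := hle
  have q3' : K * ε ≤ R/8 := by rw [le_div_iff₀ (by linarith)] at q3; linarith
  have prof : ∀ w : En n → ℝ, Minimizes n W ε w → ∃ z : En n, ∃ ζ d, RM n W ε ζ d ∧ ∀ x, w x = ζ ‖x - z‖ := by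
    intro w mw
    obtain ⟨z, ζ0, ha, hz⟩ := minimizer_rad hn g h0 hε mw
    obtain ⟨ζ, d, rm, hζ⟩ := RM_of_min hn g h0 (mw.trans z) ha (fun x => by rw [hz]; simp)
    exact ⟨z, ζ, d, rm, fun x => by rw [← hζ]; simp⟩
  obtain ⟨z1, ζ1, d1, rm1, hu⟩ := prof u mu
  obtain ⟨z2, ζ2, d2, rm2, hv⟩ := prof v mv
  obtain ⟨ϱ1, G1⟩ := good ε hε q2 q3' _ _ rm1
  obtain ⟨ϱ2, G2⟩ := good ε hε q2 q3' _ _ rm2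
  have e := uniq ε hε q1 _ _ _ _ _ _ _ _ G1 G2
  refine ⟨z2 - z1, fun x => ?_⟩
  rw [hu, hv, ← e _ (norm_nonneg _)]
  congr 2; abel
theorem statement10 (n : ℕ) (hn : 2 ≤ n) (W : ℝ → ℝ) (hW : DoubleWell W) :
    ∃ ε₀ > (0:ℝ), ∀ ε : ℝ, 0 < ε → ε < ε₀ →
      ∀ u v : En n → ℝ, Minimizes n W ε u → Minimizes n W ε v →
        ∃ x₀ : En n, ∀ᵐ x : En n ∂(volume : Measure (En n)), v x = u (x - x₀) := by
  obtain ⟨We, W1, W2, g, hWe⟩ := ext_GW hW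
  obtain ⟨ε₀, h0, H⟩ := main_GW hn g
  refine ⟨ε₀, h0, fun ε hε hlt u v mu mv => ?_⟩
  obtain ⟨x₀, hx⟩ := H ε hε hlt u v ((Minimizes_congr hWe ε u).1 mu) ((Minimizes_congr hWe ε v).1 mv)
  exact ⟨x₀, ae_of_all _ hx⟩
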